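/- Let Ω ⊂ ℝⁿ (n ≥ 2) be a domain and u ∈ C^{1,β}_{loc}(Ω) a weak solution of -Δ_p u = f in Ω. Define q_N by q_0 = 4 and q_N = 2(q_{N-1}-1), and let q ≥ q_0 satisfy q_N ≤ q < q_{N+1} for some N ∈ ℕ₀. Assume 2 - 1/C(n,q) < p < min{2 + 1/(q-1), 2 + 1/C(n,q)} and let f ∈ W^{2,q/(q-1)}_{loc}(Ω) ∩ C^{1,β'}_{loc}(Ω) (no sign condition on f). Then for every α with α > (3-p)/2^N + 1 if N ≥ 1 (respectively α ≥ 4-p if N = 0) and every k ≥ (p+α)/2, the vector field |∇u|^{k-1} ∇u belongs to W^{2,1}_{loc}(Ω, ℝⁿ). -/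

import Mathlib

open MeasureTheory Real Set
open scoped InnerProductSpace ENNReal NNReal Topology

noncomputable section

abbrev Euc (n : ℕ) : Type := EuclideanSpace ℝ (Fin n)

variable {n : ℕ}

/-- A smooth test function compactly supported in `Ω`. -/
def IsTestFun (Ω : Set (Euc n)) (ψ : Euc n → ℝ) : Prop :=
  ContDiff ℝ (⊤ : ℕ∞) ψ ∧ HasCompactSupport ψ ∧ tsupport ψ ⊆ Ω

/-- `u` is a weak solution of `-Δ_p u = f` in `Ω`. -/
def IsPWeakSol (p : ℝ) (Ω : Set (Euc n)) (u f : Euc n → ℝ) : Prop :=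
  ∀ ψ : Euc n → ℝ, IsTestFun Ω ψ →
    (∫ x in Ω, ‖gradient u x‖ ^ (p - 2) * ⟪gradient u x, gradient ψ x⟫_ℝ) =
      ∫ x in Ω, f x * ψ x

/-- `f ∈ C^{0,β}_loc(Ω)`. -/
def C0Loc (Ω : Set (Euc n)) (β : ℝ≥0) (f : Euc n → ℝ) : Prop :=
  ContinuousOn f Ω ∧
  ∀ K : Set (Euc n), K ⊆ Ω → IsCompact K → ∃ C : ℝ≥0, HolderOnWith C β f K

/-- `u ∈ C^{1,β}_loc(Ω)`. -/
def C1Loc (Ω : Set (Euc n)) (β : ℝ≥0) (u : Euc n → ℝ) : Prop :=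
  (∀ x ∈ Ω, DifferentiableAt ℝ u x) ∧
  ∀ K : Set (Euc n), K ⊆ Ω → IsCompact K →
    ∃ C : ℝ≥0, HolderOnWith C β (fun x => gradient u x) K

/-- The `i`-th partial derivative of `g`. -/
def pd (g : Euc n → ℝ) (i : Fin n) (x : Euc n) : ℝ :=
  fderiv ℝ g x (EuclideanSpace.single i 1)

/-- `h` is the weak `i`-th partial derivative of `g` on `Ω`. -/
def HasWeakPD (Ω : Set (Euc n)) (g h : Euc n → ℝ) (i : Fin n) : Prop :=
  ∀ ψ : Euc n → ℝ, IsTestFun Ω ψ →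
    (∫ x in Ω, g x * pd ψ i x) = - ∫ x in Ω, h x * ψ x

/-- `g ∈ W^{1,q}_loc(Ω)`. -/
def MemW1Loc (Ω : Set (Euc n)) (q : ℝ) (g : Euc n → ℝ) : Prop :=
  ∃ d : Fin n → Euc n → ℝ,
    (∀ i, HasWeakPD Ω g (d i) i) ∧
    ∀ K : Set (Euc n), K ⊆ Ω → IsCompact K →
      IntegrableOn (fun x => |g x| ^ q) K volume ∧
      ∀ i, IntegrableOn (fun x => |d i x| ^ q) K volume

/-- `g ∈ W^{2,q}_loc(Ω)`. -/
def MemW2Loc (Ω : Set (Euc n)) (q : ℝ) (g : Euc n → ℝ) : Prop :=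
  ∃ d : Fin n → Euc n → ℝ, ∃ d2 : Fin n → Fin n → Euc n → ℝ,
    (∀ i, HasWeakPD Ω g (d i) i) ∧
    (∀ i j, HasWeakPD Ω (d i) (d2 i j) j) ∧
    ∀ K : Set (Euc n), K ⊆ Ω → IsCompact K →
      IntegrableOn (fun x => |g x| ^ q) K volume ∧
      (∀ i, IntegrableOn (fun x => |d i x| ^ q) K volume) ∧
      (∀ i j, IntegrableOn (fun x => |d2 i j x| ^ q) K volume)

/-- The Laplacian of `w`. -/
def lapl (w : Euc n → ℝ) (x : Euc n) : ℝ :=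
  ∑ i : Fin n, iteratedFDeriv ℝ 2 w x ![EuclideanSpace.single i 1, EuclideanSpace.single i 1]

/-- The Calderón–Zygmund constant `C(n,q)`: the best constant in
`‖D²w‖_{L^q} ≤ C ‖Δw‖_{L^q}`. -/
def CZ (n : ℕ) (q : ℝ) : ℝ :=
  sInf {C : ℝ | 0 ≤ C ∧ ∀ w : Euc n → ℝ, ContDiff ℝ (⊤ : ℕ∞) w → HasCompactSupport w →
    (∫ x, ‖iteratedFDeriv ℝ 2 w x‖ ^ q) ^ (1 / q) ≤ C * (∫ x, |lapl w x| ^ q) ^ (1 / q)}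

/-- The critical set `Z_u` of `u`. -/
def Zset (u : Euc n → ℝ) : Set (Euc n) := {x | gradient u x = 0}

/-- The recursion `q_N = 2 (q_{N-1} - 1)` starting from `q0`. -/
def qseq (q0 : ℝ) : ℕ → ℝ
  | 0 => q0
  | N + 1 => 2 * (qseq q0 N - 1)

/-- `A` is compactly contained in `Ω`. -/
def CptIn (A Ω : Set (Euc n)) : Prop :=
  IsOpen A ∧ IsCompact (closure A) ∧ closure A ⊆ Ω

/-- `v` is a weak solution of the regularized problem
`-div((ε + |∇v|²)^{(p-2)/2} ∇v) = f` in `B`. -/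
def IsRegWeakSol (p ε : ℝ) (B : Set (Euc n)) (v f : Euc n → ℝ) : Prop :=
  ∀ ψ : Euc n → ℝ, IsTestFun B ψ →
    (∫ x in B, (ε + ‖gradient v x‖ ^ (2 : ℝ)) ^ ((p - 2) / 2) *
        ⟪gradient v x, gradient ψ x⟫_ℝ) =
      ∫ x in B, f x * ψ x

namespace StressField

section

abbrev e (i : Fin n) : Euc n := EuclideanSpace.single i 1

lemma gradient_apply (g : Euc n → ℝ) (x : Euc n) (i : Fin n) : gradient g x i = pd g i x := by
  have h : ⟪gradient g x, EuclideanSpace.single i (1 : ℝ)⟫_ℝ = fderiv ℝ g x (EuclideanSpace.single i 1) := by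
    simp [gradient]
  rw [pd, ← h, EuclideanSpace.inner_single_right]
  simp

lemma inner_eq_sum (a b : Euc n) : ⟪a, b⟫_ℝ = ∑ i, a i * b i := by
  simp [PiLp.inner_apply, mul_comm]

lemma norm_sq_eq_sum (a : Euc n) : ‖a‖ ^ 2 = ∑ i, a i ^ 2 := by
  simp [EuclideanSpace.norm_sq_eq]

lemma abs_apply_le (a : Euc n) (i : Fin n) : |a i| ≤ ‖a‖ := by
  simpa using PiLp.norm_apply_le a i

section PD

variable {g h : Euc n → ℝ} {x : Euc n} {i : Fin n}

lemma pd_add (hg : DifferentiableAt ℝ g x) (hh : DifferentiableAt ℝ h x) :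
    pd (fun y => g y + h y) i x = pd g i x + pd h i x := by
  simp [pd, fderiv_fun_add hg hh]

lemma pd_sub (hg : DifferentiableAt ℝ g x) (hh : DifferentiableAt ℝ h x) :
    pd (fun y => g y - h y) i x = pd g i x - pd h i x := by
  simp [pd, fderiv_fun_sub hg hh]

lemma pd_mul (hg : DifferentiableAt ℝ g x) (hh : DifferentiableAt ℝ h x) :
    pd (fun y => g y * h y) i x = g x * pd h i x + pd g i x * h x := by
  simp [pd, fderiv_fun_mul hg hh]; ring

lemma pd_const_mul (c : ℝ) (hh : DifferentiableAt ℝ h x) :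
    pd (fun y => c * h y) i x = c * pd h i x := by
  simp [pd, fderiv_const_mul hh]

lemma pd_sum {ι : Type*} (s : Finset ι) {g : ι → Euc n → ℝ}
    (hg : ∀ a ∈ s, DifferentiableAt ℝ (g a) x) :
    pd (fun y => ∑ a ∈ s, g a y) i x = ∑ a ∈ s, pd (g a) i x := by
  simp [pd, fderiv_fun_sum hg]

lemma pd_comp {m : ℝ → ℝ} (hm : DifferentiableAt ℝ m (g x)) (hg : DifferentiableAt ℝ g x) :
    pd (fun y => m (g y)) i x = deriv m (g x) * pd g i x := by
  have := (hm.hasDerivAt.comp_hasFDerivAt x hg.hasFDerivAt).fderiv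
  simp only [Function.comp_def] at this
  simp [pd, this]

lemma pd_congr (hgh : g =ᶠ[𝓝 x] h) : pd g i x = pd h i x := by
  simp [pd, hgh.fderiv_eq]

lemma pd_comp_add (g : Euc n → ℝ) (y : Euc n) : pd (fun z => g (z + y)) i x = pd g i (x + y) := by
  simp [pd, fderiv_comp_add_right]

lemma contDiff_pd (hg : ContDiff ℝ (⊤ : ℕ∞) g) (i : Fin n) : ContDiff ℝ (⊤ : ℕ∞) (pd g i) := by
  unfold pd
  exact (hg.fderiv_right (m := (⊤ : ℕ∞)) (by simp)).clm_apply contDiff_const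

lemma tsupport_pd_subset (g : Euc n → ℝ) (i : Fin n) : tsupport (pd g i) ⊆ tsupport g := by
  refine (closure_mono ?_).trans (tsupport_fderiv_subset ℝ (f := g))
  intro x hx h
  apply hx
  simp [pd, h]

lemma pd_eq_zero_of_notMem (hx : x ∉ tsupport g) : pd g i x = 0 :=
  image_eq_zero_of_notMem_tsupport fun h => hx (tsupport_pd_subset g i h)

end PD

lemma _root_.ContDiff.diffAt {g : Euc n → ℝ} (hg : ContDiff ℝ (⊤ : ℕ∞) g) (x : Euc n) :
    DifferentiableAt ℝ g x := (hg.differentiable (by simp)) x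

section Test

variable {Ω U : Set (Euc n)} {ψ χ : Euc n → ℝ}

lemma _root_.IsTestFun.mono (h : IsTestFun U ψ) (hU : U ⊆ Ω) : IsTestFun Ω ψ :=
  ⟨h.1, h.2.1, h.2.2.trans hU⟩

lemma _root_.IsTestFun.add (h : IsTestFun Ω ψ) (h' : IsTestFun Ω χ) :
    IsTestFun Ω (fun x => ψ x + χ x) := by
  refine ⟨h.1.add h'.1, h.2.1.add h'.2.1, (tsupport_add ψ χ).trans (union_subset h.2.2 h'.2.2)⟩

lemma _root_.IsTestFun.mul_left (h : IsTestFun Ω ψ) {g : Euc n → ℝ} (hg : ContDiff ℝ (⊤ : ℕ∞) g) :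
    IsTestFun Ω (fun x => g x * ψ x) :=
  ⟨hg.mul h.1, h.2.1.mul_left, (tsupport_mul_subset_right).trans h.2.2⟩

lemma _root_.IsTestFun.const_mul (h : IsTestFun Ω ψ) (c : ℝ) : IsTestFun Ω (fun x => c * ψ x) :=
  h.mul_left contDiff_const

lemma _root_.IsTestFun.pd (h : IsTestFun Ω ψ) (i : Fin n) : IsTestFun Ω (pd ψ i) :=
  ⟨contDiff_pd h.1 i, h.2.1.mono' (subset_closure.trans (tsupport_pd_subset ψ i)),
    (tsupport_pd_subset ψ i).trans h.2.2⟩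

lemma _root_.IsTestFun.continuous (h : IsTestFun Ω ψ) : Continuous ψ := h.1.continuous

lemma _root_.IsTestFun.isCompact (h : IsTestFun Ω ψ) : IsCompact (tsupport ψ) := h.2.1

lemma _root_.IsTestFun.eq_zero (_h : IsTestFun Ω ψ) {x : Euc n} (hx : x ∉ tsupport ψ) : ψ x = 0 :=
  image_eq_zero_of_notMem_tsupport hx

lemma _root_.IsTestFun.eq_zero' (h : IsTestFun Ω ψ) {x : Euc n} (hx : x ∉ Ω) : ψ x = 0 :=
  h.eq_zero fun hx' => hx (h.2.2 hx')

lemma _root_.IsTestFun.integrable (h : IsTestFun Ω ψ) : Integrable ψ :=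
  h.continuous.integrable_of_hasCompactSupport h.2.1

lemma _root_.IsTestFun.bdd (h : IsTestFun Ω ψ) : ∃ C, 0 ≤ C ∧ ∀ x, |ψ x| ≤ C := by
  obtain ⟨C, hC⟩ := h.continuous.bounded_above_of_compact_support h.2.1
  exact ⟨C, (norm_nonneg _).trans (hC 0), hC⟩

lemma isTestFun_of_subset {K : Set (Euc n)} (h : ContDiff ℝ (⊤ : ℕ∞) ψ) (hK : IsCompact K)
    (hKΩ : K ⊆ Ω) (h0 : ∀ x, x ∉ K → ψ x = 0) : IsTestFun Ω ψ := by
  have hs : tsupport ψ ⊆ K := closure_minimal (fun x hx => by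
    by_contra hxK; exact hx (h0 x hxK)) hK.isClosed
  exact ⟨h, HasCompactSupport.of_support_subset_isCompact hK (subset_closure.trans hs),
    hs.trans hKΩ⟩

lemma setIntegral_eq_of_zero {g : Euc n → ℝ} (h : ∀ x, x ∉ Ω → g x = 0) :
    ∫ x in Ω, g x = ∫ x, g x :=
  setIntegral_eq_integral_of_forall_compl_eq_zero h

/-- A smooth cutoff function. -/
lemma exists_cutoff (hU : IsOpen U) {K : Set (Euc n)} (hK : IsCompact K) (hKU : K ⊆ U) :
    ∃ φ : Euc n → ℝ, IsTestFun U φ ∧ (∀ x, 0 ≤ φ x ∧ φ x ≤ 1) ∧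
      ∃ V, IsOpen V ∧ K ⊆ V ∧ ∀ x ∈ V, φ x = 1 := by
  obtain ⟨L, hL, hKL, hLU⟩ := exists_compact_between hK hU hKU
  obtain ⟨M, hM, hLM, hMU⟩ := exists_compact_between hL hU hLU
  obtain ⟨f, hf1, hf0, hf⟩ := exists_contMDiffMap_one_nhds_of_subset_interior
    (n := (⊤ : ℕ∞)) (modelWithCornersSelf ℝ (Euc n)) (s := L) (t := M) hL.isClosed hLM
  refine ⟨f, isTestFun_of_subset f.contMDiff.contDiff hM hMU hf0, fun x => hf x,
    interior L, isOpen_interior, hKL, fun x hx => ?_⟩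
  exact (hf1.filter_mono (nhds_le_nhdsSet (interior_subset hx))).self_of_nhds

end Test

end

section

lemma exists_riesz_of_bound {V H : Type*} [AddCommGroup V] [Module ℝ V] [NormedAddCommGroup H]
    [InnerProductSpace ℝ H] [CompleteSpace H] (ι : V →ₗ[ℝ] H) (l : V →ₗ[ℝ] ℝ) (C : ℝ)
    (hb : ∀ v, |l v| ≤ C * ‖ι v‖) : ∃ h : H, ∀ v, l v = ⟪h, ι v⟫_ℝ := by
  obtain ⟨s, hs⟩ := ι.rangeRestrict.exists_rightInverse_of_surjective ι.range_rangeRestrict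
  have hs' : ∀ w : ι.range, ι (s w) = w := fun w => by
    have := LinearMap.congr_fun hs w
    simpa using congrArg Subtype.val this
  let f : StrongDual ℝ ι.range := (l ∘ₗ s).mkContinuous C (fun w => by
    have := hb (s w)
    rw [hs' w] at this
    simpa using this)
  obtain ⟨F, hF, -⟩ := _root_.exists_extension_norm_eq ι.range f
  refine ⟨(InnerProductSpace.toDual ℝ H).symm F, fun v => ?_⟩
  rw [InnerProductSpace.toDual_symm_apply]
  have h1 := hF ⟨ι v, v, rfl⟩
  simp only at h1
  rw [h1]
  change l v = l (s ⟨ι v, v, rfl⟩)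
  have h2 : ι (v - s ⟨ι v, v, rfl⟩) = 0 := by
    rw [map_sub, hs']; simp
  have h3 := hb (v - s ⟨ι v, v, rfl⟩)
  rw [h2, norm_zero, mul_zero] at h3
  have h4 := abs_nonpos_iff.1 h3
  rw [map_sub, sub_eq_zero] at h4
  exact h4

variable {U : Set (Euc n)}

lemma exists_L2_of_bound {K : Set (Euc n)} (l : (Euc n → ℝ) → ℝ)
    (hadd : ∀ ψ χ, IsTestFun U ψ → IsTestFun U χ → l (fun x => ψ x + χ x) = l ψ + l χ)
    (hsmul : ∀ (c : ℝ) ψ, IsTestFun U ψ → l (fun x => c * ψ x) = c * l ψ) (C : ℝ)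
    (hb : ∀ ψ, IsTestFun U ψ → tsupport ψ ⊆ K → |l ψ| ≤ C * √(∫ x, ψ x ^ 2)) :
    ∃ d : Euc n → ℝ, MemLp d 2 ∧
      ∀ ψ, IsTestFun U ψ → tsupport ψ ⊆ K → l ψ = ∫ x, d x * ψ x := by
  let V : Submodule ℝ (Euc n → ℝ) :=
    { carrier := {ψ | IsTestFun U ψ ∧ tsupport ψ ⊆ K}
      add_mem' := fun {a b} ha hb => ⟨ha.1.add hb.1,
        (tsupport_add a b).trans (union_subset ha.2 hb.2)⟩
      zero_mem' := ⟨⟨contDiff_const, HasCompactSupport.zero, by simp⟩, by simp⟩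
      smul_mem' := fun c a ha => ⟨ha.1.const_mul c,
        (tsupport_mul_subset_right (f := fun _ => c) (g := a)).trans ha.2⟩ }
  have hmem : ∀ ψ : V, MemLp (ψ : Euc n → ℝ) 2 := fun ψ =>
    ψ.2.1.continuous.memLp_of_hasCompactSupport ψ.2.1.2.1
  let ι : V →ₗ[ℝ] Lp ℝ 2 (volume : Measure (Euc n)) :=
    { toFun := fun ψ => (hmem ψ).toLp
      map_add' := fun a b => (MemLp.toLp_add (hmem a) (hmem b))
      map_smul' := fun c a => (MemLp.toLp_const_smul c (hmem a)) }
  let l' : V →ₗ[ℝ] ℝ :=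
    { toFun := fun ψ => l ψ
      map_add' := fun a b => hadd _ _ a.2.1 b.2.1
      map_smul' := fun c a => hsmul c _ a.2.1 }
  have hinner : ∀ (h : Lp ℝ 2 (volume : Measure (Euc n))) (ψ : V),
      ⟪h, ι ψ⟫_ℝ = ∫ x, h x * (ψ : Euc n → ℝ) x := fun h ψ => by
    rw [L2.inner_def]
    refine integral_congr_ae ?_
    filter_upwards [(hmem ψ).coeFn_toLp] with x hx
    change ⟪h x, ((hmem ψ).toLp) x⟫_ℝ = _
    rw [hx]
    simp [mul_comm]
  obtain ⟨h, hh⟩ := exists_riesz_of_bound ι l' C (fun ψ => by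
    have h1 : ‖ι ψ‖ = √(∫ x, (ψ : Euc n → ℝ) x ^ 2) := by
      rw [← Real.sqrt_sq (norm_nonneg (ι ψ)), ← real_inner_self_eq_norm_sq, hinner]
      congr 1
      refine integral_congr_ae ?_
      filter_upwards [(hmem ψ).coeFn_toLp] with x hx
      change ((hmem ψ).toLp) x * _ = _
      rw [hx]; ring
    rw [h1]
    exact hb _ ψ.2.1 ψ.2.2)
  exact ⟨h, Lp.memLp h, fun ψ h1 h2 => by rw [← hinner h ⟨ψ, h1, h2⟩]; exact hh ⟨ψ, h1, h2⟩⟩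

lemma ae_eq_of_forall_test {V : Set (Euc n)} (hV : IsOpen V) {d d' : Euc n → ℝ}
    (hd : LocallyIntegrableOn d V) (hd' : LocallyIntegrableOn d' V)
    (h : ∀ ψ, IsTestFun V ψ → ∫ x, d x * ψ x = ∫ x, d' x * ψ x) :
    ∀ᵐ x, x ∈ V → d x = d' x := by
  have h1 := hV.ae_eq_zero_of_integral_contDiff_smul_eq_zero (μ := volume)
    (f := fun x => d x - d' x) (hd.sub hd') (fun g hg hgc hgV => by
      have hi : ∀ {d : Euc n → ℝ}, LocallyIntegrableOn d V → Integrable (fun x => d x * g x) := by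
        intro d hd
        have h1 : IntegrableOn (fun x => d x * g x) (tsupport g) :=
          (hd.integrableOn_compact_subset hgV hgc).mul_continuousOn hg.continuous.continuousOn hgc
        rwa [integrableOn_iff_integrable_of_support_subset] at h1
        exact (Function.support_mul_subset_right _ _).trans subset_closure
      have := h g ⟨hg, hgc, hgV⟩
      rw [← sub_eq_zero, ← integral_sub (hi hd) (hi hd')] at this
      rw [← this]
      refine integral_congr_ae (ae_of_all _ fun x => ?_)
      simp; ring)
  filter_upwards [h1] with x hx hxV
  exact sub_eq_zero.1 (hx hxV)

/-- A linear functional on test functions which is locally bounded in `L²` is represented by a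
locally square integrable function. -/
lemma exists_L2loc_of_bound (hU : IsOpen U) (l : (Euc n → ℝ) → ℝ)
    (hadd : ∀ ψ χ, IsTestFun U ψ → IsTestFun U χ → l (fun x => ψ x + χ x) = l ψ + l χ)
    (hsmul : ∀ (c : ℝ) ψ, IsTestFun U ψ → l (fun x => c * ψ x) = c * l ψ)
    (hb : ∀ K, IsCompact K → K ⊆ U → ∃ C : ℝ, ∀ ψ, IsTestFun U ψ → tsupport ψ ⊆ K →
      |l ψ| ≤ C * √(∫ x, ψ x ^ 2)) :
    ∃ d : Euc n → ℝ, (∀ K, IsCompact K → K ⊆ U → MemLp d 2 (volume.restrict K)) ∧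
      ∀ ψ, IsTestFun U ψ → l ψ = ∫ x, d x * ψ x := by
  have h1 : ∀ K, ∃ d : Euc n → ℝ, IsCompact K → K ⊆ U → MemLp d 2 ∧
      ∀ ψ, IsTestFun U ψ → tsupport ψ ⊆ K → l ψ = ∫ x, d x * ψ x := fun K => by
    by_cases hK : IsCompact K ∧ K ⊆ U
    · obtain ⟨C, hC⟩ := hb K hK.1 hK.2
      obtain ⟨d, hd⟩ := exists_L2_of_bound l hadd hsmul C hC
      exact ⟨d, fun _ _ => hd⟩
    · exact ⟨0, fun a b => (hK ⟨a, b⟩).elim⟩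
  choose D hD using h1
  have hDD : ∀ K L, IsCompact K → K ⊆ U → IsCompact L → L ⊆ U →
      ∀ᵐ x, x ∈ interior K ∩ interior L → D K x = D L x := by
    intro K L hK hKU hL hLU
    refine ae_eq_of_forall_test (isOpen_interior.inter isOpen_interior)
      (((hD K hK hKU).1.locallyIntegrable (by norm_num)).locallyIntegrableOn _)
      (((hD L hL hLU).1.locallyIntegrable (by norm_num)).locallyIntegrableOn _) ?_
    intro ψ hψ
    have hψU : IsTestFun U ψ :=
      hψ.mono (inter_subset_left.trans (interior_subset.trans hKU))
    rw [← (hD K hK hKU).2 ψ hψU (hψ.2.2.trans (inter_subset_left.trans interior_subset)),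
      ← (hD L hL hLU).2 ψ hψU (hψ.2.2.trans (inter_subset_right.trans interior_subset))]
  have h2 : ∀ x : Euc n, ∃ r : ℝ, 0 < r ∧ (x ∈ U → Metric.closedBall x r ⊆ U) := fun x => by
    by_cases hx : x ∈ U
    · obtain ⟨r, hr, h⟩ := Metric.nhds_basis_closedBall.mem_iff.1 (hU.mem_nhds hx)
      exact ⟨r, hr, fun _ => h⟩
    · exact ⟨1, one_pos, fun h => (hx h).elim⟩
  choose r hr hrU using h2
  obtain ⟨t, htU, htc, ht⟩ := TopologicalSpace.countable_cover_nhdsWithin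
    (f := fun x => Metric.ball x (r x)) (s := U)
    (fun x _ => mem_nhdsWithin_of_mem_nhds (Metric.ball_mem_nhds x (hr x)))
  have := htc.to_subtype
  let B : t → Set (Euc n) := fun a => Metric.closedBall a.1 (r a.1)
  have hBc : ∀ a, IsCompact (B a) := fun a => isCompact_closedBall _ _
  have hBU : ∀ a, B a ⊆ U := fun a => hrU a.1 (htU a.2)
  classical
  let d : Euc n → ℝ := fun x => if h : ∃ a : t, x ∈ interior (B a) then D (B h.choose) x else 0
  have hd : ∀ K, IsCompact K → K ⊆ U → ∀ᵐ x, x ∈ interior K → d x = D K x := by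
    intro K hK hKU
    filter_upwards [ae_all_iff.2 fun a => hDD (B a) K (hBc a) (hBU a) hK hKU] with x hx hxK
    have hex : ∃ a : t, x ∈ interior (B a) := by
      have := ht (hKU (interior_subset hxK))
      simp only [mem_iUnion] at this
      obtain ⟨y, hy, hxy⟩ := this
      exact ⟨⟨y, hy⟩, Metric.ball_subset_interior_closedBall hxy⟩
    simp only [d, dif_pos hex]
    exact hx _ ⟨hex.choose_spec, hxK⟩
  refine ⟨d, fun K hK hKU => ?_, fun ψ hψ => ?_⟩
  · obtain ⟨L, hL, hKL, hLU⟩ := exists_compact_between hK hU hKU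
    refine ((hD L hL hLU).1.restrict K).ae_eq ?_
    refine (ae_restrict_iff' hK.measurableSet).2 ?_
    filter_upwards [hd L hL hLU] with x hx hxK
    exact (hx (hKL hxK)).symm
  · obtain ⟨L, hL, hKL, hLU⟩ := exists_compact_between hψ.isCompact hU hψ.2.2
    rw [(hD L hL hLU).2 ψ hψ (hKL.trans interior_subset)]
    refine integral_congr_ae ?_
    filter_upwards [hd L hL hLU] with x hx
    by_cases hxψ : x ∈ tsupport ψ
    · rw [hx (hKL hxψ)]
    · simp [hψ.eq_zero hxψ]

end

section

open Filter

lemma _root_.MeasureTheory.MemLp.imul {μ : Measure (Euc n)} {a b : Euc n → ℝ} (ha : MemLp a 2 μ)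
    (hb : MemLp b 2 μ) : Integrable (fun x => a x * b x) μ := ha.integrable_mul hb

lemma _root_.MeasureTheory.MemLp.isub {μ : Measure (Euc n)} {q : ℝ≥0∞} {a b : Euc n → ℝ}
    (ha : MemLp a q μ) (hb : MemLp b q μ) : MemLp (fun x => a x - b x) q μ := ha.sub hb

lemma _root_.MeasureTheory.MemLp.iadd {μ : Measure (Euc n)} {q : ℝ≥0∞} {a b : Euc n → ℝ}
    (ha : MemLp a q μ) (hb : MemLp b q μ) : MemLp (fun x => a x + b x) q μ := ha.add hb

lemma abs_integral_mul_le {a b : Euc n → ℝ} (ha : MemLp a 2) (hb : MemLp b 2) :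
    |∫ x, a x * b x| ≤ √(∫ x, a x ^ 2) * √(∫ x, b x ^ 2) := by
  have h := integral_mul_le_Lp_mul_Lq_of_nonneg (μ := (volume : Measure (Euc n)))
    (Real.HolderConjugate.two_two) (f := fun x => |a x|) (g := fun x => |b x|)
    (ae_of_all _ fun x => abs_nonneg _) (ae_of_all _ fun x => abs_nonneg _)
    (by simpa using ha.norm) (by simpa using hb.norm)
  have h2 : |∫ x, a x * b x| ≤ ∫ x, |a x| * |b x| := by
    refine (abs_integral_le_integral_abs).trans (le_of_eq ?_)
    simp [abs_mul]
  refine h2.trans (h.trans (le_of_eq ?_))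
  simp [Real.sqrt_eq_rpow]

lemma _root_.MeasureTheory.Integrable.iadd {μ : Measure (Euc n)} {a b : Euc n → ℝ}
    (ha : Integrable a μ) (hb : Integrable b μ) : Integrable (fun x => a x + b x) μ := ha.add hb

lemma _root_.MeasureTheory.Integrable.isub {μ : Measure (Euc n)} {a b : Euc n → ℝ}
    (ha : Integrable a μ) (hb : Integrable b μ) : Integrable (fun x => a x - b x) μ := ha.sub hb

/-- `x m` tends to `g` in `L²`. -/
structure TL2 (x : ℕ → Euc n → ℝ) (g : Euc n → ℝ) : Prop where
  mem : ∀ m, MemLp (x m) 2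
  memLim : MemLp g 2
  tendsto : Tendsto (fun m => ∫ z, (x m z - g z) ^ 2) atTop (𝓝 0)

lemma TL2.integral_mul_const {x : ℕ → Euc n → ℝ} {g b : Euc n → ℝ} (h : TL2 x g)
    (hb : MemLp b 2) : Tendsto (fun m => ∫ z, x m z * b z) atTop (𝓝 (∫ z, g z * b z)) := by
  rw [tendsto_iff_dist_tendsto_zero]
  refine squeeze_zero (g := fun m => √(∫ z, (x m z - g z) ^ 2) * √(∫ z, b z ^ 2))
    (fun _ => dist_nonneg) (fun m => ?_) ?_
  · rw [Real.dist_eq, ← integral_sub ((h.mem m).imul hb) (h.memLim.imul hb)]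
    refine le_trans (le_of_eq ?_) (abs_integral_mul_le ((h.mem m).isub h.memLim) hb)
    congr 1
    refine integral_congr_ae (ae_of_all _ fun z => ?_)
    simp; ring
  · have := (h.tendsto.sqrt).mul_const (√(∫ z, b z ^ 2))
    simpa using this

lemma TL2.bdd {x : ℕ → Euc n → ℝ} {g : Euc n → ℝ} (h : TL2 x g) :
    ∃ C, 0 ≤ C ∧ ∀ᶠ m in atTop, ∫ z, x m z ^ 2 ≤ C := by
  refine ⟨2 * (1 + ∫ z, g z ^ 2), by positivity, ?_⟩
  filter_upwards [h.tendsto.eventually_le_const one_pos] with m hm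
  have h1 := ((h.mem m).isub h.memLim).integrable_sq
  have : ∫ z, x m z ^ 2 ≤ ∫ z, 2 * ((x m z - g z) ^ 2 + g z ^ 2) := by
    refine integral_mono (h.mem m).integrable_sq ((h1.add h.memLim.integrable_sq).const_mul 2)
      fun z => ?_
    simp only
    nlinarith [sq_nonneg (x m z - g z - g z)]
  rw [integral_const_mul, integral_add h1 h.memLim.integrable_sq] at this
  linarith

lemma TL2.integral_mul {x y : ℕ → Euc n → ℝ} {g k : Euc n → ℝ} (h : TL2 x g)
    (h' : TL2 y k) : Tendsto (fun m => ∫ z, x m z * y m z) atTop (𝓝 (∫ z, g z * k z)) := by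
  obtain ⟨C, hC, hb⟩ := h.bdd
  have h1 := h.integral_mul_const h'.memLim
  have h2 : Tendsto (fun m => ∫ z, x m z * (y m z - k z)) atTop (𝓝 0) := by
    refine squeeze_zero_norm' (a := fun m => √C * √(∫ z, (y m z - k z) ^ 2)) ?_ ?_
    · filter_upwards [hb] with m hm
      refine (abs_integral_mul_le (h.mem m) ((h'.mem m).isub h'.memLim)).trans ?_
      gcongr
    · simpa using (h'.tendsto.sqrt).const_mul (√C)
  have h3 := h1.add h2
  rw [add_zero] at h3
  refine h3.congr fun m => ?_
  rw [← integral_add ((h.mem m).imul h'.memLim)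
    ((h.mem m).imul ((h'.mem m).isub h'.memLim))]
  refine integral_congr_ae (ae_of_all _ fun z => ?_)
  simp; ring

/-- Uniform convergence with supports in a fixed compact set implies convergence in `L²`. -/
lemma TL2.of_unif {x : ℕ → Euc n → ℝ} {g : Euc n → ℝ} {K : Set (Euc n)} (hK : IsCompact K)
    (hx : ∀ m, MemLp (x m) 2) (hg : MemLp g 2)
    (h0 : ∀ᶠ m in atTop, ∀ z, z ∉ K → x m z = g z)
    (hu : ∀ ε > 0, ∀ᶠ m in atTop, ∀ z, |x m z - g z| ≤ ε) : TL2 x g := by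
  refine ⟨hx, hg, ?_⟩
  rw [Metric.tendsto_atTop']
  intro ε hε
  have hv : 0 ≤ volume.real K := measureReal_nonneg
  have h1 := hu (√(ε / (2 * (volume.real K + 1)))) (by positivity)
  obtain ⟨M, hM⟩ := eventually_atTop.1 (h0.and h1)
  refine ⟨M, fun m hm => ?_⟩
  obtain ⟨h2, h3⟩ := hM m hm.le
  rw [Real.dist_eq, sub_zero, abs_of_nonneg (by positivity)]
  have h4 : ∫ z, (x m z - g z) ^ 2 ≤ ∫ z, K.indicator (fun _ => ε / (2 * (volume.real K + 1))) z := by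
    refine integral_mono (((hx m).isub hg).integrable_sq)
      ((integrable_indicator_iff hK.measurableSet).2 (integrableOn_const hK.measure_lt_top.ne)) fun z => ?_
    by_cases hz : z ∈ K
    · simp only [indicator_of_mem hz]
      rw [← sq_abs]
      refine (pow_le_pow_left₀ (abs_nonneg _) (h3 z) 2).trans (le_of_eq ?_)
      rw [Real.sq_sqrt (by positivity)]
    · simp [indicator_of_notMem hz, h2 z hz]
  refine h4.trans_lt ?_
  rw [integral_indicator hK.measurableSet, setIntegral_const, smul_eq_mul]
  have h5 : volume.real K * (ε / (2 * (volume.real K + 1))) = ε / 2 * (volume.real K / (volume.real K + 1)) := by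
    field_simp
  have h6 : volume.real K / (volume.real K + 1) ≤ 1 := by
    rw [div_le_one (by positivity)]; linarith
  rw [h5]
  nlinarith

lemma memLp_of_continuousOn {K : Set (Euc n)} (hK : IsCompact K) {g : Euc n → ℝ}
    (hg : ContinuousOn g K) : MemLp g 2 (volume.restrict K) := by
  have hm : AEStronglyMeasurable g (volume.restrict K) := hg.aestronglyMeasurable hK.measurableSet
  rw [memLp_two_iff_integrable_sq hm]
  exact (hg.pow 2).integrableOn_compact hK

lemma memLp_of_restrict {K : Set (Euc n)} {q : ℝ≥0∞} (hK : IsCompact K) {g : Euc n → ℝ}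
    (hg : MemLp g q (volume.restrict K)) (h0 : ∀ x, x ∉ K → g x = 0) : MemLp g q := by
  have := (memLp_indicator_iff_restrict hK.measurableSet (f := g) (p := q) (μ := volume)).2 hg
  rwa [indicator_eq_self.2 (fun x hx => by by_contra h; exact hx (h0 x h))] at this

end

section

open Filter

/-- Convolution of `g` with `ρ`. -/
def cv (g ρ : Euc n → ℝ) (x : Euc n) : ℝ := ∫ t, g t * ρ (x - t)

/-- `d` is the weak `i`-th derivative of `g` in `U`, in terms of integrals over the whole space. -/
def WPD (U : Set (Euc n)) (g d : Euc n → ℝ) (i : Fin n) : Prop :=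
  ∀ ψ : Euc n → ℝ, IsTestFun U ψ → ∫ x, g x * pd ψ i x = - ∫ x, d x * ψ x

lemma cv_eq (g ρ : Euc n → ℝ) :
    cv g ρ = convolution g ρ (ContinuousLinearMap.lsmul ℝ ℝ) volume := rfl

section

variable {g ρ d : Euc n → ℝ}

lemma cv_contDiff (hg : LocallyIntegrable g) (hρ : IsTestFun univ ρ) :
    ContDiff ℝ (⊤ : ℕ∞) (cv g ρ) :=
  hρ.2.1.contDiff_convolution_right (ContinuousLinearMap.lsmul ℝ ℝ) hg hρ.1

lemma isTestFun_reflect (hρ : IsTestFun univ ρ) (x : Euc n) :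
    IsTestFun univ (fun t => ρ (x - t)) :=
  ⟨hρ.1.comp (contDiff_const.sub contDiff_id), hρ.2.1.comp_homeomorph (Homeomorph.subLeft x),
    subset_univ _⟩

lemma _root_.MeasureTheory.LocallyIntegrable.mul_test (hg : LocallyIntegrable g) {χ : Euc n → ℝ}
    (hχ : Continuous χ) (hc : HasCompactSupport χ) : Integrable (fun t => g t * χ t) := by
  have := hg.integrable_smul_right_of_hasCompactSupport hχ hc
  simpa [mul_comm] using this

lemma cv_integrable (hg : LocallyIntegrable g) (hρ : IsTestFun univ ρ) (x : Euc n) :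
    Integrable (fun t => g t * ρ (x - t)) :=
  hg.mul_test (isTestFun_reflect hρ x).continuous (isTestFun_reflect hρ x).2.1

lemma pd_reflect (hρ : ContDiff ℝ (⊤ : ℕ∞) ρ) (i : Fin n) (x t : Euc n) :
    pd (fun s => ρ (x - s)) i t = - pd ρ i (x - t) := by
  have h1 : HasFDerivAt (fun s => x - s) (-ContinuousLinearMap.id ℝ (Euc n)) t := by
    simpa using (hasFDerivAt_id t).const_sub x
  have := ((hρ.diffAt (x - t)).hasFDerivAt.comp t h1).fderiv
  simp only [Function.comp_def] at this
  simp [pd, this]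

lemma cv_pd (hg : LocallyIntegrable g) (hρ : IsTestFun univ ρ) (i : Fin n) :
    pd (cv g ρ) i = cv g (pd ρ i) := by
  ext x
  have h := (hρ.2.1.hasFDerivAt_convolution_right (ContinuousLinearMap.lsmul ℝ ℝ) hg
    (hρ.1.of_le (by norm_cast)) x).fderiv
  rw [pd, cv_eq, h, cv]
  unfold convolution
  rw [ContinuousLinearMap.integral_apply]
  · simp [pd]
  · exact ((hρ.2.1.fderiv ℝ).convolutionExists_right _ hg
      (hρ.1.continuous_fderiv (by simp))) x

lemma cv_pd_of_weak (hg : LocallyIntegrable g) {i : Fin n}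
    (hw : WPD univ g d i) (hρ : IsTestFun univ ρ) : pd (cv g ρ) i = cv d ρ := by
  rw [cv_pd hg hρ]
  ext x
  have h := hw _ (isTestFun_reflect hρ x)
  simp only [pd_reflect hρ.1, mul_neg, integral_neg, neg_inj] at h
  exact h

lemma cv_eq_zero {K : Set (Euc n)} {r : ℝ} (hg : ∀ x, x ∉ K → g x = 0)
    (hρ : ∀ x, r < ‖x‖ → ρ x = 0) {x : Euc n} (hx : x ∉ Metric.cthickening r K) :
    cv g ρ x = 0 := by
  unfold cv
  rw [← integral_zero (Euc n) ℝ (μ := volume)]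
  refine integral_congr_ae (ae_of_all _ fun t => ?_)
  by_cases ht : t ∈ K
  · have : r < ‖x - t‖ := by
      by_contra h
      exact hx (Metric.mem_cthickening_of_dist_le x t r K ht (by rw [dist_eq_norm]; linarith))
    simp [hρ _ this]
  · simp [hg _ ht]

lemma cv_sub {g' : Euc n → ℝ} (hg : LocallyIntegrable g) (hg' : LocallyIntegrable g')
    (hρ : IsTestFun univ ρ) (x : Euc n) :
    cv (fun t => g t - g' t) ρ x = cv g ρ x - cv g' ρ x := by
  unfold cv
  rw [← integral_sub (cv_integrable hg hρ x) (cv_integrable hg' hρ x)]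
  simp [sub_mul]

end

/-- A sequence of mollifying kernels. -/
def bump (n m : ℕ) : ContDiffBump (0 : Euc n) :=
  ⟨1 / (m + 2), 1 / (m + 1), by positivity, by gcongr; norm_num⟩

/-- The normalised mollifying kernel. -/
def rho (m : ℕ) : Euc n → ℝ := (bump n m).normed volume

/-- Mollification. -/
def moll (m : ℕ) (g : Euc n → ℝ) : Euc n → ℝ := cv g (rho m)

lemma rho_test (m : ℕ) : IsTestFun univ (rho (n := n) m) :=
  ⟨(bump n m).contDiff_normed, (bump n m).hasCompactSupport_normed, subset_univ _⟩

lemma rho_nonneg (m : ℕ) (x : Euc n) : 0 ≤ rho m x := (bump n m).nonneg_normed x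

lemma rho_integral (m : ℕ) : ∫ x, rho (n := n) m x = 1 := (bump n m).integral_normed

lemma rho_eq_zero (m : ℕ) (x : Euc n) (hx : 1 / ((m : ℝ) + 1) < ‖x‖) : rho m x = 0 := by
  refine image_eq_zero_of_notMem_tsupport ?_
  unfold rho
  rw [ContDiffBump.tsupport_normed_eq]
  simpa [bump] using hx

lemma rho_sub_integral (m : ℕ) (x : Euc n) : ∫ t, rho m (x - t) = 1 := by
  rw [integral_sub_left_eq_self (fun t => rho m t) volume x, rho_integral]

lemma sq_cv_le {g ρ : Euc n → ℝ} (hg : MemLp g 2) (hρ : IsTestFun univ ρ) (h0 : ∀ x, 0 ≤ ρ x)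
    (h1 : ∀ x, ∫ t, ρ (x - t) = 1) (x : Euc n) : cv g ρ x ^ 2 ≤ cv (fun t => g t ^ 2) ρ x := by
  have hgl := hg.locallyIntegrable (by norm_num)
  have hg2 := hg.integrable_sq.locallyIntegrable
  set c := cv g ρ x with hc
  have i1 := cv_integrable hg2 hρ x
  have i2 := (cv_integrable hgl hρ x).const_mul (2 * c)
  have i3 := (isTestFun_reflect hρ x).integrable.const_mul (c ^ 2)
  have h2 : 0 ≤ ∫ t, (g t ^ 2 * ρ (x - t) - 2 * c * (g t * ρ (x - t)) + c ^ 2 * ρ (x - t)) := by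
    refine integral_nonneg fun t => ?_
    have : g t ^ 2 * ρ (x - t) - 2 * c * (g t * ρ (x - t)) + c ^ 2 * ρ (x - t) =
      (g t - c) ^ 2 * ρ (x - t) := by ring
    simp only [this]
    exact mul_nonneg (sq_nonneg _) (h0 _)
  rw [integral_add (i1.isub i2) i3, integral_sub i1 i2, integral_const_mul, integral_const_mul,
    h1 x] at h2
  change 0 ≤ cv (fun t => g t ^ 2) ρ x - 2 * c * cv g ρ x + c ^ 2 * 1 at h2
  rw [← hc] at h2
  nlinarith

lemma cv_sq_integral {g ρ : Euc n → ℝ} (hg : MemLp g 2) (hρ : IsTestFun univ ρ)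
    (h0 : ∀ x, 0 ≤ ρ x) (h1 : ∀ x, ∫ t, ρ (x - t) = 1) (h2 : ∫ t, ρ t = 1) :
    MemLp (cv g ρ) 2 ∧ ∫ x, cv g ρ x ^ 2 ≤ ∫ x, g x ^ 2 := by
  have hgl := hg.locallyIntegrable (by norm_num)
  have i1 : Integrable (cv (fun t => g t ^ 2) ρ) := by
    rw [cv_eq]
    exact hg.integrable_sq.integrable_convolution _ hρ.integrable
  have hm : Continuous (cv g ρ) := (cv_contDiff hgl hρ).continuous
  have i2 : Integrable (fun x => cv g ρ x ^ 2) := by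
    refine i1.mono (hm.pow 2).aestronglyMeasurable (ae_of_all _ fun x => ?_)
    rw [Real.norm_of_nonneg (sq_nonneg _)]
    exact (sq_cv_le hg hρ h0 h1 x).trans (le_abs_self _)
  refine ⟨(memLp_two_iff_integrable_sq hm.aestronglyMeasurable).2 i2, ?_⟩
  refine (integral_mono i2 i1 (sq_cv_le hg hρ h0 h1)).trans (le_of_eq ?_)
  rw [cv_eq, integral_convolution _ hg.integrable_sq hρ.integrable, h2]
  simp

lemma moll_unif {g : Euc n → ℝ} (hg : UniformContinuous g) {ε : ℝ} (hε : 0 < ε) :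
    ∀ᶠ m in atTop, ∀ x, |moll m g x - g x| ≤ ε := by
  obtain ⟨δ, hδ, h⟩ := Metric.uniformContinuous_iff.1 hg ε hε
  have h1 : Tendsto (fun m : ℕ => 1 / ((m : ℝ) + 1)) atTop (𝓝 0) :=
    tendsto_one_div_add_atTop_nhds_zero_nat
  filter_upwards [h1.eventually_lt_const hδ] with m hm x
  have h2 : moll m g x - g x = ∫ t, (g t - g x) * rho m (x - t) := by
    have i1 := cv_integrable hg.continuous.locallyIntegrable (rho_test m) x
    have i2 := (isTestFun_reflect (rho_test m) x).integrable.const_mul (g x)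
    simp_rw [sub_mul]
    rw [integral_sub i1 i2, integral_const_mul, rho_sub_integral, mul_one]
    rfl
  rw [h2]
  refine (abs_integral_le_integral_abs).trans ?_
  have i2 := (isTestFun_reflect (rho_test m) x).integrable.const_mul ε
  have h3 : ∫ t, |(g t - g x) * rho m (x - t)| ≤ ∫ t, ε * rho m (x - t) := by
    refine integral_mono_of_nonneg (ae_of_all _ fun t => abs_nonneg _) i2 (ae_of_all _ fun t => ?_)
    simp only [abs_mul, abs_of_nonneg (rho_nonneg _ _)]
    by_cases ht : 1 / ((m : ℝ) + 1) < ‖x - t‖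
    · simp [rho_eq_zero m _ ht]
    · refine mul_le_mul_of_nonneg_right (le_of_lt ?_) (rho_nonneg _ _)
      rw [← Real.dist_eq]
      refine h ?_
      rw [dist_comm, dist_eq_norm]
      linarith
  refine h3.trans (le_of_eq ?_)
  rw [integral_const_mul, rho_sub_integral, mul_one]

lemma moll_eq_zero {K : Set (Euc n)} {g : Euc n → ℝ} (hg : ∀ x, x ∉ K → g x = 0) (m : ℕ)
    {x : Euc n} (hx : x ∉ Metric.cthickening (1 / ((m : ℝ) + 1)) K) : moll m g x = 0 :=
  cv_eq_zero hg (rho_eq_zero m) hx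

lemma moll_test {K U : Set (Euc n)} {g : Euc n → ℝ} (hgl : LocallyIntegrable g)
    (hK : IsCompact K) (hU : IsOpen U) (hKU : K ⊆ U) (hg : ∀ x, x ∉ K → g x = 0) :
    ∀ᶠ m in atTop, IsTestFun U (moll m g) := by
  obtain ⟨δ, hδ, h⟩ := hK.exists_cthickening_subset_open hU hKU
  have h1 : Tendsto (fun m : ℕ => 1 / ((m : ℝ) + 1)) atTop (𝓝 0) :=
    tendsto_one_div_add_atTop_nhds_zero_nat
  filter_upwards [h1.eventually_lt_const hδ] with m hm
  exact isTestFun_of_subset (cv_contDiff hgl (rho_test m)) hK.cthickening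
    ((Metric.cthickening_mono hm.le K).trans h) fun x hx => moll_eq_zero hg m hx

lemma moll_tl2 {g : Euc n → ℝ} (hg : MemLp g 2) : TL2 (fun m => moll m g) g := by
  have hb : ∀ {g : Euc n → ℝ} m, MemLp g 2 → MemLp (moll m g) 2 ∧
      ∫ x, moll m g x ^ 2 ≤ ∫ x, g x ^ 2 := fun m hg =>
    cv_sq_integral hg (rho_test m) (rho_nonneg m) (rho_sub_integral m) (rho_integral m)
  refine ⟨fun m => (hb m hg).1, hg, ?_⟩
  rw [Metric.tendsto_atTop']
  intro ε hε
  obtain ⟨k, hkc, hk1, hk2, hk3⟩ := MemLp.exists_hasCompactSupport_integral_rpow_sub_le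
    (p := 2) two_pos (f := g) (by simpa using hg) (ε := ε / 12) (by positivity)
  have hk3 : MemLp k 2 := by simpa using hk3
  have hk1 : ∫ x, (g x - k x) ^ 2 ≤ ε / 12 := by simpa using hk1
  have hT : TL2 (fun m => moll m k) k := by
    refine TL2.of_unif (hkc.isCompact.cthickening (r := 1)) (fun m => (hb m hk3).1) hk3
      (.of_forall fun m z hz => ?_) fun ε hε => moll_unif (hkc.uniformContinuous_of_continuous hk2) hε
    have h1 : 1 / ((m : ℝ) + 1) ≤ 1 := by rw [div_le_one (by positivity)]; linarith [m.cast_nonneg (α := ℝ)]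
    rw [moll_eq_zero (fun x hx => image_eq_zero_of_notMem_tsupport hx) m
      (fun h => hz (Metric.cthickening_mono h1 _ h)),
      image_eq_zero_of_notMem_tsupport fun h => hz (Metric.self_subset_cthickening _ h)]
  obtain ⟨M, hM⟩ := eventually_atTop.1 (hT.tendsto.eventually_lt_const (show 0 < ε / 12 by positivity))
  refine ⟨M, fun m hm => ?_⟩
  rw [Real.dist_eq, sub_zero, abs_of_nonneg (by positivity)]
  have h1 := (hg.isub hk3)
  have h2 := hb m h1
  have h3 := (hT.mem m).isub hk3
  have hl := hg.locallyIntegrable (by norm_num : (1 : ℝ≥0∞) ≤ 2)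
  have hlk := hk3.locallyIntegrable (by norm_num : (1 : ℝ≥0∞) ≤ 2)
  have h4 : ∫ z, (moll m g z - g z) ^ 2 ≤
      ∫ z, 3 * (moll m (fun t => g t - k t) z ^ 2 + (moll m k z - k z) ^ 2 + (g z - k z) ^ 2) := by
    refine integral_mono (((hb m hg).1.isub hg).integrable_sq)
      (((h2.1.integrable_sq.iadd h3.integrable_sq).iadd h1.integrable_sq).const_mul 3) fun z => ?_
    have := cv_sub hl hlk (rho_test m) z
    simp only [moll, this]
    nlinarith [sq_nonneg (cv g (rho m) z - cv k (rho m) z - (cv k (rho m) z - k z)),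
      sq_nonneg (cv g (rho m) z - cv k (rho m) z + (g z - k z)),
      sq_nonneg ((cv k (rho m) z - k z) + (g z - k z))]
  rw [integral_const_mul, integral_add (h2.1.integrable_sq.iadd h3.integrable_sq) h1.integrable_sq,
    integral_add h2.1.integrable_sq h3.integrable_sq] at h4
  have := hM m hm.le
  linarith [h2.2]

end

section

open Filter

variable {U V : Set (Euc n)} {g d g' d' : Euc n → ℝ} {i : Fin n}

/-- Locally square integrable functions. -/
def L2loc (U : Set (Euc n)) (g : Euc n → ℝ) : Prop :=
  ∀ K, IsCompact K → K ⊆ U → MemLp g 2 (volume.restrict K)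

lemma L2loc.mono (h : L2loc U g) (hV : V ⊆ U) : L2loc V g := fun K hK hKV => h K hK (hKV.trans hV)

lemma L2loc.memLp (h : L2loc U g) {K : Set (Euc n)} (hK : IsCompact K) (hKU : K ⊆ U)
    (h0 : ∀ x, x ∉ K → g x = 0) : MemLp g 2 := memLp_of_restrict hK (h K hK hKU) h0

lemma L2loc.of_continuousOn (h : ContinuousOn g U) : L2loc U g := fun _ hK hKU =>
  memLp_of_continuousOn hK (h.mono hKU)

lemma L2loc.add (h : L2loc U g) (h' : L2loc U g') : L2loc U (fun x => g x + g' x) :=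
  fun K hK hKU => (h K hK hKU).iadd (h' K hK hKU)

lemma L2loc.sub (h : L2loc U g) (h' : L2loc U g') : L2loc U (fun x => g x - g' x) :=
  fun K hK hKU => (h K hK hKU).isub (h' K hK hKU)

lemma L2loc.sum {ι : Type*} (s : Finset ι) {g : ι → Euc n → ℝ} (h : ∀ a ∈ s, L2loc U (g a)) :
    L2loc U (fun x => ∑ a ∈ s, g a x) :=
  fun K hK hKU => memLp_finsetSum s fun a ha => h a ha K hK hKU

lemma L2loc.mul_cont (h : L2loc U g) {a : Euc n → ℝ} (ha : ContinuousOn a U) :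
    L2loc U (fun x => a x * g x) := by
  intro K hK hKU
  obtain ⟨C, hC⟩ := hK.exists_bound_of_continuousOn (ha.mono hKU)
  have h1 := h K hK hKU
  have hm : AEStronglyMeasurable a (volume.restrict K) :=
    (ha.mono hKU).aestronglyMeasurable hK.measurableSet
  refine MemLp.of_le (h1.const_mul C) (hm.mul h1.1) ?_
  refine (ae_restrict_iff' hK.measurableSet).2 (ae_of_all _ fun x hx => ?_)
  rw [norm_mul, norm_mul]
  exact mul_le_mul_of_nonneg_right ((hC x hx).trans (le_abs_self _)) (norm_nonneg _)

lemma L2loc.const_mul (h : L2loc U g) (c : ℝ) : L2loc U (fun x => c * g x) :=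
  h.mul_cont continuousOn_const

lemma L2loc.locallyIntegrableOn (h : L2loc U g) (hU : IsOpen U) : LocallyIntegrableOn g U := by
  rw [locallyIntegrableOn_iff hU.isLocallyClosed]
  intro K hKU hK
  have := isFiniteMeasure_restrict.2 (hK.measure_lt_top (μ := (volume : Measure (Euc n)))).ne
  exact (h K hK hKU).integrable (by norm_num)

lemma L2loc.mul_test (h : L2loc U g) {χ : Euc n → ℝ} (hχ : IsTestFun U χ) :
    MemLp (fun x => χ x * g x) 2 :=
  (h.mul_cont hχ.continuous.continuousOn).memLp hχ.isCompact hχ.2.2 fun x hx => by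
    simp [hχ.eq_zero hx]

lemma L2loc.integrable (h : L2loc U g) {K : Set (Euc n)} (hK : IsCompact K) (hKU : K ⊆ U)
    (h0 : ∀ x, x ∉ K → g x = 0) : Integrable g := by
  have := isFiniteMeasure_restrict.2 (hK.measure_lt_top (μ := (volume : Measure (Euc n)))).ne
  have h1 := (h K hK hKU).integrable (by norm_num)
  rwa [← IntegrableOn, integrableOn_iff_integrable_of_support_subset] at h1
  exact fun x hx => by by_contra h; exact hx (h0 x h)

lemma L2loc.integrable_test (h : L2loc U g) {χ : Euc n → ℝ} (hχ : IsTestFun U χ) :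
    Integrable (fun x => g x * χ x) := by
  have := (h.mul_cont hχ.continuous.continuousOn).integrable hχ.isCompact hχ.2.2 fun x hx => by
    simp [hχ.eq_zero hx]
  simpa [mul_comm] using this

/-- A locally integrable product of two locally square integrable functions. -/
lemma L2loc.integrable_mul (h : L2loc U g) (h' : L2loc U g') {χ : Euc n → ℝ}
    (hχ : IsTestFun U χ) : Integrable (fun x => g x * g' x * χ x) := by
  obtain ⟨ζ, hζ, -, W, hW, hKW, h1⟩ := exists_cutoff isOpen_univ hχ.isCompact (subset_univ _)
  have h1' : ∀ x, χ x * ζ x = χ x := fun x => by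
    by_cases hx : x ∈ tsupport χ
    · rw [h1 x (hKW hx), mul_one]
    · simp [hχ.eq_zero hx]
  have h2 : MemLp (fun x => (χ x * ζ x) * g x) 2 := by
    simp only [h1']; exact h.mul_test hχ
  have hK := hχ.isCompact
  have h3 := (h' _ hK hχ.2.2).imul (h.mul_test hχ |>.restrict (tsupport χ))
  have h4 : IntegrableOn (fun x => g x * g' x * χ x) (tsupport χ) := by
    refine h3.congr (ae_of_all _ fun x => ?_)
    simp only; ring
  rwa [integrableOn_iff_integrable_of_support_subset] at h4
  intro x hx
  by_contra h
  exact hx (by simp [hχ.eq_zero h])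

lemma WPD.mono (h : WPD U g d i) (hV : V ⊆ U) : WPD V g d i := fun ψ hψ => h ψ (hψ.mono hV)

lemma WPD.congr (h : WPD U g d i) (h1 : ∀ᵐ x, x ∈ U → g x = g' x)
    (h2 : ∀ᵐ x, x ∈ U → d x = d' x) : WPD U g' d' i := by
  intro ψ hψ
  have e1 : ∫ x, g' x * pd ψ i x = ∫ x, g x * pd ψ i x := by
    refine integral_congr_ae ?_
    filter_upwards [h1] with x hx
    by_cases hxU : x ∈ U
    · rw [hx hxU]
    · simp [(hψ.pd i).eq_zero' hxU]
  have e2 : ∫ x, d' x * ψ x = ∫ x, d x * ψ x := by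
    refine integral_congr_ae ?_
    filter_upwards [h2] with x hx
    by_cases hxU : x ∈ U
    · rw [hx hxU]
    · simp [hψ.eq_zero' hxU]
  rw [e1, e2, h ψ hψ]

lemma hasWeakPD_of_wpd (h : WPD U g d i) : HasWeakPD U g d i := by
  intro ψ hψ
  rw [setIntegral_eq_of_zero fun x hx => by simp [(hψ.pd i).eq_zero' hx],
    setIntegral_eq_of_zero fun x hx => by simp [hψ.eq_zero' hx], h ψ hψ]

lemma WPD.add (h : WPD U g d i) (h' : WPD U g' d' i) (hg : L2loc U g) (hd : L2loc U d)
    (hg' : L2loc U g') (hd' : L2loc U d') :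
    WPD U (fun x => g x + g' x) (fun x => d x + d' x) i := by
  intro ψ hψ
  simp only [add_mul]
  rw [integral_add (hg.integrable_test (hψ.pd i)) (hg'.integrable_test (hψ.pd i)),
    integral_add (hd.integrable_test hψ) (hd'.integrable_test hψ), h ψ hψ, h' ψ hψ]
  ring

lemma WPD.const_mul (h : WPD U g d i) (c : ℝ) : WPD U (fun x => c * g x) (fun x => c * d x) i := by
  intro ψ hψ
  simp only [mul_assoc]
  rw [integral_const_mul, integral_const_mul, h ψ hψ, mul_neg]

lemma WPD.sub (h : WPD U g d i) (h' : WPD U g' d' i) (hg : L2loc U g) (hd : L2loc U d)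
    (hg' : L2loc U g') (hd' : L2loc U d') :
    WPD U (fun x => g x - g' x) (fun x => d x - d' x) i := by
  have := h.add (h'.const_mul (-1)) hg hd (hg'.const_mul _) (hd'.const_mul _)
  simpa [sub_eq_add_neg] using this

lemma wpd_zero : WPD U (fun _ => 0) (fun _ => 0) i := fun ψ _ => by simp

lemma WPD.sum {ι : Type*} (s : Finset ι) {g d : ι → Euc n → ℝ} (h : ∀ a ∈ s, WPD U (g a) (d a) i)
    (hg : ∀ a ∈ s, L2loc U (g a)) (hd : ∀ a ∈ s, L2loc U (d a)) :
    WPD U (fun x => ∑ a ∈ s, g a x) (fun x => ∑ a ∈ s, d a x) i := by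
  classical
  induction s using Finset.induction_on with
  | empty => simpa using wpd_zero
  | insert a s ha ih =>
    simp only [Finset.sum_insert ha]
    refine (h a (Finset.mem_insert_self a s)).add (ih (fun b hb => h b (Finset.mem_insert_of_mem hb))
      (fun b hb => hg b (Finset.mem_insert_of_mem hb)) fun b hb => hd b (Finset.mem_insert_of_mem hb))
      (hg a (Finset.mem_insert_self a s)) (hd a (Finset.mem_insert_self a s))
      (L2loc.sum s fun b hb => hg b (Finset.mem_insert_of_mem hb))
      (L2loc.sum s fun b hb => hd b (Finset.mem_insert_of_mem hb))

/-- Classical derivatives are weak derivatives. -/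
lemma wpd_of_C1 (hg : ∀ x ∈ U, DifferentiableAt ℝ g x) (hc : ContinuousOn (pd g i) U) :
    WPD U g (pd g i) i := by
  intro ψ hψ
  have hgc : ContinuousOn g U := fun x hx => (hg x hx).continuousAt.continuousWithinAt
  exact integral_mul_fderiv_eq_neg_fderiv_mul_of_integrable
    ((L2loc.of_continuousOn hc).integrable_test hψ)
    ((L2loc.of_continuousOn hgc).integrable_test (hψ.pd i))
    ((L2loc.of_continuousOn hgc).integrable_test hψ) (fun x hx => hg x (hψ.2.2 hx))
    (fun x _ => hψ.1.diffAt x)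

lemma wpd_of_contDiff (hg : ContDiff ℝ (⊤ : ℕ∞) g) : WPD U g (pd g i) i :=
  wpd_of_C1 (fun x _ => hg.diffAt x) (contDiff_pd hg i).continuous.continuousOn

lemma WPD.localize (h : WPD U g d i) (hg : L2loc U g) (hd : L2loc U d) {ζ : Euc n → ℝ}
    (hζ : IsTestFun U ζ) :
    WPD univ (fun x => ζ x * g x) (fun x => ζ x * d x + pd ζ i x * g x) i := by
  intro ψ hψ
  have h1 : IsTestFun U (fun x => ψ x * ζ x) := hζ.mul_left hψ.1
  have h2 := h _ h1
  have h3 : ∀ x, pd (fun x => ψ x * ζ x) i x = ψ x * pd ζ i x + pd ψ i x * ζ x := fun x =>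
    pd_mul (hψ.1.diffAt x) (hζ.1.diffAt x)
  simp only [h3] at h2
  have i1 := hg.integrable_test ((hζ.pd i).mul_left hψ.1)
  have i2 := hg.integrable_test (hζ.mul_left (hψ.pd i).1)
  have i3 := hd.integrable_test h1
  simp only [mul_add] at h2
  rw [integral_add i1 i2] at h2
  have e1 : ∫ x, (ζ x * d x + pd ζ i x * g x) * ψ x =
      ∫ x, d x * (ψ x * ζ x) + g x * (ψ x * pd ζ i x) := by
    congr 1; ext x; ring
  rw [e1, integral_add i3 i1]
  have e2 : ∫ x, ζ x * g x * pd ψ i x = ∫ x, g x * (pd ψ i x * ζ x) := by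
    congr 1; ext x; ring
  rw [e2]
  linarith

lemma WPD.to_univ (h : WPD U g d i) (hg : L2loc U g) (hd : L2loc U d) (hU : IsOpen U)
    {K : Set (Euc n)} (hK : IsCompact K) (hKU : K ⊆ U) (hg0 : ∀ x, x ∉ K → g x = 0)
    (hd0 : ∀ x, x ∉ K → d x = 0) : WPD univ g d i := by
  obtain ⟨ζ, hζ, -, W, hW, hKW, h1⟩ := exists_cutoff hU hK hKU
  refine (h.localize hg hd hζ).congr (ae_of_all _ fun x _ => ?_) (ae_of_all _ fun x _ => ?_)
  · by_cases hx : x ∈ K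
    · rw [h1 x (hKW hx), one_mul]
    · simp [hg0 x hx]
  · by_cases hx : x ∈ K
    · have : pd ζ i x = 0 := by
        have h2 : ζ =ᶠ[𝓝 x] fun _ => 1 := by
          filter_upwards [hW.mem_nhds (hKW hx)] with y hy using h1 y hy
        rw [pd_congr h2]; simp [pd]
      rw [h1 x (hKW hx), this]; ring
    · simp [hg0 x hx, hd0 x hx]

lemma pd_eq_zero_of_eventually {ζ : Euc n → ℝ} {W : Set (Euc n)} (hW : IsOpen W) {c : ℝ}
    (h1 : ∀ x ∈ W, ζ x = c) {x : Euc n} (hx : x ∈ W) : pd ζ i x = 0 := by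
  have h2 : ζ =ᶠ[𝓝 x] fun _ => c := by
    filter_upwards [hW.mem_nhds hx] with y hy using h1 y hy
  rw [pd_congr h2]; simp [pd]

/-- The product rule for weak derivatives. -/
lemma WPD.mul (h : WPD U g d i) (h' : WPD U g' d' i) (hU : IsOpen U) (hg : L2loc U g)
    (hd : L2loc U d) (hg' : L2loc U g') (hd' : L2loc U d') :
    WPD U (fun x => g x * g' x) (fun x => d x * g' x + g x * d' x) i := by
  intro ψ hψ
  obtain ⟨ζ, hζ, -, W, hW, hKW, h1⟩ := exists_cutoff hU hψ.isCompact hψ.2.2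
  have hw := h.localize hg hd hζ
  have m1 : MemLp (fun x => ζ x * g x) 2 := hg.mul_test hζ
  have m2 : MemLp (fun x => ζ x * d x + pd ζ i x * g x) 2 :=
    (hd.mul_test hζ).iadd (hg.mul_test (hζ.pd i))
  set a := fun x => ζ x * g x
  set a' := fun x => ζ x * d x + pd ζ i x * g x
  have hal := m1.locallyIntegrable (by norm_num : (1 : ℝ≥0∞) ≤ 2)
  have hsm : ∀ m, ContDiff ℝ (⊤ : ℕ∞) (moll m a) := fun m => cv_contDiff hal (rho_test m)
  have hid : ∀ m, (∫ x, moll m a' x * (ψ x * g' x)) + ∫ x, moll m a x * (pd ψ i x * g' x)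
      = - ∫ x, moll m a x * (ψ x * d' x) := by
    intro m
    have h2 := h' _ (hψ.mul_left (hsm m))
    have h3 : ∀ x, pd (fun x => moll m a x * ψ x) i x =
        moll m a x * pd ψ i x + moll m a' x * ψ x := fun x => by
      rw [pd_mul ((hsm m).diffAt x) (hψ.1.diffAt x)]
      congr 2
      exact congrFun (cv_pd_of_weak hal hw (rho_test m)) x
    simp only [h3] at h2
    rw [← integral_add (((moll_tl2 m2).mem m).imul (hg'.mul_test hψ))
      (((moll_tl2 m1).mem m).imul (hg'.mul_test (hψ.pd i)))]
    have e1 : ∫ x, moll m a x * (ψ x * d' x) = ∫ x, d' x * (moll m a x * ψ x) := by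
      congr 1; ext x; ring
    rw [e1, ← h2]
    congr 1; ext x; ring
  have t1 := (moll_tl2 m2).integral_mul_const (hg'.mul_test hψ)
  have t2 := (moll_tl2 m1).integral_mul_const (hg'.mul_test (hψ.pd i))
  have t3 := (moll_tl2 m1).integral_mul_const (hd'.mul_test hψ)
  have t4 := tendsto_nhds_unique ((t1.add t2).congr hid) t3.neg
  have z0 : ∀ x, a x * (pd ψ i x * g' x) = g x * g' x * pd ψ i x := fun x => by
    by_cases hx : x ∈ tsupport ψ
    · simp only [a, h1 x (hKW hx)]; ring
    · simp [(pd_eq_zero_of_notMem hx : pd ψ i x = 0)]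
  have z1 : ∀ x, a x * (ψ x * d' x) = g x * d' x * ψ x := fun x => by
    by_cases hx : x ∈ tsupport ψ
    · simp only [a, h1 x (hKW hx)]; ring
    · simp [hψ.eq_zero hx]
  have z2 : ∀ x, a' x * (ψ x * g' x) = d x * g' x * ψ x := fun x => by
    by_cases hx : x ∈ tsupport ψ
    · simp only [a', h1 x (hKW hx), pd_eq_zero_of_eventually hW h1 (hKW hx)]; ring
    · simp [hψ.eq_zero hx]
  simp only [z0, z1, z2] at t4
  simp only [add_mul]
  rw [integral_add (hd.integrable_mul hg' hψ) (hg.integrable_mul hd' hψ)]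
  linarith

/-- Weak formulations extend to compactly supported Sobolev test functions. -/
lemma weak_form_extend (hU : IsOpen U) {X : Fin n → Euc n → ℝ} (hX : ∀ j, L2loc U (X j))
    (hg : L2loc U g)
    (h : ∀ ψ, IsTestFun U ψ → ∑ j, ∫ x, X j x * pd ψ j x = ∫ x, g x * ψ x)
    {ψ : Euc n → ℝ} {Ψ : Fin n → Euc n → ℝ} (hψ : L2loc U ψ) (hΨ : ∀ j, L2loc U (Ψ j))
    (hw : ∀ j, WPD U ψ (Ψ j) j)
    {K : Set (Euc n)} (hK : IsCompact K) (hKU : K ⊆ U)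
    (hψ0 : ∀ x, x ∉ K → ψ x = 0) (hΨ0 : ∀ j x, x ∉ K → Ψ j x = 0) :
    ∑ j, ∫ x, X j x * Ψ j x = ∫ x, g x * ψ x := by
  have hw' : ∀ j, WPD univ ψ (Ψ j) j := fun j =>
    (hw j).to_univ hψ (hΨ j) hU hK hKU hψ0 (hΨ0 j)
  have hψ := hψ.memLp hK hKU hψ0
  have hΨ := fun j => (hΨ j).memLp hK hKU (hΨ0 j)
  have hw := hw'
  obtain ⟨L, hL, hKL, hLU⟩ := exists_compact_between hK hU hKU
  have hψl := hψ.locallyIntegrable (by norm_num : (1 : ℝ≥0∞) ≤ 2)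
  have key : ∀ {g ψ : Euc n → ℝ} (_ : L2loc U g) (_ : MemLp ψ 2) (_ : ∀ x, x ∉ K → ψ x = 0),
      Tendsto (fun m => ∫ x, L.indicator g x * moll m ψ x) atTop (𝓝 (∫ x, g x * ψ x)) := by
    intro g ψ hg hψ hψ0
    have m1 : MemLp (L.indicator g) 2 :=
      (memLp_indicator_iff_restrict hL.measurableSet).2 (hg L hL hLU)
    have := (moll_tl2 hψ).integral_mul_const m1
    have e : ∫ x, ψ x * L.indicator g x = ∫ x, g x * ψ x := by
      congr 1; ext x
      by_cases hx : x ∈ K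
      · rw [indicator_of_mem (interior_subset (hKL hx)), mul_comm]
      · simp [hψ0 x hx]
    rw [e] at this
    simpa [mul_comm] using this
  have t1 := tendsto_finsetSum Finset.univ fun j _ => key (hX j) (hΨ j) (hΨ0 j)
  have t2 := key hg hψ hψ0
  refine tendsto_nhds_unique (t1.congr' ?_) t2
  filter_upwards [moll_test hψl hK isOpen_interior hKL hψ0] with m hm
  have hz : ∀ {g χ : Euc n → ℝ}, IsTestFun (interior L) χ →
      ∫ x, L.indicator g x * χ x = ∫ x, g x * χ x := by
    intro g χ hχ
    congr 1; ext x
    by_cases hx : x ∈ interior L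
    · rw [indicator_of_mem (interior_subset hx)]
    · simp [hχ.eq_zero' hx]
  rw [hz hm, ← h _ (hm.mono (interior_subset.trans hLU))]
  refine Finset.sum_congr rfl fun j _ => ?_
  have : moll m (Ψ j) = pd (moll m ψ) j := (cv_pd_of_weak hψl (hw j) (rho_test m)).symm
  rw [this, hz (hm.pd j)]

end

section

open Filter

variable {U : Set (Euc n)}

lemma clm_apply_eq_sum (L : Euc n →L[ℝ] ℝ) (w : Euc n) :
    L w = ∑ k, w k * L (EuclideanSpace.single k 1) := by
  conv_lhs => rw [← (EuclideanSpace.basisFun (Fin n) ℝ).sum_repr w]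
  simp

lemma norm_le_sum_abs (a : Euc n) : ‖a‖ ≤ ∑ k, |a k| := by
  conv_lhs => rw [← (EuclideanSpace.basisFun (Fin n) ℝ).sum_repr a]
  refine (norm_sum_le _ _).trans (le_of_eq ?_)
  simp [norm_smul]

lemma pd_comp_vec {Φ : Euc n → ℝ} {A : Euc n → Euc n} {x : Euc n} (j : Fin n)
    (hΦ : DifferentiableAt ℝ Φ (A x)) (hA : ∀ k, DifferentiableAt ℝ (fun z => A z k) x) :
    pd (fun z => Φ (A z)) j x = ∑ k, pd Φ k (A x) * pd (fun z => A z k) j x := by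
  have hA' : DifferentiableAt ℝ A x := by
    rw [differentiableAt_euclidean]; exact hA
  have h1 := (hΦ.hasFDerivAt.comp x hA'.hasFDerivAt).fderiv
  simp only [Function.comp_def] at h1
  rw [pd, h1, ContinuousLinearMap.comp_apply, clm_apply_eq_sum]
  refine Finset.sum_congr rfl fun k _ => ?_
  rw [mul_comm]
  congr 1
  have h2 := ((EuclideanSpace.proj k : Euc n →L[ℝ] ℝ).hasFDerivAt.comp x hA'.hasFDerivAt).fderiv
  have h3 : (fun z => A z k) = (EuclideanSpace.proj k : Euc n →L[ℝ] ℝ) ∘ A := rfl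
  rw [pd, h3, h2]
  rfl

lemma continuous_cutoff_mul {F : Type*} [NormedAddCommGroup F] [NormedSpace ℝ F] (hU : IsOpen U)
    {ζ : Euc n → ℝ} (hζ : IsTestFun U ζ) {g : Euc n → F}
    (hg : ContinuousOn g U) : Continuous (fun x => ζ x • g x) := by
  rw [continuous_iff_continuousAt]
  intro x
  by_cases hx : x ∈ U
  · exact hζ.continuous.continuousAt.smul (hg.continuousAt (hU.mem_nhds hx))
  · have hx' : x ∉ tsupport ζ := fun h => hx (hζ.2.2 h)
    have h1 : (fun x => ζ x • g x) =ᶠ[𝓝 x] fun _ => 0 := by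
      filter_upwards [(isClosed_tsupport ζ).isOpen_compl.mem_nhds hx'] with y hy
      simp [hζ.eq_zero hy]
    exact h1.continuousAt

lemma TL2.shift {x : ℕ → Euc n → ℝ} {g : Euc n → ℝ} (h : TL2 x g) (M : ℕ) :
    TL2 (fun m => x (m + M)) g :=
  ⟨fun m => h.mem _, h.memLim, (tendsto_add_atTop_iff_nat M).2 h.tendsto⟩

lemma tl2_comp {Φ : Euc n → ℝ} {C K : Set (Euc n)} (hC : IsCompact C) (hK : IsCompact K)
    (hΦ : ContinuousOn Φ C) {A : ℕ → Euc n → Euc n} {V : Euc n → Euc n}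
    (hA : ∀ m, ContinuousOn (A m) K) (hV : ContinuousOn V K) (hAC : ∀ m, ∀ z ∈ K, A m z ∈ C)
    (hVC : ∀ z ∈ K, V z ∈ C)
    (hAV : ∀ δ > 0, ∀ᶠ m in atTop, ∀ z ∈ K, dist (A m z) (V z) < δ)
    {χ : Euc n → ℝ} (hχ : Continuous χ) (hχ0 : ∀ x, x ∉ K → χ x = 0) :
    TL2 (fun m z => Φ (A m z) * χ z) (fun z => Φ (V z) * χ z) := by
  have hz : ∀ (a : Euc n → ℝ), ∀ x, x ∉ K → a x * χ x = 0 := fun a x hx => by simp [hχ0 x hx]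
  refine TL2.of_unif hK (fun m => memLp_of_restrict hK (memLp_of_continuousOn hK
    ((hΦ.comp (hA m) (hAC m)).mul hχ.continuousOn)) (hz _))
    (memLp_of_restrict hK (memLp_of_continuousOn hK
    ((hΦ.comp hV hVC).mul hχ.continuousOn)) (hz _)) (.of_forall fun m z hzK => by
      simp [hχ0 z hzK]) fun ε hε => ?_
  obtain ⟨B, hB⟩ := hK.exists_bound_of_continuousOn hχ.continuousOn
  have hu := hC.uniformContinuousOn_of_continuous hΦ
  obtain ⟨δ, hδ, h⟩ := Metric.uniformContinuousOn_iff.1 hu (ε / (|B| + 1)) (by positivity)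
  filter_upwards [hAV δ hδ] with m hm z
  by_cases hzK : z ∈ K
  · have h1 := h _ (hAC m z hzK) _ (hVC z hzK) (hm z hzK)
    rw [← sub_mul, abs_mul, ← Real.dist_eq]
    have h2 : |χ z| ≤ |B| + 1 := (hB z hzK).trans (by linarith [le_abs_self B])
    calc _ ≤ ε / (|B| + 1) * (|B| + 1) := by gcongr
      _ = ε := by field_simp
  · simp [hχ0 z hzK, hε.le]

/-- The chain rule for weak derivatives. -/
lemma WPD.chain (hU : IsOpen U) {O : Set (Euc n)} (hO : IsOpen O) {Φ : Euc n → ℝ}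
    (hΦ : ContDiffOn ℝ 1 Φ O) {V : Euc n → Euc n} (hV : ContinuousOn V U) (hVO : MapsTo V U O)
    {j : Fin n} {H : Fin n → Euc n → ℝ} (hH : ∀ k, L2loc U (H k))
    (hw : ∀ k, WPD U (fun x => V x k) (H k) j) :
    WPD U (fun x => Φ (V x)) (fun x => ∑ k, pd Φ k (V x) * H k x) j := by
  intro ψ hψ
  obtain ⟨ζ, hζ, -, W, hW, hKW, h1⟩ := exists_cutoff hU hψ.isCompact hψ.2.2
  set K := tsupport ψ with hKdef
  have hK : IsCompact K := hψ.isCompact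
  have hVk : ∀ k, ContinuousOn (fun x => V x k) U := fun k =>
    (EuclideanSpace.proj k : Euc n →L[ℝ] ℝ).continuous.comp_continuousOn hV
  have hVl := fun k => L2loc.of_continuousOn (hVk k)
  have hwl := fun k => (hw k).localize (hVl k) (hH k) hζ
  have m1 := fun k => (hVl k).mul_test hζ
  have m2 := fun k => ((hH k).mul_test hζ).iadd ((hVl k).mul_test (hζ.pd j))
  set a : Fin n → Euc n → ℝ := fun k x => ζ x * V x k with ha
  set a' : Fin n → Euc n → ℝ := fun k x => ζ x * H k x + pd ζ j x * V x k with ha'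
  have hal := fun k => (m1 k).locallyIntegrable (by norm_num : (1 : ℝ≥0∞) ≤ 2)
  have hac : ∀ k, UniformContinuous (a k) := fun k => by
    refine HasCompactSupport.uniformContinuous_of_continuous ?_ (continuous_cutoff_mul hU hζ (hVk k))
    exact hζ.2.1.mul_right
  let A : ℕ → Euc n → Euc n := fun m x => WithLp.toLp 2 fun k => moll m (a k) x
  have hAs : ∀ m k, ContDiff ℝ (⊤ : ℕ∞) (fun x => A m x k) := fun m k =>
    cv_contDiff (hal k) (rho_test m)
  have hAs' : ∀ m, ContDiff ℝ (⊤ : ℕ∞) (A m) := fun m => contDiff_euclidean.2 (hAs m)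
  have hAV : ∀ δ > 0, ∀ᶠ m in atTop, ∀ z ∈ K, dist (A m z) (V z) < δ := by
    intro δ hδ
    have := fun k => moll_unif (hac k) (show 0 < δ / (n + 1) by positivity)
    filter_upwards [eventually_all.2 this] with m hm z hz
    rw [dist_eq_norm]
    refine (norm_le_sum_abs _).trans_lt ?_
    have h2 : ∑ k, |(A m z - V z) k| ≤ ∑ k : Fin n, δ / (n + 1) := by
      refine Finset.sum_le_sum fun k _ => ?_
      have := hm k z
      simp only [ha, h1 z (hKW hz), one_mul] at this
      exact this
    refine h2.trans_lt ?_
    simp only [Finset.sum_const, Finset.card_univ, Fintype.card_fin, nsmul_eq_mul]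
    rw [mul_div_assoc', div_lt_iff₀ (by positivity)]
    nlinarith
  have hVK : IsCompact (V '' K) := hK.image_of_continuousOn (hV.mono hψ.2.2)
  obtain ⟨δ, hδ, hδO⟩ := hVK.exists_cthickening_subset_open hO
    (image_subset_iff.2 fun z hz => hVO (hψ.2.2 hz))
  obtain ⟨M, hM⟩ := eventually_atTop.1 (hAV δ hδ)
  set C := Metric.cthickening δ (V '' K)
  have hC : IsCompact C := hVK.cthickening
  have hAC : ∀ m, ∀ z ∈ K, A (m + M) z ∈ C := fun m z hz =>
    Metric.mem_cthickening_of_dist_le _ (V z) _ _ (mem_image_of_mem _ hz)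
      (hM (m + M) (by omega) z hz).le
  have hVC : ∀ z ∈ K, V z ∈ C := fun z hz =>
    Metric.self_subset_cthickening _ (mem_image_of_mem _ hz)
  have tl : ∀ {Φ : Euc n → ℝ} {χ : Euc n → ℝ}, ContinuousOn Φ O → Continuous χ →
      (∀ x, x ∉ K → χ x = 0) →
      TL2 (fun m z => Φ (A (m + M) z) * χ z) (fun z => Φ (V z) * χ z) := by
    intro Φ χ hΦ hχ hχ0
    refine tl2_comp hC hK (hΦ.mono hδO) (fun m => (hAs' _).continuous.continuousOn)
      (hV.mono hψ.2.2) hAC hVC (fun δ hδ => ?_) hχ hχ0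
    exact (tendsto_add_atTop_nat M).eventually (hAV δ hδ)
  have hΦp : ∀ k, ContinuousOn (pd Φ k) O := fun k =>
    (hΦ.continuousOn_fderiv_of_isOpen hO (by simp)).clm_apply continuousOn_const
  have hid : ∀ m, ∫ x, Φ (A (m + M) x) * pd ψ j x =
      - ∑ k, ∫ x, (pd Φ k (A (m + M) x) * ψ x) * moll (m + M) (a' k) x := by
    intro m
    have hU' : IsOpen {x | A (m + M) x ∈ O} := hO.preimage (hAs' _).continuous
    have hψ' : IsTestFun {x | A (m + M) x ∈ O} ψ :=
      ⟨hψ.1, hψ.2.1, fun z hz => hδO (hAC m z hz)⟩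
    have hcd : ContDiffOn ℝ 1 (fun x => Φ (A (m + M) x)) {x | A (m + M) x ∈ O} :=
      hΦ.comp ((hAs' _).of_le (by norm_cast)).contDiffOn (fun x hx => hx)
    have h2 := wpd_of_C1 (i := j) (fun x hx =>
      ((hcd.differentiableOn (by simp)) x hx).differentiableAt (hU'.mem_nhds hx))
      ((hcd.continuousOn_fderiv_of_isOpen hU' (by simp)).clm_apply continuousOn_const) ψ hψ'
    rw [h2, ← integral_finsetSum]
    · congr 2; ext x
      by_cases hx : x ∈ K
      · rw [pd_comp_vec j ((hΦ.differentiableOn (by simp) _ (hδO (hAC m x hx))).differentiableAt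
          (hO.mem_nhds (hδO (hAC m x hx)))) fun k => (hAs _ k).diffAt x, Finset.sum_mul]
        refine Finset.sum_congr rfl fun k _ => ?_
        have : pd (fun z => A (m + M) z k) j x = moll (m + M) (a' k) x :=
          congrFun (cv_pd_of_weak (hal k) (hwl k) (rho_test (m + M))) x
        rw [this]; ring
      · simp [hψ.eq_zero hx]
    · intro k _
      exact ((tl (hΦp k) hψ.continuous fun x hx => hψ.eq_zero hx).mem m).imul
        ((moll_tl2 (m2 k)).mem _)
  have m3 : MemLp (fun z => Φ (V z) * pd ψ j z) 2 :=
    (tl hΦ.continuousOn (hψ.pd j).continuous fun x hx => pd_eq_zero_of_notMem hx).memLim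
  have t1 := (tl hΦ.continuousOn hψ.continuous fun x hx => hψ.eq_zero hx)
  have t2 := tendsto_finsetSum Finset.univ fun k (_ : k ∈ Finset.univ) =>
    (tl (hΦp k) hψ.continuous fun x hx => hψ.eq_zero hx).integral_mul ((moll_tl2 (m2 k)).shift M)
  have t3 : Tendsto (fun m => ∫ x, Φ (A (m + M) x) * pd ψ j x) atTop
      (𝓝 (∫ x, Φ (V x) * pd ψ j x)) := by
    obtain ⟨χ, hχ, -, W', -, hKW', hχ1⟩ := exists_cutoff isOpen_univ hK (subset_univ _)
    have hχm : MemLp χ 2 := hχ.continuous.memLp_of_hasCompactSupport hχ.2.1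
    have := (tl hΦ.continuousOn (hψ.pd j).continuous
      fun x hx => pd_eq_zero_of_notMem hx).integral_mul_const hχm
    have e : ∀ B : Euc n → Euc n, ∫ z, Φ (B z) * pd ψ j z * χ z = ∫ z, Φ (B z) * pd ψ j z := by
      intro B; congr 1; ext z
      by_cases hz : z ∈ K
      · rw [hχ1 z (hKW' hz), mul_one]
      · simp [(pd_eq_zero_of_notMem hz : pd ψ j z = 0)]
    simpa only [e] using this
  have t4 := tendsto_nhds_unique (t3.congr hid) t2.neg
  rw [t4, ← integral_finsetSum]
  · congr 2; ext x
    rw [Finset.sum_mul]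
    refine Finset.sum_congr rfl fun k _ => ?_
    by_cases hx : x ∈ K
    · simp only [h1 x (hKW hx), pd_eq_zero_of_eventually hW h1 (hKW hx)]; ring
    · simp [hψ.eq_zero hx]
  · intro k _
    exact ((tl (hΦp k) hψ.continuous fun x hx => hψ.eq_zero hx).memLim).imul (m2 k)

end

section

open Filter

/-- The power `‖ξ‖ ^ s` of the norm times a coordinate. -/
def vf (s : ℝ) (j : Fin n) (ξ : Euc n) : ℝ := ‖ξ‖ ^ s * ξ j

/-- The Jacobian of `vf s`. -/
def dvf (s : ℝ) (j k : Fin n) (ξ : Euc n) : ℝ :=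
  (if j = k then ‖ξ‖ ^ s else 0) + s * ‖ξ‖ ^ (s - 2) * ξ j * ξ k

lemma rpow_norm_eq (s : ℝ) (ξ : Euc n) : ‖ξ‖ ^ s = (‖ξ‖ ^ 2) ^ (s / 2) := by
  rw [← Real.rpow_natCast, ← Real.rpow_mul (norm_nonneg _)]
  congr 1
  push_cast; ring

lemma isOpen_ne_zero : IsOpen {ξ : Euc n | ξ ≠ 0} := isOpen_ne

lemma contDiffAt_rpow_norm (s : ℝ) {ξ : Euc n} (hξ : ξ ≠ 0) :
    ContDiffAt ℝ (⊤ : ℕ∞) (fun ξ : Euc n => ‖ξ‖ ^ s) ξ := by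
  simp_rw [rpow_norm_eq s]
  exact (contDiff_norm_sq ℝ).contDiffAt.rpow_const_of_ne (by simpa using hξ)

lemma contDiff_coord (j : Fin n) : ContDiff ℝ (⊤ : ℕ∞) (fun ξ : Euc n => ξ j) :=
  (EuclideanSpace.proj (𝕜 := ℝ) j).contDiff

lemma contDiffAt_vf (s : ℝ) (j : Fin n) {ξ : Euc n} (hξ : ξ ≠ 0) :
    ContDiffAt ℝ (⊤ : ℕ∞) (vf s j) ξ :=
  (contDiffAt_rpow_norm s hξ).mul (contDiff_coord j).contDiffAt

lemma contDiffAt_dvf (s : ℝ) (j k : Fin n) {ξ : Euc n} (hξ : ξ ≠ 0) :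
    ContDiffAt ℝ (⊤ : ℕ∞) (dvf s j k) ξ := by
  refine ContDiffAt.add ?_ (((contDiffAt_const.mul (contDiffAt_rpow_norm _ hξ)).mul
    (contDiff_coord j).contDiffAt).mul (contDiff_coord k).contDiffAt)
  split_ifs
  · exact contDiffAt_rpow_norm s hξ
  · exact contDiffAt_const

lemma pd_coord (j k : Fin n) (ξ : Euc n) :
    pd (fun ξ : Euc n => ξ j) k ξ = if j = k then 1 else 0 := by
  unfold pd
  have : (fun ξ : Euc n => ξ j) = EuclideanSpace.proj (𝕜 := ℝ) j := rfl
  rw [this, ContinuousLinearMap.fderiv]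
  simp

lemma pd_normsq (k : Fin n) (ξ : Euc n) : pd (fun ξ : Euc n => ‖ξ‖ ^ 2) k ξ = 2 * ξ k := by
  unfold pd
  rw [(hasStrictFDerivAt_norm_sq ξ).hasFDerivAt.fderiv]
  simp [EuclideanSpace.inner_single_right]

lemma pd_rpow_norm (s : ℝ) (k : Fin n) {ξ : Euc n} (hξ : ξ ≠ 0) :
    pd (fun ξ : Euc n => ‖ξ‖ ^ s) k ξ = s * ‖ξ‖ ^ (s - 2) * ξ k := by
  simp_rw [rpow_norm_eq s]
  have h0 : ‖ξ‖ ^ 2 ≠ 0 := by simpa using hξ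
  rw [pd_comp (m := fun t => t ^ (s / 2)) (Real.differentiableAt_rpow_const_of_ne _ h0)
    ((contDiff_norm_sq ℝ).contDiffAt.differentiableAt (n := 1) (by simp)), pd_normsq,
    Real.deriv_rpow_const, rpow_norm_eq (s - 2), show (s - 2) / 2 = s / 2 - 1 by ring]
  ring

lemma pd_vf (s : ℝ) (j k : Fin n) {ξ : Euc n} (hξ : ξ ≠ 0) : pd (vf s j) k ξ = dvf s j k ξ := by
  unfold vf dvf
  rw [pd_mul ((contDiffAt_rpow_norm s hξ).differentiableAt (by simp)) ((contDiff_coord j).diffAt ξ),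
    pd_rpow_norm s k hξ, pd_coord]
  split_ifs <;> ring

lemma abs_dvf_le (s : ℝ) (j k : Fin n) {ξ : Euc n} (hξ : ξ ≠ 0) :
    |dvf s j k ξ| ≤ (1 + |s|) * ‖ξ‖ ^ s := by
  have h0 : 0 < ‖ξ‖ := norm_pos_iff.2 hξ
  have h1 : ‖ξ‖ ^ s = ‖ξ‖ ^ (s - 2) * (‖ξ‖ * ‖ξ‖) := by
    rw [← sq, ← Real.rpow_natCast, ← Real.rpow_add h0]; congr 1; push_cast; ring
  have h2 : |s * ‖ξ‖ ^ (s - 2) * ξ j * ξ k| ≤ |s| * ‖ξ‖ ^ s := by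
    rw [h1, mul_assoc, abs_mul, abs_mul, abs_mul, abs_of_nonneg (Real.rpow_nonneg h0.le _),
      mul_assoc]
    gcongr <;> exact abs_apply_le _ _
  have h3 : |if j = k then ‖ξ‖ ^ s else 0| ≤ ‖ξ‖ ^ s := by
    have := Real.rpow_nonneg h0.le s
    split_ifs
    · rw [abs_of_nonneg this]
    · simpa using this
  refine (abs_add_le _ _).trans ?_
  linarith

lemma abs_pd_dvf_le (s : ℝ) (j k m : Fin n) {ξ : Euc n} (hξ : ξ ≠ 0) :
    |pd (dvf s j k) m ξ| ≤ (3 * |s| + |s| * |s - 2|) * ‖ξ‖ ^ (s - 1) := by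
  have h0 : 0 < ‖ξ‖ := norm_pos_iff.2 hξ
  have e1 : ‖ξ‖ ^ (s - 1) = ‖ξ‖ ^ (s - 2) * ‖ξ‖ := by
    nth_rewrite 3 [← Real.rpow_one ‖ξ‖]
    rw [← Real.rpow_add h0]; congr 1; ring
  have e2 : ‖ξ‖ ^ (s - 1) = ‖ξ‖ ^ (s - 2 - 2) * (‖ξ‖ * ‖ξ‖ * ‖ξ‖) := by
    rw [show ‖ξ‖ * ‖ξ‖ * ‖ξ‖ = ‖ξ‖ ^ (3 : ℕ) by ring, ← Real.rpow_natCast, ← Real.rpow_add h0]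
    congr 1; push_cast; ring
  have d1 := (contDiffAt_rpow_norm (n := n) s hξ).differentiableAt (by simp)
  have d2 := (contDiffAt_rpow_norm (n := n) (s - 2) hξ).differentiableAt (by simp)
  have dj := (contDiff_coord j).diffAt ξ
  have dk := (contDiff_coord k).diffAt ξ
  have hd : pd (dvf s j k) m ξ = (if j = k then s * ‖ξ‖ ^ (s - 2) * ξ m else 0) +
      (s * ‖ξ‖ ^ (s - 2) * ξ j * (if k = m then 1 else 0) +
       s * ‖ξ‖ ^ (s - 2) * (if j = m then 1 else 0) * ξ k +
        s * ((s - 2) * ‖ξ‖ ^ (s - 2 - 2) * ξ m) * ξ j * ξ k) := by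
    have d0 : DifferentiableAt ℝ (fun ξ : Euc n => if j = k then ‖ξ‖ ^ s else 0) ξ := by
      split_ifs
      exacts [d1, differentiableAt_const _]
    unfold dvf
    rw [pd_add (h := fun ξ : Euc n => s * ‖ξ‖ ^ (s - 2) * ξ j * ξ k) d0
      (((d2.const_mul s).mul dj).mul dk), pd_mul (g := fun ξ : Euc n => s * ‖ξ‖ ^ (s - 2) * ξ j) ((d2.const_mul s).mul dj) dk,
      pd_mul (g := fun ξ : Euc n => s * ‖ξ‖ ^ (s - 2)) (d2.const_mul s) dj, pd_const_mul s d2, pd_rpow_norm _ _ hξ, pd_coord, pd_coord]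
    congr 1
    · split_ifs
      · rw [pd_rpow_norm _ _ hξ]
      · simp [pd]
    · ring
  have hp := Real.rpow_nonneg h0.le (s - 2)
  have hp2 := Real.rpow_nonneg h0.le (s - 2 - 2)
  have b1 : |if j = k then s * ‖ξ‖ ^ (s - 2) * ξ m else 0| ≤ |s| * ‖ξ‖ ^ (s - 1) := by
    split_ifs
    · rw [e1, abs_mul, abs_mul, abs_of_nonneg hp, mul_assoc]
      gcongr; exact abs_apply_le _ _
    · simp; positivity
  have b2 : |s * ‖ξ‖ ^ (s - 2) * ξ j * (if k = m then 1 else 0)| ≤ |s| * ‖ξ‖ ^ (s - 1) := by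
    split_ifs
    · rw [e1, mul_one, abs_mul, abs_mul, abs_of_nonneg hp, mul_assoc]
      gcongr; exact abs_apply_le _ _
    · simp; positivity
  have b3 : |s * ‖ξ‖ ^ (s - 2) * (if j = m then 1 else 0) * ξ k| ≤ |s| * ‖ξ‖ ^ (s - 1) := by
    split_ifs
    · rw [e1, mul_one, abs_mul, abs_mul, abs_of_nonneg hp, mul_assoc]
      gcongr; exact abs_apply_le _ _
    · simp; positivity
  have b4 : |s * ((s - 2) * ‖ξ‖ ^ (s - 2 - 2) * ξ m) * ξ j * ξ k| ≤
      |s| * |s - 2| * ‖ξ‖ ^ (s - 1) := by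
    rw [e2, show s * ((s - 2) * ‖ξ‖ ^ (s - 2 - 2) * ξ m) * ξ j * ξ k =
      s * (s - 2) * (‖ξ‖ ^ (s - 2 - 2) * (ξ m * ξ j * ξ k)) by ring, abs_mul, abs_mul, abs_mul,
      abs_mul, abs_mul, abs_of_nonneg hp2]
    gcongr <;> exact abs_apply_le _ _
  rw [hd]
  refine (abs_add_le _ _).trans ?_
  refine (add_le_add_right ((abs_add_le _ _).trans (add_le_add_left (abs_add_le _ _) _)) _).trans ?_
  linarith

lemma sum_dvf (s : ℝ) (j : Fin n) (ξ a : Euc n) :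
    ∑ k, dvf s j k ξ * a k = ‖ξ‖ ^ s * a j + s * ‖ξ‖ ^ (s - 2) * ξ j * ⟪ξ, a⟫_ℝ := by
  unfold dvf
  simp_rw [add_mul, Finset.sum_add_distrib, ite_mul, zero_mul, Finset.sum_ite_eq, Finset.mem_univ,
    if_true, inner_eq_sum, Finset.mul_sum, mul_assoc]

lemma sum_sum_dvf (s : ℝ) (ξ a b : Euc n) :
    ∑ j, (∑ k, dvf s j k ξ * a k) * b j =
      ‖ξ‖ ^ s * ⟪a, b⟫_ℝ + s * ‖ξ‖ ^ (s - 2) * ⟪ξ, a⟫_ℝ * ⟪ξ, b⟫_ℝ := by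
  simp_rw [sum_dvf, add_mul, Finset.sum_add_distrib, inner_eq_sum a b, inner_eq_sum ξ b,
    Finset.mul_sum]
  congr 1 <;> exact Finset.sum_congr rfl fun j _ => by ring

lemma dvf_elliptic {s : ℝ} {ξ : Euc n} (hξ : ξ ≠ 0) (a : Euc n) :
    min 1 (1 + s) * ‖ξ‖ ^ s * ‖a‖ ^ 2 ≤ ∑ j, (∑ k, dvf s j k ξ * a k) * a j := by
  have h0 : 0 < ‖ξ‖ := norm_pos_iff.2 hξ
  have h1 : ‖ξ‖ ^ s = ‖ξ‖ ^ (s - 2) * ‖ξ‖ ^ 2 := by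
    rw [← Real.rpow_natCast, ← Real.rpow_add h0]; congr 1; push_cast; ring
  have h2 : ⟪ξ, a⟫_ℝ ^ 2 ≤ ‖ξ‖ ^ 2 * ‖a‖ ^ 2 := by
    rw [← mul_pow, ← sq_abs]; gcongr; exact abs_real_inner_le_norm _ _
  rw [sum_sum_dvf, real_inner_self_eq_norm_sq, h1]
  have h3 := Real.rpow_nonneg h0.le (s - 2)
  have h4 : min 1 (1 + s) * (‖ξ‖ ^ 2 * ‖a‖ ^ 2) ≤ ‖ξ‖ ^ 2 * ‖a‖ ^ 2 + s * ⟪ξ, a⟫_ℝ ^ 2 := by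
    have h5 : 0 ≤ ‖ξ‖ ^ 2 * ‖a‖ ^ 2 := by positivity
    rcases le_total 0 s with hs | hs
    · have := min_le_left 1 (1 + s)
      nlinarith [sq_nonneg ⟪ξ, a⟫_ℝ]
    · have := min_le_right 1 (1 + s)
      nlinarith [sq_nonneg ⟪ξ, a⟫_ℝ]
  nlinarith [mul_le_mul_of_nonneg_left h4 h3]

/-- Cauchy–Schwarz for the quadratic form of the Jacobian of `vf s`. -/
lemma dvf_cs {s : ℝ} (hs : -1 < s) {ξ : Euc n} (hξ : ξ ≠ 0) (c : Fin n → ℝ) (a : Fin n → Euc n) :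
    ∑ j, (∑ k, dvf s j k ξ * (∑ i, c i • a i) k) * (∑ i, c i • a i) j ≤
      (∑ i, c i ^ 2) * ∑ i, ∑ j, (∑ k, dvf s j k ξ * a i k) * a i j := by
  set b := ∑ i, c i • a i with hb
  set V := ∑ i, c i ^ 2 with hV
  have hpos : ∀ a : Euc n, 0 ≤ ∑ j, (∑ k, dvf s j k ξ * a k) * a j := fun a =>
    le_trans (by have : 0 ≤ min 1 (1 + s) := le_min zero_le_one (by linarith)
                 positivity) (dvf_elliptic hξ a)
  have hV0 : 0 ≤ V := Finset.sum_nonneg fun i _ => sq_nonneg (c i)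
  rcases hV0.eq_or_lt with h | h
  · have hc : ∀ i, c i = 0 := fun i => by
      have := (Finset.sum_eq_zero_iff_of_nonneg fun i _ => sq_nonneg (c i)).1 h.symm i
        (Finset.mem_univ i)
      simpa using this
    have : b = 0 := by simp [hb, hc]
    rw [this, ← h]; simp
  have key := Finset.sum_nonneg fun i (_ : i ∈ Finset.univ) => hpos (a i - (c i / V) • b)
  simp_rw [sum_sum_dvf] at key ⊢
  have e1 : ∀ i, ‖ξ‖ ^ s * ⟪a i - (c i / V) • b, a i - (c i / V) • b⟫_ℝ +
      s * ‖ξ‖ ^ (s - 2) * ⟪ξ, a i - (c i / V) • b⟫_ℝ * ⟪ξ, a i - (c i / V) • b⟫_ℝ =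
      (‖ξ‖ ^ s * ⟪a i, a i⟫_ℝ + s * ‖ξ‖ ^ (s - 2) * ⟪ξ, a i⟫_ℝ * ⟪ξ, a i⟫_ℝ) -
      2 / V * (‖ξ‖ ^ s * ⟪c i • a i, b⟫_ℝ + s * ‖ξ‖ ^ (s - 2) * ⟪ξ, c i • a i⟫_ℝ * ⟪ξ, b⟫_ℝ) +
      c i ^ 2 / V ^ 2 * (‖ξ‖ ^ s * ⟪b, b⟫_ℝ + s * ‖ξ‖ ^ (s - 2) * ⟪ξ, b⟫_ℝ * ⟪ξ, b⟫_ℝ) := fun i => by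
    simp only [inner_sub_left, inner_sub_right, inner_smul_left, inner_smul_right,
      real_inner_comm (a i) b]
    simp
    ring
  simp_rw [e1, Finset.sum_add_distrib, Finset.sum_sub_distrib, ← Finset.mul_sum, ← Finset.sum_mul,
    Finset.sum_add_distrib, ← Finset.mul_sum, ← Finset.sum_mul, ← Finset.mul_sum, ← sum_inner,
    ← inner_sum, ← hb, ← Finset.sum_div, ← hV] at key
  rw [Finset.sum_add_distrib]
  have h2 : V / V ^ 2 = 1 / V := by field_simp
  rw [h2] at key
  set Qb := ‖ξ‖ ^ s * ⟪b, b⟫_ℝ + s * ‖ξ‖ ^ (s - 2) * ⟪ξ, b⟫_ℝ * ⟪ξ, b⟫_ℝ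
  have h3 : 2 / V * Qb = 1 / V * Qb + 1 / V * Qb := by ring
  rw [← inv_mul_le_iff₀ h, ← one_div]
  simp_rw [← Finset.mul_sum] at key ⊢
  linarith

end

section

open Filter

variable {U V : Set (Euc n)} {g d : Euc n → ℝ} {i : Fin n}

lemma L2loc.shift (h : L2loc U g) {y : Euc n} (hV : ∀ x ∈ V, x + y ∈ U) :
    L2loc V (fun x => g (x + y)) := by
  intro K hK hKV
  have h1 := h ((fun x => x + y) '' K) (hK.image (by fun_prop))
    (by rintro _ ⟨x, hx, rfl⟩; exact hV x (hKV hx))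
  have hmp := (measurePreserving_add_right (volume : Measure (Euc n)) y).restrict_preimage_emb
    (MeasurableEquiv.addRight y).measurableEmbedding ((fun x => x + y) '' K)
  rw [preimage_image_eq _ (add_left_injective y)] at hmp
  exact h1.comp_measurePreserving hmp

lemma _root_.IsTestFun.translate {ψ : Euc n → ℝ} (h : IsTestFun V ψ) {y : Euc n}
    (hV : ∀ x ∈ V, x + y ∈ U) : IsTestFun U (fun x => ψ (x - y)) := by
  refine isTestFun_of_subset (K := (fun x => x + y) '' tsupport ψ)
    (h.1.comp (contDiff_id.sub contDiff_const)) (h.isCompact.image (by fun_prop))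
    (by rintro _ ⟨x, hx, rfl⟩; exact hV x (h.2.2 hx)) fun x hx => ?_
  refine h.eq_zero fun hx' => hx ⟨x - y, hx', by simp⟩

lemma integral_shift_mul (a b : Euc n → ℝ) (y : Euc n) :
    ∫ x, a (x + y) * b x = ∫ x, a x * b (x - y) := by
  rw [← integral_add_right_eq_self (fun x => a x * b (x - y)) y]
  simp

lemma pd_translate (ψ : Euc n → ℝ) (y : Euc n) (j : Fin n) (x : Euc n) :
    pd (fun z => ψ (z - y)) j x = pd ψ j (x - y) := by
  simp_rw [sub_eq_add_neg]; exact pd_comp_add ψ (-y)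

lemma WPD.shift (h : WPD U g d i) {y : Euc n} (hV : ∀ x ∈ V, x + y ∈ U) :
    WPD V (fun x => g (x + y)) (fun x => d (x + y)) i := by
  intro ψ hψ
  have h1 := h _ (hψ.translate hV)
  rw [integral_shift_mul, integral_shift_mul, ← h1]
  simp_rw [pd_translate]

lemma exists_nhd_shift (hU : IsOpen U) {K : Set (Euc n)} (hK : IsCompact K) (hKU : K ⊆ U) :
    ∃ V, IsOpen V ∧ K ⊆ V ∧ V ⊆ U ∧ ∃ δ > 0, ∀ y : Euc n, ‖y‖ ≤ δ → ∀ x ∈ V, x + y ∈ U := by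
  obtain ⟨δ, hδ, h⟩ := hK.exists_cthickening_subset_open hU hKU
  refine ⟨Metric.thickening (δ / 2) K, Metric.isOpen_thickening,
    Metric.self_subset_thickening (by positivity) K, ?_, δ / 2, by positivity, fun y hy x hx => ?_⟩
  · exact (Metric.thickening_mono (by linarith) K).trans
      ((Metric.thickening_subset_cthickening _ _).trans h)
  · apply h
    apply Metric.thickening_subset_cthickening
    rw [Metric.mem_thickening_iff] at hx ⊢
    obtain ⟨z, hz, hxz⟩ := hx
    refine ⟨z, hz, ?_⟩
    calc dist (x + y) z ≤ dist (x + y) x + dist x z := dist_triangle _ _ _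
      _ < δ := by rw [dist_eq_norm]; simp; linarith

lemma L2loc.integrable_mul_of_zero {a b : Euc n → ℝ} (ha : L2loc U a) (hb : L2loc U b)
    {K : Set (Euc n)} (hK : IsCompact K) (hKU : K ⊆ U) (h0 : ∀ x, x ∉ K → a x * b x = 0) :
    Integrable (fun x => a x * b x) := by
  have h1 := (ha K hK hKU).imul (hb K hK hKU)
  have h2 : IntegrableOn (fun x => a x * b x) K := h1
  rwa [integrableOn_iff_integrable_of_support_subset] at h2
  intro x hx
  by_contra h
  exact hx (h0 x h)

lemma dq_pointwise {S l L ε M κ φ Δw Δg N : ℝ} {ι : Type*} [Fintype ι] (ΔG ΔW φ' : ι → ℝ)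
    (hN : (Fintype.card ι : ℝ) = N)
    (hS : S = ∑ j, ΔW j ^ 2) (h1 : l * S ≤ (∑ j, ΔG j * ΔW j) + κ)
    (h2 : ∀ j, ΔG j ^ 2 ≤ L * S + κ) (h3 : Δw ^ 2 ≤ κ) (h4 : Δg ^ 2 ≤ κ) (hφ0 : 0 ≤ φ)
    (hφ1 : φ ≤ 1) (hM : ∀ j, |φ' j| ≤ M) (hε : 0 < ε) (hεl : N * (ε * L) ≤ l / 2) :
    l / 2 * (φ * φ * S) - (2 + N * ε + N * (ε⁻¹ * M ^ 2)) * κ ≤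
      (∑ j, ΔG j * ((φ' j * φ + φ * φ' j) * Δw + φ * φ * ΔW j)) - Δg * (φ * φ * Δw) := by
  have hS0 : 0 ≤ S := hS ▸ Finset.sum_nonneg fun j _ => sq_nonneg _
  have hκ : 0 ≤ κ := (sq_nonneg _).trans h3
  have hφφ : φ * φ ≤ 1 := by nlinarith
  have hφφ0 : 0 ≤ φ * φ := by positivity
  have a1 : ∀ j, φ * φ * (ΔG j * ΔW j) - (φ * φ * (ε * (L * S)) + ε * κ + ε⁻¹ * M ^ 2 * κ) ≤
      ΔG j * ((φ' j * φ + φ * φ' j) * Δw + φ * φ * ΔW j) := by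
    intro j
    have b1 : 0 ≤ (ε * (φ * ΔG j) + φ' j * Δw) ^ 2 := sq_nonneg _
    have b2 : -(ε * (φ * φ * ΔG j ^ 2) + ε⁻¹ * (φ' j ^ 2 * Δw ^ 2)) ≤
        2 * (φ * ΔG j) * (φ' j * Δw) := by
      have : ε⁻¹ * (ε * (φ * ΔG j) + φ' j * Δw) ^ 2 =
        ε * (φ * φ * ΔG j ^ 2) + ε⁻¹ * (φ' j ^ 2 * Δw ^ 2) + 2 * (φ * ΔG j) * (φ' j * Δw) := by
        field_simp; ring
      have h5 : 0 ≤ ε⁻¹ * (ε * (φ * ΔG j) + φ' j * Δw) ^ 2 := by positivity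
      linarith
    have b3 : φ' j ^ 2 * Δw ^ 2 ≤ M ^ 2 * κ := by
      have : φ' j ^ 2 ≤ M ^ 2 := sq_le_sq' (abs_le.1 (hM j)).1 (abs_le.1 (hM j)).2
      gcongr
    have b4 : ε⁻¹ * (φ' j ^ 2 * Δw ^ 2) ≤ ε⁻¹ * (M ^ 2 * κ) := by gcongr
    have b5 : ε * (φ * φ * ΔG j ^ 2) ≤ ε * (φ * φ * (L * S + κ)) := by
      gcongr; exact h2 j
    have b6 : ε * (φ * φ * κ) ≤ ε * κ := by
      have : φ * φ * κ ≤ 1 * κ := by gcongr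
      rw [one_mul] at this
      gcongr
    nlinarith
  have a2 := Finset.sum_le_sum fun j (_ : j ∈ Finset.univ) => a1 j
  rw [Finset.sum_sub_distrib, ← Finset.mul_sum, Finset.sum_const, Finset.card_univ,
    nsmul_eq_mul, hN] at a2
  have a3 : Δg * (φ * φ * Δw) ≤ κ := by
    have c1 : Δg * Δw ≤ κ := by nlinarith [sq_nonneg (Δg - Δw)]
    have c2 : φ * φ * (Δg * Δw) ≤ φ * φ * κ := by gcongr
    have c3 : φ * φ * κ ≤ 1 * κ := by gcongr
    nlinarith
  have a4 : φ * φ * (l * S) ≤ φ * φ * ((∑ j, ΔG j * ΔW j) + κ) := by gcongr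
  have a5 : φ * φ * κ ≤ 1 * κ := by gcongr
  have a6 : φ * φ * S * (N * (ε * L)) ≤ φ * φ * S * (l / 2) := by gcongr
  nlinarith

lemma dq_bound (hU : IsOpen U) {G W : Fin n → Euc n → ℝ} {w : Euc n → ℝ}
    (hG : ∀ j, L2loc U (G j)) (hg : L2loc U g) (hw : L2loc U w) (hW : ∀ j, L2loc U (W j))
    (hwW : ∀ j, WPD U w (W j) j)
    (heq : ∀ ψ, IsTestFun U ψ → ∑ j, ∫ x, G j x * pd ψ j x = ∫ x, g x * ψ x)
    (hyp : ∀ K, IsCompact K → K ⊆ U → ∃ C l L δ : ℝ, 0 ≤ C ∧ 0 < l ∧ 0 ≤ L ∧ 0 < δ ∧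
      ∀ y : Euc n, ‖y‖ ≤ δ → ∃ κ : Euc n → ℝ, IntegrableOn κ K ∧
        ∫ x in K, κ x ≤ C * ‖y‖ ^ 2 ∧ ∀ᵐ x, x ∈ K →
          l * (∑ j, (W j (x + y) - W j x) ^ 2) ≤
            (∑ j, (G j (x + y) - G j x) * (W j (x + y) - W j x)) + κ x ∧
          (∀ j, (G j (x + y) - G j x) ^ 2 ≤ L * (∑ j, (W j (x + y) - W j x) ^ 2) + κ x) ∧
          (w (x + y) - w x) ^ 2 ≤ κ x ∧ (g (x + y) - g x) ^ 2 ≤ κ x)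
    {K : Set (Euc n)} (hK : IsCompact K) (hKU : K ⊆ U) :
    ∃ C δ : ℝ, 0 ≤ C ∧ 0 < δ ∧ ∀ y : Euc n, ‖y‖ ≤ δ → ∀ j,
      ∫ x in K, (W j (x + y) - W j x) ^ 2 ≤ C * ‖y‖ ^ 2 := by
  obtain ⟨φ, hφ, hφ01, O, -, hKO, hO1⟩ := exists_cutoff hU hK hKU
  obtain ⟨C, l, L, δ₁, hC, hl, hL, hδ₁, hyp⟩ := hyp _ hφ.isCompact hφ.2.2
  obtain ⟨V, hV, hKV, hVU, δ₂, hδ₂, hsh⟩ := exists_nhd_shift hU hφ.isCompact hφ.2.2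
  have hφV : IsTestFun V φ := ⟨hφ.1, hφ.2.1, hKV⟩
  have hM : ∃ M : ℝ, ∀ j x, |pd φ j x| ≤ M := by
    choose M h0 hM using fun j => (hφ.pd j).bdd
    exact ⟨∑ j, M j, fun j x => (hM j x).trans
      (Finset.single_le_sum (fun j _ => h0 j) (Finset.mem_univ j))⟩
  obtain ⟨M, hM⟩ := hM
  set ε : ℝ := l / (2 * (n * L + 1)) with hεd
  have hε : 0 < ε := by positivity
  have hεl : (n : ℝ) * (ε * L) ≤ l / 2 := by
    have : (n : ℝ) * (ε * L) = l / 2 * ((n * L) / (n * L + 1)) := by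
      rw [hεd]; field_simp
    rw [this]
    have h1 : (n * L) / (n * L + 1) ≤ 1 := by
      rw [div_le_one (by positivity)]; linarith
    nlinarith
  set B : ℝ := 2 + n * ε + n * (ε⁻¹ * M ^ 2) with hB
  have hB0 : 0 ≤ B := by positivity
  refine ⟨2 / l * (B * C), min δ₁ δ₂, by positivity, lt_min hδ₁ hδ₂, fun y hy j₀ => ?_⟩
  obtain ⟨κ, hκi, hκ, hae⟩ := hyp y (hy.trans (min_le_left _ _))
  have hs := hsh y (hy.trans (min_le_right _ _))
  have dG : ∀ j, L2loc V (fun x => G j (x + y) - G j x) := fun j =>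
    ((hG j).shift hs).sub ((hG j).mono hVU)
  have dW : ∀ j, L2loc V (fun x => W j (x + y) - W j x) := fun j =>
    ((hW j).shift hs).sub ((hW j).mono hVU)
  have dg : L2loc V (fun x => g (x + y) - g x) := (hg.shift hs).sub (hg.mono hVU)
  have dw : L2loc V (fun x => w (x + y) - w x) := (hw.shift hs).sub (hw.mono hVU)
  have dwW : ∀ j, WPD V (fun x => w (x + y) - w x) (fun x => W j (x + y) - W j x) j := fun j =>
    ((hwW j).shift hs).sub ((hwW j).mono hVU) (hw.shift hs) ((hW j).shift hs) (hw.mono hVU)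
      ((hW j).mono hVU)
  have dform : ∀ ψ, IsTestFun V ψ → ∑ j, ∫ x, (G j (x + y) - G j x) * pd ψ j x =
      ∫ x, (g (x + y) - g x) * ψ x := by
    intro ψ hψ
    have h1 := heq _ (hψ.translate hs)
    have h2 := heq _ (hψ.mono hVU)
    simp_rw [pd_translate, ← integral_shift_mul] at h1
    simp_rw [sub_mul]
    rw [integral_sub ((hg.shift hs).integrable_test hψ) ((hg.mono hVU).integrable_test hψ), ← h1,
      ← h2, ← Finset.sum_sub_distrib]
    exact Finset.sum_congr rfl fun j _ => integral_sub
      (((hG j).shift hs).integrable_test (hψ.pd j)) (((hG j).mono hVU).integrable_test (hψ.pd j))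
  have hφc : ContinuousOn φ V := hφ.continuous.continuousOn
  have hφ'c : ∀ j, ContinuousOn (pd φ j) V := fun j => (hφ.pd j).continuous.continuousOn
  have hφ2 : ∀ j, WPD V (fun x => φ x * φ x) (fun x => pd φ j x * φ x + φ x * pd φ j x) j := fun j =>
    (wpd_of_contDiff hφ.1).mul (wpd_of_contDiff hφ.1) hV (.of_continuousOn hφc)
      (.of_continuousOn (hφ'c j)) (.of_continuousOn hφc) (.of_continuousOn (hφ'c j))
  have hφ2l : L2loc V (fun x => φ x * φ x) := .of_continuousOn (hφc.mul hφc)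
  have hφ2l' : ∀ j, L2loc V (fun x => pd φ j x * φ x + φ x * pd φ j x) := fun j =>
    .of_continuousOn (((hφ'c j).mul hφc).add (hφc.mul (hφ'c j)))
  have hΨ := fun j => (hφ2 j).mul (dwW j) hV hφ2l (hφ2l' j) dw (dW j)
  have hΨl : ∀ j, L2loc V (fun x => (pd φ j x * φ x + φ x * pd φ j x) * (w (x + y) - w x) +
      φ x * φ x * (W j (x + y) - W j x)) := fun j =>
    (dw.mul_cont (((hφ'c j).mul hφc).add (hφc.mul (hφ'c j)))).add ((dW j).mul_cont (hφc.mul hφc))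
  have hψl : L2loc V (fun x => φ x * φ x * (w (x + y) - w x)) := dw.mul_cont (hφc.mul hφc)
  have h0 : ∀ x, x ∉ tsupport φ → φ x = 0 := fun x hx => hφ.eq_zero hx
  have h0Ψ : ∀ j x, x ∉ tsupport φ → (pd φ j x * φ x + φ x * pd φ j x) * (w (x + y) - w x) +
      φ x * φ x * (W j (x + y) - W j x) = 0 := fun j x hx => by simp [h0 x hx]
  have h0ψ : ∀ x, x ∉ tsupport φ → φ x * φ x * (w (x + y) - w x) = 0 := fun x hx => by
    simp [h0 x hx]
  have key := weak_form_extend hV dG dg dform hψl hΨl hΨ hφ.isCompact hKV h0ψ h0Ψ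
  have i1 : ∀ j, Integrable (fun x => (G j (x + y) - G j x) *
      ((pd φ j x * φ x + φ x * pd φ j x) * (w (x + y) - w x) +
      φ x * φ x * (W j (x + y) - W j x))) := fun j =>
    (dG j).integrable_mul_of_zero (hΨl j) hφ.isCompact hKV fun x hx => by
      rw [h0Ψ j x hx, mul_zero]
  have i2 : Integrable (fun x => (g (x + y) - g x) * (φ x * φ x * (w (x + y) - w x))) :=
    dg.integrable_mul_of_zero hψl hφ.isCompact hKV fun x hx => by rw [h0ψ x hx, mul_zero]
  have i3' : ∀ j, Integrable (fun x => (φ x * (W j (x + y) - W j x)) *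
      (φ x * (W j (x + y) - W j x))) := fun j =>
    ((dW j).mul_cont hφc).integrable_mul_of_zero ((dW j).mul_cont hφc) hφ.isCompact hKV fun x hx => by
      simp [h0 x hx]
  have i3 : Integrable (fun x => φ x * φ x * ∑ j, (W j (x + y) - W j x) ^ 2) := by
    have : (fun x => φ x * φ x * ∑ j, (W j (x + y) - W j x) ^ 2) = fun x => ∑ j,
        (φ x * (W j (x + y) - W j x)) * (φ x * (W j (x + y) - W j x)) := by
      funext x; rw [Finset.mul_sum]; exact Finset.sum_congr rfl fun j _ => by ring
    rw [this]
    exact integrable_finsetSum _ fun j _ => i3' j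
  have i4 : Integrable ((tsupport φ).indicator κ) :=
    hκi.integrable_indicator hφ.isCompact.measurableSet
  have hle : ∫ x, (l / 2 * (φ x * φ x * ∑ j, (W j (x + y) - W j x) ^ 2) -
      B * (tsupport φ).indicator κ x) ≤
      ∫ x, ((∑ j, (G j (x + y) - G j x) * ((pd φ j x * φ x + φ x * pd φ j x) * (w (x + y) - w x) +
      φ x * φ x * (W j (x + y) - W j x))) - (g (x + y) - g x) * (φ x * φ x * (w (x + y) - w x))) := by
    refine integral_mono_ae ((i3.const_mul _).isub (i4.const_mul _))
      ((integrable_finsetSum _ fun j _ => i1 j).isub i2) ?_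
    filter_upwards [hae] with x hx
    by_cases hxK : x ∈ tsupport φ
    · obtain ⟨h1, h2, h3, h4⟩ := hx hxK
      simp only [indicator_of_mem hxK]
      exact dq_pointwise (fun j => G j (x + y) - G j x) (fun j => W j (x + y) - W j x)
        (fun j => pd φ j x) (by simp) rfl h1 h2 h3 h4 (hφ01 x).1 (hφ01 x).2 (fun j => hM j x) hε hεl
    · simp [indicator_of_notMem hxK, h0 x hxK]
  rw [integral_sub (i3.const_mul _) (i4.const_mul _),
    integral_sub (integrable_finsetSum _ fun j _ => i1 j) i2, integral_finsetSum _ fun j _ => i1 j,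
    key, sub_self, integral_const_mul, integral_const_mul,
    integral_indicator hφ.isCompact.measurableSet] at hle
  have hfin : ∫ x in K, (W j₀ (x + y) - W j₀ x) ^ 2 ≤
      ∫ x, φ x * φ x * ∑ j, (W j (x + y) - W j x) ^ 2 := by
    rw [← integral_indicator hK.measurableSet]
    refine integral_mono_of_nonneg (.of_forall fun x => indicator_nonneg (fun _ _ => sq_nonneg _) x)
      i3 (.of_forall fun x => ?_)
    by_cases hx : x ∈ K
    · simp only [indicator_of_mem hx, hO1 x (hKO hx), one_mul]
      exact Finset.single_le_sum (f := fun j => (W j (x + y) - W j x) ^ 2)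
        (fun j _ => sq_nonneg _) (Finset.mem_univ j₀)
    · simp only [indicator_of_notMem hx]
      exact mul_nonneg (mul_self_nonneg _) (Finset.sum_nonneg fun j _ => sq_nonneg _)
  have h9 : l / 2 * (∫ x, φ x * φ x * ∑ j, (W j (x + y) - W j x) ^ 2) ≤ B * (C * ‖y‖ ^ 2) := by
    have := mul_le_mul_of_nonneg_left hκ hB0
    linarith
  refine hfin.trans ?_
  have : (∫ x, φ x * φ x * ∑ j, (W j (x + y) - W j x) ^ 2) =
      2 / l * (l / 2 * (∫ x, φ x * φ x * ∑ j, (W j (x + y) - W j x) ^ 2)) := by field_simp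
  rw [this, mul_assoc, mul_assoc]
  gcongr

end

section

open Filter

variable {U V : Set (Euc n)} {g d : Euc n → ℝ} {i : Fin n}

lemma _root_.IsTestFun.lipschitz {ψ : Euc n → ℝ} (h : IsTestFun U ψ) :
    ∃ M : ℝ, 0 ≤ M ∧ ∀ x y, |ψ x - ψ y| ≤ M * ‖x - y‖ := by
  have h1 : ContDiff ℝ 1 ψ := h.1.of_le (by simp)
  obtain ⟨C, hC⟩ := h1.lipschitzWith_of_hasCompactSupport h.2.1 (by simp)
  exact ⟨C, C.2, fun x y => by simpa [dist_eq_norm] using hC.dist_le_mul x y⟩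

lemma tendsto_dq {ψ : Euc n → ℝ} (h : IsTestFun U ψ) (l : Fin n) (x : Euc n) {t : ℕ → ℝ}
    (ht : Tendsto t atTop (𝓝 0)) (ht0 : ∀ m, t m ≠ 0) :
    Tendsto (fun m => (ψ (x - t m • e l) - ψ x) / t m) atTop (𝓝 (-pd ψ l x)) := by
  have h1 : HasDerivAt (fun s : ℝ => ψ (x - s • e l)) (-pd ψ l x) 0 := by
    have h2 : HasFDerivAt ψ (fderiv ℝ ψ x) (x - (0 : ℝ) • e l) := by
      simpa using (h.1.diffAt x).hasFDerivAt
    have h3 : HasDerivAt (fun s : ℝ => x - s • e l) (-e l) 0 := by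
      simpa using ((hasDerivAt_id (0 : ℝ)).smul_const (e l)).const_sub x
    have h4 := h2.comp_hasDerivAt _ h3
    rw [map_neg] at h4
    exact h4
  have h4 := (hasDerivAt_iff_tendsto_slope.1 h1).comp
    (tendsto_nhdsWithin_iff.2 ⟨ht, .of_forall fun m => ht0 m⟩)
  refine h4.congr fun m => ?_
  simp [slope_def_field]

/-- A bound on difference quotients in `L²` yields weak derivatives. -/
lemma exists_wpd_of_dq (hU : IsOpen U) (hg : L2loc U g) (l : Fin n)
    (hb : ∀ K, IsCompact K → K ⊆ U → ∃ C δ : ℝ, 0 ≤ C ∧ 0 < δ ∧ ∀ y : Euc n, ‖y‖ ≤ δ →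
      ∫ x in K, (g (x + y) - g x) ^ 2 ≤ C * ‖y‖ ^ 2) :
    ∃ d, L2loc U d ∧ WPD U g d l := by
  obtain ⟨d, hd, hd'⟩ := exists_L2loc_of_bound hU (fun ψ => -∫ x, g x * pd ψ l x)
    (fun ψ χ hψ hχ => by
      have : (fun x => g x * pd (fun x => ψ x + χ x) l x) =
          fun x => g x * pd ψ l x + g x * pd χ l x := by
        funext x; rw [pd_add (hψ.1.diffAt x) (hχ.1.diffAt x)]; ring
      rw [this, integral_add (hg.integrable_test (hψ.pd l)) (hg.integrable_test (hχ.pd l))]; ring)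
    (fun c ψ hψ => by
      have : (fun x => g x * pd (fun x => c * ψ x) l x) = fun x => c * (g x * pd ψ l x) := by
        funext x; rw [pd_const_mul c (hψ.1.diffAt x)]; ring
      rw [this, integral_const_mul]; ring)
    (fun K hK hKU => by
      obtain ⟨C, δ, hC, hδ, hb⟩ := hb K hK hKU
      obtain ⟨V, hV, hKV, hVU, δ₂, hδ₂, hsh⟩ := exists_nhd_shift hU hK hKU
      refine ⟨√C, fun ψ hψ hψK => ?_⟩
      have hψV : IsTestFun V ψ := ⟨hψ.1, hψ.2.1, hψK.trans hKV⟩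
      set t : ℕ → ℝ := fun m => min δ δ₂ / (m + 1) with ht
      have hδ3 : 0 < min δ δ₂ := lt_min hδ hδ₂
      have ht0 : ∀ m, 0 < t m := fun m => by positivity
      have htle : ∀ m, t m ≤ min δ δ₂ := fun m => by
        rw [ht]; exact div_le_self hδ3.le (by simp)
      have htl : Tendsto t atTop (𝓝 0) := by
        have := (tendsto_one_div_add_atTop_nhds_zero_nat (𝕜 := ℝ)).const_mul (min δ δ₂)
        simpa [ht, div_eq_mul_inv] using this
      have hny : ∀ m, ‖t m • (e l : Euc n)‖ = t m := fun m => by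
        simp [norm_smul, abs_of_pos (ht0 m)]
      have hyδ : ∀ m, ‖t m • (e l : Euc n)‖ ≤ δ := fun m =>
        (hny m).le.trans ((htle m).trans (min_le_left _ _))
      have hyδ₂ : ∀ m, ‖t m • (e l : Euc n)‖ ≤ δ₂ := fun m =>
        (hny m).le.trans ((htle m).trans (min_le_right _ _))
      have hbd : ∀ m, |∫ x, g x * ((ψ (x - t m • e l) - ψ x) / t m)| ≤
          √C * √(∫ x, ψ x ^ 2) := by
        intro m
        have hs := hsh _ (hyδ₂ m)
        have hD : L2loc V (fun x => g (x + t m • e l) - g x) := (hg.shift hs).sub (hg.mono hVU)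
        have e1 : ∫ x, g x * ((ψ (x - t m • e l) - ψ x) / t m) =
            (t m)⁻¹ * ∫ x, (K.indicator (fun x => g (x + t m • e l) - g x) x) * ψ x := by
          have : ∀ x, (K.indicator (fun x => g (x + t m • e l) - g x) x) * ψ x =
              g (x + t m • e l) * ψ x - g x * ψ x := fun x => by
            by_cases hx : x ∈ K
            · rw [indicator_of_mem hx]; ring
            · rw [hψ.eq_zero fun h => hx (hψK h)]; ring
          simp_rw [this]
          rw [integral_sub ((hg.shift hs).integrable_test hψV)
            ((hg.mono hVU).integrable_test hψV), integral_shift_mul, ← integral_sub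
            (hg.integrable_test (hψV.translate hs)) (hg.integrable_test hψ), ← integral_const_mul]
          congr 1; funext x; rw [div_eq_inv_mul]; ring
        have hm1 : MemLp (K.indicator (fun x => g (x + t m • e l) - g x)) 2 :=
          (memLp_indicator_iff_restrict hK.measurableSet).2 (hD K hK hKV)
        have hm2 : MemLp ψ 2 := hψ.continuous.memLp_of_hasCompactSupport hψ.2.1
        rw [e1, abs_mul, abs_of_pos (inv_pos.2 (ht0 m)), inv_mul_le_iff₀ (ht0 m)]
        refine (abs_integral_mul_le hm1 hm2).trans ?_
        rw [← mul_assoc]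
        gcongr
        have e2 : ∀ x, K.indicator (fun x => g (x + t m • e l) - g x) x ^ 2 =
            K.indicator (fun x => (g (x + t m • e l) - g x) ^ 2) x := fun x => by
          by_cases hx : x ∈ K
          · simp [indicator_of_mem hx]
          · simp [indicator_of_notMem hx]
        simp_rw [e2]
        rw [integral_indicator hK.measurableSet]
        refine Real.sqrt_le_iff.2 ⟨by have := ht0 m; positivity, (hb _ (hyδ m)).trans ?_⟩
        rw [hny, mul_pow, Real.sq_sqrt hC, mul_comm]
      obtain ⟨M, hM0, hM⟩ := hψ.lipschitz
      obtain ⟨δ₃, hδ₃, hcth⟩ := hK.exists_cthickening_subset_open hU hKU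
      have hK3 : IsCompact (Metric.cthickening δ₃ K) := hK.cthickening
      have hgi : Integrable ((Metric.cthickening δ₃ K).indicator (fun x => |g x| * M)) := by
        refine IntegrableOn.integrable_indicator ?_ hK3.measurableSet
        refine Integrable.mul_const ?_ M
        have : IsFiniteMeasure (volume.restrict (Metric.cthickening δ₃ K)) :=
          ⟨by simpa using hK3.measure_lt_top⟩
        exact ((hg _ hK3 hcth).integrable (by norm_num)).abs
      have hev : ∀ᶠ m in atTop, t m ≤ δ₃ := (htl.eventually (ge_mem_nhds hδ₃))
      have hout : ∀ᶠ m in atTop, ∀ x, x ∉ Metric.cthickening δ₃ K →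
          ψ (x - t m • e l) - ψ x = 0 := by
        filter_upwards [hev] with m hm x hx
        have h1 : x ∉ K := fun h => hx (Metric.self_subset_cthickening K h)
        have h2 : x - t m • e l ∉ K := fun h => hx (Metric.mem_cthickening_of_dist_le x _ _ _ h (by
          rw [dist_eq_norm]; simpa [norm_smul, abs_of_pos (ht0 m)] using hm))
        rw [hψ.eq_zero fun h => h1 (hψK h), hψ.eq_zero fun h => h2 (hψK h), sub_zero]
      have hlim : Tendsto (fun m => ∫ x, g x * ((ψ (x - t m • e l) - ψ x) / t m)) atTop
          (𝓝 (∫ x, g x * (-pd ψ l x))) := by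
        refine tendsto_integral_filter_of_dominated_convergence _ ?_ ?_ hgi
          (.of_forall fun x => (tendsto_dq hψ l x htl fun m => (ht0 m).ne').const_mul _)
        · refine .of_forall fun m => ?_
          have hs := hsh _ (hyδ₂ m)
          have := (((hg.integrable_test (hψV.translate hs)).sub
            (hg.integrable_test hψ)).const_mul (t m)⁻¹).aestronglyMeasurable
          refine this.congr (.of_forall fun x => ?_)
          simp only [Pi.sub_apply]
          rw [div_eq_inv_mul]; ring
        · filter_upwards [hout] with m hm
          refine .of_forall fun x => ?_
          by_cases hx : x ∈ Metric.cthickening δ₃ K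
          · rw [indicator_of_mem hx, Real.norm_eq_abs, abs_mul]
            gcongr
            rw [abs_div, abs_of_pos (ht0 m), div_le_iff₀ (ht0 m)]
            refine (hM _ _).trans ?_
            rw [show x - t m • (e l : Euc n) - x = -(t m • e l) by abel, norm_neg, hny]
          · rw [indicator_of_notMem hx, hm x hx]; simp
      have := le_of_tendsto hlim.abs (.of_forall hbd)
      simpa [integral_neg] using this)
  exact ⟨d, hd, fun ψ hψ => by have := hd' ψ hψ; linarith⟩

end

section

open Filter

variable {U V : Set (Euc n)} {g d : Euc n → ℝ} {i : Fin n}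

lemma sum_pow_four_le (p : Fin n → ℝ) : (∑ j, |p j|) ^ 4 ≤ n ^ 3 * ∑ j, p j ^ 4 := by
  have h1 := sq_sum_le_card_mul_sum_sq (s := Finset.univ) (f := fun j => |p j|)
  have h2 := sq_sum_le_card_mul_sum_sq (s := Finset.univ) (f := fun j => |p j| ^ 2)
  simp only [Finset.card_univ, Fintype.card_fin, sq_abs] at h1 h2
  have h3 : ∀ j, (p j ^ 2) ^ 2 = p j ^ 4 := fun j => by ring
  simp_rw [h3] at h2
  have h0 : 0 ≤ (∑ j, |p j|) ^ 2 := sq_nonneg _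
  calc (∑ j, |p j|) ^ 4 = ((∑ j, |p j|) ^ 2) ^ 2 := by ring
    _ ≤ (n * ∑ j, p j ^ 2) ^ 2 := by gcongr
    _ = n ^ 2 * (∑ j, p j ^ 2) ^ 2 := by ring
    _ ≤ n ^ 2 * (n * ∑ j, p j ^ 4) := by gcongr
    _ = _ := by ring

lemma smooth_shift_pointwise {a : Euc n → ℝ} (ha : ContDiff ℝ (⊤ : ℕ∞) a) (x y : Euc n) :
    ENNReal.ofReal ((a (x + y) - a x) ^ 4) ≤ ∫⁻ t in Icc (0 : ℝ) 1,
      ENNReal.ofReal (‖y‖ ^ 4 * (n ^ 3 * ∑ j, pd a j (x + t • y) ^ 4)) := by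
  have hc : Continuous fun t : ℝ => fderiv ℝ a (x + t • y) y := by
    have := (ha.continuous_fderiv (by simp))
    fun_prop
  have hd : ∀ t : ℝ, HasDerivAt (fun t : ℝ => a (x + t • y)) (fderiv ℝ a (x + t • y) y) t := by
    intro t
    have h3 : HasDerivAt (fun s : ℝ => x + s • y) y t := by
      simpa using ((hasDerivAt_id t).smul_const y).const_add x
    exact (ha.diffAt _).hasFDerivAt.comp_hasDerivAt t h3
  have hftc := intervalIntegral.integral_eq_sub_of_hasDerivAt (a := 0) (b := 1)
    (fun t _ => hd t) (hc.intervalIntegrable _ _)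
  rw [one_smul, zero_smul, add_zero, intervalIntegral.integral_of_le zero_le_one,
    ← integral_Icc_eq_integral_Ioc] at hftc
  have hpr : IsProbabilityMeasure (volume.restrict (Icc (0 : ℝ) 1)) := ⟨by simp⟩
  have hj := (Even.convexOn_pow (𝕜 := ℝ) (show Even 4 by decide)).map_integral_le
    (μ := volume.restrict (Icc (0 : ℝ) 1)) (f := fun t : ℝ => fderiv ℝ a (x + t • y) y)
    (by fun_prop) isClosed_univ (by simp) (hc.integrableOn_Icc) ((hc.pow 4).integrableOn_Icc)
  rw [hftc] at hj
  refine (ENNReal.ofReal_le_ofReal hj).trans ?_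
  have hi : Integrable (fun t : ℝ => fderiv ℝ a (x + t • y) y ^ 4) (volume.restrict (Icc 0 1)) :=
    (hc.pow 4).integrableOn_Icc
  change ENNReal.ofReal (∫ t in Icc (0 : ℝ) 1, fderiv ℝ a (x + t • y) y ^ 4) ≤ _
  rw [ofReal_integral_eq_lintegral_ofReal hi
    (.of_forall fun t => by simp only [Pi.zero_apply]; positivity)]
  refine lintegral_mono fun t => ENNReal.ofReal_le_ofReal ?_
  refine le_trans ?_ (mul_le_mul_of_nonneg_left (sum_pow_four_le fun j => pd a j (x + t • y))
    (by positivity))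
  rw [← mul_pow]
  have : |fderiv ℝ a (x + t • y) y| ≤ ‖y‖ * ∑ j, |pd a j (x + t • y)| := by
    rw [clm_apply_eq_sum, Finset.mul_sum]
    refine (Finset.abs_sum_le_sum_abs _ _).trans (Finset.sum_le_sum fun j _ => ?_)
    rw [abs_mul]
    exact mul_le_mul_of_nonneg_right (abs_apply_le y j) (abs_nonneg _)
  rw [← (show Even 4 by decide).pow_abs (fderiv ℝ a (x + t • y) y)]
  gcongr

lemma smooth_shift_integral {a : Euc n → ℝ} (ha : ContDiff ℝ (⊤ : ℕ∞) a) (y : Euc n) :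
    ∫⁻ x, ENNReal.ofReal ((a (x + y) - a x) ^ 4) ≤
      ∫⁻ x, ENNReal.ofReal (‖y‖ ^ 4 * (n ^ 3 * ∑ j, pd a j x ^ 4)) := by
  have hc : Continuous fun z : Euc n => ENNReal.ofReal (‖y‖ ^ 4 * (n ^ 3 * ∑ j, pd a j z ^ 4)) := by
    have := fun j => (contDiff_pd ha j).continuous
    exact ENNReal.continuous_ofReal.comp (by fun_prop :
      Continuous fun z : Euc n => ‖y‖ ^ 4 * (n ^ 3 * ∑ j, pd a j z ^ 4))
  calc _ ≤ ∫⁻ x, ∫⁻ t in Icc (0 : ℝ) 1,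
        ENNReal.ofReal (‖y‖ ^ 4 * (n ^ 3 * ∑ j, pd a j (x + t • y) ^ 4)) :=
        lintegral_mono fun x => smooth_shift_pointwise ha x y
    _ = ∫⁻ t in Icc (0 : ℝ) 1, ∫⁻ x,
        ENNReal.ofReal (‖y‖ ^ 4 * (n ^ 3 * ∑ j, pd a j (x + t • y) ^ 4)) :=
        lintegral_lintegral_swap (by
          refine Continuous.aemeasurable ?_
          exact hc.comp (by fun_prop : Continuous fun z : Euc n × ℝ => z.1 + z.2 • y))
    _ = _ := by
      simp_rw [lintegral_add_right_eq_self
        (fun x => ENNReal.ofReal (‖y‖ ^ 4 * (n ^ 3 * ∑ j, pd a j x ^ 4)))]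
      simp

lemma shift_four {D : Fin n → Euc n → ℝ} (hU : IsOpen U) (hg : ContinuousOn g U)
    (hD : ∀ j, L2loc U (D j)) (hD2 : ∀ j, L2loc U (fun x => D j x ^ 2))
    (hw : ∀ j, WPD U g (D j) j) {K : Set (Euc n)} (hK : IsCompact K) (hKU : K ⊆ U) :
    ∃ C δ : ℝ, 0 ≤ C ∧ 0 < δ ∧ ∀ y : Euc n, ‖y‖ ≤ δ →
      ∫ x in K, (g (x + y) - g x) ^ 4 ≤ C * ‖y‖ ^ 4 := by
  obtain ⟨ζ, hζ, -, O, hO, hKO, hO1⟩ := exists_cutoff hU hK hKU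
  obtain ⟨V, hV, hKV, hVO, δ, hδ, hsh⟩ := exists_nhd_shift hO hK hKO
  have hgl : L2loc U g := .of_continuousOn hg
  set a : Euc n → ℝ := fun x => ζ x * g x with ha
  set b : Fin n → Euc n → ℝ := fun j x => ζ x * D j x + pd ζ j x * g x with hb
  have hac : Continuous a := by simpa using continuous_cutoff_mul hU hζ hg
  have ha0 : ∀ x, x ∉ tsupport ζ → a x = 0 := fun x hx => by simp [ha, hζ.eq_zero hx]
  have hacs : HasCompactSupport a := HasCompactSupport.of_support_subset_isCompact hζ.isCompact
    fun x hx => by by_contra h; exact hx (ha0 x h)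
  have hal : LocallyIntegrable a := hac.locallyIntegrable
  have hwa : ∀ j, WPD univ a (b j) j := fun j => (hw j).localize hgl (hD j) hζ
  have hb0 : ∀ j x, x ∉ tsupport ζ → b j x = 0 := fun j x hx => by
    simp [hb, hζ.eq_zero hx, pd_eq_zero_of_notMem hx]
  have hbl : ∀ j, L2loc U (b j) := fun j => ((hD j).mul_cont hζ.continuous.continuousOn).add
    (hgl.mul_cont (hζ.pd j).continuous.continuousOn)
  have hbm : ∀ j, MemLp (b j) 2 := fun j => (hbl j).memLp hζ.isCompact hζ.2.2 (hb0 j)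
  have hb2 : ∀ j, MemLp (fun x => b j x ^ 2) 2 := by
    intro j
    refine memLp_of_restrict hζ.isCompact ?_ fun x hx => by simp [hb0 j x hx]
    have h1 : L2loc U (fun x => (2 * ζ x ^ 2) * D j x ^ 2 + 2 * (pd ζ j x * g x) ^ 2) :=
      ((hD2 j).mul_cont (by have := hζ.continuous; fun_prop)).add (.of_continuousOn (by
        have := (hζ.pd j).continuous.continuousOn (s := U)
        fun_prop))
    refine (h1 _ hζ.isCompact hζ.2.2).mono'
      (((hbl j) _ hζ.isCompact hζ.2.2).aestronglyMeasurable.pow 2) (.of_forall fun x => ?_)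
    rw [Real.norm_eq_abs, abs_of_nonneg (sq_nonneg _)]
    simp only [hb]
    nlinarith [sq_nonneg (ζ x * D j x - pd ζ j x * g x)]
  have hmom : ∀ m j, MemLp (fun x => pd (moll m a) j x ^ 2) 2 ∧
      ∫ x, pd (moll m a) j x ^ 4 ≤ ∫ x, b j x ^ 4 := by
    intro m j
    have e1 : pd (moll m a) j = cv (b j) (rho m) := cv_pd_of_weak hal (hwa j) (rho_test m)
    have h2 := cv_sq_integral (hb2 j) (rho_test m) (rho_nonneg m) (rho_sub_integral m)
      (rho_integral m)
    have h3 := sq_cv_le (hbm j) (rho_test m) (rho_nonneg m) (rho_sub_integral m)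
    have h4 : MemLp (fun x => pd (moll m a) j x ^ 2) 2 := by
      refine h2.1.mono' ?_ (.of_forall fun x => ?_)
      · exact ((contDiff_pd (cv_contDiff hal (rho_test m)) j).continuous.pow 2).aestronglyMeasurable
      · rw [Real.norm_eq_abs, abs_of_nonneg (sq_nonneg _), e1]
        exact h3 x
    refine ⟨h4, ?_⟩
    have e2 : ∀ x, b j x ^ 4 = (b j x ^ 2) ^ 2 := fun x => by ring
    have e3 : ∀ x, pd (moll m a) j x ^ 4 = (pd (moll m a) j x ^ 2) ^ 2 := fun x => by ring
    simp_rw [e2, e3]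
    refine le_trans (integral_mono h4.integrable_sq h2.1.integrable_sq fun x => ?_) h2.2
    simp only [e1]
    have := h3 x
    gcongr
  refine ⟨n ^ 3 * ∑ j, ∫ x, b j x ^ 4, δ, by positivity, hδ, fun y hy => ?_⟩
  set C := n ^ 3 * ∑ j, ∫ x, b j x ^ 4 with hC
  have hbound : ∀ m, ∫⁻ x in K, ENNReal.ofReal ((moll m a (x + y) - moll m a x) ^ 4) ≤
      ENNReal.ofReal (C * ‖y‖ ^ 4) := by
    intro m
    refine (setLIntegral_le_lintegral _ _).trans
      ((smooth_shift_integral (cv_contDiff hal (rho_test m)) y).trans ?_)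
    have hi : ∀ j, Integrable (fun x => pd (moll m a) j x ^ 4) := fun j => by
      have := (hmom m j).1.integrable_sq
      refine this.congr (.of_forall fun x => ?_)
      simp only; ring
    change ∫⁻ x, ENNReal.ofReal (‖y‖ ^ 4 * (n ^ 3 * ∑ j, pd (moll m a) j x ^ 4)) ≤ _
    rw [← ofReal_integral_eq_lintegral_ofReal
      (((integrable_finsetSum _ fun j _ => hi j).const_mul _).const_mul _)
      (.of_forall fun x => by simp only [Pi.zero_apply]; positivity)]
    refine ENNReal.ofReal_le_ofReal ?_
    rw [integral_const_mul, integral_const_mul, integral_finsetSum _ fun j _ => hi j, mul_comm, hC]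
    exact mul_le_mul_of_nonneg_right (mul_le_mul_of_nonneg_left
      (Finset.sum_le_sum fun j _ => (hmom m j).2) (by positivity)) (by positivity)
  have hlim : ∀ x, Tendsto (fun m => ENNReal.ofReal ((moll m a (x + y) - moll m a x) ^ 4)) atTop
      (𝓝 (ENNReal.ofReal ((a (x + y) - a x) ^ 4))) := by
    have hp : ∀ x, Tendsto (fun m => moll m a x) atTop (𝓝 (a x)) := fun x => by
      rw [Metric.tendsto_atTop']
      intro ε hε
      obtain ⟨N, hN⟩ := eventually_atTop.1 (moll_unif
        (hacs.uniformContinuous_of_continuous hac) (half_pos hε))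
      exact ⟨N, fun m hm => by
        rw [Real.dist_eq]; exact (hN m hm.le x).trans_lt (half_lt_self hε)⟩
    exact fun x => (ENNReal.continuous_ofReal.tendsto _).comp (((hp _).sub (hp _)).pow 4)
  have hfatou : ∫⁻ x in K, ENNReal.ofReal ((a (x + y) - a x) ^ 4) ≤ ENNReal.ofReal (C * ‖y‖ ^ 4) := by
    calc _ = ∫⁻ x in K, liminf (fun m =>
          ENNReal.ofReal ((moll m a (x + y) - moll m a x) ^ 4)) atTop := by
          simp_rw [fun x => (hlim x).liminf_eq]
      _ ≤ liminf (fun m => ∫⁻ x in K,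
          ENNReal.ofReal ((moll m a (x + y) - moll m a x) ^ 4)) atTop := by
          refine lintegral_liminf_le fun m => ?_
          have := (cv_contDiff hal (rho_test m)).continuous
          have h2 : Continuous (moll m a) := this
          exact (ENNReal.continuous_ofReal.comp (by fun_prop : Continuous fun x =>
            (moll m a (x + y) - moll m a x) ^ 4)).measurable
      _ ≤ _ := by
          refine (liminf_le_liminf (.of_forall hbound)).trans ?_
          simp
  have e5 : ∫ x in K, (g (x + y) - g x) ^ 4 = ∫ x in K, (a (x + y) - a x) ^ 4 := by
    refine setIntegral_congr_fun hK.measurableSet fun x hx => ?_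
    simp only [ha]
    rw [hO1 x (hKO hx), hO1 _ (hsh y hy x (hKV hx)), one_mul, one_mul]
  rw [e5, integral_eq_lintegral_of_nonneg_ae (.of_forall fun x => by
    simp only [Pi.zero_apply]; positivity) (by
      exact (by fun_prop : Continuous fun x => (a (x + y) - a x) ^ 4).aestronglyMeasurable)]
  exact ENNReal.toReal_le_of_le_ofReal (by positivity) hfatou

end

section

open Filter

variable {U V : Set (Euc n)} {g d : Euc n → ℝ} {i : Fin n}

lemma sq_sum_le (a : Euc n) : (∑ k, |a k|) ^ 2 ≤ n * ‖a‖ ^ 2 := by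
  have h1 := sq_sum_le_card_mul_sum_sq (s := Finset.univ) (f := fun j => |a j|)
  simpa [norm_sq_eq_sum] using h1

lemma exists_segment_deriv {Φ : Euc n → ℝ} {a b : Euc n}
    (h : ∀ t ∈ Icc (0 : ℝ) 1, DifferentiableAt ℝ Φ (a + t • (b - a))) :
    ∃ t ∈ Icc (0 : ℝ) 1, Φ b - Φ a = ∑ k, pd Φ k (a + t • (b - a)) * (b - a) k := by
  have hd : ∀ t ∈ Icc (0 : ℝ) 1, HasDerivAt (fun t : ℝ => Φ (a + t • (b - a)))
      (fderiv ℝ Φ (a + t • (b - a)) (b - a)) t := by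
    intro t ht
    have h3 : HasDerivAt (fun s : ℝ => a + s • (b - a)) (b - a) t := by
      simpa using ((hasDerivAt_id t).smul_const (b - a)).const_add a
    exact (h t ht).hasFDerivAt.comp_hasDerivAt t h3
  obtain ⟨t, ht, h2⟩ := exists_hasDerivAt_eq_slope (fun t : ℝ => Φ (a + t • (b - a))) _
    zero_lt_one (fun t ht => (hd t ht).continuousAt.continuousWithinAt)
    fun t ht => hd t ⟨ht.1.le, ht.2.le⟩
  refine ⟨t, ⟨ht.1.le, ht.2.le⟩, ?_⟩
  rw [clm_apply_eq_sum] at h2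
  simp only [one_smul, add_sub_cancel, zero_smul, add_zero, sub_zero, div_one] at h2
  rw [← h2]
  exact Finset.sum_congr rfl fun k _ => mul_comm _ _

lemma sq_sub_le_of_segment {Φ : Euc n → ℝ} {a b : Euc n} {M : ℝ}
    (h : ∀ t ∈ Icc (0 : ℝ) 1, DifferentiableAt ℝ Φ (a + t • (b - a)))
    (hM : ∀ t ∈ Icc (0 : ℝ) 1, ∀ k, |pd Φ k (a + t • (b - a))| ≤ M) :
    (Φ b - Φ a) ^ 2 ≤ M ^ 2 * n * ‖b - a‖ ^ 2 := by
  obtain ⟨t, ht, e⟩ := exists_segment_deriv h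
  have h1 : |Φ b - Φ a| ≤ M * ∑ k, |(b - a) k| := by
    rw [e, Finset.mul_sum]
    refine (Finset.abs_sum_le_sum_abs _ _).trans (Finset.sum_le_sum fun k _ => ?_)
    rw [abs_mul]
    exact mul_le_mul_of_nonneg_right (hM t ht k) (abs_nonneg _)
  calc (Φ b - Φ a) ^ 2 = |Φ b - Φ a| ^ 2 := (sq_abs _).symm
    _ ≤ (M * ∑ k, |(b - a) k|) ^ 2 := by gcongr
    _ = M ^ 2 * (∑ k, |(b - a) k|) ^ 2 := by ring
    _ ≤ M ^ 2 * (n * ‖b - a‖ ^ 2) := by gcongr; exact sq_sum_le _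
    _ = _ := by ring

lemma rpow_between {r R t : ℝ} (s : ℝ) (hr : 0 < r) (h1 : r ≤ t) (h2 : t ≤ R) :
    min (r ^ s) (R ^ s) ≤ t ^ s ∧ t ^ s ≤ max (r ^ s) (R ^ s) := by
  rcases le_total 0 s with hs | hs
  · exact ⟨(min_le_left _ _).trans (rpow_le_rpow hr.le h1 hs),
      (rpow_le_rpow (hr.le.trans h1) h2 hs).trans (le_max_right _ _)⟩
  · exact ⟨(min_le_right _ _).trans (rpow_le_rpow_of_nonpos (hr.trans_le h1) h2 hs),
      (rpow_le_rpow_of_nonpos hr h1 hs).trans (le_max_left _ _)⟩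

/-- On a compact set where `v ≠ 0`, small increments of `v` stay in a fixed annulus. -/
lemma exists_annulus (hU : IsOpen U) {v : Euc n → Euc n} (hv : ContinuousOn v U)
    (hv0 : ∀ x ∈ U, v x ≠ 0) {K : Set (Euc n)} (hK : IsCompact K) (hKU : K ⊆ U) :
    ∃ r R δ : ℝ, 0 < r ∧ 0 < R ∧ 0 < δ ∧ ∀ y : Euc n, ‖y‖ ≤ δ → ∀ x ∈ K, x + y ∈ U ∧
      ∀ t ∈ Icc (0 : ℝ) 1, r ≤ ‖v x + t • (v (x + y) - v x)‖ ∧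
        ‖v x + t • (v (x + y) - v x)‖ ≤ R := by
  obtain ⟨δ₀, hδ₀, hδU⟩ := hK.exists_cthickening_subset_open hU hKU
  have hK' := hK.cthickening (r := δ₀)
  have hvK := hv.mono hδU
  obtain ⟨R, hR⟩ := hK'.exists_bound_of_continuousOn hvK
  have hr : ∃ r > 0, ∀ x ∈ Metric.cthickening δ₀ K, r ≤ ‖v x‖ := by
    rcases (Metric.cthickening δ₀ K).eq_empty_or_nonempty with he | hne
    · exact ⟨1, one_pos, by simp [he]⟩
    · obtain ⟨z, hz, hzm⟩ := hK'.exists_isMinOn hne hvK.norm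
      exact ⟨‖v z‖, norm_pos_iff.2 (hv0 z (hδU hz)), fun x hx => hzm hx⟩
  obtain ⟨r, hr0, hr⟩ := hr
  obtain ⟨δ₁, hδ₁, h1⟩ := Metric.uniformContinuousOn_iff.1
    (hK'.uniformContinuousOn_of_continuous hvK) (r / 2) (half_pos hr0)
  refine ⟨r / 2, max R 0 + r, min δ₀ (δ₁ / 2), half_pos hr0, by positivity, by positivity,
    fun y hy x hx => ?_⟩
  have hxK : x ∈ Metric.cthickening δ₀ K := Metric.self_subset_cthickening _ hx
  have hxy : x + y ∈ Metric.cthickening δ₀ K := Metric.mem_cthickening_of_dist_le _ x _ _ hx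
    (by simpa using hy.trans (min_le_left _ _))
  refine ⟨hδU hxy, fun t ht => ?_⟩
  have hd : ‖v (x + y) - v x‖ < r / 2 := by
    rw [← dist_eq_norm]
    refine h1 _ hxy _ hxK ?_
    have := hy.trans (min_le_right _ _)
    simp only [dist_self_add_left]
    linarith
  have ht' : ‖t • (v (x + y) - v x)‖ ≤ r / 2 := by
    rw [norm_smul, Real.norm_eq_abs, abs_of_nonneg ht.1]
    nlinarith [norm_nonneg (v (x + y) - v x), ht.2]
  constructor
  · have := norm_sub_norm_le (v x) (-(t • (v (x + y) - v x)))
    rw [norm_neg, sub_neg_eq_add] at this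
    linarith [hr x hxK]
  · have := norm_add_le (v x) (t • (v (x + y) - v x))
    linarith [hR x hxK, le_max_left R 0]

lemma C1_shift_bound (hU : IsOpen U) (hg : ∀ x ∈ U, DifferentiableAt ℝ g x)
    (hc : ∀ j, ContinuousOn (pd g j) U) {K : Set (Euc n)} (hK : IsCompact K) (hKU : K ⊆ U) :
    ∃ C δ : ℝ, 0 ≤ C ∧ 0 < δ ∧ ∀ y : Euc n, ‖y‖ ≤ δ → ∀ x ∈ K,
      (g (x + y) - g x) ^ 2 ≤ C * ‖y‖ ^ 2 := by
  obtain ⟨δ₀, hδ₀, hδU⟩ := hK.exists_cthickening_subset_open hU hKU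
  have hK' := hK.cthickening (r := δ₀)
  obtain ⟨M, hM⟩ := hK'.exists_bound_of_continuousOn
    (f := fun x => ∑ j, |pd g j x|) (by
      have := fun j => (hc j).mono hδU
      fun_prop)
  have hmem : ∀ y : Euc n, ‖y‖ ≤ δ₀ → ∀ x ∈ K, ∀ t ∈ Icc (0 : ℝ) 1,
      x + t • (x + y - x) ∈ Metric.cthickening δ₀ K := fun y hy x hx t ht => by
    refine Metric.mem_cthickening_of_dist_le _ x _ _ hx ?_
    simp only [add_sub_cancel_left, dist_self_add_left, norm_smul, Real.norm_eq_abs,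
      abs_of_nonneg ht.1]
    nlinarith [ht.1, ht.2, norm_nonneg y]
  refine ⟨M ^ 2 * n, δ₀, by positivity, hδ₀, fun y hy x hx => ?_⟩
  have := sq_sub_le_of_segment (Φ := g) (a := x) (b := x + y) (M := M)
    (fun t ht => hg _ (hδU (hmem y hy x hx t ht))) fun t ht k => by
      refine le_trans ?_ ((le_abs_self _).trans (hM _ (hmem y hy x hx t ht)))
      exact Finset.single_le_sum (f := fun j => |pd g j (x + t • (x + y - x))|)
        (fun j _ => abs_nonneg _) (Finset.mem_univ k)
  simpa using this

lemma vf_monotone {s r R : ℝ} (hs : -1 < s) (hr : 0 < r) {a b : Euc n}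
    (h : ∀ t ∈ Icc (0 : ℝ) 1, r ≤ ‖a + t • (b - a)‖ ∧ ‖a + t • (b - a)‖ ≤ R) :
    min 1 (1 + s) * min (r ^ s) (R ^ s) * ‖b - a‖ ^ 2 ≤
      ∑ j, (vf s j b - vf s j a) * (b j - a j) := by
  have hne : ∀ t ∈ Icc (0 : ℝ) 1, a + t • (b - a) ≠ 0 := fun t ht h0 => by
    have := (h t ht).1
    rw [h0, norm_zero] at this
    linarith
  have hdiff : ∀ t ∈ Icc (0 : ℝ) 1, ∀ j, DifferentiableAt ℝ (vf s j) (a + t • (b - a)) :=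
    fun t ht j => (contDiffAt_vf s j (hne t ht)).differentiableAt (by simp)
  obtain ⟨t, ht, e⟩ := exists_segment_deriv (Φ := fun ξ => ∑ j, vf s j ξ * (b - a) j)
    (a := a) (b := b) fun t ht => by
      refine DifferentiableAt.fun_sum fun j _ => (hdiff t ht j).mul_const _
  have e2 : ∀ k : Fin n, pd (fun ξ => ∑ j, vf s j ξ * (b - a) j) k (a + t • (b - a)) =
      ∑ j, dvf s j k (a + t • (b - a)) * (b - a) j := by
    intro k
    rw [pd_sum _ fun j _ => (hdiff t ht j).mul_const _]
    refine Finset.sum_congr rfl fun j _ => ?_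
    have := pd_const_mul (i := k) ((b - a) j) (hdiff t ht j)
    rw [pd_vf s j k (hne t ht)] at this
    simp_rw [mul_comm _ ((b - a) j)]
    exact this
  have hell := dvf_elliptic (s := s) (hne t ht) (b - a)
  have e3 : ∑ j, (vf s j b - vf s j a) * (b j - a j) =
      ∑ j, (∑ k, dvf s j k (a + t • (b - a)) * (b - a) k) * (b - a) j := by
    calc _ = (∑ j, vf s j b * (b - a) j) - ∑ j, vf s j a * (b - a) j := by
          rw [← Finset.sum_sub_distrib]
          refine Finset.sum_congr rfl fun j _ => ?_
          simp only [PiLp.sub_apply]; ring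
      _ = _ := by
          rw [e]
          simp_rw [e2, Finset.sum_mul]
          rw [Finset.sum_comm]
          refine Finset.sum_congr rfl fun j _ => Finset.sum_congr rfl fun k _ => by ring
  rw [e3]
  refine le_trans ?_ hell
  have := (rpow_between s hr (h t ht).1 (h t ht).2).1
  have h0 : 0 ≤ min 1 (1 + s) := le_min zero_le_one (by linarith)
  gcongr

end

section

open Filter

/-- A `C¹` weak solution of `-Δ_p u = f` with gradient `v`. -/
structure PSol (p : ℝ) (Ω : Set (Euc n)) (u f : Euc n → ℝ) (v : Euc n → Euc n) : Prop where
  isOpen : IsOpen Ω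
  one_lt : 1 < p
  lt_three : p < 3
  cont : ContinuousOn v Ω
  diff : ∀ x ∈ Ω, DifferentiableAt ℝ u x
  pd_eq : ∀ x ∈ Ω, ∀ j, pd u j x = v x j
  fdiff : ∀ x ∈ Ω, DifferentiableAt ℝ f x
  fcont : ∀ j, ContinuousOn (pd f j) Ω
  weak : ∀ ψ, IsTestFun Ω ψ → ∑ j, ∫ x, vf (p - 2) j (v x) * pd ψ j x = ∫ x, f x * ψ x

/-- The set of regular points. -/
def Reg (Ω : Set (Euc n)) (v : Euc n → Euc n) : Set (Euc n) := {x | x ∈ Ω ∧ v x ≠ 0}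

variable {p : ℝ} {Ω : Set (Euc n)} {u f : Euc n → ℝ} {v : Euc n → Euc n}

lemma reg_subset : Reg Ω v ⊆ Ω := fun _ hx => hx.1

lemma continuousOn_coord {U : Set (Euc n)} (h : ContinuousOn v U) (i : Fin n) :
    ContinuousOn (fun x => v x i) U :=
  (contDiff_coord i).continuous.comp_continuousOn h

lemma continuousOn_comp_ne {U : Set (Euc n)} {Φ : Euc n → ℝ} (h : ContinuousOn v U)
    (h0 : ∀ x ∈ U, v x ≠ 0) (hΦ : ∀ ξ : Euc n, ξ ≠ 0 → ContDiffAt ℝ (⊤ : ℕ∞) Φ ξ) :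
    ContinuousOn (fun x => Φ (v x)) U := fun x hx =>
  (hΦ _ (h0 x hx)).continuousAt.comp_continuousWithinAt (h x hx)

namespace PSol

lemma isOpen_reg (S : PSol p Ω u f v) : IsOpen (Reg Ω v) :=
  S.cont.isOpen_inter_preimage S.isOpen isOpen_ne_zero

lemma cont_reg (S : PSol p Ω u f v) : ContinuousOn v (Reg Ω v) := S.cont.mono reg_subset

lemma cont_comp (S : PSol p Ω u f v) {Φ : Euc n → ℝ}
    (hΦ : ∀ ξ : Euc n, ξ ≠ 0 → ContDiffAt ℝ (⊤ : ℕ∞) Φ ξ) :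
    ContinuousOn (fun x => Φ (v x)) (Reg Ω v) :=
  continuousOn_comp_ne S.cont_reg (fun _ hx => hx.2) hΦ

lemma ucont (S : PSol p Ω u f v) : ContinuousOn u Ω :=
  fun x hx => (S.diff x hx).continuousAt.continuousWithinAt

lemma fcont' (S : PSol p Ω u f v) : ContinuousOn f Ω :=
  fun x hx => (S.fdiff x hx).continuousAt.continuousWithinAt

lemma pd_cont (S : PSol p Ω u f v) (j : Fin n) : ContinuousOn (pd u j) Ω :=
  (continuousOn_coord S.cont j).congr fun x hx => S.pd_eq x hx j

lemma wpd_u (S : PSol p Ω u f v) (j : Fin n) : WPD Ω u (fun x => v x j) j :=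
  (wpd_of_C1 S.diff (S.pd_cont j)).congr (.of_forall fun _ _ => rfl)
    (.of_forall fun x hx => S.pd_eq x hx j)

lemma wpd_f (S : PSol p Ω u f v) (j : Fin n) : WPD Ω f (pd f j) j :=
  wpd_of_C1 S.fdiff (S.fcont j)

lemma dq_v (S : PSol p Ω u f v) {K : Set (Euc n)} (hK : IsCompact K) (hKU : K ⊆ Reg Ω v) :
    ∃ C δ : ℝ, 0 ≤ C ∧ 0 < δ ∧ ∀ y : Euc n, ‖y‖ ≤ δ → ∀ j,
      ∫ x in K, (v (x + y) j - v x j) ^ 2 ≤ C * ‖y‖ ^ 2 := by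
  refine dq_bound S.isOpen_reg (G := fun j x => vf (p - 2) j (v x)) (g := f) (w := u)
    (fun j => .of_continuousOn (S.cont_comp fun ξ hξ => contDiffAt_vf _ j hξ))
    (.of_continuousOn (S.fcont'.mono reg_subset)) (.of_continuousOn (S.ucont.mono reg_subset))
    (fun j => .of_continuousOn (continuousOn_coord S.cont_reg j))
    (fun j => (S.wpd_u j).mono reg_subset)
    (fun ψ hψ => S.weak ψ (hψ.mono reg_subset)) (fun K hK hKU => ?_) hK hKU
  obtain ⟨r, R, δ, hr, hR, hδ, han⟩ := exists_annulus S.isOpen_reg S.cont_reg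
    (fun x hx => hx.2) hK hKU
  obtain ⟨C₁, δ₁, hC₁, hδ₁, h1⟩ := C1_shift_bound S.isOpen S.diff S.pd_cont hK
    (hKU.trans reg_subset)
  obtain ⟨C₂, δ₂, hC₂, hδ₂, h2⟩ := C1_shift_bound S.isOpen S.fdiff S.fcont hK
    (hKU.trans reg_subset)
  set s := p - 2 with hs
  have hs1 : -1 < s := by linarith [S.one_lt]
  set M := (1 + |s|) * max (r ^ s) (R ^ s) with hM
  refine ⟨(C₁ + C₂) * volume.real K, min 1 (1 + s) * min (r ^ s) (R ^ s), M ^ 2 * n,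
    min δ (min δ₁ δ₂), by positivity, ?_, by positivity, by positivity, fun y hy => ?_⟩
  · have : 0 < min 1 (1 + s) := lt_min one_pos (by linarith)
    positivity
  refine ⟨fun _ => (C₁ + C₂) * ‖y‖ ^ 2, ?_, ?_, .of_forall fun x hx => ?_⟩
  · exact integrableOn_const (hK.measure_lt_top.ne)
  · simp only [integral_const, smul_eq_mul, MeasurableSet.univ, measureReal_restrict_apply,
      univ_inter]
    exact le_of_eq (by ring)
  have hy1 := hy.trans (min_le_left _ _)
  have hy2 := (hy.trans (min_le_right _ _)).trans (min_le_left _ _)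
  have hy3 := (hy.trans (min_le_right _ _)).trans (min_le_right _ _)
  obtain ⟨hxy, hseg⟩ := han y hy1 x hx
  have hκ : 0 ≤ (C₁ + C₂) * ‖y‖ ^ 2 := by positivity
  have e : ∑ j, (v (x + y) j - v x j) ^ 2 = ‖v (x + y) - v x‖ ^ 2 := by
    rw [norm_sq_eq_sum]; simp
  have hne : ∀ t ∈ Icc (0 : ℝ) 1, v x + t • (v (x + y) - v x) ≠ 0 := fun t ht h0 => by
    have := (hseg t ht).1
    rw [h0, norm_zero] at this
    linarith
  refine ⟨?_, fun j => ?_, ?_, ?_⟩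
  · rw [e]
    have := vf_monotone hs1 hr hseg
    linarith
  · rw [e]
    have := sq_sub_le_of_segment (Φ := vf s j) (M := M)
      (fun t ht => (contDiffAt_vf s j (hne t ht)).differentiableAt (by simp)) fun t ht k => by
        rw [pd_vf s j k (hne t ht)]
        refine (abs_dvf_le s j k (hne t ht)).trans ?_
        rw [hM]
        gcongr
        exact (rpow_between s hr (hseg t ht).1 (hseg t ht).2).2
    linarith
  · nlinarith [h1 y hy2 x hx, sq_nonneg ‖y‖]
  · nlinarith [h2 y hy3 x hx, sq_nonneg ‖y‖]

end PSol

lemma L2loc.congr {U : Set (Euc n)} {g h : Euc n → ℝ} (hg : L2loc U g)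
    (h1 : ∀ᵐ x, x ∈ U → g x = h x) : L2loc U h := fun K hK hKU =>
  (hg K hK hKU).ae_eq ((ae_restrict_iff' hK.measurableSet).2
    (h1.mono fun _ hx hxK => hx (hKU hxK)))

lemma pd_comm {ψ : Euc n → ℝ} (h : ContDiff ℝ (⊤ : ℕ∞) ψ) (i j : Fin n) (x : Euc n) :
    pd (pd ψ i) j x = pd (pd ψ j) i x := by
  have hle : (2 : WithTop ℕ∞) ≤ ((⊤ : ℕ∞) : WithTop ℕ∞) :=
    WithTop.coe_le_coe.2 (le_top (a := (2 : ℕ∞)))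
  have h2 : ContDiff ℝ 2 ψ := h.of_le hle
  have e : ∀ i j : Fin n, pd (pd ψ i) j x =
      fderiv ℝ (fderiv ℝ ψ) x (EuclideanSpace.single j 1) (EuclideanSpace.single i 1) := by
    intro i j
    have hd : DifferentiableAt ℝ (fderiv ℝ ψ) x :=
      (h2.fderiv_right (m := 1) (by norm_num)).differentiable (by simp) x
    change fderiv ℝ (fun z => fderiv ℝ ψ z (EuclideanSpace.single i 1)) x _ = _
    rw [fderiv_clm_apply hd (differentiableAt_const _)]
    simp
  rw [e, e]
  exact (h.contDiffAt.isSymmSndFDerivAt (by simpa using hle)) _ _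

lemma wpd_symm {U : Set (Euc n)} (hU : IsOpen U) {g d₁ d₂ h₁₂ h₂₁ : Euc n → ℝ} {i j : Fin n}
    (h1 : WPD U g d₁ i) (h2 : WPD U g d₂ j) (h12 : WPD U d₁ h₁₂ j) (h21 : WPD U d₂ h₂₁ i)
    (l1 : L2loc U h₁₂) (l2 : L2loc U h₂₁) : ∀ᵐ x, x ∈ U → h₁₂ x = h₂₁ x := by
  refine ae_eq_of_forall_test hU (l1.locallyIntegrableOn hU) (l2.locallyIntegrableOn hU)
    fun ψ hψ => ?_
  have e1 := h1 _ (hψ.pd j)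
  have e2 := h2 _ (hψ.pd i)
  have e3 := h12 _ hψ
  have e4 := h21 _ hψ
  simp_rw [pd_comm hψ.1 i j] at e2
  linarith

lemma exists_zero_off {U : Set (Euc n)} {g d : Euc n → ℝ} {j : Fin n} (hd : L2loc U d)
    (hw : WPD U g d j) : ∃ d', L2loc U d' ∧ WPD U g d' j ∧ ∀ x, x ∉ U → d' x = 0 := by
  classical
  refine ⟨U.indicator d, hd.congr (.of_forall fun x hx => (indicator_of_mem hx _).symm),
    hw.congr (.of_forall fun _ _ => rfl)
      (.of_forall fun x hx => (indicator_of_mem hx _).symm),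
    fun x hx => indicator_of_notMem hx _⟩

lemma PSol.exists_hess (S : PSol p Ω u f v) : ∃ H : Fin n → Fin n → Euc n → ℝ,
    (∀ i j, L2loc (Reg Ω v) (H i j)) ∧ (∀ i j, WPD (Reg Ω v) (fun x => v x i) (H i j) j) ∧
    (∀ i j, H i j = H j i) ∧ ∀ i j x, x ∉ Reg Ω v → H i j x = 0 := by
  have h1 : ∀ i j, ∃ d, L2loc (Reg Ω v) d ∧ WPD (Reg Ω v) (fun x => v x i) d j ∧
      ∀ x, x ∉ Reg Ω v → d x = 0 := by
    intro i j
    obtain ⟨d, hd, hw⟩ := exists_wpd_of_dq S.isOpen_reg (.of_continuousOn (continuousOn_coord S.cont_reg i)) j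
      fun K hK hKU => by
        obtain ⟨C, δ, hC, hδ, h⟩ := S.dq_v hK hKU
        exact ⟨C, δ, hC, hδ, fun y hy => h y hy i⟩
    exact exists_zero_off hd hw
  choose D hD hw hz using h1
  have hsymm : ∀ i j, ∀ᵐ x, x ∈ Reg Ω v → D i j x = D j i x := fun i j =>
    wpd_symm S.isOpen_reg ((S.wpd_u i).mono reg_subset) ((S.wpd_u j).mono reg_subset)
      (hw i j) (hw j i) (hD i j) (hD j i)
  refine ⟨fun i j => D (min i j) (max i j), fun i j => hD _ _, fun i j => ?_, fun i j => ?_,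
    fun i j => hz _ _⟩
  · rcases le_total i j with h | h
    · simpa [min_eq_left h, max_eq_right h] using hw i j
    · simp only [min_eq_right h, max_eq_left h]
      exact (hw i j).congr (.of_forall fun _ _ => rfl) (hsymm i j)
  · simp only [min_comm, max_comm]

end

section

open Filter

/-- A smooth radial cutoff that vanishes for `‖ξ‖² ≤ δ` and equals `1` for `‖ξ‖² ≥ 2 δ`. -/
def eta (δ : ℝ) (ξ : Euc n) : ℝ := smoothTransition (‖ξ‖ ^ 2 / δ - 1)

def deta (δ : ℝ) (ξ : Euc n) : ℝ := deriv smoothTransition (‖ξ‖ ^ 2 / δ - 1) * (2 / δ)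

lemma eta_nonneg (δ : ℝ) (ξ : Euc n) : 0 ≤ eta δ ξ := smoothTransition.nonneg _

lemma eta_le_one (δ : ℝ) (ξ : Euc n) : eta δ ξ ≤ 1 := smoothTransition.le_one _

lemma eta_eq_zero {δ : ℝ} (hδ : 0 < δ) {ξ : Euc n} (h : ‖ξ‖ ^ 2 ≤ δ) : eta δ ξ = 0 :=
  smoothTransition.zero_of_nonpos (by rw [sub_nonpos, div_le_one hδ]; exact h)

lemma eta_eq_one {δ : ℝ} (hδ : 0 < δ) {ξ : Euc n} (h : 2 * δ ≤ ‖ξ‖ ^ 2) : eta δ ξ = 1 :=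
  smoothTransition.one_of_one_le (by rw [le_sub_iff_add_le, le_div_iff₀ hδ]; linarith)

lemma contDiff_normsq : ContDiff ℝ (⊤ : ℕ∞) fun ξ : Euc n => ‖ξ‖ ^ 2 := contDiff_norm_sq ℝ

lemma contDiff_eta (δ : ℝ) : ContDiff ℝ (⊤ : ℕ∞) (eta (n := n) δ) :=
  smoothTransition.contDiff.comp ((contDiff_normsq.div_const δ).sub contDiff_const)

lemma pd_eta (δ : ℝ) (k : Fin n) (ξ : Euc n) : pd (eta δ) k ξ = deta δ ξ * ξ k := by
  have h1 : DifferentiableAt ℝ (fun ξ : Euc n => ‖ξ‖ ^ 2) ξ := contDiff_normsq.diffAt ξ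
  have e : (fun ξ : Euc n => ‖ξ‖ ^ 2 / δ - 1) = fun ξ => δ⁻¹ * ‖ξ‖ ^ 2 - 1 := by
    ext; ring
  unfold eta deta
  rw [pd_comp (m := smoothTransition)
    ((smoothTransition.contDiff (n := 1)).differentiable (by simp) _) (by rw [e]; fun_prop)]
  rw [e, pd_sub (g := fun ξ : Euc n => δ⁻¹ * ‖ξ‖ ^ 2) (h := fun _ => 1)
    (h1.const_mul _) (differentiableAt_const _), pd_const_mul _ h1, pd_normsq]
  have : pd (fun _ : Euc n => (1 : ℝ)) k ξ = 0 := by simp [pd]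
  rw [this, div_eq_mul_inv, div_eq_mul_inv, mul_comm (‖ξ‖ ^ 2)]
  ring

lemma deta_nonneg {δ : ℝ} (hδ : 0 < δ) (ξ : Euc n) : 0 ≤ deta δ ξ :=
  mul_nonneg (smoothTransition.monotone.deriv_nonneg) (by positivity)

lemma continuous_deta (δ : ℝ) : Continuous (deta (n := n) δ) := by
  have : Continuous (deriv smoothTransition) :=
    (smoothTransition.contDiff (n := 1)).continuous_deriv (by simp)
  unfold deta
  fun_prop

lemma exists_deta_le : ∃ C : ℝ, 0 ≤ C ∧ ∀ {n : ℕ} (δ : ℝ) (ξ : Euc n), 0 < δ →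
    deta δ ξ * ‖ξ‖ ^ 2 ≤ C := by
  have hc : Continuous (deriv smoothTransition) :=
    (smoothTransition.contDiff (n := 1)).continuous_deriv (by simp)
  obtain ⟨C, hC⟩ := (isCompact_Icc (a := (0 : ℝ)) (b := 1)).exists_bound_of_continuousOn
    hc.continuousOn
  have hC0 : 0 ≤ C := (norm_nonneg _).trans (hC 0 (by simp))
  refine ⟨4 * C, by positivity, fun δ ξ hδ => ?_⟩
  unfold deta
  set t := ‖ξ‖ ^ 2 / δ - 1 with ht
  have et : ‖ξ‖ ^ 2 = δ * (t + 1) := by rw [ht]; field_simp; ring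
  have e2 : deriv smoothTransition t * (2 / δ) * ‖ξ‖ ^ 2 =
      2 * (deriv smoothTransition t * (t + 1)) := by rw [et]; field_simp
  rw [e2]
  have hm : 0 ≤ deriv smoothTransition t := smoothTransition.monotone.deriv_nonneg
  have ht1 : 0 ≤ t + 1 := by rw [ht]; simp only [sub_add_cancel]; positivity
  rcases le_or_gt t 1 with h1 | h1
  · rcases lt_or_ge t 0 with h0 | h0
    · have : smoothTransition =ᶠ[𝓝 t] fun _ => 0 :=
        (eventually_lt_nhds h0).mono fun t ht => smoothTransition.zero_of_nonpos ht.le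
      rw [this.deriv_eq, deriv_const]
      linarith
    · have := (le_abs_self _).trans (hC t ⟨h0, h1⟩)
      nlinarith
  · have : smoothTransition =ᶠ[𝓝 t] fun _ => 1 :=
      (eventually_gt_nhds h1).mono fun t ht => smoothTransition.one_of_one_le ht.le
    rw [this.deriv_eq, deriv_const]
    linarith

def Phi (τ δ : ℝ) (ξ : Euc n) : ℝ := ‖ξ‖ ^ τ * eta δ ξ ^ 2

def cPhi (τ δ : ℝ) (ξ : Euc n) : ℝ :=
  τ * ‖ξ‖ ^ (τ - 2) * eta δ ξ ^ 2 + ‖ξ‖ ^ τ * (2 * eta δ ξ * deta δ ξ)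

lemma contDiffAt_Phi (τ δ : ℝ) {ξ : Euc n} (hξ : ξ ≠ 0) : ContDiffAt ℝ (⊤ : ℕ∞) (Phi τ δ) ξ :=
  (contDiffAt_rpow_norm τ hξ).mul ((contDiff_eta δ).contDiffAt.pow 2)

lemma pd_Phi (τ δ : ℝ) (k : Fin n) {ξ : Euc n} (hξ : ξ ≠ 0) :
    pd (Phi τ δ) k ξ = cPhi τ δ ξ * ξ k := by
  have h1 : DifferentiableAt ℝ (fun ξ : Euc n => ‖ξ‖ ^ τ) ξ :=
    (contDiffAt_rpow_norm τ hξ).differentiableAt (by simp)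
  have h2 := (contDiff_eta δ).diffAt ξ
  have e : (fun ξ : Euc n => ‖ξ‖ ^ τ * eta δ ξ ^ 2) =
      fun ξ => ‖ξ‖ ^ τ * (eta δ ξ * eta δ ξ) := by ext; ring
  unfold Phi cPhi
  rw [e, pd_mul (h := fun ξ => eta δ ξ * eta δ ξ) h1 (h2.mul h2), pd_mul h2 h2, pd_rpow_norm τ k hξ, pd_eta]
  ring

lemma abs_cPhi_le : ∃ C : ℝ, 0 ≤ C ∧ ∀ {n : ℕ} (τ δ : ℝ) (ξ : Euc n), 0 < δ → ξ ≠ 0 →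
    |cPhi τ δ ξ| ≤ (|τ| + C) * (eta δ ξ * ‖ξ‖ ^ (τ - 2)) := by
  obtain ⟨C, hC, h⟩ := exists_deta_le
  refine ⟨2 * C, by positivity, fun τ δ ξ hδ hξ => ?_⟩
  have h0 : 0 < ‖ξ‖ := norm_pos_iff.2 hξ
  have e1 : ‖ξ‖ ^ τ = ‖ξ‖ ^ (τ - 2) * ‖ξ‖ ^ 2 := by
    rw [← Real.rpow_natCast, ← Real.rpow_add h0]; congr 1; push_cast; ring
  have hr : 0 < ‖ξ‖ ^ (τ - 2) := by positivity
  have hη := eta_nonneg δ ξ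
  have hη1 := eta_le_one δ ξ
  have hd := deta_nonneg hδ ξ
  unfold cPhi
  refine (abs_add_le _ _).trans ?_
  rw [abs_mul, abs_mul, abs_of_pos hr, abs_of_nonneg (sq_nonneg (eta δ ξ)), e1,
    abs_of_nonneg (by positivity : 0 ≤ ‖ξ‖ ^ (τ - 2) * ‖ξ‖ ^ 2 * (2 * eta δ ξ * deta δ ξ))]
  have h1 : |τ| * ‖ξ‖ ^ (τ - 2) * eta δ ξ ^ 2 ≤ |τ| * ‖ξ‖ ^ (τ - 2) * eta δ ξ := by
    refine mul_le_mul_of_nonneg_left ?_ (by positivity)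
    nlinarith
  have h2 : ‖ξ‖ ^ (τ - 2) * eta δ ξ * (deta δ ξ * ‖ξ‖ ^ 2) ≤ ‖ξ‖ ^ (τ - 2) * eta δ ξ * C :=
    mul_le_mul_of_nonneg_left (h δ ξ hδ) (by positivity)
  nlinarith

lemma cPhi_ge {τ δ : ℝ} (hδ : 0 < δ) (ξ : Euc n) :
    τ * ‖ξ‖ ^ (τ - 2) * eta δ ξ ^ 2 ≤ cPhi τ δ ξ := by
  have := deta_nonneg hδ ξ
  have := eta_nonneg δ ξ
  unfold cPhi
  have : 0 ≤ ‖ξ‖ ^ τ * (2 * eta δ ξ * deta δ ξ) := by positivity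
  linarith

lemma Phi_eq_zero {τ δ : ℝ} (hδ : 0 < δ) {ξ : Euc n} (h : ‖ξ‖ ^ 2 < δ) : Phi τ δ ξ = 0 := by
  simp [Phi, eta_eq_zero hδ h.le]

lemma cPhi_eq_zero {τ δ : ℝ} (hδ : 0 < δ) {ξ : Euc n} (h : ‖ξ‖ ^ 2 < δ) : cPhi τ δ ξ = 0 := by
  simp [cPhi, eta_eq_zero hδ h.le]

lemma continuousAt_cPhi (τ δ : ℝ) {ξ : Euc n} (hξ : ξ ≠ 0) : ContinuousAt (cPhi τ δ) ξ := by
  have h1 : ∀ s : ℝ, ContinuousAt (fun ξ : Euc n => ‖ξ‖ ^ s) ξ := fun s =>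
    (contDiffAt_rpow_norm s hξ).continuousAt
  have h2 : ContinuousAt (eta (n := n) δ) ξ := (contDiff_eta δ).continuous.continuousAt
  have h3 : ContinuousAt (deta (n := n) δ) ξ := (continuous_deta δ).continuousAt
  unfold cPhi
  have h4 := h1 τ
  have h5 := h1 (τ - 2)
  fun_prop

/-- `H` is the (symmetric) matrix of weak derivatives of `v` on the regular set, extended by `0`. -/
structure Hess (Ω : Set (Euc n)) (v : Euc n → Euc n) (H : Fin n → Fin n → Euc n → ℝ) : Prop where
  l2 : ∀ i j, L2loc (Reg Ω v) (H i j)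
  wpd : ∀ i j, WPD (Reg Ω v) (fun x => v x i) (H i j) j
  symm : ∀ i j, H i j = H j i
  zero : ∀ i j x, x ∉ Reg Ω v → H i j x = 0

lemma L2loc.aestronglyMeasurable {U : Set (Euc n)} (hU : IsOpen U) {g : Euc n → ℝ}
    (hg : L2loc U g) (h0 : ∀ x, x ∉ U → g x = 0) : AEStronglyMeasurable g := by
  have h1 := (hg.locallyIntegrableOn hU).aestronglyMeasurable
  have h2 := (aestronglyMeasurable_indicator_iff hU.measurableSet).2 h1
  have : U.indicator g = g := by
    ext x
    by_cases hx : x ∈ U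
    · simp [hx]
    · simp [hx, h0 x hx]
  rwa [this] at h2

variable {p : ℝ} {Ω : Set (Euc n)} {u f : Euc n → ℝ} {v : Euc n → Euc n}
  {H : Fin n → Fin n → Euc n → ℝ}

lemma PSol.test_reg (S : PSol p Ω u f v) (hH : Hess Ω v H) {X : Fin n → Euc n → ℝ}
    {g : Euc n → ℝ} (hX : ∀ j, L2loc (Reg Ω v) (X j)) (hg : L2loc (Reg Ω v) g)
    (hform : ∀ ψ, IsTestFun (Reg Ω v) ψ → ∑ j, ∫ x, X j x * pd ψ j x = ∫ x, g x * ψ x)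
    {w : Euc n → ℝ} {W : Fin n → Euc n → ℝ} (hw : L2loc (Reg Ω v) w)
    (hW : ∀ j, L2loc (Reg Ω v) (W j)) (hwd : ∀ j, WPD (Reg Ω v) w (W j) j)
    (hwH : ∀ k j, L2loc (Reg Ω v) (fun x => w x * H k j x)) {φ : Euc n → ℝ}
    (hφ : IsTestFun Ω φ) (τ : ℝ) {δ : ℝ} (hδ : 0 < δ) :
    Integrable (fun x => ∑ j, X j x * (W j x * (Phi τ δ (v x) * φ x) +
        w x * (cPhi τ δ (v x) * (∑ k, v x k * H k j x) * φ x + Phi τ δ (v x) * pd φ j x)) -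
        g x * (w x * (Phi τ δ (v x) * φ x))) ∧
      ∫ x, (∑ j, X j x * (W j x * (Phi τ δ (v x) * φ x) +
        w x * (cPhi τ δ (v x) * (∑ k, v x k * H k j x) * φ x + Phi τ δ (v x) * pd φ j x)) -
        g x * (w x * (Phi τ δ (v x) * φ x))) = 0 := by
  have hU := S.isOpen_reg
  have cP : ContinuousOn (fun x => Phi τ δ (v x)) (Reg Ω v) :=
    S.cont_comp fun ξ hξ => contDiffAt_Phi τ δ hξ
  have cc : ContinuousOn (fun x => cPhi τ δ (v x)) (Reg Ω v) := fun x hx =>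
    (continuousAt_cPhi τ δ hx.2).comp_continuousWithinAt (S.cont_reg x hx)
  have cφ : ContinuousOn φ (Reg Ω v) := hφ.continuous.continuousOn
  have cdφ : ∀ j, ContinuousOn (pd φ j) (Reg Ω v) := fun j => (hφ.pd j).continuous.continuousOn
  have cv' : ∀ k, ContinuousOn (fun x => v x k) (Reg Ω v) := continuousOn_coord S.cont_reg
  have hdP : ∀ j, L2loc (Reg Ω v) (fun x => cPhi τ δ (v x) * ∑ k, v x k * H k j x) := fun j =>
    (L2loc.sum _ fun k _ => (hH.l2 k j).mul_cont (cv' k)).mul_cont cc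
  have hP : ∀ j, WPD (Reg Ω v) (fun x => Phi τ δ (v x))
      (fun x => cPhi τ δ (v x) * ∑ k, v x k * H k j x) j := by
    intro j
    refine (WPD.chain hU isOpen_ne_zero (fun ξ hξ => ((contDiffAt_Phi τ δ hξ).of_le
      (by exact_mod_cast le_top)).contDiffWithinAt) S.cont_reg (fun x hx => hx.2)
      (fun k => hH.l2 k j) fun k => hH.wpd k j).congr (.of_forall fun _ _ => rfl)
      (.of_forall fun x hx => ?_)
    rw [Finset.mul_sum]
    exact Finset.sum_congr rfl fun k _ => by rw [pd_Phi τ δ k hx.2]; ring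
  have hPφ : ∀ j, WPD (Reg Ω v) (fun x => Phi τ δ (v x) * φ x)
      (fun x => cPhi τ δ (v x) * (∑ k, v x k * H k j x) * φ x + Phi τ δ (v x) * pd φ j x) j :=
    fun j => (hP j).mul (wpd_of_contDiff hφ.1) hU (.of_continuousOn cP) (hdP j)
      (.of_continuousOn cφ) (.of_continuousOn (cdφ j))
  have hdPφ : ∀ j, L2loc (Reg Ω v) (fun x => cPhi τ δ (v x) * (∑ k, v x k * H k j x) * φ x +
      Phi τ δ (v x) * pd φ j x) := fun j => by
    refine L2loc.add ?_ (.of_continuousOn (cP.mul (cdφ j)))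
    refine ((hdP j).mul_cont cφ).congr (.of_forall fun x _ => mul_comm _ _)
  have hψd : ∀ j, WPD (Reg Ω v) (fun x => w x * (Phi τ δ (v x) * φ x))
      (fun x => W j x * (Phi τ δ (v x) * φ x) +
        w x * (cPhi τ δ (v x) * (∑ k, v x k * H k j x) * φ x + Phi τ δ (v x) * pd φ j x)) j :=
    fun j => (hwd j).mul (hPφ j) hU hw (hW j) (.of_continuousOn (cP.mul cφ)) (hdPφ j)
  have hψ : L2loc (Reg Ω v) (fun x => w x * (Phi τ δ (v x) * φ x)) :=
    (hw.mul_cont (cP.mul cφ)).congr (.of_forall fun x _ => mul_comm _ _)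
  have hΨ : ∀ j, L2loc (Reg Ω v) (fun x => W j x * (Phi τ δ (v x) * φ x) +
        w x * (cPhi τ δ (v x) * (∑ k, v x k * H k j x) * φ x + Phi τ δ (v x) * pd φ j x)) := by
    intro j
    have h1 := (hW j).mul_cont (cP.mul cφ)
    have h2 := (L2loc.sum Finset.univ fun k _ => (hwH k j).mul_cont (cv' k)).mul_cont (cc.mul cφ)
    have h3 := hw.mul_cont (cP.mul (cdφ j))
    refine (h1.add (h2.add h3)).congr (.of_forall fun x _ => ?_)
    have : ∑ k, v x k * (w x * H k j x) = w x * ∑ k, v x k * H k j x := by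
      rw [Finset.mul_sum]; exact Finset.sum_congr rfl fun k _ => by ring
    simp only [Pi.mul_apply, this]
    ring
  set K : Set (Euc n) := tsupport φ ∩ (fun x => ‖v x‖ ^ 2) ⁻¹' Ici δ with hKdef
  have hK : IsCompact K := by
    refine hφ.isCompact.of_isClosed_subset ?_ inter_subset_left
    exact ((S.cont.mono hφ.2.2).norm.pow 2).preimage_isClosed_of_isClosed hφ.isCompact.isClosed
      isClosed_Ici
  have hKU : K ⊆ Reg Ω v := fun x hx => ⟨hφ.2.2 hx.1, fun h0 => by
    have : δ ≤ ‖v x‖ ^ 2 := hx.2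
    rw [h0, norm_zero] at this
    linarith⟩
  have hzero : ∀ x, x ∉ K → Phi τ δ (v x) * φ x = 0 ∧ cPhi τ δ (v x) * φ x = 0 ∧
      ∀ j, Phi τ δ (v x) * pd φ j x = 0 := by
    intro x hx
    by_cases hxφ : x ∈ tsupport φ
    · have : ‖v x‖ ^ 2 < δ := not_le.1 fun h => hx ⟨hxφ, h⟩
      simp [Phi_eq_zero hδ this, cPhi_eq_zero hδ this]
    · simp [hφ.eq_zero hxφ, pd_eq_zero_of_notMem hxφ]
  have hψ0 : ∀ x, x ∉ K → w x * (Phi τ δ (v x) * φ x) = 0 := fun x hx => by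
    rw [(hzero x hx).1, mul_zero]
  have hΨ0 : ∀ j x, x ∉ K → W j x * (Phi τ δ (v x) * φ x) +
      w x * (cPhi τ δ (v x) * (∑ k, v x k * H k j x) * φ x + Phi τ δ (v x) * pd φ j x) = 0 := by
    intro j x hx
    obtain ⟨h1, h2, h3⟩ := hzero x hx
    rw [h1, h3 j, mul_right_comm, h2]
    simp
  have hmain := weak_form_extend hU hX hg hform hψ hΨ hψd hK hKU hψ0 hΨ0
  have i1 := fun j => (hX j).integrable_mul_of_zero (hΨ j) hK hKU fun x hx => by
    simp only [hΨ0 j x hx, mul_zero]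
  have i2 := hg.integrable_mul_of_zero hψ hK hKU fun x hx => by simp only [hψ0 x hx, mul_zero]
  refine ⟨(integrable_finsetSum _ fun j _ => i1 j).isub i2, ?_⟩
  rw [integral_sub (integrable_finsetSum _ fun j _ => i1 j) i2, integral_finsetSum _ fun j _ => i1 j,
    hmain, sub_self]

end

section

open Filter

variable {p : ℝ} {Ω : Set (Euc n)} {u f : Euc n → ℝ} {v : Euc n → Euc n}
  {H : Fin n → Fin n → Euc n → ℝ}

lemma PSol.integrable_of_cutoff_bound (S : PSol p Ω u f v) {F B : Euc n → ℝ} (hF : AEStronglyMeasurable F)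
    (hF0 : ∀ x, 0 ≤ F x) (hFU : ∀ x, x ∉ Reg Ω v → F x = 0) (hB : Integrable B)
    (I : ℝ → Euc n → ℝ) (hI : ∀ δ > 0, Integrable (I δ)) (hI0 : ∀ δ > 0, ∫ x, I δ x = 0)
    (h : ∀ δ > 0, ∀ᵐ x, eta δ (v x) ^ 2 * F x ≤ I δ x + B x) : Integrable F := by
  refine ⟨hF, ?_⟩
  have h1 : ∀ δ > 0, ∫⁻ x, ENNReal.ofReal (eta δ (v x) ^ 2 * F x) ≤
      ENNReal.ofReal (∫ x, B x) := by
    intro δ hδ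
    refine (lintegral_mono_ae ((h δ hδ).mono fun x hx => ENNReal.ofReal_le_ofReal hx)).trans ?_
    rw [← ofReal_integral_eq_lintegral_ofReal ((hI δ hδ).iadd hB)
      ((h δ hδ).mono fun x hx => le_trans (mul_nonneg (sq_nonneg _) (hF0 x)) hx)]
    rw [integral_add (hI δ hδ) hB, hI0 δ hδ, zero_add]
  set t : ℕ → ℝ := fun m => 1 / ((m : ℝ) + 1) with ht
  have ht0 : ∀ m, 0 < t m := fun m => by positivity
  have hlim : ∀ x, Tendsto (fun m => ENNReal.ofReal (eta (t m) (v x) ^ 2 * F x)) atTop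
      (𝓝 (ENNReal.ofReal (F x))) := by
    intro x
    by_cases hxU : x ∉ Reg Ω v
    · simp [hFU x hxU]
    · have hx : v x ≠ 0 := (not_not.1 hxU).2
      refine tendsto_const_nhds.congr' ?_
      have hpos : 0 < ‖v x‖ ^ 2 / 2 := by have := norm_pos_iff.2 hx; positivity
      have : ∀ᶠ m in atTop, t m < ‖v x‖ ^ 2 / 2 :=
        (tendsto_one_div_add_atTop_nhds_zero_nat (𝕜 := ℝ)).eventually (gt_mem_nhds hpos)
      filter_upwards [this] with m hm
      rw [eta_eq_one (ht0 m) (by linarith)]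
      simp
  have hle : ∫⁻ x, ENNReal.ofReal (F x) ≤ ENNReal.ofReal (∫ x, B x) := by
    have hmeas : ∀ m, AEMeasurable (fun x => ENNReal.ofReal (eta (t m) (v x) ^ 2 * F x)) := by
      intro m
      have hc : ContinuousOn (fun x => eta (t m) (v x) ^ 2) (Reg Ω v) :=
        ((contDiff_eta (t m)).continuous.comp_continuousOn S.cont_reg).pow 2
      have h2 := ((aestronglyMeasurable_indicator_iff S.isOpen_reg.measurableSet).2
        (hc.aestronglyMeasurable (μ := volume) S.isOpen_reg.measurableSet)).mul hF
      refine (h2.congr (.of_forall fun x => ?_)).aemeasurable.ennreal_ofReal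
      by_cases hx : x ∈ Reg Ω v
      · simp [hx]
      · simp [hx, hFU x hx]
    calc _ = ∫⁻ x, liminf (fun m => ENNReal.ofReal (eta (t m) (v x) ^ 2 * F x)) atTop := by
            simp_rw [fun x => (hlim x).liminf_eq]
        _ ≤ liminf (fun m => ∫⁻ x, ENNReal.ofReal (eta (t m) (v x) ^ 2 * F x)) atTop :=
            lintegral_liminf_le' hmeas
        _ ≤ _ := by
            refine (liminf_le_liminf (.of_forall fun m => h1 _ (ht0 m))).trans ?_
            simp
  rw [hasFiniteIntegral_iff_ofReal (.of_forall hF0)]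
  exact hle.trans_lt ENNReal.ofReal_lt_top

/-- The components of `A(v) ∇v_i`, with `A` the derivative of the stress field. -/
def AH (p : ℝ) (v : Euc n → Euc n) (H : Fin n → Fin n → Euc n → ℝ) (i j : Fin n) (x : Euc n) : ℝ :=
  ∑ k, dvf (p - 2) j k (v x) * H i k x

lemma PSol.l2_AH (S : PSol p Ω u f v) (hH : Hess Ω v H) (i j : Fin n) :
    L2loc (Reg Ω v) (AH p v H i j) :=
  L2loc.sum _ fun k _ => (hH.l2 i k).mul_cont (S.cont_comp fun _ hξ => contDiffAt_dvf _ j k hξ)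

lemma PSol.wpd_vf (S : PSol p Ω u f v) (hH : Hess Ω v H) (s : ℝ) (i j : Fin n) :
    WPD (Reg Ω v) (fun x => vf s j (v x)) (fun x => ∑ k, dvf s j k (v x) * H k i x) i := by
  refine (WPD.chain S.isOpen_reg isOpen_ne_zero (fun ξ hξ => ((contDiffAt_vf s j hξ).of_le
    (by exact_mod_cast le_top)).contDiffWithinAt) S.cont_reg (fun x hx => hx.2)
    (fun k => hH.l2 k i) fun k => hH.wpd k i).congr (.of_forall fun _ _ => rfl)
    (.of_forall fun x hx => ?_)
  exact Finset.sum_congr rfl fun k _ => by rw [pd_vf s j k hx.2]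

lemma PSol.lin (S : PSol p Ω u f v) (hH : Hess Ω v H) (i : Fin n) {ψ : Euc n → ℝ}
    (hψ : IsTestFun (Reg Ω v) ψ) :
    ∑ j, ∫ x, AH p v H i j x * pd ψ j x = ∫ x, pd f i x * ψ x := by
  have h1 := S.weak _ ((hψ.pd i).mono reg_subset)
  have h2 := S.wpd_f i _ (hψ.mono reg_subset)
  have h3 : ∀ j, ∫ x, vf (p - 2) j (v x) * pd (pd ψ i) j x = -∫ x, AH p v H i j x * pd ψ j x := by
    intro j
    simp_rw [pd_comm hψ.1 i j]
    rw [S.wpd_vf hH (p - 2) i j _ (hψ.pd j)]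
    simp_rw [hH.symm _ i]
    rfl
  simp_rw [h3, Finset.sum_neg_distrib] at h1
  linarith

end

section

open Filter

lemma dvf_elliptic' {s : ℝ} {ξ : Euc n} (hξ : ξ ≠ 0) (a : Fin n → ℝ) :
    min 1 (1 + s) * ‖ξ‖ ^ s * ∑ k, a k ^ 2 ≤ ∑ j, (∑ k, dvf s j k ξ * a k) * a j := by
  have := dvf_elliptic (s := s) hξ (WithLp.toLp 2 a)
  rw [norm_sq_eq_sum] at this
  exact this

lemma dvf_cs' {s : ℝ} (hs : -1 < s) {ξ : Euc n} (hξ : ξ ≠ 0) (c : Fin n → ℝ)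
    (a : Fin n → Fin n → ℝ) :
    ∑ j, (∑ k, dvf s j k ξ * ∑ i, c i * a i k) * ∑ i, c i * a i j ≤
      (∑ i, c i ^ 2) * ∑ i, ∑ j, (∑ k, dvf s j k ξ * a i k) * a i j := by
  have := dvf_cs (s := s) hs hξ c (fun i => WithLp.toLp 2 (a i))
  simpa using this

lemma dvf_nonneg {s : ℝ} (hs : -1 < s) {ξ : Euc n} (hξ : ξ ≠ 0) (a : Fin n → ℝ) :
    0 ≤ ∑ j, (∑ k, dvf s j k ξ * a k) * a j := by
  refine le_trans ?_ (dvf_elliptic' (s := s) hξ a)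
  have : 0 ≤ min 1 (1 + s) := le_min zero_le_one (by linarith)
  have : 0 ≤ ∑ k, a k ^ 2 := Finset.sum_nonneg fun k _ => sq_nonneg _
  positivity

set_option maxHeartbeats 2000000 in
/-- Pointwise coercivity behind the weighted second-order estimate. -/
lemma hess_energy_pointwise {s τ δ φ : ℝ} (hs : -1 < s) (hτ : -1 < τ) {ξ : Euc n} (hξ : ξ ≠ 0)
    (hδ : 0 < δ) (h : Fin n → Fin n → ℝ) (φ' f' : Fin n → ℝ) {c : ℝ}
    (hc : c = min 1 (1 + τ) * min 1 (1 + s)) :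
    eta δ ξ ^ 2 * (c / 2 * (‖ξ‖ ^ (τ + s) * ((∑ i, ∑ k, h i k ^ 2) * φ ^ 2))) ≤
      (∑ i, (∑ j, (∑ k, dvf s j k ξ * h i k) * (h i j * (Phi τ δ ξ * φ ^ 2) +
        ξ i * (cPhi τ δ ξ * (∑ k, ξ k * h k j) * φ ^ 2 + Phi τ δ ξ * (2 * φ * φ' j))) -
        f' i * (ξ i * (Phi τ δ ξ * φ ^ 2)))) +
      (n ^ 2 * ((2 * (1 + |s|)) ^ 2 / (2 * c)) * (‖ξ‖ ^ (τ + s + 2) * (∑ j, |φ' j|) ^ 2) +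
        ‖ξ‖ ^ (τ + 1) * ((∑ i, |f' i|) * φ ^ 2)) := by
  have h0 : 0 < ‖ξ‖ := norm_pos_iff.2 hξ
  have hc1 : 0 < min 1 (1 + τ) := lt_min one_pos (by linarith)
  have hc2 : 0 < min 1 (1 + s) := lt_min one_pos (by linarith)
  have hc0 : 0 < c := by rw [hc]; positivity
  set E := eta δ ξ with hE
  have hE0 : 0 ≤ E := eta_nonneg δ ξ
  have hE1 : E ≤ 1 := eta_le_one δ ξ
  have hE2 : E ^ 2 ≤ 1 := pow_le_one₀ hE0 hE1
  set Pτ := ‖ξ‖ ^ τ with hPτ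
  have hPτ0 : 0 < Pτ := by positivity
  have ePhi : Phi τ δ ξ = Pτ * E ^ 2 := rfl
  set Q := ∑ i, ∑ j, (∑ k, dvf s j k ξ * h i k) * h i j with hQ
  set Qv := ∑ j, (∑ k, dvf s j k ξ * ∑ i, ξ i * h i k) * ∑ i, ξ i * h i j with hQv
  have hQv0 : 0 ≤ Qv := dvf_nonneg hs hξ _
  have hQ0 : 0 ≤ Q := Finset.sum_nonneg fun i _ => dvf_nonneg hs hξ _
  have hcs : Qv ≤ ‖ξ‖ ^ 2 * Q := by
    have := dvf_cs' hs hξ (fun i => ξ i) h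
    rwa [← norm_sq_eq_sum] at this
  have hQge : min 1 (1 + s) * ‖ξ‖ ^ s * (∑ i, ∑ k, h i k ^ 2) ≤ Q := by
    rw [Finset.mul_sum]
    exact Finset.sum_le_sum fun i _ => dvf_elliptic' hξ _
  set T := ∑ i, ∑ j, (∑ k, dvf s j k ξ * h i k) * (ξ i * (Phi τ δ ξ * (2 * φ * φ' j))) with hT
  have key : (∑ i, (∑ j, (∑ k, dvf s j k ξ * h i k) * (h i j * (Phi τ δ ξ * φ ^ 2) +
        ξ i * (cPhi τ δ ξ * (∑ k, ξ k * h k j) * φ ^ 2 + Phi τ δ ξ * (2 * φ * φ' j))) -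
        f' i * (ξ i * (Phi τ δ ξ * φ ^ 2)))) =
      Phi τ δ ξ * φ ^ 2 * Q + cPhi τ δ ξ * φ ^ 2 * Qv + T -
        ∑ i, f' i * (ξ i * (Phi τ δ ξ * φ ^ 2)) := by
    have e1 : Qv = ∑ i, ∑ j, (∑ k, dvf s j k ξ * h i k) * (ξ i * ∑ k, ξ k * h k j) := by
      rw [hQv, Finset.sum_comm]
      refine Finset.sum_congr rfl fun j _ => ?_
      calc _ = (∑ i, ξ i * ∑ k, dvf s j k ξ * h i k) * ∑ i, ξ i * h i j := by
            congr 1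
            simp only [Finset.mul_sum]
            rw [Finset.sum_comm]
            exact Finset.sum_congr rfl fun i _ => Finset.sum_congr rfl fun k _ => by ring
        _ = _ := by
            rw [Finset.sum_mul]
            exact Finset.sum_congr rfl fun i _ => by ring
    rw [Finset.sum_sub_distrib, e1, hQ, hT]
    congr 1
    simp_rw [Finset.mul_sum, ← Finset.sum_add_distrib]
    refine Finset.sum_congr rfl fun i _ => Finset.sum_congr rfl fun j _ => ?_
    simp_rw [← Finset.mul_sum]
    ring
  have hmain : c * (E ^ 2 * (‖ξ‖ ^ (τ + s) * ((∑ i, ∑ k, h i k ^ 2) * φ ^ 2))) ≤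
      Phi τ δ ξ * φ ^ 2 * Q + cPhi τ δ ξ * φ ^ 2 * Qv := by
    have hcp := cPhi_ge (τ := τ) hδ ξ
    have e2 : Pτ = ‖ξ‖ ^ (τ - 2) * ‖ξ‖ ^ 2 := by
      rw [hPτ, ← Real.rpow_natCast, ← Real.rpow_add h0]; congr 1; push_cast; ring
    have hr : 0 < ‖ξ‖ ^ (τ - 2) := by positivity
    have h1 : min 1 (1 + τ) * (Pτ * E ^ 2 * Q) ≤ Phi τ δ ξ * Q + cPhi τ δ ξ * Qv := by
      rw [ePhi]
      have h2 : τ * ‖ξ‖ ^ (τ - 2) * E ^ 2 * Qv ≤ cPhi τ δ ξ * Qv :=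
        mul_le_mul_of_nonneg_right hcp hQv0
      rcases le_total 0 τ with h3 | h3
      · rw [min_eq_left (by linarith)]
        have : 0 ≤ τ * ‖ξ‖ ^ (τ - 2) * E ^ 2 * Qv := by positivity
        linarith
      · rw [min_eq_right (by linarith)]
        have h4 : ‖ξ‖ ^ (τ - 2) * E ^ 2 * Qv ≤ ‖ξ‖ ^ (τ - 2) * E ^ 2 * (‖ξ‖ ^ 2 * Q) := by gcongr
        have h5 : ‖ξ‖ ^ (τ - 2) * E ^ 2 * (‖ξ‖ ^ 2 * Q) = Pτ * E ^ 2 * Q := by rw [e2]; ring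
        nlinarith
    have h6 : c * (‖ξ‖ ^ (τ + s) * (∑ i, ∑ k, h i k ^ 2)) ≤ min 1 (1 + τ) * (Pτ * Q) := by
      rw [Real.rpow_add h0, hc]
      have := mul_le_mul_of_nonneg_left hQge (by positivity : 0 ≤ min 1 (1 + τ) * Pτ)
      linarith
    have h7 : 0 ≤ E ^ 2 * φ ^ 2 := by positivity
    calc _ = (E ^ 2 * φ ^ 2) * (c * (‖ξ‖ ^ (τ + s) * (∑ i, ∑ k, h i k ^ 2))) := by ring
      _ ≤ (E ^ 2 * φ ^ 2) * (min 1 (1 + τ) * (Pτ * Q)) := mul_le_mul_of_nonneg_left h6 h7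
      _ = φ ^ 2 * (min 1 (1 + τ) * (Pτ * E ^ 2 * Q)) := by ring
      _ ≤ φ ^ 2 * (Phi τ δ ξ * Q + cPhi τ δ ξ * Qv) :=
          mul_le_mul_of_nonneg_left h1 (sq_nonneg _)
      _ = _ := by ring
  set m := ∑ j, |φ' j| with hm
  have hm0 : 0 ≤ m := Finset.sum_nonneg fun j _ => abs_nonneg _
  have hPs : 0 < ‖ξ‖ ^ (τ + s) := by positivity
  set z := 2 * (1 + |s|) * m * ‖ξ‖ with hz
  have hTb : |T| ≤ ∑ i, ∑ k, ‖ξ‖ ^ (τ + s) * E ^ 2 * (|h i k| * |φ| * z) := by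
    refine (Finset.abs_sum_le_sum_abs _ _).trans (Finset.sum_le_sum fun i _ => ?_)
    calc _ ≤ ∑ j, ∑ k, ‖ξ‖ ^ (τ + s) * E ^ 2 * (|h i k| * |φ| * (2 * (1 + |s|) * |φ' j| * ‖ξ‖)) := by
          refine (Finset.abs_sum_le_sum_abs _ _).trans (Finset.sum_le_sum fun j _ => ?_)
          rw [Finset.sum_mul]
          refine (Finset.abs_sum_le_sum_abs _ _).trans (Finset.sum_le_sum fun k _ => ?_)
          rw [ePhi, Real.rpow_add h0]
          simp only [abs_mul, abs_of_pos hPτ0, abs_of_nonneg (sq_nonneg E), abs_two]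
          have h1 := abs_dvf_le s j k hξ
          have h2 := abs_apply_le ξ i
          calc |dvf s j k ξ| * |h i k| * (|ξ i| * (Pτ * E ^ 2 * (2 * |φ| * |φ' j|)))
              ≤ ((1 + |s|) * ‖ξ‖ ^ s) * |h i k| * (‖ξ‖ * (Pτ * E ^ 2 * (2 * |φ| * |φ' j|))) := by
                gcongr
            _ = _ := by ring
      _ = _ := by
          rw [Finset.sum_comm]
          refine Finset.sum_congr rfl fun k _ => ?_
          rw [← Finset.mul_sum, ← Finset.mul_sum, ← Finset.sum_mul, ← Finset.mul_sum]
  have hT2 : |T| ≤ c / 2 * (E ^ 2 * (‖ξ‖ ^ (τ + s) * ((∑ i, ∑ k, h i k ^ 2) * φ ^ 2))) +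
      n ^ 2 * ((2 * (1 + |s|)) ^ 2 / (2 * c)) * (‖ξ‖ ^ (τ + s + 2) * m ^ 2) := by
    refine hTb.trans ?_
    have e3 : ‖ξ‖ ^ (τ + s + 2) = ‖ξ‖ ^ (τ + s) * ‖ξ‖ ^ 2 := by
      rw [← Real.rpow_natCast, ← Real.rpow_add h0]; norm_num
    calc _ ≤ ∑ i, ∑ k, (c / 2 * (E ^ 2 * (‖ξ‖ ^ (τ + s) * (h i k ^ 2 * φ ^ 2))) +
          ‖ξ‖ ^ (τ + s) * (z ^ 2 / (2 * c))) := by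
          refine Finset.sum_le_sum fun i _ => Finset.sum_le_sum fun k _ => ?_
          have hy : |h i k| * |φ| * z ≤ c / 2 * (h i k ^ 2 * φ ^ 2) + z ^ 2 / (2 * c) := by
            have e : c / 2 * (h i k ^ 2 * φ ^ 2) + z ^ 2 / (2 * c) - |h i k| * |φ| * z =
                (c * (|h i k| * |φ|) - z) ^ 2 / (2 * c) := by
              rw [← sq_abs (h i k), ← sq_abs φ]; field_simp; ring
            have : 0 ≤ (c * (|h i k| * |φ|) - z) ^ 2 / (2 * c) := by positivity
            linarith
          have hz2 : 0 ≤ z ^ 2 / (2 * c) := by positivity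
          calc _ ≤ ‖ξ‖ ^ (τ + s) * E ^ 2 * (c / 2 * (h i k ^ 2 * φ ^ 2) + z ^ 2 / (2 * c)) := by
                gcongr
            _ = c / 2 * (E ^ 2 * (‖ξ‖ ^ (τ + s) * (h i k ^ 2 * φ ^ 2))) +
                ‖ξ‖ ^ (τ + s) * (E ^ 2 * (z ^ 2 / (2 * c))) := by ring
            _ ≤ _ := by
                gcongr
                nlinarith
      _ = _ := by
          simp_rw [Finset.sum_add_distrib, Finset.sum_const, Finset.card_univ, Fintype.card_fin,
            ← Finset.mul_sum, ← Finset.sum_mul, e3, hz]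
          simp only [nsmul_eq_mul]
          ring
  have hf : |∑ i, f' i * (ξ i * (Phi τ δ ξ * φ ^ 2))| ≤ ‖ξ‖ ^ (τ + 1) * ((∑ i, |f' i|) * φ ^ 2) := by
    rw [Finset.sum_mul, Finset.mul_sum]
    refine (Finset.abs_sum_le_sum_abs _ _).trans (Finset.sum_le_sum fun i _ => ?_)
    rw [ePhi, Real.rpow_add h0, Real.rpow_one]
    simp only [abs_mul, abs_of_pos hPτ0, abs_of_nonneg (sq_nonneg E), abs_of_nonneg (sq_nonneg φ)]
    have h2 := abs_apply_le ξ i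
    calc |f' i| * (|ξ i| * (Pτ * E ^ 2 * φ ^ 2)) ≤ |f' i| * (‖ξ‖ * (Pτ * 1 * φ ^ 2)) := by
          gcongr
      _ = _ := by ring
  rw [key]
  have := neg_abs_le T
  have := le_abs_self (∑ i, f' i * (ξ i * (Phi τ δ ξ * φ ^ 2)))
  nlinarith

end

section

open Filter

lemma aesm_mul_cont {U : Set (Euc n)} (hU : IsOpen U) {a F : Euc n → ℝ} (ha : ContinuousOn a U)
    (hF : AEStronglyMeasurable F) (h0 : ∀ x, x ∉ U → F x = 0) :
    AEStronglyMeasurable (fun x => a x * F x) := by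
  have h2 := ((aestronglyMeasurable_indicator_iff hU.measurableSet).2
    (ha.aestronglyMeasurable (μ := volume) hU.measurableSet)).mul hF
  refine h2.congr (.of_forall fun x => ?_)
  by_cases hx : x ∈ U
  · simp [hx]
  · simp [hx, h0 x hx]

lemma integrable_of_continuousOn {U K : Set (Euc n)} (hK : IsCompact K) (hKU : K ⊆ U)
    {g : Euc n → ℝ} (hg : ContinuousOn g U) (h0 : ∀ x, x ∉ K → g x = 0) : Integrable g :=
  (integrableOn_iff_integrable_of_support_subset (s := K)
    (fun x hx => by by_contra h; exact hx (h0 x h))).1 ((hg.mono hKU).integrableOn_compact hK)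

lemma _root_.IsTestFun.sq {Ω : Set (Euc n)} {φ : Euc n → ℝ} (hφ : IsTestFun Ω φ) :
    IsTestFun Ω (fun x => φ x ^ 2) := by
  simp_rw [pow_two]; exact hφ.mul_left hφ.1

lemma pd_sq {φ : Euc n → ℝ} (hφ : ContDiff ℝ (⊤ : ℕ∞) φ) (j : Fin n) (x : Euc n) :
    pd (fun x => φ x ^ 2) j x = 2 * φ x * pd φ j x := by
  simp_rw [pow_two]
  rw [pd_mul (hφ.diffAt x) (hφ.diffAt x)]; ring

lemma continuousOn_norm_rpow {U : Set (Euc n)} {v : Euc n → Euc n} (hv : ContinuousOn v U) {s : ℝ}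
    (hs : 0 ≤ s) : ContinuousOn (fun x => ‖v x‖ ^ s) U :=
  hv.norm.rpow_const fun _ _ => Or.inr hs

/-- The squared norm of a matrix field. -/
def sqn (H : Fin n → Fin n → Euc n → ℝ) (x : Euc n) : ℝ := ∑ i, ∑ k, H i k x ^ 2

lemma sqn_nonneg (H : Fin n → Fin n → Euc n → ℝ) (x : Euc n) : 0 ≤ sqn H x :=
  Finset.sum_nonneg fun _ _ => Finset.sum_nonneg fun _ _ => sq_nonneg _

lemma sq_le_sqn (H : Fin n → Fin n → Euc n → ℝ) (x : Euc n) (i k : Fin n) :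
    H i k x ^ 2 ≤ sqn H x :=
  (Finset.single_le_sum (f := fun k => H i k x ^ 2) (fun _ _ => sq_nonneg _)
    (Finset.mem_univ k)).trans (Finset.single_le_sum (f := fun i => ∑ k, H i k x ^ 2)
      (fun _ _ => Finset.sum_nonneg fun _ _ => sq_nonneg _) (Finset.mem_univ i))

lemma sqn_aesm {H : Fin n → Fin n → Euc n → ℝ} (h : ∀ i j, AEStronglyMeasurable (H i j)) :
    AEStronglyMeasurable (sqn H) := by
  unfold sqn
  exact Finset.aestronglyMeasurable_fun_sum _ fun i _ =>
    Finset.aestronglyMeasurable_fun_sum _ fun k _ => (h i k).pow 2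

variable {p : ℝ} {Ω : Set (Euc n)} {u f : Euc n → ℝ} {v : Euc n → Euc n}
  {H : Fin n → Fin n → Euc n → ℝ}

lemma Hess.aesm (hH : Hess Ω v H) (S : PSol p Ω u f v) (i j : Fin n) :
    AEStronglyMeasurable (H i j) :=
  (hH.l2 i j).aestronglyMeasurable S.isOpen_reg (hH.zero i j)

lemma Hess.sqn_zero (hH : Hess Ω v H) {x : Euc n} (hx : x ∉ Reg Ω v) : sqn H x = 0 := by
  simp [sqn, fun i j => hH.zero i j x hx]

lemma Hess.weight_aesm (hH : Hess Ω v H) (S : PSol p Ω u f v) (b : ℝ) {φ : Euc n → ℝ}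
    (hφ : Continuous φ) : AEStronglyMeasurable (fun x => ‖v x‖ ^ b * (sqn H x * φ x)) := by
  refine aesm_mul_cont S.isOpen_reg (S.cont_comp fun _ hξ => contDiffAt_rpow_norm b hξ)
    ((sqn_aesm (hH.aesm S)).mul hφ.aestronglyMeasurable) fun x hx => ?_
  simp [hH.sqn_zero hx]

/-- The weighted second-order estimate. -/
theorem PSol.weighted_hess (S : PSol p Ω u f v) (hH : Hess Ω v H) {b : ℝ} (hb : p - 3 < b)
    {φ : Euc n → ℝ} (hφ : IsTestFun Ω φ) :
    Integrable (fun x => ‖v x‖ ^ b * (sqn H x * φ x ^ 2)) := by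
  obtain ⟨τ, hτ⟩ : ∃ τ, τ = b - (p - 2) := ⟨_, rfl⟩
  have hτ1 : -1 < τ := by linarith
  have hs : -1 < p - 2 := by linarith [S.one_lt]
  have hbe : τ + (p - 2) = b := by linarith
  obtain ⟨c, hc⟩ : ∃ c, c = min 1 (1 + τ) * min 1 (1 + (p - 2)) := ⟨_, rfl⟩
  have hc0 : 0 < c := by
    rw [hc]; exact mul_pos (lt_min one_pos (by linarith)) (lt_min one_pos (by linarith))
  have hv := fun i => continuousOn_coord S.cont i
  have key := fun (i : Fin n) (δ : ℝ) (hδ : 0 < δ) =>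
    S.test_reg hH (fun j => S.l2_AH hH i j) (.of_continuousOn ((S.fcont i).mono reg_subset))
      (fun ψ hψ => S.lin hH i hψ) (w := fun x => v x i) (W := H i)
      (.of_continuousOn ((hv i).mono reg_subset)) (hH.l2 i) (hH.wpd i)
      (fun k j => (hH.l2 k j).mul_cont ((hv i).mono reg_subset)) hφ.sq τ hδ
  set I : ℝ → Euc n → ℝ := fun δ x => ∑ i, (∑ j, AH p v H i j x * (H i j x *
    (Phi τ δ (v x) * φ x ^ 2) + v x i * (cPhi τ δ (v x) * (∑ k, v x k * H k j x) * φ x ^ 2 +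
      Phi τ δ (v x) * pd (fun x => φ x ^ 2) j x)) - pd f i x * (v x i * (Phi τ δ (v x) * φ x ^ 2)))
    with hI
  set B : Euc n → ℝ := fun x => n ^ 2 * ((2 * (1 + |p - 2|)) ^ 2 / (2 * c)) *
    (‖v x‖ ^ (τ + (p - 2) + 2) * (∑ j, |pd φ j x|) ^ 2) +
    ‖v x‖ ^ (τ + 1) * ((∑ i, |pd f i x|) * φ x ^ 2) with hB
  have hB0 : ∀ x, 0 ≤ B x := fun x => by
    have : 0 ≤ ∑ i, |pd f i x| := Finset.sum_nonneg fun _ _ => abs_nonneg _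
    simp only [hB]; positivity
  have hφ0 : ∀ x, x ∉ tsupport φ → φ x = 0 ∧ ∀ j, pd φ j x = 0 := fun x hx =>
    ⟨hφ.eq_zero hx, fun j => pd_eq_zero_of_notMem hx⟩
  have hBint : Integrable B := by
    refine integrable_of_continuousOn hφ.isCompact hφ.2.2 ?_ fun x hx => ?_
    · have h1 := continuousOn_norm_rpow S.cont (s := τ + (p - 2) + 2) (by linarith)
      have h2 := continuousOn_norm_rpow S.cont (s := τ + 1) (by linarith)
      have h3 : ContinuousOn (fun x => ∑ i, |pd f i x|) Ω :=
        continuousOn_finsetSum _ fun i _ => (S.fcont i).abs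
      have h4 : Continuous (fun x => ∑ i, |pd φ i x|) :=
        continuous_finsetSum _ fun i _ => (hφ.pd i).continuous.abs
      have h5 := hφ.continuous
      exact (continuousOn_const.mul (h1.mul (h4.pow 2).continuousOn)).add
        (h2.mul (h3.mul (h5.pow 2).continuousOn))
    · simp [hB, hφ0 x hx]
  have h0 : Integrable (fun x => c / 2 * (‖v x‖ ^ b * (sqn H x * φ x ^ 2))) := by
    refine S.integrable_of_cutoff_bound
      ((hH.weight_aesm S b (hφ.continuous.pow 2)).const_mul _) (fun x => ?_) (fun x hx => ?_)
      hBint I (fun δ hδ => integrable_finsetSum _ fun i _ => (key i δ hδ).1) (fun δ hδ => ?_)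
      fun δ hδ => .of_forall fun x => ?_
    · have := sqn_nonneg H x
      positivity
    · simp [hH.sqn_zero hx]
    · simp only [hI]
      rw [integral_finsetSum _ fun i _ => (key i δ hδ).1]
      exact Finset.sum_eq_zero fun i _ => (key i δ hδ).2
    · by_cases hx : x ∈ Reg Ω v
      · have := hess_energy_pointwise hs hτ1 hx.2 hδ (fun i j => H i j x) (φ := φ x)
          (fun j => pd φ j x) (fun i => pd f i x) hc
        simp only [hI, hB, AH, pd_sq hφ.1, sqn]
        rw [hbe] at this ⊢
        exact this
      · have e1 : I δ x = 0 := by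
          by_cases hxΩ : x ∈ Ω
          · have hv0 : v x = 0 := by
              by_contra h; exact hx ⟨hxΩ, h⟩
            simp [hI, hv0, Phi_eq_zero hδ (show ‖(0 : Euc n)‖ ^ 2 < δ by simpa using hδ)]
          · have := hφ0 x (fun h => hxΩ (hφ.2.2 h))
            simp [hI, pd_sq hφ.1, this]
        rw [e1, hH.sqn_zero hx]
        simpa using hB0 x
  have := h0.const_mul (2 / c)
  refine this.congr (.of_forall fun x => ?_)
  simp only
  field_simp

end

section

open Filter

lemma deta_eq_zero' {δ : ℝ} (hδ : 0 < δ) {ξ : Euc n} (h : 2 * δ < ‖ξ‖ ^ 2) : deta δ ξ = 0 := by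
  have : deriv smoothTransition (‖ξ‖ ^ 2 / δ - 1) = 0 := by
    have h0 : 1 < ‖ξ‖ ^ 2 / δ - 1 := by rw [lt_sub_iff_add_lt, lt_div_iff₀ hδ]; linarith
    have : smoothTransition =ᶠ[𝓝 (‖ξ‖ ^ 2 / δ - 1)] fun _ => 1 :=
      (eventually_gt_nhds h0).mono fun t ht => smoothTransition.one_of_one_le ht.le
    rw [this.deriv_eq, deriv_const]
  simp [deta, this]

variable {p : ℝ} {Ω : Set (Euc n)} {u f : Euc n → ℝ} {v : Euc n → Euc n}
  {H : Fin n → Fin n → Euc n → ℝ}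

/-- Weak derivatives on the regular set, extended by zero, are weak derivatives on `Ω`. -/
theorem PSol.wpd_extend (S : PSol p Ω u f v) (hH : Hess Ω v H) {G D : Euc n → ℝ} {j : Fin n}
    (hG : L2loc (Reg Ω v) G) (hD : L2loc (Reg Ω v) D) (hG0 : ∀ x, x ∉ Reg Ω v → G x = 0)
    (hD0 : ∀ x, x ∉ Reg Ω v → D x = 0) (hw : WPD (Reg Ω v) G D j)
    (hGi : ∀ φ, IsTestFun Ω φ → Integrable (fun x => G x * φ x))
    (hDi : ∀ φ, IsTestFun Ω φ → Integrable (fun x => D x * φ x))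
    (hGH : ∀ k φ, IsTestFun Ω φ → Integrable (fun x => G x * (‖v x‖ ^ (-1 : ℝ) * H k j x) * φ x)) :
    WPD Ω G D j := by
  intro φ hφ
  obtain ⟨C, hC, hcP⟩ := abs_cPhi_le
  have key := fun (δ : ℝ) (hδ : 0 < δ) =>
    S.test_reg hH (X := fun l => if l = j then G else fun _ => 0) (g := fun x => -D x)
      (fun l => by
        by_cases h : l = j
        · simpa [h] using hG
        · simpa [h] using L2loc.of_continuousOn continuousOn_const)
      (by simpa using hD.const_mul (-1))
      (fun ψ hψ => by
        rw [Finset.sum_eq_single j (fun l _ hl => by simp [hl]) (by simp)]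
        simp only [if_true, hw ψ hψ, neg_mul, integral_neg])
      (w := fun _ => 1) (W := fun _ _ => 0) (.of_continuousOn continuousOn_const)
      (fun _ => .of_continuousOn continuousOn_const)
      (fun l => by
        have : pd (fun _ : Euc n => (1 : ℝ)) l = fun _ => 0 := by ext; simp [pd]
        have h := wpd_of_contDiff (U := Reg Ω v) (i := l) (g := fun _ : Euc n => (1 : ℝ)) contDiff_const
        rwa [this] at h)
      (fun k l => by simpa using hH.l2 k l) hφ 0 hδ
  set F : ℝ → Euc n → ℝ := fun δ x => G x * (cPhi 0 δ (v x) * (∑ k, v x k * H k j x) * φ x +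
    Phi 0 δ (v x) * pd φ j x) + D x * (Phi 0 δ (v x) * φ x) with hF
  have key2 : ∀ δ, 0 < δ → Integrable (F δ) ∧ ∫ x, F δ x = 0 := by
    intro δ hδ
    have h := key δ hδ
    have e : (fun x => ∑ l, (if l = j then G else fun _ => 0) x * (0 * (Phi 0 δ (v x) * φ x) +
        1 * (cPhi 0 δ (v x) * (∑ k, v x k * H k l x) * φ x + Phi 0 δ (v x) * pd φ l x)) -
        -D x * (1 * (Phi 0 δ (v x) * φ x))) = F δ := by
      ext x
      rw [Finset.sum_eq_single j (fun l _ hl => by simp [hl]) (by simp)]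
      simp [hF]
    rw [e] at h
    exact h
  set t : ℕ → ℝ := fun m => 1 / ((m : ℝ) + 1) with ht
  have ht0 : ∀ m, 0 < t m := fun m => by positivity
  have hb : Integrable (fun x => C * (∑ k, |G x * (‖v x‖ ^ (-1 : ℝ) * H k j x) * φ x|) +
      |G x * pd φ j x| + |D x * φ x|) :=
    (((integrable_finsetSum _ fun k _ => (hGH k φ hφ).abs).const_mul C).iadd
      (hGi _ (hφ.pd j)).abs).iadd (hDi _ hφ).abs
  have hlim := tendsto_integral_of_dominated_convergence (F := fun m => F (t m))
    (f := fun x => G x * pd φ j x + D x * φ x) _ (fun m => (key2 _ (ht0 m)).1.1) hb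
    (fun m => .of_forall fun x => ?_) (.of_forall fun x => ?_)
  · simp_rw [fun m => (key2 _ (ht0 m)).2] at hlim
    have h0 := tendsto_nhds_unique hlim tendsto_const_nhds
    rw [integral_add (hGi _ (hφ.pd j)) (hDi _ hφ)] at h0
    linarith
  · by_cases hx : x ∈ Reg Ω v
    · have h0 : 0 < ‖v x‖ := norm_pos_iff.2 hx.2
      have hP : |Phi 0 (t m) (v x)| ≤ 1 := by
        simp only [Phi, Real.rpow_zero, one_mul]
        rw [abs_of_nonneg (sq_nonneg _)]
        exact pow_le_one₀ (eta_nonneg _ _) (eta_le_one _ _)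
      have h1 : |cPhi 0 (t m) (v x) * (∑ k, v x k * H k j x)| ≤
          C * ∑ k, ‖v x‖ ^ (-1 : ℝ) * |H k j x| := by
        rw [abs_mul]
        have h2 : |∑ k, v x k * H k j x| ≤ ∑ k, ‖v x‖ * |H k j x| := by
          refine (Finset.abs_sum_le_sum_abs _ _).trans (Finset.sum_le_sum fun k _ => ?_)
          rw [abs_mul]
          exact mul_le_mul_of_nonneg_right (abs_apply_le _ _) (abs_nonneg _)
        have h3 := hcP 0 (t m) (v x) (ht0 m) hx.2
        have h4 : |cPhi 0 (t m) (v x)| ≤ C * ‖v x‖ ^ (0 - 2 : ℝ) := by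
          refine h3.trans ?_
          rw [abs_zero, zero_add]
          have := mul_le_mul_of_nonneg_right (eta_le_one (t m) (v x))
            (by positivity : 0 ≤ ‖v x‖ ^ (0 - 2 : ℝ))
          rw [one_mul] at this
          exact mul_le_mul_of_nonneg_left this hC
        have e : ‖v x‖ ^ (0 - 2 : ℝ) * ‖v x‖ = ‖v x‖ ^ (-1 : ℝ) := by
          rw [← Real.rpow_add_one h0.ne']; norm_num
        calc _ ≤ C * ‖v x‖ ^ (0 - 2 : ℝ) * ∑ k, ‖v x‖ * |H k j x| :=
              mul_le_mul h4 h2 (abs_nonneg _) (by positivity)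
          _ = _ := by
              rw [Finset.mul_sum, Finset.mul_sum]
              exact Finset.sum_congr rfl fun k _ => by rw [← e]; ring
      simp only [hF, Real.norm_eq_abs]
      calc _ ≤ |G x| * (|cPhi 0 (t m) (v x) * (∑ k, v x k * H k j x)| * |φ x| +
            |Phi 0 (t m) (v x)| * |pd φ j x|) + |D x| * (|Phi 0 (t m) (v x)| * |φ x|) := by
            refine (abs_add_le _ _).trans ?_
            rw [abs_mul, abs_mul (D x), abs_mul _ (φ x)]
            refine add_le_add (mul_le_mul_of_nonneg_left ((abs_add_le _ _).trans ?_)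
              (abs_nonneg _)) le_rfl
            rw [abs_mul _ (φ x), abs_mul _ (pd φ j x)]
        _ ≤ |G x| * ((C * ∑ k, ‖v x‖ ^ (-1 : ℝ) * |H k j x|) * |φ x| +
            1 * |pd φ j x|) + |D x| * (1 * |φ x|) := by gcongr
        _ = _ := by
            simp only [abs_mul, abs_of_pos (Real.rpow_pos_of_pos h0 (-1 : ℝ)), Finset.mul_sum,
              Finset.sum_mul, mul_add, one_mul]
            congr 2
            exact Finset.sum_congr rfl fun k _ => by ring
    · simp [hF, hG0 x hx, hD0 x hx]
  · by_cases hx : x ∈ Reg Ω v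
    · have hpos : 0 < ‖v x‖ ^ 2 / 2 := by have := norm_pos_iff.2 hx.2; positivity
      refine tendsto_const_nhds.congr' ?_
      filter_upwards [(tendsto_one_div_add_atTop_nhds_zero_nat (𝕜 := ℝ)).eventually
        (gt_mem_nhds hpos)] with m hm
      have h1 := eta_eq_one (ht0 m) (ξ := v x) (by simp only [ht]; linarith)
      have h2 := deta_eq_zero' (ht0 m) (ξ := v x) (by simp only [ht]; linarith)
      simp [hF, Phi, cPhi, h1, h2]
    · simp [hF, hG0 x hx, hD0 x hx]

/-- The Hessian is locally square integrable on all of `Ω`. -/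
lemma PSol.sq_integrable (S : PSol p Ω u f v) (hH : Hess Ω v H) {b : ℝ} (hb : p - 3 < b)
    {φ : Euc n → ℝ} (hφ : IsTestFun Ω φ) (i k : Fin n) :
    Integrable (fun x => ‖v x‖ ^ b * (H i k x ^ 2 * φ x ^ 2)) := by
  refine (S.weighted_hess hH hb hφ).mono ?_ (.of_forall fun x => ?_)
  · refine aesm_mul_cont S.isOpen_reg (S.cont_comp fun _ hξ => contDiffAt_rpow_norm b hξ)
      (((hH.aesm S i k).pow 2).mul (hφ.continuous.pow 2).aestronglyMeasurable) fun x hx => ?_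
    simp [hH.zero i k x hx]
  · have h1 : 0 ≤ ‖v x‖ ^ b := by positivity
    have h2 := sq_le_sqn H x i k
    rw [Real.norm_of_nonneg (by positivity), Real.norm_of_nonneg
      (mul_nonneg h1 (mul_nonneg (sqn_nonneg H x) (sq_nonneg _)))]
    gcongr

lemma memLp_two_of_sq {g : Euc n → ℝ} (hg : AEStronglyMeasurable g)
    (h : Integrable (fun x => g x ^ 2)) : MemLp g 2 :=
  (memLp_two_iff_integrable_sq hg).2 h

lemma l2loc_of_test (hΩ : IsOpen Ω) {g : Euc n → ℝ} (hg : AEStronglyMeasurable g)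
    (h : ∀ φ, IsTestFun Ω φ → Integrable (fun x => g x ^ 2 * φ x ^ 2)) : L2loc Ω g := by
  intro K hK hKΩ
  obtain ⟨φ, hφ, -, V, -, hKV, h1⟩ := exists_cutoff hΩ hK hKΩ
  have h2 : MemLp (fun x => g x * φ x) 2 :=
    memLp_two_of_sq (hg.mul hφ.continuous.aestronglyMeasurable)
      ((h φ hφ).congr (.of_forall fun x => (mul_pow _ _ 2).symm))
  refine (h2.restrict K).ae_eq ?_
  refine (ae_restrict_iff' hK.measurableSet).2 (.of_forall fun x hx => ?_)
  simp [h1 x (hKV hx)]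

lemma PSol.l2_weight_hess (S : PSol p Ω u f v) (hH : Hess Ω v H) {b : ℝ} (hb : p - 3 < 2 * b)
    (i k : Fin n) : L2loc Ω (fun x => ‖v x‖ ^ b * H i k x) := by
  refine l2loc_of_test S.isOpen (aesm_mul_cont S.isOpen_reg
    (S.cont_comp fun _ hξ => contDiffAt_rpow_norm b hξ) (hH.aesm S i k) (hH.zero i k))
    fun φ hφ => (S.sq_integrable hH hb hφ i k).congr (.of_forall fun x => ?_)
  simp only [mul_pow, ← Real.rpow_natCast (‖v x‖ ^ b), ← Real.rpow_mul (norm_nonneg (v x))]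
  rw [Nat.cast_ofNat, mul_comm b 2]
  ring

lemma PSol.l2_hess (S : PSol p Ω u f v) (hH : Hess Ω v H) (i k : Fin n) : L2loc Ω (H i k) :=
  (S.l2_weight_hess hH (b := 0) (by linarith [S.lt_three]) i k).congr
    (.of_forall fun x _ => by simp)

lemma PSol.wpd_v (S : PSol p Ω u f v) (hH : Hess Ω v H) (i j : Fin n) :
    WPD Ω (fun x => v x i) (H i j) j := by
  have hv := continuousOn_coord S.cont i
  have h := S.wpd_extend hH (G := fun x => (Reg Ω v).indicator (fun x => v x i) x) (j := j)
    ((L2loc.of_continuousOn (hv.mono reg_subset)).congr (.of_forall fun x hx => by simp [hx]))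
    (hH.l2 i j) (fun x hx => by simp [hx]) (hH.zero i j)
    ((hH.wpd i j).congr (.of_forall fun x hx => by simp [hx]) (.of_forall fun _ _ => rfl))
  have e : ∀ x ∈ Ω, (Reg Ω v).indicator (fun x => v x i) x = v x i := fun x hx => by
    by_cases h0 : v x = 0
    · have : x ∉ Reg Ω v := fun h => h.2 h0
      simp [this, h0]
    · have : x ∈ Reg Ω v := ⟨hx, h0⟩
      simp [this]
  refine (h (fun φ hφ => ?_) (fun φ hφ => (S.l2_hess hH i j).integrable_test hφ)
    fun k φ hφ => ?_).congr (.of_forall e) (.of_forall fun _ _ => rfl)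
  · exact ((L2loc.of_continuousOn hv).congr (.of_forall fun x hx => (e x hx).symm)).integrable_test hφ
  · refine ((S.l2_hess hH k j).integrable_test hφ).mono ?_ (.of_forall fun x => ?_)
    · have h1 : ContinuousOn (fun x => v x i * ‖v x‖ ^ (-1 : ℝ)) (Reg Ω v) :=
        (hv.mono reg_subset).mul (S.cont_comp fun _ hξ => contDiffAt_rpow_norm _ hξ)
      refine ((aesm_mul_cont S.isOpen_reg h1 (hH.aesm S k j) (hH.zero k j)).mul
        hφ.continuous.aestronglyMeasurable).congr (.of_forall fun x => ?_)
      by_cases hx : x ∈ Reg Ω v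
      · simp only [indicator_of_mem hx, Pi.mul_apply]; ring
      · simp [hx, hH.zero k j x hx]
    · by_cases hx : x ∈ Reg Ω v
      · have h0 : 0 < ‖v x‖ := norm_pos_iff.2 hx.2
        simp only [indicator_of_mem hx, norm_mul]
        rw [Real.norm_of_nonneg (by positivity : 0 ≤ ‖v x‖ ^ (-1 : ℝ)), Real.rpow_neg_one,
          Real.norm_eq_abs (v x i)]
        have := abs_apply_le (v x) i
        have h2 : |v x i| * ‖v x‖⁻¹ ≤ 1 := by
          rw [mul_inv_le_iff₀ h0]; linarith
        rw [← mul_assoc]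
        have := mul_le_mul_of_nonneg_right h2 (norm_nonneg (H k j x))
        rw [one_mul] at this
        exact mul_le_mul_of_nonneg_right this (norm_nonneg _)
      · simp only [hx, not_false_eq_true, indicator_of_notMem, zero_mul, norm_zero]
        positivity

end

section

open Filter

lemma sum_abs_sq_le (h : Fin n → Fin n → ℝ) :
    (∑ k, ∑ j, |h k j|) ^ 2 ≤ n ^ 2 * ∑ k, ∑ j, h k j ^ 2 := by
  have h1 : (∑ k, ∑ j, |h k j|) ^ 2 ≤ n * ∑ k, (∑ j, |h k j|) ^ 2 := by
    simpa using sq_sum_le_card_mul_sum_sq (s := Finset.univ) (f := fun k => ∑ j, |h k j|)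
  have h2 : ∀ k, (∑ j, |h k j|) ^ 2 ≤ n * ∑ j, h k j ^ 2 := fun k => by
    simpa using sq_sum_le_card_mul_sum_sq (s := Finset.univ) (f := fun j => |h k j|)
  refine h1.trans ?_
  calc _ ≤ (n : ℝ) * ∑ k, n * ∑ j, h k j ^ 2 := by
        gcongr with k; exact h2 k
    _ = _ := by rw [← Finset.mul_sum]; ring

lemma abs_vf_le (s : ℝ) (j : Fin n) {ξ : Euc n} (hξ : ξ ≠ 0) : |vf s j ξ| ≤ ‖ξ‖ ^ (s + 1) := by
  have h0 : 0 < ‖ξ‖ := norm_pos_iff.2 hξ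
  rw [vf, abs_mul, abs_of_nonneg (by positivity), Real.rpow_add_one h0.ne']
  exact mul_le_mul_of_nonneg_left (abs_apply_le _ _) (by positivity)

lemma source_energy_pointwise {s σ δ φ f C : ℝ} {ξ : Euc n} (hξ : ξ ≠ 0) (hC : 0 ≤ C)
    (hcP : |cPhi (-σ) δ ξ| ≤ C * (eta δ ξ * ‖ξ‖ ^ (-σ - 2))) (h : Fin n → Fin n → ℝ)
    (φ' f' : Fin n → ℝ) :
    eta δ ξ ^ 2 * (1 / 2 * (‖ξ‖ ^ (-σ) * (f ^ 2 * φ ^ 2))) ≤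
      -(∑ j, vf s j ξ * (f' j * (Phi (-σ) δ ξ * φ ^ 2) +
        f * (cPhi (-σ) δ ξ * (∑ k, ξ k * h k j) * φ ^ 2 + Phi (-σ) δ ξ * (2 * φ * φ' j))) -
        f * (f * (Phi (-σ) δ ξ * φ ^ 2))) +
      (‖ξ‖ ^ (s + 1 - σ) * ((∑ j, |f' j|) * φ ^ 2 + |f| * (2 * |φ| * ∑ j, |φ' j|)) +
        C ^ 2 / 2 * n ^ 2 * (‖ξ‖ ^ (2 * s - σ) * ((∑ k, ∑ j, h k j ^ 2) * φ ^ 2))) := by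
  have h0 : 0 < ‖ξ‖ := norm_pos_iff.2 hξ
  obtain ⟨E, hE⟩ : ∃ E, E = eta δ ξ := ⟨_, rfl⟩
  obtain ⟨P, hP⟩ : ∃ P, P = ‖ξ‖ ^ (-σ) := ⟨_, rfl⟩
  have hE0 : 0 ≤ E := hE ▸ eta_nonneg δ ξ
  have hE1 : E ≤ 1 := hE ▸ eta_le_one δ ξ
  have hE2 : E ^ 2 ≤ 1 := pow_le_one₀ hE0 hE1
  have hP0 : 0 < P := hP ▸ (by positivity)
  have ePhi : Phi (-σ) δ ξ = P * E ^ 2 := by rw [hP, hE]; rfl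
  have hPhi1 : |Phi (-σ) δ ξ| ≤ P := by
    rw [ePhi, abs_of_nonneg (by positivity)]; nlinarith
  have es : ‖ξ‖ ^ (s + 1 - σ) = ‖ξ‖ ^ (s + 1) * P := by
    rw [hP, ← Real.rpow_add h0]; congr 1
  obtain ⟨R, hR⟩ : ∃ R, R = ‖ξ‖ ^ (s + 1) := ⟨_, rfl⟩
  have hR0 : 0 < R := hR ▸ (by positivity)
  have hvf : ∀ j, |vf s j ξ| ≤ R := fun j => hR ▸ abs_vf_le s j hξ
  obtain ⟨A1, hA1⟩ : ∃ A, A = ∑ j, vf s j ξ * (f' j * (Phi (-σ) δ ξ * φ ^ 2)) := ⟨_, rfl⟩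
  obtain ⟨A2, hA2⟩ : ∃ A, A = ∑ j, vf s j ξ * (f * (cPhi (-σ) δ ξ * (∑ k, ξ k * h k j) * φ ^ 2)) :=
    ⟨_, rfl⟩
  obtain ⟨A3, hA3⟩ : ∃ A, A = ∑ j, vf s j ξ * (f * (Phi (-σ) δ ξ * (2 * φ * φ' j))) := ⟨_, rfl⟩
  have hsum : (∑ j, vf s j ξ * (f' j * (Phi (-σ) δ ξ * φ ^ 2) +
        f * (cPhi (-σ) δ ξ * (∑ k, ξ k * h k j) * φ ^ 2 + Phi (-σ) δ ξ * (2 * φ * φ' j)))) =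
      A1 + A2 + A3 := by
    rw [hA1, hA2, hA3, ← Finset.sum_add_distrib, ← Finset.sum_add_distrib]
    exact Finset.sum_congr rfl fun j _ => by ring
  have b1 : |A1| ≤ R * P * ((∑ j, |f' j|) * φ ^ 2) := by
    rw [hA1, Finset.sum_mul, Finset.mul_sum]
    refine (Finset.abs_sum_le_sum_abs _ _).trans (Finset.sum_le_sum fun j _ => ?_)
    rw [abs_mul, abs_mul, abs_mul _ (φ ^ 2), abs_of_nonneg (sq_nonneg φ)]
    calc _ ≤ R * (|f' j| * (P * φ ^ 2)) := by gcongr; exact hvf j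
      _ = _ := by ring
  have b3 : |A3| ≤ R * P * (|f| * (2 * |φ| * ∑ j, |φ' j|)) := by
    rw [hA3, Finset.mul_sum, Finset.mul_sum, Finset.mul_sum]
    refine (Finset.abs_sum_le_sum_abs _ _).trans (Finset.sum_le_sum fun j _ => ?_)
    rw [abs_mul, abs_mul, abs_mul _ (2 * φ * φ' j), abs_mul, abs_mul, abs_two]
    calc _ ≤ R * (|f| * (P * (2 * |φ| * |φ' j|))) := by gcongr; exact hvf j
      _ = _ := by ring
  obtain ⟨M, hM⟩ : ∃ M, M = ∑ k, ∑ j, |h k j| := ⟨_, rfl⟩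
  have hM0 : 0 ≤ M := hM ▸ Finset.sum_nonneg fun _ _ => Finset.sum_nonneg fun _ _ => abs_nonneg _
  have b2 : |A2| ≤ R * (|f| * (C * (E * ‖ξ‖ ^ (-σ - 2)) * (‖ξ‖ * M) * φ ^ 2)) := by
    have : ‖ξ‖ * M = ∑ j, ∑ k, ‖ξ‖ * |h k j| := by
      rw [hM, Finset.sum_comm, Finset.mul_sum]
      exact Finset.sum_congr rfl fun j _ => Finset.mul_sum _ _ _
    rw [hA2, this, Finset.mul_sum, Finset.sum_mul, Finset.mul_sum, Finset.mul_sum]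
    refine (Finset.abs_sum_le_sum_abs _ _).trans (Finset.sum_le_sum fun j _ => ?_)
    rw [abs_mul, abs_mul, abs_mul _ (φ ^ 2), abs_of_nonneg (sq_nonneg φ), abs_mul]
    have h2 : |∑ k, ξ k * h k j| ≤ ∑ k, ‖ξ‖ * |h k j| := by
      refine (Finset.abs_sum_le_sum_abs _ _).trans (Finset.sum_le_sum fun k _ => ?_)
      rw [abs_mul]
      exact mul_le_mul_of_nonneg_right (abs_apply_le _ _) (abs_nonneg _)
    have h3 := eta_nonneg δ ξ
    rw [hE]
    gcongr
    exact hvf j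
  obtain ⟨Q, hQ⟩ : ∃ Q, Q = ‖ξ‖ ^ s := ⟨_, rfl⟩
  have hQ0 : 0 < Q := hQ ▸ (by positivity)
  have b2' : |A2| ≤ P * Q * (|f| * (C * E * M * φ ^ 2)) := by
    refine b2.trans (le_of_eq ?_)
    have : R * ‖ξ‖ ^ (-σ - 2) * ‖ξ‖ = P * Q := by
      rw [hR, hP, hQ, ← Real.rpow_add h0, ← Real.rpow_add h0, ← Real.rpow_add_one h0.ne']
      congr 1; ring
    rw [← this]; ring
  have hMS : M ^ 2 ≤ n ^ 2 * ∑ k, ∑ j, h k j ^ 2 := hM ▸ sum_abs_sq_le h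
  have e2 : ‖ξ‖ ^ (2 * s - σ) = P * Q ^ 2 := by
    rw [hP, hQ, ← Real.rpow_natCast, ← Real.rpow_mul h0.le, ← Real.rpow_add h0]
    congr 1; push_cast; ring
  have b2'' : |A2| ≤ 1 / 2 * (P * (E ^ 2 * f ^ 2 * φ ^ 2)) +
      C ^ 2 / 2 * n ^ 2 * (P * Q ^ 2 * ((∑ k, ∑ j, h k j ^ 2) * φ ^ 2)) := by
    refine b2'.trans ?_
    have h1 : P * Q * (|f| * (C * E * M * φ ^ 2)) ≤
        1 / 2 * (P * (E ^ 2 * f ^ 2 * φ ^ 2)) + 1 / 2 * (P * (Q ^ 2 * C ^ 2 * M ^ 2 * φ ^ 2)) := by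
      have h3 : 0 ≤ (E * |f| - Q * C * M) ^ 2 * (P * φ ^ 2) := by positivity
      rw [← sq_abs f]
      nlinarith
    have h2 : P * (Q ^ 2 * C ^ 2 * M ^ 2 * φ ^ 2) ≤
        P * (Q ^ 2 * C ^ 2 * (n ^ 2 * ∑ k, ∑ j, h k j ^ 2) * φ ^ 2) := by gcongr
    linarith
  rw [hsum, es, e2, ← hR, ← hE, ← hP, ePhi]
  have := neg_abs_le A1
  have := neg_abs_le A2
  have := neg_abs_le A3
  have := le_abs_self A1
  have := le_abs_self A2
  have := le_abs_self A3
  linarith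

variable {p : ℝ} {Ω : Set (Euc n)} {u f : Euc n → ℝ} {v : Euc n → Euc n}
  {H : Fin n → Fin n → Euc n → ℝ}

/-- Negative powers of the gradient are controlled by the source term. -/
theorem PSol.weighted_source (S : PSol p Ω u f v) (hH : Hess Ω v H) {σ : ℝ} (hσ : σ < p - 1)
    {φ : Euc n → ℝ} (hφ : IsTestFun Ω φ) :
    Integrable (fun x => (Reg Ω v).indicator (fun x => ‖v x‖ ^ (-σ) * (f x ^ 2 * φ x ^ 2)) x) := by
  have hv := fun i => continuousOn_coord S.cont i
  obtain ⟨C, hC, hcP⟩ := abs_cPhi_le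
  have key := fun (δ : ℝ) (hδ : 0 < δ) =>
    S.test_reg hH (X := fun j x => vf (p - 2) j (v x)) (g := f)
      (fun j => .of_continuousOn (S.cont_comp fun _ hξ => contDiffAt_vf _ j hξ))
      (.of_continuousOn (S.fcont'.mono reg_subset)) (fun ψ hψ => S.weak ψ (hψ.mono reg_subset))
      (w := f) (W := fun j => pd f j)
      (.of_continuousOn (S.fcont'.mono reg_subset))
      (fun j => .of_continuousOn ((S.fcont j).mono reg_subset))
      (fun j => (S.wpd_f j).mono reg_subset)
      (fun k j => (hH.l2 k j).mul_cont (S.fcont'.mono reg_subset)) hφ.sq (-σ) hδ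
  set J : ℝ → Euc n → ℝ := fun δ x => ∑ j, vf (p - 2) j (v x) * (pd f j x *
    (Phi (-σ) δ (v x) * φ x ^ 2) + f x * (cPhi (-σ) δ (v x) * (∑ k, v x k * H k j x) * φ x ^ 2 +
      Phi (-σ) δ (v x) * pd (fun x => φ x ^ 2) j x)) - f x * (f x * (Phi (-σ) δ (v x) * φ x ^ 2))
    with hJ
  set B : Euc n → ℝ := fun x => ‖v x‖ ^ (p - 2 + 1 - σ) * ((∑ j, |pd f j x|) * φ x ^ 2 +
    |f x| * (2 * |φ x| * ∑ j, |pd φ j x|)) + (|-σ| + C) ^ 2 / 2 * n ^ 2 *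
      (‖v x‖ ^ (2 * (p - 2) - σ) * (sqn H x * φ x ^ 2)) with hB
  have hB0 : ∀ x, 0 ≤ B x := fun x => by
    have : 0 ≤ ∑ i, |pd f i x| := Finset.sum_nonneg fun _ _ => abs_nonneg _
    have : 0 ≤ ∑ i, |pd φ i x| := Finset.sum_nonneg fun _ _ => abs_nonneg _
    have := sqn_nonneg H x
    simp only [hB]; positivity
  have hφ0 : ∀ x, x ∉ tsupport φ → φ x = 0 ∧ ∀ j, pd φ j x = 0 := fun x hx =>
    ⟨hφ.eq_zero hx, fun j => pd_eq_zero_of_notMem hx⟩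
  have hBint : Integrable B := by
    refine Integrable.iadd ?_ ((S.weighted_hess hH (by linarith) hφ).const_mul _)
    refine integrable_of_continuousOn hφ.isCompact hφ.2.2 ?_ fun x hx => ?_
    · have h1 := continuousOn_norm_rpow S.cont (s := p - 2 + 1 - σ) (by linarith)
      have h3 : ContinuousOn (fun x => ∑ i, |pd f i x|) Ω :=
        continuousOn_finsetSum _ fun i _ => (S.fcont i).abs
      have h4 : Continuous (fun x => ∑ i, |pd φ i x|) :=
        continuous_finsetSum _ fun i _ => (hφ.pd i).continuous.abs
      have h5 := hφ.continuous
      exact h1.mul ((h3.mul (h5.pow 2).continuousOn).add (S.fcont'.abs.mul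
        ((continuous_const.mul h5.abs).mul h4).continuousOn))
    · simp [hφ0 x hx]
  have h0 : Integrable (fun x => 1 / 2 *
      (Reg Ω v).indicator (fun x => ‖v x‖ ^ (-σ) * (f x ^ 2 * φ x ^ 2)) x) := by
    refine S.integrable_of_cutoff_bound ?_ (fun x => ?_) (fun x hx => ?_)
      hBint (fun δ x => -J δ x) (fun δ hδ => (key δ hδ).1.neg) (fun δ hδ => ?_)
      fun δ hδ => .of_forall fun x => ?_
    · refine AEStronglyMeasurable.const_mul ((aestronglyMeasurable_indicator_iff
        S.isOpen_reg.measurableSet).2 (ContinuousOn.aestronglyMeasurable ?_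
          S.isOpen_reg.measurableSet)) _
      exact (S.cont_comp fun _ hξ => contDiffAt_rpow_norm (-σ) hξ).mul
        (((S.fcont'.mono reg_subset).pow 2).mul (hφ.continuous.pow 2).continuousOn)
    · exact mul_nonneg (by norm_num) (indicator_nonneg (fun x _ => by positivity) x)
    · simp [hx]
    · rw [integral_neg, (key δ hδ).2, neg_zero]
    · by_cases hx : x ∈ Reg Ω v
      · have := source_energy_pointwise (s := p - 2) (f := f x) (φ := φ x) hx.2 (by positivity)
          (hcP (-σ) δ (v x) hδ hx.2) (fun i j => H i j x) (fun j => pd φ j x) (fun i => pd f i x)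
        simp only [hJ, hB, pd_sq hφ.1, sqn, indicator_of_mem hx]
        exact this
      · have e1 : J δ x = 0 := by
          by_cases hxΩ : x ∈ Ω
          · have hv0 : v x = 0 := by
              by_contra h; exact hx ⟨hxΩ, h⟩
            simp [hJ, hv0, Phi_eq_zero hδ (show ‖(0 : Euc n)‖ ^ 2 < δ by simpa using hδ),
              cPhi_eq_zero hδ (show ‖(0 : Euc n)‖ ^ 2 < δ by simpa using hδ)]
          · have := hφ0 x (fun h => hxΩ (hφ.2.2 h))
            simp [hJ, pd_sq hφ.1, this]
        simp only [e1, indicator_of_notMem hx]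
        simpa using hB0 x
  refine (h0.const_mul 2).congr (.of_forall fun x => ?_)
  simp only
  ring

end

section

open Filter

/-- Second partial derivatives. -/
def pd2 (w : Euc n → ℝ) (i j : Fin n) : Euc n → ℝ := pd (pd w i) j

lemma pd2_eq {w : Euc n → ℝ} (hw : ContDiff ℝ (⊤ : ℕ∞) w) (i j : Fin n) (x : Euc n) :
    pd2 w i j x = iteratedFDeriv ℝ 2 w x ![e j, e i] := by
  rw [iteratedFDeriv_two_apply]
  simp only [Matrix.cons_val_zero, Matrix.cons_val_one]
  have h1 : DifferentiableAt ℝ (fderiv ℝ w) x :=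
    ((hw.fderiv_right (m := (⊤ : ℕ∞)) (by simp)).differentiable (by simp)) x
  unfold pd2 pd
  rw [fderiv_clm_apply h1 (differentiableAt_const _)]
  simp

lemma lapl_eq {w : Euc n → ℝ} (hw : ContDiff ℝ (⊤ : ℕ∞) w) (x : Euc n) :
    lapl w x = ∑ i, pd2 w i i x := by
  simp only [lapl, pd2_eq hw]

/-- The Hessian quadratic form of `w` along the field `η`. -/
def quad (w : Euc n → ℝ) (η : Euc n → Euc n) (x : Euc n) : ℝ :=
  ∑ i, ∑ j, pd2 w i j x * (η x i * η x j)

lemma eq_sum_e (ξ : Euc n) : ξ = ∑ i, ξ i • e i := by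
  ext j
  simp [Pi.single_apply]

lemma quad_eq {w : Euc n → ℝ} (hw : ContDiff ℝ (⊤ : ℕ∞) w) (η : Euc n → Euc n) (x : Euc n) :
    quad w η x = iteratedFDeriv ℝ 2 w x ![η x, η x] := by
  unfold quad
  simp only [pd2_eq hw, iteratedFDeriv_two_apply, Matrix.cons_val_zero, Matrix.cons_val_one]
  set B := fderiv ℝ (fderiv ℝ w) x
  have h := eq_sum_e (η x)
  conv_rhs => rw [h]
  simp only [map_sum, map_smul, sum_apply, smul_apply, smul_eq_mul]
  simp only [Finset.mul_sum]
  refine Finset.sum_congr rfl fun i _ => Finset.sum_congr rfl fun j _ => by ring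

lemma abs_quad_le {w : Euc n → ℝ} (hw : ContDiff ℝ (⊤ : ℕ∞) w) {η : Euc n → Euc n} {x : Euc n}
    (hη : ‖η x‖ ≤ 1) : |quad w η x| ≤ ‖iteratedFDeriv ℝ 2 w x‖ := by
  rw [quad_eq hw]
  refine ((iteratedFDeriv ℝ 2 w x).le_opNorm _).trans ?_
  refine mul_le_of_le_one_right (norm_nonneg _) ?_
  simp only [Fin.prod_univ_two, Matrix.cons_val_zero, Matrix.cons_val_one]
  exact mul_le_one₀ hη (norm_nonneg _) hη

lemma abs_pd2_le {w : Euc n → ℝ} (hw : ContDiff ℝ (⊤ : ℕ∞) w) (i j : Fin n) (x : Euc n) :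
    |pd2 w i j x| ≤ ‖iteratedFDeriv ℝ 2 w x‖ := by
  rw [pd2_eq hw]
  refine ((iteratedFDeriv ℝ 2 w x).le_opNorm _).trans ?_
  simp [Fin.prod_univ_two]

lemma sq_form_le (X : Fin n → Fin n → ℝ) {ξ : Euc n} (hξ : ‖ξ‖ ≤ 1) :
    (∑ i, ∑ j, X i j * (ξ i * ξ j)) ^ 2 ≤ ∑ i, ∑ j, X i j ^ 2 := by
  have h1 : (∑ i, ∑ j, X i j * (ξ i * ξ j)) ^ 2 ≤ (∑ a : Fin n × Fin n, X a.1 a.2 ^ 2) *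
      ∑ a : Fin n × Fin n, (ξ a.1 * ξ a.2) ^ 2 := by
    have := Finset.sum_mul_sq_le_sq_mul_sq Finset.univ
      (fun a : Fin n × Fin n => X a.1 a.2) (fun a => ξ a.1 * ξ a.2)
    rwa [Fintype.sum_prod_type] at this
  have h2 : ∑ a : Fin n × Fin n, (ξ a.1 * ξ a.2) ^ 2 = (‖ξ‖ ^ 2) ^ 2 := by
    rw [norm_sq_eq_sum, sq, Finset.sum_mul_sum, Fintype.sum_prod_type]
    exact Finset.sum_congr rfl fun i _ => Finset.sum_congr rfl fun j _ => by ring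
  rw [h2, Fintype.sum_prod_type] at h1
  refine h1.trans (mul_le_of_le_one_right (by positivity) ?_)
  have : ‖ξ‖ ^ 2 ≤ 1 := pow_le_one₀ (norm_nonneg _) hξ
  exact pow_le_one₀ (by positivity) this

lemma sq_quad_le (w : Euc n → ℝ) {η : Euc n → Euc n} {x : Euc n}
    (hη : ‖η x‖ ≤ 1) : quad w η x ^ 2 ≤ ∑ i, ∑ j, pd2 w i j x ^ 2 :=
  sq_form_le (fun i j => pd2 w i j x) hη

lemma pd2_add {w h : Euc n → ℝ} (hw : ContDiff ℝ (⊤ : ℕ∞) w) (hh : ContDiff ℝ (⊤ : ℕ∞) h)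
    (i j : Fin n) (x : Euc n) : pd2 (fun y => w y + h y) i j x = pd2 w i j x + pd2 h i j x := by
  unfold pd2
  have : pd (fun y => w y + h y) i = fun y => pd w i y + pd h i y :=
    funext fun y => pd_add (hw.diffAt y) (hh.diffAt y)
  rw [this, pd_add ((contDiff_pd hw i).diffAt x) ((contDiff_pd hh i).diffAt x)]

lemma pd2_const_mul {w : Euc n → ℝ} (hw : ContDiff ℝ (⊤ : ℕ∞) w) (c : ℝ) (i j : Fin n)
    (x : Euc n) : pd2 (fun y => c * w y) i j x = c * pd2 w i j x := by
  unfold pd2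
  have : pd (fun y => c * w y) i = fun y => c * pd w i y :=
    funext fun y => pd_const_mul c (hw.diffAt y)
  rw [this, pd_const_mul c ((contDiff_pd hw i).diffAt x)]

lemma pd2_test {U : Set (Euc n)} {w : Euc n → ℝ} (hw : IsTestFun U w) (i j : Fin n) :
    IsTestFun U (pd2 w i j) := (hw.pd i).pd j

lemma test_by_parts {a b : Euc n → ℝ} (ha : IsTestFun univ a) (hb : IsTestFun univ b) (i : Fin n) :
    ∫ x, a x * pd b i x = - ∫ x, pd a i x * b x := wpd_of_contDiff ha.1 b hb

lemma pd_comm_test {w : Euc n → ℝ} (hw : ContDiff ℝ (⊤ : ℕ∞) w) (i j : Fin n) :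
    pd (pd w i) j = pd (pd w j) i := by
  ext x
  exact pd_comm hw i j x

lemma integral_pd2_pair {w : Euc n → ℝ} (hw : IsTestFun univ w) (i j : Fin n) :
    ∫ x, pd2 w i j x * pd2 w i j x = ∫ x, pd2 w i i x * pd2 w j j x := by
  unfold pd2
  rw [test_by_parts ((hw.pd i).pd j) (hw.pd i) j, pd_comm_test (hw.pd i).1 j j,
    pd_comm_test hw.1 i j]
  have e1 : pd (pd (pd w j) i) j = pd (pd (pd w j) j) i := pd_comm_test (hw.pd j).1 i j
  rw [e1]
  have := test_by_parts ((hw.pd j).pd j) (hw.pd i) i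
  rw [← this]
  exact integral_congr_ae (ae_of_all _ fun x => mul_comm _ _)

lemma integral_pd2_sq {w : Euc n → ℝ} (hw : IsTestFun univ w) :
    ∫ x, ∑ i, ∑ j, pd2 w i j x ^ 2 = ∫ x, lapl w x ^ 2 := by
  have hi : ∀ i j k l, Integrable (fun x => pd2 w i j x * pd2 w k l x) := fun i j k l =>
    ((pd2_test hw k l).mul_left (pd2_test hw i j).1).integrable
  have e1 : ∀ x, lapl w x ^ 2 = ∑ i, ∑ j, pd2 w i i x * pd2 w j j x := by
    intro x
    rw [lapl_eq hw.1, sq, Finset.sum_mul_sum]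
  simp only [e1, sq]
  rw [integral_finsetSum _ fun i _ => integrable_finsetSum _ fun j _ => hi _ _ _ _,
    integral_finsetSum _ fun i _ => integrable_finsetSum _ fun j _ => hi _ _ _ _]
  refine Finset.sum_congr rfl fun i _ => ?_
  rw [integral_finsetSum _ fun j _ => hi _ _ _ _, integral_finsetSum _ fun j _ => hi _ _ _ _]
  exact Finset.sum_congr rfl fun j _ => integral_pd2_pair hw i j

end

section

open Filter

/-- The real-valued `L^r` norm. -/
def nq (r : ℝ) (g : Euc n → ℝ) : ℝ := (eLpNorm g (ENNReal.ofReal r) volume).toReal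

section Norm

variable {r : ℝ} {g h : Euc n → ℝ}

lemma nq_nonneg : 0 ≤ nq r g := ENNReal.toReal_nonneg

lemma nq_add (hr : 1 ≤ r) (hg : MemLp g (ENNReal.ofReal r)) (hh : MemLp h (ENNReal.ofReal r)) :
    nq r (fun x => g x + h x) ≤ nq r g + nq r h := by
  unfold nq
  rw [← ENNReal.toReal_add hg.eLpNorm_ne_top hh.eLpNorm_ne_top]
  exact ENNReal.toReal_mono (ENNReal.add_ne_top.2 ⟨hg.eLpNorm_ne_top, hh.eLpNorm_ne_top⟩)
    (eLpNorm_add_le hg.1 hh.1 (by simpa using hr))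

lemma nq_mono (hh : MemLp h (ENNReal.ofReal r)) (hgh : ∀ᵐ x, |g x| ≤ |h x|) :
    nq r g ≤ nq r h :=
  ENNReal.toReal_mono hh.eLpNorm_ne_top (eLpNorm_mono_ae (by simpa using hgh))

lemma nq_const_mul (c : ℝ) : nq r (fun x => c * g x) = |c| * nq r g := by
  unfold nq
  have : (fun x => c * g x) = c • g := rfl
  rw [this, eLpNorm_const_smul, ENNReal.toReal_mul]
  simp

lemma nq_eq (hr : 1 ≤ r) (hg : MemLp g (ENNReal.ofReal r)) :
    nq r g = (∫ x, |g x| ^ r) ^ (1 / r) := by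
  have h0 : (0:ℝ) < r := by linarith
  unfold nq
  rw [hg.eLpNorm_eq_integral_rpow_norm (by simpa using h0) (by simp),
    ENNReal.toReal_ofReal (by positivity), ENNReal.toReal_ofReal h0.le, one_div]
  rfl

lemma nq_rpow (hr : 1 ≤ r) (hg : MemLp g (ENNReal.ofReal r)) :
    nq r g ^ r = ∫ x, |g x| ^ r := by
  have h0 : (0:ℝ) < r := by linarith
  rw [nq_eq hr hg, one_div, Real.rpow_inv_rpow (by positivity) h0.ne']

lemma nq_two (hg : MemLp g 2) : nq 2 g = √(∫ x, g x ^ 2) := by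
  rw [nq_eq one_le_two (by simpa using hg), Real.sqrt_eq_rpow]
  simp

lemma _root_.IsTestFun.memLp {U : Set (Euc n)} (hg : IsTestFun U g) (s : ℝ≥0∞) : MemLp g s :=
  hg.continuous.memLp_of_hasCompactSupport hg.2.1

end Norm

section CZ

variable {q : ℝ} {w : Euc n → ℝ}

lemma CZ_bound (h0 : CZ n q ≠ 0) (hw : IsTestFun univ w) :
    (∫ x, ‖iteratedFDeriv ℝ 2 w x‖ ^ q) ^ (1 / q) ≤ CZ n q * (∫ x, |lapl w x| ^ q) ^ (1 / q) := by
  have hne : {C : ℝ | 0 ≤ C ∧ ∀ w : Euc n → ℝ, ContDiff ℝ (⊤ : ℕ∞) w → HasCompactSupport w →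
    (∫ x, ‖iteratedFDeriv ℝ 2 w x‖ ^ q) ^ (1 / q) ≤
      C * (∫ x, |lapl w x| ^ q) ^ (1 / q)}.Nonempty := by
    by_contra h
    rw [Set.not_nonempty_iff_eq_empty] at h
    apply h0
    unfold CZ
    rw [h, Real.sInf_empty]
  have hb : 0 ≤ (∫ x, |lapl w x| ^ q) ^ (1 / q) := by positivity
  rcases hb.eq_or_lt with hb | hb
  · obtain ⟨C, hC⟩ := hne
    have := hC.2 w hw.1 hw.2.1
    rw [← hb] at this ⊢
    simpa using this
  · rw [← div_le_iff₀ hb]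
    refine le_csInf hne fun C hC => ?_
    rw [div_le_iff₀ hb]
    exact hC.2 w hw.1 hw.2.1

lemma CZ_nonneg : 0 ≤ CZ n q := Real.sInf_nonneg fun _ h => h.1

lemma hess_memLp (hw : IsTestFun univ w) (s : ℝ≥0∞) :
    MemLp (fun x => ‖iteratedFDeriv ℝ 2 w x‖) s := by
  have h1 : Continuous (iteratedFDeriv ℝ 2 w) :=
    hw.1.continuous_iteratedFDeriv (WithTop.coe_le_coe.2 (le_top (a := (2 : ℕ∞))))
  exact (h1.memLp_of_hasCompactSupport (hw.2.1.iteratedFDeriv (𝕜 := ℝ) 2)).norm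

lemma lapl_test {U : Set (Euc n)} (hw : IsTestFun U w) : IsTestFun U (lapl w) := by
  have : lapl w = fun x => ∑ i, pd2 w i i x := funext (lapl_eq hw.1)
  rw [this]
  refine isTestFun_of_subset (ContDiff.sum fun i _ => (pd2_test hw i i).1) hw.isCompact hw.2.2
    fun x hx => Finset.sum_eq_zero fun i _ => ?_
  exact pd_eq_zero_of_notMem fun h => hx (tsupport_pd_subset _ _ h)

lemma CZ_nq (h0 : CZ n q ≠ 0) (hq : 1 ≤ q) (hw : IsTestFun univ w) {g : Euc n → ℝ}
    (hg : ∀ x, |g x| ≤ ‖iteratedFDeriv ℝ 2 w x‖) : nq q g ≤ CZ n q * nq q (lapl w) := by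
  refine (nq_mono (hess_memLp hw _) (ae_of_all _ fun x => (hg x).trans (le_abs_self _))).trans ?_
  rw [nq_eq hq (hess_memLp hw _), nq_eq hq ((lapl_test hw).memLp _)]
  simpa using CZ_bound h0 hw

lemma quad_two (hw : IsTestFun univ w) {η : Euc n → Euc n} (hη : ∀ x, ‖η x‖ ≤ 1) :
    nq 2 (quad w η) ≤ nq 2 (lapl w) := by
  have hm : ∀ i j, Integrable (fun x => pd2 w i j x ^ 2) := fun i j =>
    ((pd2_test hw i j).memLp 2).integrable_sq
  have h2 : MemLp (fun x => √(∑ i, ∑ j, pd2 w i j x ^ 2)) 2 := by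
    have hc : Continuous (fun x => √(∑ i, ∑ j, pd2 w i j x ^ 2)) := by
      refine Real.continuous_sqrt.comp ?_
      exact continuous_finsetSum _ fun i _ => continuous_finsetSum _ fun j _ =>
        (pd2_test hw i j).continuous.pow 2
    rw [memLp_two_iff_integrable_sq hc.aestronglyMeasurable]
    have : (fun x => √(∑ i, ∑ j, pd2 w i j x ^ 2) ^ 2) = fun x => ∑ i, ∑ j, pd2 w i j x ^ 2 :=
      funext fun x => Real.sq_sqrt (by positivity)
    rw [this]
    exact integrable_finsetSum _ fun i _ => integrable_finsetSum _ fun j _ => hm i j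
  refine (nq_mono (h := fun x => √(∑ i, ∑ j, pd2 w i j x ^ 2)) (by simpa using h2)
    (ae_of_all _ fun x => ?_)).trans ?_
  · rw [abs_of_nonneg (Real.sqrt_nonneg _)]
    exact Real.abs_le_sqrt (sq_quad_le w (hη x))
  · rw [nq_two h2, nq_two ((lapl_test hw).memLp 2), ← integral_pd2_sq hw]
    refine le_of_eq ?_
    congr 2
    funext x
    exact Real.sq_sqrt (by positivity)

end CZ

end

section

open Filter

section Stretch

variable {q : ℝ} {w φ : Euc n → ℝ}

/-- The anisotropic dilation by `ε` in all directions except `i`. -/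
def stretch (ε : ℝ) (i : Fin n) : Euc n →L[ℝ] Euc n :=
  ε • ContinuousLinearMap.id ℝ (Euc n) +
    (1 - ε) • (EuclideanSpace.proj (𝕜 := ℝ) i : Euc n →L[ℝ] ℝ).smulRight (e i)

lemma stretch_apply (ε : ℝ) (i j : Fin n) (x : Euc n) :
    stretch ε i x j = (if j = i then 1 else ε) * x j := by
  by_cases h : j = i
  · subst h
    simp [stretch]
    ring
  · simp [stretch, h]

lemma stretch_e (ε : ℝ) (i j : Fin n) :
    stretch ε i (e j) = (if j = i then 1 else ε) • e j := by
  ext k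
  rw [stretch_apply]
  by_cases hj : j = i
  · by_cases hk : k = j
    · simp [hj, hk]
    · simp [hj, hj ▸ hk]
  · by_cases hk : k = j
    · simp [hj, hk]
    · simp [hj, hk]

lemma stretch_injective {ε : ℝ} (hε : ε ≠ 0) (i : Fin n) :
    Function.Injective (stretch (n := n) ε i) := by
  intro x y h
  ext j
  have := congrArg (fun z : Euc n => z j) h
  simp only [stretch_apply] at this
  refine mul_left_cancel₀ ?_ this
  split_ifs
  exacts [one_ne_zero, hε]

lemma stretch_det {ε : ℝ} (hε : ε ≠ 0) (i : Fin n) :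
    LinearMap.det (stretch ε i : Euc n →ₗ[ℝ] Euc n) ≠ 0 := by
  intro h
  exact LinearMap.det_eq_zero_iff_ker_ne_bot.1 h (LinearMap.ker_eq_bot.2 (stretch_injective hε i))

lemma pd_stretch (hw : ContDiff ℝ (⊤ : ℕ∞) w) (ε : ℝ) (i j : Fin n) :
    pd (fun x => w (stretch ε i x)) j = fun x => (if j = i then 1 else ε) * pd w j (stretch ε i x) := by
  funext x
  have := ((hw.diffAt (stretch ε i x)).hasFDerivAt.comp x (stretch ε i).hasFDerivAt).fderiv
  simp only [Function.comp_def] at this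
  simp only [pd, this, ContinuousLinearMap.comp_apply]
  have h := stretch_e ε i j
  unfold e at h
  rw [h, map_smul, smul_eq_mul]

lemma stretch_test {ε : ℝ} (hε : ε ≠ 0) (i : Fin n) (hw : IsTestFun univ w) :
    IsTestFun univ (fun x => w (stretch ε i x)) := by
  refine ⟨hw.1.comp (stretch ε i).contDiff, ?_, subset_univ _⟩
  exact hw.2.1.comp_isClosedEmbedding
    (LinearMap.isClosedEmbedding_of_injective (f := (stretch ε i : Euc n →ₗ[ℝ] Euc n))
      (LinearMap.ker_eq_bot.2 (stretch_injective hε i)))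

lemma pd2_stretch (hw : ContDiff ℝ (⊤ : ℕ∞) w) (ε : ℝ) (i j : Fin n) :
    pd2 (fun x => w (stretch ε i x)) j j =
      fun x => (if j = i then 1 else ε ^ 2) * pd2 w j j (stretch ε i x) := by
  unfold pd2
  rw [pd_stretch hw]
  funext x
  rw [pd_const_mul (h := fun x => pd w j (stretch ε i x)) _ (((contDiff_pd hw j).comp (stretch ε i).contDiff).diffAt x),
    pd_stretch (contDiff_pd hw j)]
  split_ifs <;> ring

lemma nq_stretch {ε : ℝ} (hε : ε ≠ 0) (i : Fin n) (q : ℝ) :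
    ∃ k : ℝ, 0 < k ∧ ∀ g : Euc n → ℝ, Continuous g →
      nq q (fun x => g (stretch ε i x)) = k * nq q g := by
  have hd := stretch_det hε i
  have hm := Measure.map_linearMap_addHaar_eq_smul_addHaar (volume : Measure (Euc n)) hd
  refine ⟨(ENNReal.ofReal |(LinearMap.det (stretch ε i : Euc n →ₗ[ℝ] Euc n))⁻¹| ^
    (1 / ENNReal.ofReal q).toReal).toReal, ?_, fun g hg => ?_⟩
  · have h1 : 0 < |(LinearMap.det (stretch ε i : Euc n →ₗ[ℝ] Euc n))⁻¹| := by positivity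
    rw [← ENNReal.toReal_rpow, ENNReal.toReal_ofReal h1.le]
    positivity
  · have h2 := eLpNorm_map_measure (p := ENNReal.ofReal q) (μ := (volume : Measure (Euc n)))
      (f := (stretch ε i)) (g := g) hg.aestronglyMeasurable
      (stretch ε i).continuous.measurable.aemeasurable
    rw [ContinuousLinearMap.coe_coe] at hm
    rw [hm, eLpNorm_smul_measure_of_ne_top (by simp)] at h2
    unfold nq
    rw [← ENNReal.toReal_mul, ← smul_eq_mul, h2]
    rfl

lemma one_le_CZ (hn : 0 < n) (h0 : CZ n q ≠ 0) (hq : 1 ≤ q) : 1 ≤ CZ n q := by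
  set i : Fin n := ⟨0, hn⟩
  obtain ⟨φ, hφ, -, V, hV, hKV, h1⟩ := exists_cutoff (U := univ) isOpen_univ
    (isCompact_singleton (x := (0 : Euc n))) (subset_univ _)
  obtain ⟨ψ, hψ⟩ : ∃ ψ : Euc n → ℝ, ψ = fun x => x i * x i * φ x := ⟨_, rfl⟩
  have hψt : IsTestFun univ ψ := by
    rw [hψ]
    exact hφ.mul_left ((contDiff_coord i).mul (contDiff_coord i))
  set a := nq q (pd2 ψ i i) with ha
  have hc : Continuous (pd2 ψ i i) := (pd2_test hψt i i).continuous
  have ha0 : 0 < a := by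
    refine lt_of_le_of_ne nq_nonneg fun h => ?_
    have hm := (pd2_test hψt i i).memLp (ENNReal.ofReal q)
    have h2 : eLpNorm (pd2 ψ i i) (ENNReal.ofReal q) volume = 0 := by
      have := (ENNReal.toReal_eq_zero_iff _).1 h.symm
      exact this.resolve_right hm.eLpNorm_ne_top
    rw [eLpNorm_eq_zero_iff hm.1 (by simpa using by linarith)] at h2
    have h3 : pd2 ψ i i = 0 := (hc.ae_eq_iff_eq _ continuous_zero).1 h2
    have e1 : ψ =ᶠ[𝓝 0] fun x => x i * x i := by
      filter_upwards [hV.mem_nhds (hKV rfl)] with x hx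
      rw [hψ]
      simp [h1 x hx]
    have e2 : pd ψ i =ᶠ[𝓝 0] fun x => 2 * x i := by
      filter_upwards [e1.eventually_nhds] with x hx
      rw [pd_congr hx, pd_mul ((contDiff_coord i).diffAt x) ((contDiff_coord i).diffAt x), pd_coord]
      simp
      ring
    have e3 : pd2 ψ i i 0 = 2 := by
      unfold pd2
      rw [pd_congr e2, pd_const_mul _ ((contDiff_coord i).diffAt 0), pd_coord]
      simp
    rw [h3] at e3
    norm_num at e3
  set b := nq q (fun x => ∑ j ∈ Finset.univ.erase i, pd2 ψ j j x) with hb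
  have hbc : Continuous (fun x => ∑ j ∈ Finset.univ.erase i, pd2 ψ j j x) :=
    continuous_finsetSum _ fun j _ => (pd2_test hψt j j).continuous
  have hbm : MemLp (fun x => ∑ j ∈ Finset.univ.erase i, pd2 ψ j j x) (ENNReal.ofReal q) :=
    memLp_finsetSum _ fun j _ => (pd2_test hψt j j).memLp _
  have key : ∀ ε : ℝ, 0 < ε → a ≤ CZ n q * (a + ε ^ 2 * b) := by
    intro ε hε
    obtain ⟨k, hk, hkg⟩ := nq_stretch (n := n) hε.ne' i q
    have ht := stretch_test hε.ne' i hψt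
    have h2 := CZ_nq h0 hq ht (abs_pd2_le ht.1 i i)
    have e1 : lapl (fun x => ψ (stretch ε i x)) = fun x =>
        (fun y => pd2 ψ i i y + ε ^ 2 * ∑ j ∈ Finset.univ.erase i, pd2 ψ j j y) (stretch ε i x) := by
      funext x
      rw [lapl_eq ht.1, ← Finset.add_sum_erase _ _ (Finset.mem_univ i)]
      simp only [pd2_stretch hψt.1, if_true, one_mul, Finset.mul_sum]
      congr 1
      refine Finset.sum_congr rfl fun j hj => ?_
      rw [if_neg (Finset.ne_of_mem_erase hj)]
    have e2 : Continuous (fun y => pd2 ψ i i y + ε ^ 2 * ∑ j ∈ Finset.univ.erase i, pd2 ψ j j y) :=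
      hc.add (hbc.const_mul (ε ^ 2))
    rw [e1, hkg _ e2, pd2_stretch hψt.1] at h2
    simp only [if_true, one_mul] at h2
    rw [hkg _ hc] at h2
    have h3 := nq_add hq ((pd2_test hψt i i).memLp _) (hbm.const_mul (ε ^ 2))
    rw [nq_const_mul, abs_of_nonneg (sq_nonneg ε)] at h3
    have h4 : k * a ≤ k * (CZ n q * (a + ε ^ 2 * b)) := by
      refine h2.trans ?_
      have := mul_le_mul_of_nonneg_left h3 (mul_nonneg (CZ_nonneg (n := n) (q := q)) hk.le)
      calc _ = _ := (mul_assoc _ _ _).symm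
        _ ≤ _ := this
        _ = _ := by ring
    exact le_of_mul_le_mul_left h4 hk
  have hlim : Tendsto (fun ε : ℝ => CZ n q * (a + ε ^ 2 * b)) (𝓝[>] 0)
      (𝓝 (CZ n q * (a + 0 ^ 2 * b))) := by
    refine Tendsto.mono_left (Continuous.tendsto (by fun_prop) 0) nhdsWithin_le_nhds
  have h5 : a ≤ CZ n q * (a + 0 ^ 2 * b) :=
    ge_of_tendsto hlim (by filter_upwards [self_mem_nhdsWithin] with ε hε using key ε hε)
  simp only [ne_eq, OfNat.ofNat_ne_zero, not_false_eq_true, zero_pow, zero_mul, add_zero] at h5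
  exact one_le_of_le_mul_right₀ ha0 h5

end Stretch

end

section

open Filter

section Kernel

/-- A smooth step from `0` on `(-∞, 1]` to `1` on `[2, ∞)`. -/
def step (t : ℝ) : ℝ := Real.smoothTransition (t - 1)

lemma step_contDiff : ContDiff ℝ (⊤ : ℕ∞) step :=
  Real.smoothTransition.contDiff.comp (contDiff_id.sub contDiff_const)

lemma step_zero {t : ℝ} (h : t ≤ 1) : step t = 0 :=
  Real.smoothTransition.zero_of_nonpos (by linarith)

lemma step_one {t : ℝ} (h : 2 ≤ t) : step t = 1 :=
  Real.smoothTransition.one_of_one_le (by linarith)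

lemma deriv_step_nonneg (t : ℝ) : 0 ≤ deriv step t :=
  (Real.smoothTransition.monotone.comp (fun a b h => by simpa using h : Monotone fun t : ℝ => t - 1)
    ).deriv_nonneg

lemma deriv_step_zero {t : ℝ} (h : t < 1) : deriv step t = 0 := by
  have : step =ᶠ[𝓝 t] fun _ => 0 := by
    filter_upwards [Iio_mem_nhds h] with s hs using step_zero (le_of_lt hs)
  rw [this.deriv_eq]
  simp

lemma deriv_step_zero' {t : ℝ} (h : 2 < t) : deriv step t = 0 := by
  have : step =ᶠ[𝓝 t] fun _ => 1 := by
    filter_upwards [Ioi_mem_nhds h] with s hs using step_one (le_of_lt hs)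
  rw [this.deriv_eq]
  simp

lemma exists_deriv_step : ∃ t, 0 < t ∧ deriv step t = 1 := by
  obtain ⟨c, hc, h⟩ := exists_deriv_eq_slope step (a := 1) (b := 2) (by norm_num)
    step_contDiff.continuous.continuousOn
    (step_contDiff.differentiable (by simp)).differentiableOn
  rw [step_one le_rfl, step_zero le_rfl] at h
  exact ⟨c, by linarith [hc.1], by rw [h]; norm_num⟩

lemma lapl_radial {G : ℝ → ℝ} (hG : ContDiff ℝ (⊤ : ℕ∞) G) (x : Euc n) :
    lapl (fun y : Euc n => G (‖y‖ ^ 2)) x =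
      2 * n * deriv G (‖x‖ ^ 2) + 4 * ‖x‖ ^ 2 * deriv (deriv G) (‖x‖ ^ 2) := by
  have hs : ContDiff ℝ (⊤ : ℕ∞) (fun y : Euc n => ‖y‖ ^ 2) := contDiff_norm_sq ℝ
  have hG' : ContDiff ℝ (⊤ : ℕ∞) (deriv G) := (contDiff_infty_iff_deriv.1 hG).2
  have hd : Differentiable ℝ G := hG.differentiable (by simp)
  have hd' : Differentiable ℝ (deriv G) := hG'.differentiable (by simp)
  rw [lapl_eq (w := fun y : Euc n => G (‖y‖ ^ 2)) (hG.comp hs)]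
  have h1 : ∀ i, pd (fun y : Euc n => G (‖y‖ ^ 2)) i = fun y => deriv G (‖y‖ ^ 2) * (2 * y i) := by
    intro i
    funext y
    rw [pd_comp (g := fun y : Euc n => ‖y‖ ^ 2) (hd _) (hs.diffAt y), pd_normsq]
  have h2 : ∀ i, pd2 (fun y : Euc n => G (‖y‖ ^ 2)) i i x =
      deriv G (‖x‖ ^ 2) * 2 + 4 * deriv (deriv G) (‖x‖ ^ 2) * x i ^ 2 := by
    intro i
    unfold pd2
    rw [h1, pd_mul (g := fun y : Euc n => deriv G (‖y‖ ^ 2)) (h := fun y : Euc n => 2 * y i)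
      ((hG'.comp hs).diffAt x) ((contDiff_const.mul (contDiff_coord i)).diffAt x),
      pd_comp (g := fun y : Euc n => ‖y‖ ^ 2) (hd' _) (hs.diffAt x), pd_normsq,
      pd_const_mul _ ((contDiff_coord i).diffAt x), pd_coord, if_pos rfl]
    ring
  simp only [h2, Finset.sum_add_distrib, ← Finset.mul_sum, ← norm_sq_eq_sum]
  simp
  ring

lemma exists_radial (m : ℝ → ℝ) (hm : ContDiff ℝ (⊤ : ℕ∞) m) {α β : ℝ} (hα : 0 < α)
    (h0 : ∀ t, t ≤ α → m t = 0) (h1 : ∀ t, β ≤ t → m t = 0) :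
    ∃ Γ : Euc n → ℝ, IsTestFun univ Γ ∧
      ∀ x, lapl Γ x = -(4 * (‖x‖ ^ 2) ^ (1 - (n : ℝ) / 2) * deriv m (‖x‖ ^ 2)) := by
  set P : ℝ → ℝ := fun t => -(t ^ (-((n : ℝ) / 2)) * m t) with hP
  have hPz : ∀ t, t < α → P =ᶠ[𝓝 t] fun _ => 0 := by
    intro t ht
    filter_upwards [Iio_mem_nhds ht] with s hs
    simp [hP, h0 s (le_of_lt hs)]
  have hPs : ContDiff ℝ (⊤ : ℕ∞) P := by
    rw [contDiff_iff_contDiffAt]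
    intro t
    rcases lt_or_ge t α with ht | ht
    · exact contDiffAt_const.congr_of_eventuallyEq (hPz t ht)
    · exact ((Real.contDiffAt_rpow_const_of_ne (by linarith : t ≠ 0)).mul hm.contDiffAt).neg
  set G : ℝ → ℝ := fun t => ∫ s in β..t, P s with hG
  have hGd : deriv G = P := by
    funext t
    exact (hPs.continuous.deriv_integral _ _ _)
  have hGs : ContDiff ℝ (⊤ : ℕ∞) G := by
    rw [contDiff_infty_iff_deriv, hGd]
    exact ⟨fun t => (intervalIntegral.integral_hasDerivAt_right
      (hPs.continuous.intervalIntegrable _ _) (hPs.continuous.stronglyMeasurableAtFilter _ _)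
      hPs.continuous.continuousAt).differentiableAt, hPs⟩
  have hG0 : ∀ t, β ≤ t → G t = 0 := by
    intro t ht
    refine (intervalIntegral.integral_congr (g := fun _ => 0) fun s hs => ?_).trans (by simp)
    rw [uIcc_of_le ht] at hs
    simp [hP, h1 s hs.1]
  refine ⟨fun y => G (‖y‖ ^ 2), ?_, fun x => ?_⟩
  · refine isTestFun_of_subset (hGs.comp (contDiff_norm_sq ℝ))
      (isCompact_closedBall (0 : Euc n) (|β| + 1)) (subset_univ _) fun x hx => hG0 _ ?_
    rw [mem_closedBall_zero_iff, not_le] at hx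
    have := abs_nonneg β
    have := le_abs_self β
    nlinarith
  · rw [lapl_radial hGs, hGd]
    set t := ‖x‖ ^ 2 with ht
    rcases lt_or_ge t α with h | h
    · have e1 : deriv m t = 0 := by
        have : m =ᶠ[𝓝 t] fun _ => 0 := by
          filter_upwards [Iio_mem_nhds h] with s hs using h0 s (le_of_lt hs)
        rw [this.deriv_eq]
        simp
      rw [(hPz t h).deriv_eq, (hPz t h).eq_of_nhds, e1]
      simp
    · have ht0 : 0 < t := by linarith
      have hd : HasDerivAt P (-(-((n : ℝ) / 2) * t ^ (-((n : ℝ) / 2) - 1) * m t +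
          t ^ (-((n : ℝ) / 2)) * deriv m t)) t :=
        ((Real.hasDerivAt_rpow_const (Or.inl ht0.ne')).mul
          ((hm.differentiable (by simp)) t).hasDerivAt).neg
      rw [hd.deriv, Real.rpow_sub_one ht0.ne', show 1 - (n : ℝ) / 2 = -((n : ℝ) / 2) + 1 by ring,
        Real.rpow_add_one ht0.ne']
      simp only [hP]
      field_simp
      ring

/-- The radial kernel whose dilations differ by Laplacians of test functions. -/
def ker0 (x : Euc n) : ℝ := 4 * (‖x‖ ^ 2) ^ (1 - (n : ℝ) / 2) * deriv step (‖x‖ ^ 2)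

lemma ker0_nonneg (x : Euc n) : 0 ≤ ker0 x :=
  mul_nonneg (by positivity) (deriv_step_nonneg _)

lemma ker0_eq_zero {x : Euc n} (hx : 2 < ‖x‖) : ker0 x = 0 := by
  rw [ker0, deriv_step_zero' (by nlinarith), mul_zero]

lemma ker0_continuous : Continuous (ker0 (n := n)) := by
  have hs : Continuous (fun y : Euc n => ‖y‖ ^ 2) := by fun_prop
  have hd : Continuous (deriv step) := (contDiff_infty_iff_deriv.1 step_contDiff).2.continuous
  rw [continuous_iff_continuousAt]
  intro x
  rcases lt_or_ge (‖x‖ ^ 2) 1 with h | h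
  · have : ker0 =ᶠ[𝓝 x] fun _ => 0 := by
      filter_upwards [hs.continuousAt.preimage_mem_nhds (Iio_mem_nhds h)] with y hy
      rw [ker0, deriv_step_zero hy, mul_zero]
    exact continuousAt_const.congr this.symm
  · unfold ker0
    refine (continuousAt_const.mul (hs.continuousAt.rpow_const (Or.inl ?_))).mul
      (hd.comp hs).continuousAt
    exact (zero_lt_one.trans_le h).ne'

lemma ker0_integral_pos (hn : 0 < n) : 0 < ∫ x : Euc n, ker0 x := by
  have hc : HasCompactSupport (ker0 (n := n)) := by
    refine HasCompactSupport.of_support_subset_isCompact (isCompact_closedBall (0 : Euc n) 2)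
      fun x hx => ?_
    by_contra h
    rw [mem_closedBall_zero_iff, not_le] at h
    exact hx (ker0_eq_zero h)
  obtain ⟨t, ht, h1⟩ := exists_deriv_step
  refine ker0_continuous.integral_pos_of_hasCompactSupport_nonneg_nonzero hc
    (fun x => ker0_nonneg x) (x := √t • e ⟨0, hn⟩) ?_
  have : ‖√t • (e ⟨0, hn⟩ : Euc n)‖ ^ 2 = t := by
    rw [norm_smul, Real.norm_of_nonneg (Real.sqrt_nonneg _)]
    simp [Real.sq_sqrt ht.le]
  rw [ker0, this, h1]
  positivity

/-- The dilation of `ker0` by `a`. -/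
def dil (a : ℝ) (x : Euc n) : ℝ := (a ^ n)⁻¹ * ker0 (a⁻¹ • x)

lemma dil_eq {a : ℝ} (ha : 0 < a) (x : Euc n) :
    dil a x = 4 * (‖x‖ ^ 2) ^ (1 - (n : ℝ) / 2) * (deriv step (‖x‖ ^ 2 / a ^ 2) / a ^ 2) := by
  have e1 : ‖a⁻¹ • x‖ ^ 2 = ‖x‖ ^ 2 / a ^ 2 := by
    rw [norm_smul, norm_inv, Real.norm_of_nonneg ha.le]
    field_simp
  rw [dil, ker0, e1, Real.div_rpow (by positivity) (by positivity)]
  have e2 : (a ^ 2) ^ (1 - (n : ℝ) / 2) = a ^ 2 / a ^ n := by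
    rw [← Real.rpow_natCast a 2, ← Real.rpow_mul ha.le, ← Real.rpow_natCast a n, ← Real.rpow_sub ha]
    congr 1
    push_cast
    ring
  rw [e2]
  field_simp

lemma exists_lapl_eq_dil_sub {a b : ℝ} (ha : 0 < a) (hab : a ≤ b) :
    ∃ Γ : Euc n → ℝ, IsTestFun univ Γ ∧ ∀ x, lapl Γ x = dil b x - dil a x := by
  have hb : 0 < b := ha.trans_le hab
  have hsq : a ^ 2 ≤ b ^ 2 := by gcongr
  obtain ⟨Γ, hΓ, h⟩ := exists_radial (n := n) (fun t => step (t / a ^ 2) - step (t / b ^ 2))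
    ((step_contDiff.comp (contDiff_id.div_const _)).sub (step_contDiff.comp (contDiff_id.div_const _)))
    (α := a ^ 2) (β := 2 * b ^ 2) (by positivity)
    (fun t ht => by
      rw [step_zero, step_zero, sub_zero]
      · rw [div_le_one (by positivity)]; linarith
      · rw [div_le_one (by positivity)]; linarith)
    (fun t ht => by
      rw [step_one, step_one, sub_self]
      · rw [le_div_iff₀ (by positivity)]; linarith
      · rw [le_div_iff₀ (by positivity)]; linarith)
  refine ⟨Γ, hΓ, fun x => ?_⟩
  have hd : ∀ c t : ℝ, HasDerivAt (fun t => step (t / c ^ 2)) (deriv step (t / c ^ 2) / c ^ 2) t := by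
    intro c t
    have h1 : HasDerivAt step (deriv step (t / c ^ 2)) (t / c ^ 2) :=
      ((step_contDiff.differentiable (by simp)) _).hasDerivAt
    have := h1.comp t ((hasDerivAt_id t).div_const (c ^ 2))
    simpa [Function.comp_def, div_eq_mul_inv] using this
  rw [h, ((hd a _).fun_sub (hd b _)).deriv, dil_eq ha, dil_eq hb]
  ring

lemma dil_integral {a : ℝ} (ha : 0 < a) : ∫ x : Euc n, dil a x = ∫ x : Euc n, ker0 x := by
  unfold dil
  rw [integral_const_mul, Measure.integral_comp_inv_smul]
  simp only [finrank_euclideanSpace, Fintype.card_fin, smul_eq_mul]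
  rw [abs_of_pos (by positivity), ← mul_assoc, inv_mul_cancel₀ (by positivity), one_mul]

end Kernel

end

section

open Filter

section Density

variable {r : ℝ} {g k : Euc n → ℝ}

lemma nq_small (hr : 1 ≤ r) (hg : Integrable g) {δ : ℝ} (hδ : ∀ x, |g x| ≤ δ) :
    MemLp g (ENNReal.ofReal r) ∧ nq r g ^ r ≤ δ ^ (r - 1) * ∫ x, |g x| := by
  have hδ0 : 0 ≤ δ := (abs_nonneg _).trans (hδ 0)
  have h0 : (0:ℝ) < r := by linarith
  have hle : ∀ x, |g x| ^ r ≤ δ ^ (r - 1) * |g x| := by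
    intro x
    have : |g x| ^ r = |g x| ^ (r - 1) * |g x| := by
      rw [← Real.rpow_add_one' (abs_nonneg _) (by simpa using h0.ne'), sub_add_cancel]
    rw [this]
    gcongr
    exact hδ x
  have hi : Integrable (fun x => |g x| ^ r) := by
    refine (hg.abs.const_mul (δ ^ (r - 1))).mono' ?_ (ae_of_all _ fun x => ?_)
    · exact ((hg.1.norm.aemeasurable).pow_const r).aestronglyMeasurable
    · rw [Real.norm_of_nonneg (by positivity)]
      exact hle x
  have hm : MemLp g (ENNReal.ofReal r) := by
    rw [← integrable_norm_rpow_iff hg.1 (by simpa using h0) (by simp), ENNReal.toReal_ofReal h0.le]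
    exact hi
  refine ⟨hm, ?_⟩
  rw [nq_rpow hr hm, ← integral_const_mul]
  exact integral_mono hi (hg.abs.const_mul _) hle

lemma tendsto_nq_zero {g : ℕ → Euc n → ℝ} (hr : 0 < r)
    (h : Tendsto (fun m => nq r (g m) ^ r) atTop (𝓝 0)) :
    Tendsto (fun m => nq r (g m)) atTop (𝓝 0) := by
  have := h.rpow_const (p := r⁻¹) (Or.inr (by positivity))
  rw [Real.zero_rpow (by positivity)] at this
  refine this.congr fun m => ?_
  rw [Real.rpow_rpow_inv nq_nonneg hr.ne']

lemma tendsto_nq_small {g : ℕ → Euc n → ℝ} (hr : 1 < r) (hg : ∀ m, Integrable (g m))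
    {δ : ℕ → ℝ} (hδ : ∀ m x, |g m x| ≤ δ m) (hδ0 : Tendsto δ atTop (𝓝 0))
    {B : ℝ} (hB : ∀ m, ∫ x, |g m x| ≤ B) : Tendsto (fun m => nq r (g m)) atTop (𝓝 0) := by
  refine tendsto_nq_zero (by linarith) ?_
  have h1 : Tendsto (fun m => δ m ^ (r - 1) * B) atTop (𝓝 0) := by
    have := (hδ0.rpow_const (p := r - 1) (Or.inr (by linarith))).mul_const B
    rwa [Real.zero_rpow (by linarith), zero_mul] at this
  refine squeeze_zero (fun m => Real.rpow_nonneg nq_nonneg _) (fun m => ?_) h1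
  refine ((nq_small hr.le (hg m) (hδ m)).2).trans ?_
  have : 0 ≤ δ m := (abs_nonneg _).trans (hδ m 0)
  exact mul_le_mul_of_nonneg_left (hB m) (by positivity)

lemma dil_continuous (a : ℝ) : Continuous (dil (n := n) a) :=
  continuous_const.mul (ker0_continuous.comp (continuous_const_smul _))

lemma dil_nonneg {a : ℝ} (ha : 0 < a) (x : Euc n) : 0 ≤ dil a x :=
  mul_nonneg (by positivity) (ker0_nonneg _)

lemma dil_eq_zero {a : ℝ} (ha : 0 < a) {x : Euc n} (hx : 2 * a < ‖x‖) : dil a x = 0 := by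
  rw [dil, ker0_eq_zero, mul_zero]
  rw [norm_smul, norm_inv, Real.norm_of_nonneg ha.le, inv_mul_eq_div, lt_div_iff₀ ha]
  exact hx

lemma dil_compact {a : ℝ} (ha : 0 < a) : HasCompactSupport (dil (n := n) a) := by
  refine HasCompactSupport.of_support_subset_isCompact (isCompact_closedBall (0 : Euc n) (2 * a))
    fun x hx => ?_
  by_contra h
  rw [mem_closedBall_zero_iff, not_le] at h
  exact hx (dil_eq_zero ha h)

lemma ker0_bdd : ∃ C, 0 ≤ C ∧ ∀ x : Euc n, ker0 x ≤ C := by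
  have h : ker0 (n := n) = dil 1 := by
    funext x
    simp [dil]
  obtain ⟨C, hC⟩ := (dil_continuous (n := n) 1).bounded_above_of_compact_support (dil_compact one_pos)
  refine ⟨C, (norm_nonneg _).trans (hC 0), fun x => ?_⟩
  rw [h]
  exact (le_abs_self _).trans (hC x)

lemma dil_integrable {a : ℝ} (ha : 0 < a) : Integrable (dil (n := n) a) :=
  (dil_continuous a).integrable_of_hasCompactSupport (dil_compact ha)

lemma integrable_cv_dil (hk : IsTestFun univ k) {a : ℝ} (x : Euc n) :
    Integrable (fun t => k t * dil a (x - t)) := by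
  refine Continuous.integrable_of_hasCompactSupport ?_ hk.2.1.mul_right
  exact hk.continuous.mul ((dil_continuous a).comp (continuous_const.sub continuous_id))

lemma cv_dil_integrable (hk : IsTestFun univ k) {a : ℝ} (ha : 0 < a) :
    Integrable (cv k (dil a)) ∧ ∫ x, |cv k (dil a) x| ≤ (∫ x, |k x|) * ∫ x : Euc n, ker0 x := by
  have h1 : Integrable (cv k (dil a)) := by
    rw [cv_eq]
    exact hk.integrable.integrable_convolution _ (dil_integrable ha)
  refine ⟨h1, ?_⟩
  have h2 : Integrable (cv (fun t => |k t|) (dil a)) := by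
    rw [cv_eq]
    exact hk.integrable.abs.integrable_convolution _ (dil_integrable ha)
  have h3 : ∫ x, cv (fun t => |k t|) (dil a) x = (∫ x, |k x|) * ∫ x : Euc n, ker0 x := by
    rw [cv_eq, integral_convolution _ hk.integrable.abs (dil_integrable ha), dil_integral ha]
    simp
  rw [← h3]
  refine integral_mono h1.abs h2 fun x => ?_
  refine abs_integral_le_integral_abs.trans (le_of_eq ?_)
  unfold cv
  congr 1
  funext t
  rw [abs_mul, abs_of_nonneg (dil_nonneg ha _)]

lemma cv_dil_sup (hk : IsTestFun univ k) {C : ℝ} (hC : ∀ x : Euc n, ker0 x ≤ C) {a : ℝ}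
    (ha : 0 < a) (x : Euc n) : |cv k (dil a) x| ≤ (a ^ n)⁻¹ * C * ∫ x, |k x| := by
  refine abs_integral_le_integral_abs.trans ?_
  rw [← integral_const_mul]
  refine integral_mono (integrable_cv_dil hk x).abs (hk.integrable.abs.const_mul _) fun t => ?_
  simp only
  rw [abs_mul, abs_of_nonneg (dil_nonneg ha _), mul_comm]
  have : dil a (x - t) ≤ (a ^ n)⁻¹ * C := mul_le_mul_of_nonneg_left (hC _) (by positivity)
  gcongr

lemma sub_cv_dil (hk : IsTestFun univ k) {M : ℝ} (hM : ∀ x y, |k x - k y| ≤ M * ‖x - y‖)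
    (hM0 : 0 ≤ M) {a : ℝ} (ha : 0 < a) (x : Euc n) :
    |(∫ y : Euc n, ker0 y) * k x - cv k (dil a) x| ≤ M * (2 * a) * ∫ y : Euc n, ker0 y := by
  have hi : Integrable (fun t => dil a (x - t)) := (dil_integrable ha).comp_sub_left x
  have e1 : (∫ y : Euc n, ker0 y) = ∫ t, dil a (x - t) := by
    rw [integral_sub_left_eq_self (fun t => dil a t) volume x, dil_integral ha]
  have e2 : (∫ y : Euc n, ker0 y) * k x - cv k (dil a) x = ∫ t, (k x - k t) * dil a (x - t) := by
    rw [e1, cv, ← integral_mul_const, ← integral_sub (hi.mul_const _) (integrable_cv_dil hk x)]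
    congr 1
    funext t
    ring
  rw [e2, e1, ← integral_const_mul]
  refine abs_integral_le_integral_abs.trans ?_
  refine integral_mono_of_nonneg (ae_of_all _ fun t => abs_nonneg _) (hi.const_mul _)
    (ae_of_all _ fun t => ?_)
  simp only
  rw [abs_mul, abs_of_nonneg (dil_nonneg ha _)]
  by_cases h : ‖x - t‖ ≤ 2 * a
  · have h1 := hM x t
    have h2 := dil_nonneg ha (x - t)
    gcongr
    exact h1.trans (by gcongr)
  · rw [dil_eq_zero ha (not_le.1 h)]
    simp

lemma lapl_const_mul {w : Euc n → ℝ} (hw : ContDiff ℝ (⊤ : ℕ∞) w) (c : ℝ) (x : Euc n) :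
    lapl (fun y => c * w y) x = c * lapl w x := by
  rw [lapl_eq (contDiff_const.mul hw), lapl_eq hw, Finset.mul_sum]
  exact Finset.sum_congr rfl fun i _ => pd2_const_mul hw c i i x

lemma cv_test {Γ : Euc n → ℝ} (hk : IsTestFun univ k) (hΓ : IsTestFun univ Γ) :
    IsTestFun univ (cv k Γ) := by
  obtain ⟨R, hR⟩ := hΓ.isCompact.isBounded.subset_closedBall (0 : Euc n)
  refine isTestFun_of_subset (cv_contDiff hk.continuous.locallyIntegrable hΓ)
    (hk.isCompact.cthickening (r := R)) (subset_univ _) fun x hx => ?_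
  refine cv_eq_zero (fun x hx => hk.eq_zero hx) (fun x hx => hΓ.eq_zero fun h => ?_) hx
  have := hR h
  rw [mem_closedBall_zero_iff] at this
  linarith

lemma lapl_cv {Γ : Euc n → ℝ} (hk : IsTestFun univ k) (hΓ : IsTestFun univ Γ) (x : Euc n) :
    lapl (cv k Γ) x = ∫ t, k t * lapl Γ (x - t) := by
  have hl := hk.continuous.locallyIntegrable (μ := (volume : Measure (Euc n)))
  rw [lapl_eq (cv_contDiff hl hΓ)]
  simp only [lapl_eq hΓ.1, Finset.mul_sum]
  rw [integral_finsetSum _ fun i _ => cv_integrable hl (pd2_test hΓ i i) x]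
  refine Finset.sum_congr rfl fun i _ => ?_
  unfold pd2
  rw [cv_pd hl hΓ, cv_pd hl (hΓ.pd i)]
  rfl

lemma exists_lapl_test (hn : 0 < n) (hk : IsTestFun univ k) {s : ℝ} (hr : 1 < r) (hs : 1 < s)
    {ε : ℝ} (hε : 0 < ε) :
    ∃ h : Euc n → ℝ, IsTestFun univ h ∧ nq r (fun x => k x - lapl h x) ≤ ε ∧
      nq s (fun x => k x - lapl h x) ≤ ε := by
  obtain ⟨c, hc⟩ : ∃ c, c = ∫ y : Euc n, ker0 y := ⟨_, rfl⟩
  have hc0 : 0 < c := hc ▸ ker0_integral_pos hn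
  obtain ⟨M, hM0, hM⟩ := hk.lipschitz
  obtain ⟨C, hC0, hC⟩ := ker0_bdd (n := n)
  set a : ℕ → ℝ := fun m => 1 / ((m : ℝ) + 1) with ha
  set b : ℕ → ℝ := fun m => (m : ℝ) + 1 with hb
  have ha0 : ∀ m, 0 < a m := fun m => by positivity
  have hb0 : ∀ m, 0 < b m := fun m => by positivity
  have hat : Tendsto a atTop (𝓝 0) := tendsto_one_div_add_atTop_nhds_zero_nat
  have hab : ∀ m, a m ≤ b m := fun m => by
    have h1 : a m ≤ 1 := by
      rw [ha]
      simp only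
      rw [div_le_one (by positivity)]
      have : (0:ℝ) ≤ m := by positivity
      linarith
    have h2 : 1 ≤ b m := by simp [hb]
    linarith
  choose Γ hΓ hΓe using fun m => exists_lapl_eq_dil_sub (n := n) (ha0 m) (hab m)
  set g1 : ℕ → Euc n → ℝ := fun m x => c⁻¹ * (c * k x - cv k (dil (a m)) x) with hg1
  set g2 : ℕ → Euc n → ℝ := fun m x => c⁻¹ * cv k (dil (b m)) x with hg2
  have i1 : ∀ m, Integrable (g1 m) := fun m =>
    ((hk.integrable.const_mul c).sub (cv_dil_integrable hk (ha0 m)).1).const_mul _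
  have i2 : ∀ m, Integrable (g2 m) := fun m => ((cv_dil_integrable hk (hb0 m)).1).const_mul _
  have t1 : ∀ {r : ℝ}, 1 < r → Tendsto (fun m => nq r (g1 m)) atTop (𝓝 0) := by
    intro r hr
    refine tendsto_nq_small hr i1 (δ := fun m => c⁻¹ * (M * (2 * a m) * c)) (fun m x => ?_) ?_
      (B := c⁻¹ * (c * (∫ x, |k x|) + (∫ x, |k x|) * c)) fun m => ?_
    · rw [hg1]
      simp only
      rw [abs_mul, abs_of_pos (inv_pos.2 hc0)]
      have := sub_cv_dil hk hM hM0 (ha0 m) x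
      rw [← hc] at this
      gcongr
    · have := (((hat.const_mul 2).const_mul M).mul_const c).const_mul c⁻¹
      simpa using this
    · have h1 := cv_dil_integrable hk (ha0 m)
      rw [← hc] at h1
      calc ∫ x, |g1 m x| ≤ ∫ x, c⁻¹ * (c * |k x| + |cv k (dil (a m)) x|) := by
            refine integral_mono (i1 m).abs
              (((hk.integrable.abs.const_mul c).add h1.1.abs).const_mul _) fun x => ?_
            simp only [hg1]
            rw [abs_mul, abs_of_pos (inv_pos.2 hc0)]
            gcongr
            refine (abs_sub _ _).trans ?_
            rw [abs_mul, abs_of_pos hc0]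
        _ = c⁻¹ * (c * (∫ x, |k x|) + ∫ x, |cv k (dil (a m)) x|) := by
            rw [integral_const_mul, integral_add (hk.integrable.abs.const_mul c) h1.1.abs,
              integral_const_mul]
        _ ≤ _ := by gcongr; exact h1.2
  have t2 : ∀ {r : ℝ}, 1 < r → Tendsto (fun m => nq r (g2 m)) atTop (𝓝 0) := by
    intro r hr
    refine tendsto_nq_small hr i2 (δ := fun m => c⁻¹ * ((b m ^ n)⁻¹ * C * ∫ x, |k x|))
      (fun m x => ?_) ?_ (B := c⁻¹ * ((∫ x, |k x|) * c)) fun m => ?_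
    · rw [hg2]
      simp only
      rw [abs_mul, abs_of_pos (inv_pos.2 hc0)]
      have := cv_dil_sup hk hC (hb0 m) x
      gcongr
    · have h3 : Tendsto (fun m : ℕ => (b m ^ n)⁻¹) atTop (𝓝 0) := by
        have := (hat.pow n)
        rw [zero_pow hn.ne'] at this
        refine this.congr fun m => ?_
        simp [ha, hb]
      have := ((h3.mul_const C).mul_const (∫ x, |k x|)).const_mul c⁻¹
      simpa using this
    · have h1 := cv_dil_integrable hk (hb0 m)
      rw [← hc] at h1
      have : ∀ x, |g2 m x| = c⁻¹ * |cv k (dil (b m)) x| := fun x => by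
        rw [hg2]
        simp only
        rw [abs_mul, abs_of_pos (inv_pos.2 hc0)]
      simp only [this]
      rw [integral_const_mul]
      gcongr
      exact h1.2
  have e0 : ∀ m x, k x - lapl (fun y => -c⁻¹ * cv k (Γ m) y) x = g1 m x + g2 m x := by
    intro m x
    rw [lapl_const_mul (cv_test hk (hΓ m)).1, lapl_cv hk (hΓ m)]
    simp only [hΓe, mul_sub]
    rw [integral_sub (integrable_cv_dil hk x) (integrable_cv_dil hk x)]
    simp only [hg1, hg2, cv]
    field_simp
    ring
  have bd1 : ∀ {r : ℝ}, 1 < r → ∀ m, MemLp (g1 m) (ENNReal.ofReal r) := fun hr m =>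
    (nq_small hr.le (i1 m) (δ := c⁻¹ * (M * (2 * a m) * c)) fun x => by
      rw [hg1]
      simp only
      rw [abs_mul, abs_of_pos (inv_pos.2 hc0)]
      have := sub_cv_dil hk hM hM0 (ha0 m) x
      rw [← hc] at this
      gcongr).1
  have bd2 : ∀ {r : ℝ}, 1 < r → ∀ m, MemLp (g2 m) (ENNReal.ofReal r) := fun hr m =>
    (nq_small hr.le (i2 m) (δ := c⁻¹ * ((b m ^ n)⁻¹ * C * ∫ x, |k x|)) fun x => by
      rw [hg2]
      simp only
      rw [abs_mul, abs_of_pos (inv_pos.2 hc0)]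
      have := cv_dil_sup hk hC (hb0 m) x
      gcongr).1
  have h1 := (((t1 hr).add (t2 hr)).eventually_le_const (u := ε) (by simpa using hε)).and
    (((t1 hs).add (t2 hs)).eventually_le_const (u := ε) (by simpa using hε))
  obtain ⟨m, hm1, hm2⟩ := h1.exists
  refine ⟨_, (cv_test hk (hΓ m)).const_mul (-c⁻¹), ?_, ?_⟩
  · simp only [e0]
    exact (nq_add hr.le (bd1 hr m) (bd2 hr m)).trans hm1
  · simp only [e0]
    exact (nq_add hs.le (bd1 hs m) (bd2 hs m)).trans hm2

end Density

end

section

open Filter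

section Density2

variable {r q : ℝ} {g k : Euc n → ℝ}

lemma nq_small_two (hq : 2 ≤ q) (hg : MemLp g 2) {δ : ℝ} (hδ : ∀ x, |g x| ≤ δ) :
    MemLp g (ENNReal.ofReal q) ∧ nq q g ^ q ≤ δ ^ (q - 2) * ∫ x, g x ^ 2 := by
  have hδ0 : 0 ≤ δ := (abs_nonneg _).trans (hδ 0)
  have h0 : (0:ℝ) < q := by linarith
  have hle : ∀ x, |g x| ^ q ≤ δ ^ (q - 2) * g x ^ 2 := by
    intro x
    have : |g x| ^ q = |g x| ^ (q - 2) * g x ^ 2 := by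
      rw [← sq_abs, ← Real.rpow_add_natCast' (abs_nonneg _) (by push_cast; linarith)]
      congr 1
      push_cast
      ring
    rw [this]
    gcongr
    exact hδ x
  have hi : Integrable (fun x => |g x| ^ q) := by
    refine (hg.integrable_sq.const_mul (δ ^ (q - 2))).mono' ?_ (ae_of_all _ fun x => ?_)
    · exact ((hg.1.norm.aemeasurable).pow_const q).aestronglyMeasurable
    · rw [Real.norm_of_nonneg (by positivity)]
      exact hle x
  have hm : MemLp g (ENNReal.ofReal q) := by
    rw [← integrable_norm_rpow_iff hg.1 (by simpa using h0) (by simp), ENNReal.toReal_ofReal h0.le]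
    exact hi
  refine ⟨hm, ?_⟩
  rw [nq_rpow (by linarith) hm, ← integral_const_mul]
  exact integral_mono hi (hg.integrable_sq.const_mul _) hle

lemma abs_moll_le {M : ℝ} (hgl : LocallyIntegrable g) (hM : ∀ x, |g x| ≤ M) (m : ℕ) (x : Euc n) :
    |moll m g x| ≤ M := by
  refine abs_integral_le_integral_abs.trans ?_
  have h1 : M = ∫ t, M * rho m (x - t) := by
    rw [integral_const_mul, rho_sub_integral, mul_one]
  rw [h1]
  refine integral_mono (cv_integrable hgl (rho_test m) x).abs
    ((isTestFun_reflect (rho_test m) x).integrable.const_mul M) fun t => ?_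
  simp only
  rw [abs_mul, abs_of_nonneg (rho_nonneg m _)]
  exact mul_le_mul_of_nonneg_right (hM t) (rho_nonneg m _)

lemma TL2.tendsto_nq {x : ℕ → Euc n → ℝ} (h : TL2 x g) (hq : 2 ≤ q) {δ : ℝ}
    (hδ : ∀ m z, |x m z - g z| ≤ δ) : Tendsto (fun m => nq q (fun z => x m z - g z)) atTop (𝓝 0) := by
  refine tendsto_nq_zero (by linarith) ?_
  have h1 := h.tendsto.const_mul (δ ^ (q - 2))
  rw [mul_zero] at h1
  exact squeeze_zero (fun m => Real.rpow_nonneg nq_nonneg _)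
    (fun m => (nq_small_two hq ((h.mem m).isub h.memLim) (hδ m)).2) h1

/-- Truncation in size and space. -/
def trunc (m : ℕ) (g : Euc n → ℝ) : Euc n → ℝ := {x | |g x| ≤ m ∧ ‖x‖ ≤ m}.indicator g

lemma trunc_aesm (hg : AEStronglyMeasurable g volume) (m : ℕ) :
    AEStronglyMeasurable (trunc m g) volume := by
  refine hg.indicator₀ ?_
  exact (nullMeasurableSet_le hg.aemeasurable.norm aemeasurable_const).inter
    (nullMeasurableSet_le measurable_norm.aemeasurable aemeasurable_const)

lemma abs_trunc_le (m : ℕ) (x : Euc n) : |trunc m g x| ≤ m := by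
  unfold trunc
  by_cases h : x ∈ {x | |g x| ≤ m ∧ ‖x‖ ≤ m}
  · rw [indicator_of_mem h]; exact h.1
  · rw [indicator_of_notMem h]; simp

lemma abs_trunc_le_abs (m : ℕ) (x : Euc n) : |trunc m g x| ≤ |g x| := by
  unfold trunc
  by_cases h : x ∈ {x | |g x| ≤ m ∧ ‖x‖ ≤ m}
  · rw [indicator_of_mem h]
  · rw [indicator_of_notMem h]; simp

lemma trunc_eventually (x : Euc n) : ∀ᶠ m : ℕ in atTop, trunc m g x = g x := by
  filter_upwards [eventually_ge_atTop ⌈max |g x| ‖x‖⌉₊] with m hm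
  have : max |g x| ‖x‖ ≤ m := Nat.ceil_le.1 hm
  exact indicator_of_mem (s := {x | |g x| ≤ m ∧ ‖x‖ ≤ m})
    ⟨(le_max_left _ _).trans this, (le_max_right _ _).trans this⟩ g

lemma trunc_memLp {s : ℝ≥0∞} (hg : MemLp g s) (m : ℕ) : MemLp (trunc m g) s :=
  hg.mono (trunc_aesm hg.1 m) (ae_of_all _ fun x => abs_trunc_le_abs m x)

lemma tendsto_nq_trunc (hr : 1 ≤ r) (hg : MemLp g (ENNReal.ofReal r)) :
    Tendsto (fun m : ℕ => nq r (fun x => g x - trunc m g x)) atTop (𝓝 0) := by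
  have h0 : (0:ℝ) < r := by linarith
  refine tendsto_nq_zero h0 ?_
  have e : ∀ m, nq r (fun x => g x - trunc m g x) ^ r = ∫ x, |g x - trunc m g x| ^ r := fun m =>
    nq_rpow hr (hg.isub (trunc_memLp hg m))
  simp only [e]
  have hi : Integrable (fun x => |g x| ^ r) := by
    have := hg.integrable_norm_rpow (by simpa using h0) (by simp)
    rwa [ENNReal.toReal_ofReal h0.le] at this
  rw [← integral_zero (Euc n) ℝ (μ := volume)]
  refine tendsto_integral_of_dominated_convergence (fun x => |g x| ^ r) (fun m => ?_) hi
    (fun m => ae_of_all _ fun x => ?_) (ae_of_all _ fun x => ?_)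
  · exact (((hg.1.sub (trunc_aesm hg.1 m)).norm.aemeasurable).pow_const r).aestronglyMeasurable
  · rw [Real.norm_of_nonneg (by positivity)]
    refine Real.rpow_le_rpow (abs_nonneg _) ?_ h0.le
    unfold trunc
    by_cases h : x ∈ {x | |g x| ≤ m ∧ ‖x‖ ≤ m}
    · rw [indicator_of_mem h]; simp
    · rw [indicator_of_notMem h]; simp
  · refine tendsto_const_nhds.congr' ?_
    filter_upwards [trunc_eventually (g := g) x] with m hm
    rw [hm, sub_self, abs_zero, Real.zero_rpow h0.ne']

lemma exists_test_approx (hq : 2 ≤ q) (hg2 : MemLp g 2) (hgq : MemLp g (ENNReal.ofReal q))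
    {ε : ℝ} (hε : 0 < ε) :
    ∃ k : Euc n → ℝ, IsTestFun univ k ∧ nq 2 (fun x => g x - k x) ≤ ε ∧
      nq q (fun x => g x - k x) ≤ ε := by
  have e2 : ENNReal.ofReal 2 = 2 := by simp
  have h1 := ((tendsto_nq_trunc one_le_two (by rwa [e2])).eventually_le_const (half_pos hε)).and
    ((tendsto_nq_trunc (by linarith) hgq).eventually_le_const (half_pos hε))
  obtain ⟨M, hM2, hMq⟩ := h1.exists
  set G := trunc M g with hG
  have hG2 : MemLp G 2 := trunc_memLp hg2 M
  have hGq : MemLp G (ENNReal.ofReal q) := trunc_memLp hgq M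
  have ht := moll_tl2 hG2
  have hGl := hG2.locallyIntegrable (by norm_num)
  have hb : ∀ m z, |moll m G z - G z| ≤ M + M := fun m z =>
    (abs_sub _ _).trans (add_le_add (abs_moll_le hGl (abs_trunc_le M) m z) (abs_trunc_le M z))
  have htest := moll_test hGl (isCompact_closedBall (0 : Euc n) M) isOpen_univ (subset_univ _)
    (fun x hx => by
      rw [mem_closedBall_zero_iff] at hx
      exact indicator_of_notMem (fun h => hx h.2) _)
  obtain ⟨m, ⟨hm2, hmq⟩, hmt⟩ := ((((ht.tendsto_nq le_rfl hb).eventually_le_const (half_pos hε)).and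
    ((ht.tendsto_nq hq hb).eventually_le_const (half_pos hε))).and htest).exists
  have hadd : ∀ {r : ℝ}, 1 ≤ r → MemLp g (ENNReal.ofReal r) → MemLp G (ENNReal.ofReal r) →
      nq r (fun x => g x - G x) ≤ ε / 2 → nq r (fun x => moll m G x - G x) ≤ ε / 2 →
      nq r (fun x => g x - moll m G x) ≤ ε := by
    intro r hr h1 h2 h3 h4
    have h5 := nq_add hr (h1.isub h2) (((hmt.memLp (ENNReal.ofReal r)).isub h2).const_mul (-1))
    rw [nq_const_mul] at h5
    have e : (fun x => g x - moll m G x) = fun x => g x - G x + -1 * (moll m G x - G x) := by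
      funext x; ring
    rw [e]
    refine h5.trans ?_
    rw [abs_neg, abs_one, one_mul]
    linarith
  exact ⟨_, hmt, hadd one_le_two (by rwa [e2]) (by rwa [e2]) hM2 hm2,
    hadd (by linarith) hgq hGq hMq hmq⟩

lemma exists_lapl_approx (hn : 0 < n) (hq : 2 ≤ q) (hg2 : MemLp g 2)
    (hgq : MemLp g (ENNReal.ofReal q)) {ε : ℝ} (hε : 0 < ε) :
    ∃ h : Euc n → ℝ, IsTestFun univ h ∧ nq 2 (fun x => g x - lapl h x) ≤ ε ∧
      nq q (fun x => g x - lapl h x) ≤ ε := by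
  have e2 : ENNReal.ofReal 2 = 2 := by simp
  obtain ⟨k, hk, hk2, hkq⟩ := exists_test_approx hq hg2 hgq (half_pos hε)
  obtain ⟨h, hh, hh2, hhq⟩ := exists_lapl_test hn hk one_lt_two (by linarith : 1 < q) (half_pos hε)
  have hadd : ∀ {r : ℝ}, 1 ≤ r → MemLp g (ENNReal.ofReal r) →
      nq r (fun x => g x - k x) ≤ ε / 2 → nq r (fun x => k x - lapl h x) ≤ ε / 2 →
      nq r (fun x => g x - lapl h x) ≤ ε := by
    intro r hr h1 h3 h4
    have h5 := nq_add hr (h1.isub (hk.memLp _)) ((hk.memLp (ENNReal.ofReal r)).isub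
      ((lapl_test hh).memLp _))
    have e : (fun x => g x - lapl h x) = fun x => g x - k x + (k x - lapl h x) := by
      funext x; ring
    rw [e]
    linarith
  exact ⟨h, hh, hadd one_le_two (by rwa [e2]) hk2 hh2, hadd (by linarith) hgq hkq hhq⟩

end Density2

end

section

open Filter

/-- The operator `Δ w + c ⟨D²w η, η⟩`. -/
def lop (c : ℝ) (η : Euc n → Euc n) (w : Euc n → ℝ) (x : Euc n) : ℝ := lapl w x + c * quad w η x

section Contraction

variable {q c θ : ℝ} {g w h : Euc n → ℝ} {η : Euc n → Euc n}

lemma quad_memLp (hw : IsTestFun univ w) (hη : ∀ x, ‖η x‖ ≤ 1)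
    (hm : ∀ i, AEStronglyMeasurable (fun x => η x i) volume) (s : ℝ≥0∞) : MemLp (quad w η) s := by
  refine (hess_memLp hw s).mono ?_ (ae_of_all _ fun x => ?_)
  · refine Finset.aestronglyMeasurable_fun_sum _ fun i _ => Finset.aestronglyMeasurable_fun_sum _ fun j _ => ?_
    exact (pd2_test hw i j).continuous.aestronglyMeasurable.mul ((hm i).mul (hm j))
  · simpa using abs_quad_le hw.1 (hη x)

lemma lop_memLp (hw : IsTestFun univ w) (hη : ∀ x, ‖η x‖ ≤ 1)
    (hm : ∀ i, AEStronglyMeasurable (fun x => η x i) volume) (s : ℝ≥0∞) : MemLp (lop c η w) s :=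
  ((lapl_test hw).memLp s).iadd ((quad_memLp hw hη hm s).const_mul c)

lemma lop_add (hw : IsTestFun univ w) (hh : IsTestFun univ h) (x : Euc n) :
    lop c η (fun x => w x + h x) x = lop c η w x + lop c η h x := by
  unfold lop quad
  rw [lapl_eq (hw.1.add hh.1), lapl_eq hw.1, lapl_eq hh.1]
  simp only [pd2_add hw.1 hh.1, add_mul, Finset.sum_add_distrib]
  ring

lemma lop_step (hn : 0 < n) (hq : 2 ≤ q) (h0 : CZ n q ≠ 0) (hg2 : MemLp g 2)
    (hgq : MemLp g (ENNReal.ofReal q)) (hη : ∀ x, ‖η x‖ ≤ 1)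
    (hm : ∀ i, AEStronglyMeasurable (fun x => η x i) volume)
    (hc : |c| ≤ θ) (hcq : |c| * CZ n q ≤ θ) {t ε : ℝ} (hε : 0 < ε)
    (hw : IsTestFun univ w) (h2 : nq 2 (fun x => g x - lop c η w x) ≤ t)
    (h3 : nq q (fun x => g x - lop c η w x) ≤ t) :
    ∃ w, IsTestFun univ w ∧ nq 2 (fun x => g x - lop c η w x) ≤ θ * t + (1 + θ) * ε ∧
      nq q (fun x => g x - lop c η w x) ≤ θ * t + (1 + θ) * ε := by
  have e2 : ENNReal.ofReal 2 = 2 := by simp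
  have hR2 := hg2.isub (lop_memLp (c := c) hw hη hm 2)
  have hRq := hgq.isub (lop_memLp (c := c) hw hη hm (ENNReal.ofReal q))
  obtain ⟨h, hh, hh2, hhq⟩ := exists_lapl_approx hn hq hR2 hRq hε
  have hθ : 0 ≤ θ := (abs_nonneg _).trans hc
  refine ⟨fun x => w x + h x, hw.add hh, ?_⟩
  have e : (fun x => g x - lop c η (fun x => w x + h x) x) =
      fun x => (g x - lop c η w x - lapl h x) + (-c) * quad h η x := by
    funext x
    rw [lop_add hw hh]
    simp only [lop]
    ring
  have key : ∀ r : ℝ, 1 ≤ r → MemLp (fun x => g x - lop c η w x) (ENNReal.ofReal r) →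
      |c| * nq r (quad h η) ≤ θ * nq r (lapl h) →
      nq r (fun x => g x - lop c η w x) ≤ t →
      nq r (fun x => g x - lop c η w x - lapl h x) ≤ ε →
      nq r (fun x => g x - lop c η (fun x => w x + h x) x) ≤ θ * t + (1 + θ) * ε := by
    intro r hr hR hqd h4 h5
    have hl := (lapl_test hh).memLp (ENNReal.ofReal r)
    have h6 := nq_add hr (hR.isub hl) ((quad_memLp hh hη hm (ENNReal.ofReal r)).const_mul (-c))
    have h7 : nq r (lapl h) ≤ t + ε := by
      have h8 := nq_add hr hR ((hR.isub hl).const_mul (-1))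
      have e' : (fun x => g x - lop c η w x + -1 * (g x - lop c η w x - lapl h x)) = lapl h := by
        funext x; ring
      rw [e', nq_const_mul, abs_neg, abs_one, one_mul] at h8
      linarith
    rw [e]
    refine h6.trans ?_
    rw [nq_const_mul, abs_neg]
    have h9 := mul_le_mul_of_nonneg_left h7 hθ
    linarith
  refine ⟨key 2 one_le_two (by rwa [e2]) ?_ h2 hh2, key q (by linarith) hRq ?_ h3 hhq⟩
  · exact mul_le_mul hc (quad_two hh hη) nq_nonneg hθ
  · have h1 := CZ_nq h0 (by linarith : 1 ≤ q) hh (g := quad h η) (fun x => abs_quad_le hh.1 (hη x))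
    calc |c| * nq q (quad h η) ≤ |c| * (CZ n q * nq q (lapl h)) := by gcongr
      _ = |c| * CZ n q * nq q (lapl h) := by ring
      _ ≤ θ * nq q (lapl h) := mul_le_mul_of_nonneg_right hcq nq_nonneg

lemma exists_lop_approx (hn : 0 < n) (hq : 2 ≤ q) (h0 : CZ n q ≠ 0) (hg2 : MemLp g 2)
    (hgq : MemLp g (ENNReal.ofReal q)) (hη : ∀ x, ‖η x‖ ≤ 1)
    (hm : ∀ i, AEStronglyMeasurable (fun x => η x i) volume)
    (hc : |c| ≤ θ) (hcq : |c| * CZ n q ≤ θ) (hθ : θ < 1) {ε : ℝ} (hε : 0 < ε) :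
    ∃ w, IsTestFun univ w ∧ nq 2 (fun x => g x - lop c η w x) ≤ ε ∧
      nq q (fun x => g x - lop c η w x) ≤ ε := by
  have hθ0 : 0 ≤ θ := (abs_nonneg _).trans hc
  obtain ⟨t0, ht0⟩ : ∃ t0, t0 = nq 2 g + nq q g := ⟨_, rfl⟩
  obtain ⟨δ, hδ⟩ : ∃ δ, δ = ε * (1 - θ) / 4 := ⟨_, rfl⟩
  have hδ0 : 0 < δ := by rw [hδ]; have : 0 < 1 - θ := by linarith
                         positivity
  have hS : ∀ m : ℕ, ∃ w, IsTestFun univ w ∧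
      nq 2 (fun x => g x - lop c η w x) ≤ θ ^ m * t0 + ε / 2 ∧
      nq q (fun x => g x - lop c η w x) ≤ θ ^ m * t0 + ε / 2 := by
    intro m
    induction m with
    | zero =>
      have hz : IsTestFun univ (fun _ : Euc n => (0:ℝ)) :=
        ⟨contDiff_const, HasCompactSupport.zero, subset_univ _⟩
      refine ⟨_, hz, ?_⟩
      have e : (fun x => g x - lop c η (fun _ => (0:ℝ)) x) = g := by
        funext x
        have : ∀ i j, pd2 (fun _ : Euc n => (0:ℝ)) i j x = 0 := by
          intro i j
          have h1 : pd (fun _ : Euc n => (0:ℝ)) i = fun _ => 0 := by funext y; simp [pd]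
          unfold pd2
          rw [h1]
          simp [pd]
        simp only [lop, quad, lapl_eq hz.1, this]
        simp
      rw [e]
      have h1 : 0 ≤ nq 2 g := nq_nonneg
      have h2 : 0 ≤ nq q g := nq_nonneg
      constructor <;> rw [pow_zero, ht0] <;> linarith
    | succ m ih =>
      obtain ⟨w, hw, h2, h3⟩ := ih
      obtain ⟨w', hw', h2', h3'⟩ := lop_step hn hq h0 hg2 hgq hη hm hc hcq hδ0 hw h2 h3
      have : θ * (θ ^ m * t0 + ε / 2) + (1 + θ) * δ ≤ θ ^ (m + 1) * t0 + ε / 2 := by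
        rw [hδ, pow_succ]
        nlinarith [mul_nonneg hε.le (mul_nonneg (sub_nonneg.2 hθ.le) (sub_nonneg.2 hθ.le))]
      exact ⟨w', hw', h2'.trans this, h3'.trans this⟩
  have hl : Tendsto (fun m : ℕ => θ ^ m * t0) atTop (𝓝 0) := by
    simpa using (tendsto_pow_atTop_nhds_zero_of_lt_one hθ0 hθ).mul_const t0
  obtain ⟨m, hm'⟩ := (hl.eventually_le_const (half_pos hε)).exists
  obtain ⟨w, hw, h2, h3⟩ := hS m
  exact ⟨w, hw, by linarith, by linarith⟩

end Contraction

end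

section

open Filter

section Conclusion

variable {q c θ : ℝ} {g : Euc n → ℝ} {η : Euc n → Euc n} {W : ℕ → Euc n → ℝ}
  {X : Fin n → Fin n → Euc n → ℝ}

lemma pair_of_lim (hW : ∀ m, IsTestFun univ (W m))
    (hX : ∀ i j, TL2 (fun m => pd2 (W m) i j) (X i j)) (i j : Fin n) :
    ∫ x, X i j x * X i j x = ∫ x, X i i x * X j j x :=
  tendsto_nhds_unique ((hX i j).integral_mul (hX i j))
    (((hX i i).integral_mul (hX j j)).congr fun m => (integral_pd2_pair (hW m) i j).symm)

lemma trace_sq_of_lim (hW : ∀ m, IsTestFun univ (W m))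
    (hX : ∀ i j, TL2 (fun m => pd2 (W m) i j) (X i j)) :
    ∫ x, (∑ i, X i i x) ^ 2 = ∫ x, ∑ i, ∑ j, X i j x ^ 2 := by
  have hM : ∀ i j, MemLp (X i j) 2 := fun i j => (hX i j).memLim
  have e : ∀ x, (∑ i, X i i x) ^ 2 = ∑ i, ∑ j, X i i x * X j j x := fun x => by
    rw [sq, Finset.sum_mul_sum]
  simp only [e]
  rw [integral_finsetSum _ fun i _ => integrable_finsetSum _ fun j _ => (hM i i).imul (hM j j),
    integral_finsetSum _ fun i _ => integrable_finsetSum _ fun j _ => (hM i j).integrable_sq]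
  refine Finset.sum_congr rfl fun i _ => ?_
  rw [integral_finsetSum _ fun j _ => (hM i i).imul (hM j j),
    integral_finsetSum _ fun j _ => (hM i j).integrable_sq]
  refine Finset.sum_congr rfl fun j _ => ?_
  rw [← pair_of_lim hW hX]
  simp only [sq]

lemma frob_bound (hW : ∀ m, IsTestFun univ (W m))
    (hX : ∀ i j, TL2 (fun m => pd2 (W m) i j) (X i j)) (hη : ∀ x, ‖η x‖ ≤ 1)
    (hm : ∀ i, AEStronglyMeasurable (fun x => η x i) volume) (hg : MemLp g 2)
    (hc : |c| ≤ θ) (heq : ∀ᵐ x, ∑ i, X i i x + c * ∑ i, ∑ j, X i j x * (η x i * η x j) = g x)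
    (i j : Fin n) : (1 - θ) * nq 2 (X i j) ≤ nq 2 g := by
  have hθ0 : 0 ≤ θ := (abs_nonneg _).trans hc
  have e2 : ENNReal.ofReal 2 = 2 := by simp
  have hM : ∀ i j, MemLp (X i j) 2 := fun i j => (hX i j).memLim
  have hF : Integrable (fun x => ∑ i, ∑ j, X i j x ^ 2) :=
    integrable_finsetSum _ fun i _ => integrable_finsetSum _ fun j _ => (hM i j).integrable_sq
  have htr : MemLp (fun x => ∑ i, X i i x) 2 := memLp_finsetSum _ fun i _ => hM i i
  have hQm : AEStronglyMeasurable (fun x => ∑ i, ∑ j, X i j x * (η x i * η x j)) volume := by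
    refine Finset.aestronglyMeasurable_fun_sum _ fun i _ => Finset.aestronglyMeasurable_fun_sum _ fun j _ => ?_
    exact (hM i j).1.mul ((hm i).mul (hm j))
  have hQ : MemLp (fun x => ∑ i, ∑ j, X i j x * (η x i * η x j)) 2 := by
    rw [memLp_two_iff_integrable_sq hQm]
    refine hF.mono' (hQm.pow 2) (ae_of_all _ fun x => ?_)
    rw [Real.norm_of_nonneg (sq_nonneg _)]
    exact sq_form_le (fun i j => X i j x) (hη x)
  obtain ⟨A, hA⟩ : ∃ A, A = √(∫ x, ∑ i, ∑ j, X i j x ^ 2) := ⟨_, rfl⟩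
  have h1 : nq 2 (fun x => ∑ i, X i i x) = A := by
    rw [nq_two htr, hA, trace_sq_of_lim hW hX]
  have h2 : nq 2 (fun x => ∑ i, ∑ j, X i j x * (η x i * η x j)) ≤ A := by
    rw [nq_two hQ, hA]
    refine Real.sqrt_le_sqrt (integral_mono hQ.integrable_sq hF fun x => ?_)
    exact sq_form_le (fun i j => X i j x) (hη x)
  have h3 : nq 2 (X i j) ≤ A := by
    rw [nq_two (hM i j), hA]
    refine Real.sqrt_le_sqrt (integral_mono (hM i j).integrable_sq hF fun x => ?_)
    refine le_trans ?_ (Finset.single_le_sum (f := fun i => ∑ j, X i j x ^ 2) (fun i _ => by positivity) (Finset.mem_univ i))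
    exact Finset.single_le_sum (f := fun j => X i j x ^ 2) (fun i _ => by positivity) (Finset.mem_univ j)
  have h4 : A ≤ nq 2 g + θ * A := by
    rw [← h1]
    have hR : MemLp (fun x => g x + (-c) * ∑ i, ∑ j, X i j x * (η x i * η x j)) 2 :=
      hg.iadd (hQ.const_mul (-c))
    refine (nq_mono (h := fun x => g x + (-c) * ∑ i, ∑ j, X i j x * (η x i * η x j))
      (by rwa [e2]) ?_).trans ?_
    · filter_upwards [heq] with x hx
      refine le_of_eq ?_
      congr 1
      linarith
    · refine (nq_add one_le_two (by rwa [e2]) (by rw [e2]; exact hQ.const_mul (-c))).trans ?_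
      rw [nq_const_mul, abs_neg, h1]
      have : |c| * nq 2 (fun x => ∑ i, ∑ j, X i j x * (η x i * η x j)) ≤ θ * A :=
        mul_le_mul hc h2 nq_nonneg hθ0
      linarith
  rcases le_or_gt θ 1 with h | h
  · have h5 := mul_le_mul_of_nonneg_left h3 (sub_nonneg.2 h)
    linarith
  · have h5 : 0 ≤ nq 2 (X i j) := nq_nonneg
    have h6 : 0 ≤ nq 2 g := nq_nonneg
    nlinarith

lemma TL2.sub_const {x : ℕ → Euc n → ℝ} {y k : Euc n → ℝ} (h : TL2 x y) (hk : MemLp k 2) :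
    TL2 (fun m z => x m z - k z) (fun z => y z - k z) := by
  refine ⟨fun m => (h.mem m).isub hk, h.memLim.isub hk, ?_⟩
  simpa using h.tendsto

/-- The Calderón–Zygmund type estimate for a bounded measurable rank-one perturbation of the
Laplacian. -/
lemma memLp_of_lop (hn : 0 < n) (hq : 2 ≤ q) (h0 : CZ n q ≠ 0) (hW : ∀ m, IsTestFun univ (W m))
    (hX : ∀ i j, TL2 (fun m => pd2 (W m) i j) (X i j)) (hη : ∀ x, ‖η x‖ ≤ 1)
    (hm : ∀ i, AEStronglyMeasurable (fun x => η x i) volume) (hg2 : MemLp g 2)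
    (hgq : MemLp g (ENNReal.ofReal q)) (hc : |c| ≤ θ) (hcq : |c| * CZ n q ≤ θ) (hθ : θ < 1)
    (heq : ∀ᵐ x, ∑ i, X i i x + c * ∑ i, ∑ j, X i j x * (η x i * η x j) = g x)
    (i j : Fin n) : MemLp (X i j) (ENNReal.ofReal q) := by
  have hθ0 : 0 ≤ θ := (abs_nonneg _).trans hc
  have hp : ∀ k : ℕ, (0:ℝ) < 1 / ((k:ℝ) + 1) := fun k => Nat.one_div_pos_of_nat
  choose w hw h2 hqk using fun k : ℕ =>
    exists_lop_approx hn hq h0 hg2 hgq hη hm hc hcq hθ (hp k)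
  have hd : ∀ k, (1 - θ) * nq 2 (fun x => X i j x - pd2 (w k) i j x) ≤ 1 / ((k:ℝ) + 1) := by
    intro k
    have hWk : ∀ m, IsTestFun univ (fun x => W m x + (-1) * w k x) := fun m =>
      (hW m).add ((hw k).const_mul (-1))
    have hXk : ∀ i j, TL2 (fun m => pd2 (fun x => W m x + (-1) * w k x) i j)
        (fun x => X i j x - pd2 (w k) i j x) := by
      intro i j
      have h := (hX i j).sub_const ((pd2_test (hw k) i j).memLp 2)
      have e : (fun (m : ℕ) => pd2 (fun x => W m x + (-1) * w k x) i j) =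
          fun m z => pd2 (W m) i j z - pd2 (w k) i j z := by
        funext m z
        rw [pd2_add (hW m).1 ((hw k).const_mul (-1)).1, pd2_const_mul (hw k).1]
        ring
      rwa [e]
    refine (frob_bound hWk hXk hη hm (hg2.isub (lop_memLp (c := c) (hw k) hη hm 2)) hc ?_ i j).trans (h2 k)
    filter_upwards [heq] with x hx
    rw [← hx]
    unfold lop quad
    rw [lapl_eq (hw k).1]
    simp only [sub_mul, Finset.sum_sub_distrib]
    ring
  have hb : ∀ k, nq q (pd2 (w k) i j) ≤ CZ n q * ((nq q g + 1) / (1 - θ)) := by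
    intro k
    have h1 : nq q (lapl (w k)) ≤ (nq q g + 1) / (1 - θ) := by
      rw [le_div_iff₀ (by linarith)]
      have hl := lop_memLp (c := c) (hw k) hη hm (ENNReal.ofReal q)
      have hqd := quad_memLp (hw k) hη hm (ENNReal.ofReal q)
      have h3 := nq_add (by linarith : 1 ≤ q) hgq (((hgq.isub hl).const_mul (-1)).iadd (hqd.const_mul (-c)))
      have h4 := nq_add (by linarith : 1 ≤ q) ((hgq.isub hl).const_mul (-1)) (hqd.const_mul (-c))
      have e : (fun x => g x + (-1 * (g x - lop c η (w k) x) + -c * quad (w k) η x)) = lapl (w k) := by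
        funext x
        unfold lop
        ring
      rw [e] at h3
      rw [nq_const_mul, nq_const_mul, abs_neg, abs_neg, abs_one, one_mul] at h4
      have h5 := CZ_nq h0 (by linarith : 1 ≤ q) (hw k) (g := quad (w k) η)
        (fun x => abs_quad_le (hw k).1 (hη x))
      have h6 : |c| * nq q (quad (w k) η) ≤ θ * nq q (lapl (w k)) := by
        refine (mul_le_mul_of_nonneg_left h5 (abs_nonneg c)).trans ?_
        rw [← mul_assoc]
        exact mul_le_mul_of_nonneg_right hcq nq_nonneg
      have h7 : 1 / ((k:ℝ) + 1) ≤ 1 := by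
        rw [div_le_one (by positivity)]; linarith [(Nat.cast_nonneg k : (0:ℝ) ≤ k)]
      have h8 := hqk k
      linarith
    refine (CZ_nq h0 (by linarith : 1 ≤ q) (hw k) (fun x => abs_pd2_le (hw k).1 i j x)).trans ?_
    exact mul_le_mul_of_nonneg_left h1 CZ_nonneg
  have hlim : Tendsto (fun k => nq 2 (fun x => X i j x - pd2 (w k) i j x)) atTop (𝓝 0) := by
    refine squeeze_zero (g := fun k : ℕ => (1 - θ)⁻¹ * (1 / ((k:ℝ) + 1))) (fun k => nq_nonneg) (fun k => ?_) ?_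
    · rw [inv_mul_eq_div, le_div_iff₀ (by linarith), mul_comm]
      exact hd k
    · simpa using (tendsto_one_div_add_atTop_nhds_zero_nat (𝕜 := ℝ)).const_mul (1 - θ)⁻¹
  have hE : Tendsto (fun k => eLpNorm (pd2 (w k) i j - X i j) 2 volume) atTop (𝓝 0) := by
    have hmem : ∀ k, MemLp (fun x => X i j x - pd2 (w k) i j x) 2 := fun k =>
      (hX i j).memLim.isub ((pd2_test (hw k) i j).memLp 2)
    have h9 : Tendsto (fun k => ENNReal.ofReal (nq 2 (fun x => X i j x - pd2 (w k) i j x))) atTop (𝓝 0) := by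
      simpa using ENNReal.tendsto_ofReal hlim
    refine h9.congr fun k => ?_
    unfold nq
    rw [ENNReal.ofReal_toReal (by simpa using (hmem k).eLpNorm_ne_top), eLpNorm_sub_comm]
    simp
    rfl
  have haem : ∀ k, AEStronglyMeasurable (pd2 (w k) i j) volume := fun k =>
    (pd2_test (hw k) i j).continuous.aestronglyMeasurable
  obtain ⟨ns, -, hns⟩ := (tendstoInMeasure_of_tendsto_eLpNorm (by norm_num) haem
    (hX i j).memLim.1 hE).exists_seq_tendsto_ae
  refine ⟨(hX i j).memLim.1, ?_⟩
  refine (Lp.eLpNorm_lim_le_liminf_eLpNorm (fun k => haem (ns k)) _ hns).trans_lt ?_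
  refine lt_of_le_of_lt (liminf_le_of_le ?_ (a := ENNReal.ofReal (CZ n q * ((nq q g + 1) / (1 - θ)))) ?_) ENNReal.ofReal_lt_top
  · isBoundedDefault
  · intro b hbb
    obtain ⟨k, hk⟩ := hbb.exists
    refine hk.trans ?_
    rw [← ENNReal.ofReal_toReal ((pd2_test (hw (ns k)) i j).memLp (ENNReal.ofReal q)).eLpNorm_ne_top]
    exact ENNReal.ofReal_le_ofReal (hb (ns k))

end Conclusion

end

section

open Filter

section CZHess

variable {p q : ℝ} {Ω : Set (Euc n)} {u f : Euc n → ℝ} {v : Euc n → Euc n}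
  {H : Fin n → Fin n → Euc n → ℝ}

lemma sum_dvf_trace (s : ℝ) {ξ : Euc n} (hξ : ξ ≠ 0) (A : Fin n → Fin n → ℝ) :
    ∑ j, ∑ k, dvf s j k ξ * A k j =
      ‖ξ‖ ^ s * (∑ i, A i i + s * ∑ i, ∑ j, A i j * (vf (-1) i ξ * vf (-1) j ξ)) := by
  have h0 : 0 < ‖ξ‖ := norm_pos_iff.2 hξ
  have h1 : ‖ξ‖ ^ (s - 2) = ‖ξ‖ ^ s * (‖ξ‖ ^ (-1 : ℝ) * ‖ξ‖ ^ (-1 : ℝ)) := by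
    rw [← Real.rpow_add h0, ← Real.rpow_add h0]; congr 1; ring
  have h2 : ∀ j k, dvf s j k ξ * A k j = (if j = k then ‖ξ‖ ^ s * A k j else 0) +
      ‖ξ‖ ^ s * (s * (A k j * (vf (-1) k ξ * vf (-1) j ξ))) := by
    intro j k
    unfold dvf vf
    rw [h1]
    split_ifs <;> ring
  simp only [h2, Finset.sum_add_distrib, Finset.sum_ite_eq, Finset.mem_univ, if_true, mul_add,
    ← Finset.mul_sum]
  rw [Finset.sum_comm]

lemma PSol.pde (S : PSol p Ω u f v) (hH : Hess Ω v H) :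
    ∀ᵐ x, x ∈ Reg Ω v → ∑ i, H i i x + (p - 2) * ∑ i, ∑ j, H i j x *
      (vf (-1) i (v x) * vf (-1) j (v x)) = -(‖v x‖ ^ (-(p - 2)) * f x) := by
  have hl : ∀ j, L2loc (Reg Ω v) (fun x => ∑ k, dvf (p - 2) j k (v x) * H k j x) := fun j =>
    L2loc.sum _ fun k _ => (hH.l2 k j).mul_cont (S.cont_comp fun _ hξ => contDiffAt_dvf _ j k hξ)
  have hf : L2loc (Reg Ω v) (fun x => -1 * f x) :=
    (L2loc.of_continuousOn (S.fcont'.mono reg_subset)).const_mul (-1)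
  have h := ae_eq_of_forall_test S.isOpen_reg ((L2loc.sum Finset.univ fun j _ => hl j).locallyIntegrableOn S.isOpen_reg)
    (hf.locallyIntegrableOn S.isOpen_reg) fun ψ hψ => by
      simp only [Finset.sum_mul]
      rw [integral_finsetSum _ fun j _ => by
        simpa only [Finset.sum_mul] using (hl j).integrable_test hψ]
      have h1 := S.weak ψ (hψ.mono reg_subset)
      simp only [mul_assoc, integral_const_mul, ← h1]
      rw [Finset.mul_sum]
      refine Finset.sum_congr rfl fun j _ => ?_
      rw [S.wpd_vf hH (p - 2) j j ψ hψ]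
      simp only [Finset.sum_mul, mul_assoc, neg_mul, one_mul, neg_neg]
  filter_upwards [h] with x hx hxU
  have h2 := hx hxU
  rw [sum_dvf_trace (p - 2) hxU.2 (fun k j => H k j x)] at h2
  have h0 : 0 < ‖v x‖ := norm_pos_iff.2 hxU.2
  rw [Real.rpow_neg h0.le]
  have h3 : ‖v x‖ ^ (p - 2) ≠ 0 := (Real.rpow_pos_of_pos h0 _).ne'
  have h4 : f x = -(‖v x‖ ^ (p - 2) * (∑ i, H i i x + (p - 2) * ∑ i, ∑ j, H i j x *
      (vf (-1) i (v x) * vf (-1) j (v x)))) := by linarith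
  rw [h4, mul_neg, inv_mul_cancel_left₀ h3, neg_neg]

lemma moll_pd2 {w : Euc n → ℝ} {d : Fin n → Euc n → ℝ} {X : Fin n → Fin n → Euc n → ℝ}
    (hw : MemLp w 2) (hd : ∀ i, MemLp (d i) 2)
    (h1 : ∀ i, WPD univ w (d i) i) (h2 : ∀ i j, WPD univ (d i) (X i j) j) (m : ℕ) (i j : Fin n) :
    pd2 (moll m w) i j = moll m (X i j) := by
  unfold pd2 moll
  rw [cv_pd_of_weak (hw.locallyIntegrable (by norm_num)) (h1 i) (rho_test m),
    cv_pd_of_weak ((hd i).locallyIntegrable (by norm_num)) (h2 i j) (rho_test m)]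

lemma memLp_mul_bdd {a b : Euc n → ℝ} {s : ℝ≥0∞} (ha : MemLp a s) (hb : AEStronglyMeasurable b volume)
    (h1 : ∀ x, |b x| ≤ 1) : MemLp (fun x => a x * b x) s := by
  refine ha.mono (ha.1.mul hb) (ae_of_all _ fun x => ?_)
  rw [norm_mul]
  exact mul_le_of_le_one_right (norm_nonneg _) (h1 x)

lemma memLp_cutoff_cont (hΩ : IsOpen Ω) {φ a : Euc n → ℝ} (hφ : IsTestFun Ω φ) (ha : ContinuousOn a Ω) (s : ℝ≥0∞) :
    MemLp (fun x => φ x * a x) s := by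
  have hc : Continuous (fun x => φ x * a x) := continuous_cutoff_mul hΩ hφ ha
  exact hc.memLp_of_hasCompactSupport hφ.2.1.mul_right

lemma PSol.source_memLp (S : PSol p Ω u f v) (hH : Hess Ω v H) (hq : 2 ≤ q) (hpq : (p - 2) * q < p - 1)
    {φ : Euc n → ℝ} (hφ : IsTestFun Ω φ) :
    MemLp ((Reg Ω v).indicator fun x => φ x * -(‖v x‖ ^ (-(p - 2)) * f x)) (ENNReal.ofReal q) := by
  have h0 : (0:ℝ) < q := by linarith
  have hm : AEStronglyMeasurable ((Reg Ω v).indicator fun x => φ x * -(‖v x‖ ^ (-(p - 2)) * f x)) volume := by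
    rw [aestronglyMeasurable_indicator_iff S.isOpen_reg.measurableSet]
    refine ContinuousOn.aestronglyMeasurable ?_ S.isOpen_reg.measurableSet
    exact hφ.continuous.continuousOn.mul (((S.cont_comp fun _ hξ => contDiffAt_rpow_norm _ hξ).mul
      (S.fcont'.mono reg_subset)).neg)
  obtain ⟨M, hM⟩ : ∃ M, ∀ x, |f x * φ x| ≤ M := by
    have hc : Continuous (fun x => φ x • f x) := continuous_cutoff_mul S.isOpen hφ S.fcont'
    obtain ⟨M, hM⟩ := (hφ.2.1.smul_right (f' := f)).exists_bound_of_continuous hc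
    exact ⟨M, fun x => by simpa [mul_comm] using hM x⟩
  have hM0 : 0 ≤ M := (abs_nonneg _).trans (hM 0)
  rw [← integrable_norm_rpow_iff hm (by simpa using h0) (by simp), ENNReal.toReal_ofReal h0.le]
  refine ((S.weighted_source hH hpq hφ).const_mul (M ^ (q - 2))).mono'
    ((hm.norm.aemeasurable.pow_const q).aestronglyMeasurable) (ae_of_all _ fun x => ?_)
  rw [Real.norm_of_nonneg (by positivity)]
  by_cases hx : x ∈ Reg Ω v
  · simp only [indicator_of_mem hx]
    have hv0 : 0 < ‖v x‖ := norm_pos_iff.2 hx.2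
    have e1 : ‖φ x * -(‖v x‖ ^ (-(p - 2)) * f x)‖ = ‖v x‖ ^ (-(p - 2)) * |f x * φ x| := by
      rw [Real.norm_eq_abs, show φ x * -(‖v x‖ ^ (-(p - 2)) * f x) =
        -(‖v x‖ ^ (-(p - 2)) * (f x * φ x)) by ring, abs_neg, abs_mul, abs_of_nonneg (by positivity)]
    have e2 : |f x * φ x| ^ q = |f x * φ x| ^ (q - 2) * (f x ^ 2 * φ x ^ 2) := by
      rw [← mul_pow, ← sq_abs (f x * φ x), ← Real.rpow_add_natCast' (abs_nonneg _) (by push_cast; linarith)]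
      congr 1
      push_cast
      ring
    rw [e1, Real.mul_rpow (by positivity) (abs_nonneg _), ← Real.rpow_mul hv0.le, e2, neg_mul]
    have e3 : |f x * φ x| ^ (q - 2) ≤ M ^ (q - 2) :=
      Real.rpow_le_rpow (abs_nonneg _) (hM x) (by linarith)
    calc ‖v x‖ ^ (-((p - 2) * q)) * (|f x * φ x| ^ (q - 2) * (f x ^ 2 * φ x ^ 2))
        ≤ ‖v x‖ ^ (-((p - 2) * q)) * (M ^ (q - 2) * (f x ^ 2 * φ x ^ 2)) := by gcongr
      _ = _ := by ring
  · simp [indicator_of_notMem hx, h0.ne']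

end CZHess

end

section

open Filter

section CZHess

variable {p q θ : ℝ} {Ω : Set (Euc n)} {u f : Euc n → ℝ} {v : Euc n → Euc n}
  {H : Fin n → Fin n → Euc n → ℝ}

/-- The direction of `v`, extended by zero. -/
def dir (Ω : Set (Euc n)) (v : Euc n → Euc n) : Euc n → Euc n :=
  (Reg Ω v).indicator fun x => ‖v x‖ ^ (-1 : ℝ) • v x

lemma dir_apply (x : Euc n) (i : Fin n) :
    dir Ω v x i = (Reg Ω v).indicator (fun x => vf (-1) i (v x)) x := by
  unfold dir vf
  by_cases hx : x ∈ Reg Ω v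
  · simp [indicator_of_mem hx]
  · simp [indicator_of_notMem hx]

lemma norm_dir_le (x : Euc n) : ‖dir Ω v x‖ ≤ 1 := by
  unfold dir
  by_cases hx : x ∈ Reg Ω v
  · have h0 : 0 < ‖v x‖ := norm_pos_iff.2 hx.2
    rw [indicator_of_mem hx, norm_smul, Real.norm_of_nonneg (by positivity), Real.rpow_neg_one,
      inv_mul_cancel₀ h0.ne']
  · simp [indicator_of_notMem hx]

lemma PSol.dir_aesm (S : PSol p Ω u f v) (i : Fin n) :
    AEStronglyMeasurable (fun x => dir Ω v x i) volume := by
  simp only [dir_apply]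
  exact (aestronglyMeasurable_indicator_iff S.isOpen_reg.measurableSet).2
    ((S.cont_comp fun _ hξ => contDiffAt_vf (-1) i hξ).aestronglyMeasurable S.isOpen_reg.measurableSet)

theorem PSol.hess_cz (hn : 0 < n) (S : PSol p Ω u f v) (hH : Hess Ω v H) (hq : 2 ≤ q)
    (hpq : (p - 2) * q < p - 1) (h0 : CZ n q ≠ 0) (hc : |p - 2| ≤ θ) (hcq : |p - 2| * CZ n q ≤ θ)
    (hθ : θ < 1) {φ : Euc n → ℝ} (hφ : IsTestFun Ω φ) (i j : Fin n) :
    MemLp (fun x => φ x * H i j x) (ENNReal.ofReal q) := by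
  have hv := fun i => continuousOn_coord S.cont i
  have hΩ := S.isOpen
  obtain ⟨w, hw⟩ : ∃ w : Euc n → ℝ, w = fun x => φ x * u x := ⟨_, rfl⟩
  obtain ⟨d, hd⟩ : ∃ d : Fin n → Euc n → ℝ, d = fun i x => φ x * v x i + pd φ i x * u x := ⟨_, rfl⟩
  obtain ⟨Y, hY⟩ : ∃ Y : Fin n → Fin n → Euc n → ℝ, Y = fun i j x =>
    pd φ j x * v x i + (pd φ i x * v x j + pd (pd φ i) j x * u x) := ⟨_, rfl⟩
  obtain ⟨X, hX⟩ : ∃ X : Fin n → Fin n → Euc n → ℝ, X = fun i j x => φ x * H i j x + Y i j x := ⟨_, rfl⟩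
  have hwm : MemLp w 2 := by rw [hw]; exact memLp_cutoff_cont hΩ hφ S.ucont 2
  have hdm : ∀ i, MemLp (d i) 2 := fun i => by
    rw [hd]
    exact (memLp_cutoff_cont hΩ hφ (hv i) 2).iadd (memLp_cutoff_cont hΩ (hφ.pd i) S.ucont 2)
  have hYm : ∀ (s : ℝ≥0∞) i j, MemLp (Y i j) s := fun s i j => by
    rw [hY]
    exact (memLp_cutoff_cont hΩ (hφ.pd j) (hv i) s).iadd
      ((memLp_cutoff_cont hΩ (hφ.pd i) (hv j) s).iadd (memLp_cutoff_cont hΩ ((hφ.pd i).pd j) S.ucont s))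
  have hXm : ∀ i j, MemLp (X i j) 2 := fun i j => by
    rw [hX]
    exact ((S.l2_hess hH i j).mul_test hφ).iadd (hYm 2 i j)
  have hwd : ∀ i, WPD univ w (d i) i := fun i => by
    rw [hw, hd]
    exact (S.wpd_u i).localize (.of_continuousOn S.ucont) (.of_continuousOn (hv i)) hφ
  have hdX : ∀ i j, WPD univ (d i) (X i j) j := fun i j => by
    have h1 := (S.wpd_v hH i j).localize (.of_continuousOn (hv i)) (S.l2_hess hH i j) hφ
    have h2 := (S.wpd_u j).localize (.of_continuousOn S.ucont) (.of_continuousOn (hv j)) (hφ.pd i)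
    have l : ∀ {a : Euc n → ℝ}, MemLp a 2 → L2loc univ a := fun h K _ _ => h.restrict K
    have h3 := h1.add h2 (l (memLp_cutoff_cont hΩ hφ (hv i) 2))
      (l (((S.l2_hess hH i j).mul_test hφ).iadd (memLp_cutoff_cont hΩ (hφ.pd j) (hv i) 2)))
      (l (memLp_cutoff_cont hΩ (hφ.pd i) S.ucont 2))
      (l ((memLp_cutoff_cont hΩ (hφ.pd i) (hv j) 2).iadd
        (memLp_cutoff_cont hΩ ((hφ.pd i).pd j) S.ucont 2)))
    refine h3.congr (ae_of_all _ fun x _ => by rw [hd]) (ae_of_all _ fun x _ => ?_)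
    rw [hX, hY]
    ring
  have hK := hφ.isCompact
  obtain ⟨M, hM⟩ := eventually_atTop.1 (moll_test (hwm.locallyIntegrable (by norm_num)) hK isOpen_univ
    (subset_univ _) (fun x hx => by rw [hw]; simp [hφ.eq_zero hx]))
  have hTL : ∀ i j, TL2 (fun m => pd2 (moll (m + M) w) i j) (X i j) := fun i j => by
    have h1 := moll_tl2 (hXm i j)
    have h2 : TL2 (fun m => moll (m + M) (X i j)) (X i j) :=
      ⟨fun m => h1.mem _, h1.memLim, h1.tendsto.comp (tendsto_add_atTop_nat M)⟩
    have e : (fun m => pd2 (moll (m + M) w) i j) = fun m => moll (m + M) (X i j) :=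
      funext fun m => moll_pd2 hwm hdm hwd hdX (m + M) i j
    rwa [e]
  obtain ⟨η, hη⟩ : ∃ η, η = dir Ω v := ⟨_, rfl⟩
  have hη1 : ∀ x, ‖η x‖ ≤ 1 := fun x => by rw [hη]; exact norm_dir_le x
  have hηm : ∀ i, AEStronglyMeasurable (fun x => η x i) volume := fun i => by
    rw [hη]; exact S.dir_aesm i
  have hη2 : ∀ i j x, |η x i * η x j| ≤ 1 := fun i j x => by
    rw [abs_mul]
    exact mul_le_one₀ ((abs_apply_le _ _).trans (hη1 x)) (abs_nonneg _) ((abs_apply_le _ _).trans (hη1 x))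
  have hform : ∀ {Z : Fin n → Fin n → Euc n → ℝ} {s : ℝ≥0∞}, (∀ i j, MemLp (Z i j) s) →
      MemLp (fun x => ∑ i, Z i i x + (p - 2) * ∑ i, ∑ j, Z i j x * (η x i * η x j)) s := by
    intro Z s hZ
    exact (memLp_finsetSum _ fun i _ => hZ i i).iadd
      ((memLp_finsetSum _ fun i _ => memLp_finsetSum _ fun j _ =>
        memLp_mul_bdd (hZ i j) ((hηm i).mul (hηm j)) (hη2 i j)).const_mul (p - 2))
  have hgq : MemLp (fun x => ∑ i, X i i x + (p - 2) * ∑ i, ∑ j, X i j x * (η x i * η x j))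
      (ENNReal.ofReal q) := by
    refine ((S.source_memLp hH hq hpq hφ).iadd (hform (hYm (ENNReal.ofReal q)))).ae_eq ?_
    filter_upwards [S.pde hH] with x hx
    have e1 : ∑ i, X i i x + (p - 2) * ∑ i, ∑ j, X i j x * (η x i * η x j) =
        φ x * (∑ i, H i i x + (p - 2) * ∑ i, ∑ j, H i j x * (η x i * η x j)) +
        (∑ i, Y i i x + (p - 2) * ∑ i, ∑ j, Y i j x * (η x i * η x j)) := by
      rw [hX]
      simp only [add_mul, Finset.sum_add_distrib, mul_add, Finset.mul_sum, mul_assoc]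
      have : ∀ i j, φ x * ((p - 2) * (H i j x * (η x i * η x j))) =
        (p - 2) * (φ x * (H i j x * (η x i * η x j))) := fun i j => by ring
      simp only [this]
      ring
    rw [e1]
    congr 1
    by_cases hxU : x ∈ Reg Ω v
    · rw [indicator_of_mem hxU, ← hx hxU]
      have : ∀ i, η x i = vf (-1) i (v x) := fun i => by rw [hη, dir_apply, indicator_of_mem hxU]
      simp only [this]
    · rw [indicator_of_notMem hxU]
      simp [hH.zero _ _ x hxU]
  have h1 := memLp_of_lop hn hq h0 (fun m => hM (m + M) (by omega)) hTL hη1 hηm (hform hXm) hgq hc hcq hθ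
    (ae_of_all _ fun x => rfl) i j
  refine (h1.isub (hYm _ i j)).ae_eq (ae_of_all _ fun x => ?_)
  rw [hX]
  ring

/-- Local higher integrability of the Hessian. -/
lemma PSol.hess_lq (hn : 0 < n) (S : PSol p Ω u f v) (hH : Hess Ω v H) (hq : 2 ≤ q)
    (hpq : (p - 2) * q < p - 1) (h0 : CZ n q ≠ 0) (hc : |p - 2| ≤ θ) (hcq : |p - 2| * CZ n q ≤ θ)
    (hθ : θ < 1) {r : ℝ} (hr : r ≤ q) {K : Set (Euc n)} (hK : IsCompact K) (hKΩ : K ⊆ Ω)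
    (i j : Fin n) : MemLp (H i j) (ENNReal.ofReal r) (volume.restrict K) := by
  obtain ⟨φ, hφ, -, V, hV, hKV, h1⟩ := exists_cutoff S.isOpen hK hKΩ
  have := isFiniteMeasure_restrict.2 (hK.measure_lt_top (μ := (volume : Measure (Euc n)))).ne
  have h2 := ((S.hess_cz hn hH hq hpq h0 hc hcq hθ hφ i j).restrict K).mono_exponent
    (ENNReal.ofReal_le_ofReal hr)
  refine h2.ae_eq ((ae_restrict_iff' hK.measurableSet).2 (ae_of_all _ fun x hx => ?_))
  simp [h1 x (hKV hx)]

end CZHess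

end

section

open Filter

lemma L2loc.shift_bound {U : Set (Euc n)} (hU : IsOpen U) {g : Euc n → ℝ} (hg : L2loc U g)
    {K : Set (Euc n)} (hK : IsCompact K) (hKU : K ⊆ U) :
    ∃ C δ : ℝ, 0 ≤ C ∧ 0 < δ ∧ ∀ y : Euc n, ‖y‖ ≤ δ →
      IntegrableOn (fun x => g (x + y) ^ 2) K ∧ ∫ x in K, g (x + y) ^ 2 ≤ C := by
  obtain ⟨δ, hδ, hδU⟩ := hK.exists_cthickening_subset_open hU hKU
  have hK' := hK.cthickening (r := δ)
  have hi : IntegrableOn (fun x => g x ^ 2) (Metric.cthickening δ K) :=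
    (hg _ hK' hδU).integrable_sq
  refine ⟨∫ x in Metric.cthickening δ K, g x ^ 2, δ, integral_nonneg fun x => sq_nonneg _, hδ,
    fun y hy => ?_⟩
  have hmp := measurePreserving_add_right (volume : Measure (Euc n)) y
  have hem : MeasurableEmbedding (fun x : Euc n => x + y) := measurableEmbedding_addRight y
  have hsub : K ⊆ (fun x => x + y) ⁻¹' Metric.cthickening δ K := fun x hx =>
    Metric.mem_cthickening_of_dist_le _ x _ _ hx (by simpa [dist_eq_norm] using hy)
  have h1 : IntegrableOn (fun x => g (x + y) ^ 2) ((fun x => x + y) ⁻¹' Metric.cthickening δ K) :=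
    (hmp.integrableOn_comp_preimage hem (f := fun x => g x ^ 2)).2 hi
  refine ⟨h1.mono_set hsub, ?_⟩
  rw [← hmp.setIntegral_preimage_emb hem (fun x => g x ^ 2)]
  exact setIntegral_mono_set h1 (ae_of_all _ fun x => sq_nonneg _) hsub.eventuallyLE

lemma sq_le_of_abs_le' {a b : ℝ} (h : |a| ≤ b) : a ^ 2 ≤ b ^ 2 :=
  sq_le_sq' (abs_le.1 h).1 (abs_le.1 h).2

/-- Pointwise estimates for a perturbed linear elliptic flux. -/
lemma flux_pointwise {lam M z : ℝ} (hl : 0 < lam) {a : Fin n → Fin n → ℝ} {W G E : Fin n → ℝ}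
    (h1 : lam * ∑ k, W k ^ 2 ≤ ∑ j, (∑ k, a j k * W k) * W j) (hM : ∀ j k, |a j k| ≤ M)
    (hG : ∀ j, G j = ∑ k, a j k * W k + E j) (hE : ∀ j, E j ^ 2 ≤ z) :
    lam / 2 * ∑ k, W k ^ 2 ≤ ∑ j, G j * W j + n * (z / (2 * lam)) ∧
      ∀ j, G j ^ 2 ≤ 2 * (n * M ^ 2) * ∑ k, W k ^ 2 + 2 * z := by
  constructor
  · have h2 : ∑ j, G j * W j = ∑ j, (∑ k, a j k * W k) * W j + ∑ j, E j * W j := by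
      simp_rw [hG, add_mul, Finset.sum_add_distrib]
    have h3 : ∑ j, (-(lam / 2 * W j ^ 2 + z / (2 * lam))) ≤ ∑ j, E j * W j := by
      refine Finset.sum_le_sum fun j _ => ?_
      have e : E j * W j + lam / 2 * W j ^ 2 + E j ^ 2 / (2 * lam) =
          (lam * W j + E j) ^ 2 / (2 * lam) := by field_simp; ring
      have : 0 ≤ (lam * W j + E j) ^ 2 / (2 * lam) := by positivity
      have : E j ^ 2 / (2 * lam) ≤ z / (2 * lam) := by gcongr; exact hE j
      linarith
    rw [Finset.sum_neg_distrib, Finset.sum_add_distrib, ← Finset.mul_sum, Finset.sum_const,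
      Finset.card_univ, Fintype.card_fin, nsmul_eq_mul] at h3
    linarith
  · intro j
    have h2 : (∑ k, a j k * W k) ^ 2 ≤ n * M ^ 2 * ∑ k, W k ^ 2 := by
      refine (sq_sum_le_card_mul_sum_sq (s := Finset.univ)).trans ?_
      rw [Finset.card_univ, Fintype.card_fin, mul_assoc, Finset.mul_sum (a := M ^ 2)]
      refine mul_le_mul_of_nonneg_left (Finset.sum_le_sum fun k _ => ?_) (by positivity)
      rw [mul_pow]
      exact mul_le_mul_of_nonneg_right (sq_le_of_abs_le' (hM j k)) (sq_nonneg _)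
    have := hE j
    rw [hG]
    nlinarith [sq_nonneg (∑ k, a j k * W k - E j)]

variable {p : ℝ} {Ω : Set (Euc n)} {u f : Euc n → ℝ} {v : Euc n → Euc n}
  {H : Fin n → Fin n → Euc n → ℝ}

lemma error_pointwise {b b' h : Fin n → ℝ} {d N t ε c F : ℝ} (ht : 0 < t) 
    (hb : ∀ k, (b' k - b k) ^ 2 ≤ c * N) (hN : N ^ 2 ≤ ε) (hc : 0 ≤ c) (hN0 : 0 ≤ N)
    (hd : d ^ 2 ≤ F * t ^ 2) :
    (∑ k, (b' k - b k) * h k + d) ^ 2 ≤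
      2 * (n * (n * c)) * (ε * (t ^ 2)⁻¹ + t ^ 2 * ∑ k, (h k ^ 2) ^ 2) + 2 * (F * t ^ 2) := by
  have h1 : (∑ k, (b' k - b k) * h k) ^ 2 ≤
      n * (n * c) * (ε * (t ^ 2)⁻¹ + t ^ 2 * ∑ k, (h k ^ 2) ^ 2) := by
    refine (sq_sum_le_card_mul_sum_sq (s := Finset.univ)).trans ?_
    rw [Finset.card_univ, Fintype.card_fin, mul_assoc]
    gcongr
    calc _ ≤ ∑ k : Fin n, c * (ε * (t ^ 2)⁻¹ + t ^ 2 * ∑ k, (h k ^ 2) ^ 2) := by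
          refine Finset.sum_le_sum fun k _ => ?_
          have hk : (h k ^ 2) ^ 2 ≤ ∑ k, (h k ^ 2) ^ 2 :=
            Finset.single_le_sum (f := fun k => (h k ^ 2) ^ 2) (fun k _ => sq_nonneg _)
              (Finset.mem_univ k)
          have h2 : N * h k ^ 2 ≤ N ^ 2 * (t ^ 2)⁻¹ + t ^ 2 * (h k ^ 2) ^ 2 := by
            have e : N ^ 2 * (t ^ 2)⁻¹ + t ^ 2 * (h k ^ 2) ^ 2 - 2 * (N * h k ^ 2) =
              (N - t ^ 2 * h k ^ 2) ^ 2 * (t ^ 2)⁻¹ := by field_simp; ring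
            have : 0 ≤ (N - t ^ 2 * h k ^ 2) ^ 2 * (t ^ 2)⁻¹ := by positivity
            have : 0 ≤ N * h k ^ 2 := by positivity
            linarith
          calc _ = (b' k - b k) ^ 2 * h k ^ 2 := by ring
            _ ≤ c * N * h k ^ 2 := by gcongr; exact hb k
            _ = c * (N * h k ^ 2) := by ring
            _ ≤ c * (N ^ 2 * (t ^ 2)⁻¹ + t ^ 2 * (h k ^ 2) ^ 2) := by gcongr
            _ ≤ _ := by gcongr
      _ = _ := by simp; ring
  nlinarith [sq_nonneg (∑ k, (b' k - b k) * h k - d)]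

set_option maxHeartbeats 2000000 in
lemma PSol.dq_hess (S : PSol p Ω u f v) (hH : Hess Ω v H)
    (hH4 : ∀ i j, L2loc (Reg Ω v) (fun x => H i j x ^ 2)) (i : Fin n) {K : Set (Euc n)}
    (hK : IsCompact K) (hKU : K ⊆ Reg Ω v) :
    ∃ C δ : ℝ, 0 ≤ C ∧ 0 < δ ∧ ∀ y : Euc n, ‖y‖ ≤ δ → ∀ j,
      ∫ x in K, (H i j (x + y) - H i j x) ^ 2 ≤ C * ‖y‖ ^ 2 := by
  have hfl : L2loc (Reg Ω v) f := .of_continuousOn (S.fcont'.mono reg_subset)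
  refine dq_bound S.isOpen_reg (G := fun j x => AH p v H i j x + if j = i then f x else 0)
    (g := fun _ => 0) (w := fun x => v x i)
    (fun j => (S.l2_AH hH i j).add ?_)
    (.of_continuousOn continuousOn_const) (.of_continuousOn (continuousOn_coord S.cont_reg i))
    (hH.l2 i) (hH.wpd i) (fun ψ hψ => ?_) (fun K hK hKU => ?_) hK hKU
  · split_ifs
    · exact hfl
    · exact .of_continuousOn continuousOn_const
  · have h1 := S.lin hH i hψ
    have h2 := S.wpd_f i _ (hψ.mono reg_subset)
    have h3 : ∀ j, ∫ x, (AH p v H i j x + if j = i then f x else 0) * pd ψ j x =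
        (∫ x, AH p v H i j x * pd ψ j x) + if j = i then ∫ x, f x * pd ψ j x else 0 := by
      intro j
      split_ifs
      · simp_rw [add_mul]
        exact integral_add ((S.l2_AH hH i j).integrable_test (hψ.pd j))
          (hfl.integrable_test (hψ.pd j))
      · simp
    simp_rw [h3, Finset.sum_add_distrib, h1]
    simp [h2]
  obtain ⟨r, R, δ, hr, hR, hδ, han⟩ := exists_annulus S.isOpen_reg S.cont_reg
    (fun x hx => hx.2) hK hKU
  obtain ⟨F, δ₂, hF, hδ₂, h2⟩ := C1_shift_bound S.isOpen S.fdiff S.fcont hK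
    (hKU.trans reg_subset)
  have h4 := fun m => shift_four S.isOpen_reg (continuousOn_coord S.cont_reg m) (hH.l2 m) (hH4 m)
    (hH.wpd m) hK hKU
  choose C₄ δ₄ hC₄ hδ₄ h4 using h4
  have h5 := fun j => (hH4 i j).shift_bound S.isOpen_reg hK hKU
  choose C₅ δ₅ hC₅ hδ₅ h5 using h5
  set s := p - 2 with hs
  have hs1 : -1 < s := by linarith [S.one_lt]
  set M := (1 + |s|) * max (r ^ s) (R ^ s) with hM
  set M' := (3 * |s| + |s| * |s - 2|) * max (r ^ (s - 1)) (R ^ (s - 1)) with hM'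
  set lam := min 1 (1 + s) * min (r ^ s) (R ^ s) with hlam
  have hl : 0 < lam := by
    have : 0 < min 1 (1 + s) := lt_min one_pos (by linarith)
    positivity
  have hM'0 : 0 ≤ M' := by positivity
  set c := M' ^ 2 * n with hc
  have hc0 : 0 ≤ c := by positivity
  obtain ⟨D, hD, hDc⟩ : ∃ D : ℝ, D = 2 * (n * (n * c)) + 2 * F ∧ 0 ≤ D := ⟨_, rfl, by positivity⟩
  obtain ⟨A, hA⟩ : ∃ A : ℝ, A = 1 + n / (2 * lam) * D + 2 * D := ⟨_, rfl⟩
  have hA0 : 0 ≤ A := by rw [hA]; positivity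
  obtain ⟨δ', hδ'0, hδ'⟩ : ∃ δ' : ℝ, 0 < δ' ∧ δ' ≤ δ ∧ δ' ≤ δ₂ ∧ ∀ m, δ' ≤ δ₄ m ∧ δ' ≤ δ₅ m := by
    have h1 : ∀ᶠ δ' in 𝓝[>] (0 : ℝ), 0 < δ' ∧ δ' ≤ δ ∧ δ' ≤ δ₂ ∧ ∀ m, δ' ≤ δ₄ m ∧ δ' ≤ δ₅ m := by
      have h : ∀ d : ℝ, 0 < d → ∀ᶠ δ' in 𝓝[>] (0 : ℝ), δ' ≤ d := fun d hd =>
        nhdsWithin_le_nhds (Iic_mem_nhds hd)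
      exact (eventually_mem_nhdsWithin).and ((h _ hδ).and ((h _ hδ₂).and (eventually_all.2 fun m =>
        (h _ (hδ₄ m)).and (h _ (hδ₅ m)))))
    exact h1.exists
  refine ⟨A * (volume.real K + n * ∑ m, C₄ m + ∑ j, C₅ j), lam / 2, 2 * (n * M ^ 2), δ', ?_,
    by positivity, by positivity, hδ'0, fun y hy => ?_⟩
  · have : 0 ≤ ∑ m, C₄ m := Finset.sum_nonneg fun m _ => hC₄ m
    have : 0 ≤ ∑ m, C₅ m := Finset.sum_nonneg fun m _ => hC₅ m
    positivity
  rcases eq_or_ne y 0 with rfl | hy0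
  · exact ⟨fun _ => 0, integrableOn_zero, by simp, .of_forall fun x _ => by simp⟩
  have ht : 0 < ‖y‖ := norm_pos_iff.2 hy0
  set t := ‖y‖ with htd
  have hyδ := hy.trans hδ'.1
  have hvi : ∀ m, IntegrableOn (fun x => (v (x + y) m - v x m) ^ 4) K := fun m => by
    have c1 := (continuousOn_coord S.cont_reg m)
    have c2 : ContinuousOn (fun x => v (x + y) m) K :=
      c1.comp (f := fun x => x + y) (by fun_prop) fun x hx => (han y hyδ x hx).1
    exact ((c2.sub (c1.mono hKU)).pow 4).integrableOn_compact hK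
  have i1 : IntegrableOn (fun x => n * ∑ m, (v (x + y) m - v x m) ^ 4) K :=
    (integrable_finsetSum _ fun m _ => hvi m).const_mul _
  have i2 : IntegrableOn (fun x => ∑ j, (H i j (x + y) ^ 2) ^ 2) K :=
    integrable_finsetSum _ fun j _ => (h5 j y (hy.trans (hδ'.2.2 j).2)).1
  have i3 : IntegrableOn (fun _ : Euc n => t ^ 2) K := integrableOn_const (hK.measure_lt_top.ne)
  refine ⟨fun x => A * (t ^ 2 + (n * ∑ m, (v (x + y) m - v x m) ^ 4) * (t ^ 2)⁻¹ +
    t ^ 2 * ∑ j, (H i j (x + y) ^ 2) ^ 2), ?_, ?_, .of_forall fun x hx => ?_⟩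
  · exact ((i3.iadd (i1.mul_const _)).iadd (i2.const_mul _)).const_mul _
  · rw [integral_const_mul, integral_add (i3.iadd (i1.mul_const _)) (i2.const_mul _),
      integral_add i3 (i1.mul_const _), integral_mul_const, integral_const_mul, integral_const_mul,
      integral_finsetSum _ (fun m _ => hvi m),
      integral_finsetSum _ (fun j _ => (h5 j y (hy.trans (hδ'.2.2 j).2)).1), mul_assoc A]
    refine mul_le_mul_of_nonneg_left ?_ hA0
    have e1 : ∑ m, ∫ x in K, (v (x + y) m - v x m) ^ 4 ≤ (∑ m, C₄ m) * t ^ 4 := by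
      rw [Finset.sum_mul]
      exact Finset.sum_le_sum fun m _ => h4 m y (hy.trans (hδ'.2.2 m).1)
    have e2 : ∑ j, ∫ x in K, (H i j (x + y) ^ 2) ^ 2 ≤ ∑ j, C₅ j :=
      Finset.sum_le_sum fun j _ => (h5 j y (hy.trans (hδ'.2.2 j).2)).2
    have e3 : n * (∑ m, ∫ x in K, (v (x + y) m - v x m) ^ 4) * (t ^ 2)⁻¹ ≤
        n * ((∑ m, C₄ m) * t ^ 4) * (t ^ 2)⁻¹ := by gcongr
    have e4 : n * ((∑ m, C₄ m) * t ^ 4) * (t ^ 2)⁻¹ = n * (∑ m, C₄ m) * t ^ 2 := by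
      field_simp
    simp only [integral_const, smul_eq_mul, MeasurableSet.univ, measureReal_restrict_apply,
      univ_inter]
    have e5 := mul_le_mul_of_nonneg_left e2 (sq_nonneg t)
    linarith
  obtain ⟨hxy, hseg⟩ := han y hyδ x hx
  have hne : ∀ τ ∈ Icc (0 : ℝ) 1, v x + τ • (v (x + y) - v x) ≠ 0 := fun τ hτ h0 => by
    have := (hseg τ hτ).1
    rw [h0, norm_zero] at this
    linarith
  have hvx : v x ≠ 0 := (hKU hx).2
  have hx0 := hseg 0 ⟨le_rfl, zero_le_one⟩
  rw [zero_smul, add_zero] at hx0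
  set N := ‖v (x + y) - v x‖ ^ 2 with hN
  set ε := n * ∑ m, (v (x + y) m - v x m) ^ 4 with hε
  set Z := t ^ 2 + ε * (t ^ 2)⁻¹ + t ^ 2 * ∑ j, (H i j (x + y) ^ 2) ^ 2 with hZ
  have hNε : N ^ 2 ≤ ε := by
    rw [hN, norm_sq_eq_sum]
    refine (sq_sum_le_card_mul_sum_sq (s := Finset.univ)).trans ?_
    rw [Finset.card_univ, Fintype.card_fin, hε]
    refine mul_le_mul_of_nonneg_left (Finset.sum_le_sum fun m _ => le_of_eq ?_) (by positivity)
    simp only [PiLp.sub_apply]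
    ring
  have hN0 : 0 ≤ N := sq_nonneg _
  have hε0 : 0 ≤ ε := (sq_nonneg _).trans hNε
  have hS0 : 0 ≤ ∑ j, (H i j (x + y) ^ 2) ^ 2 := Finset.sum_nonneg fun _ _ => sq_nonneg _
  have hZ0 : 0 ≤ Z := by positivity
  have hE : ∀ j, (∑ k, (dvf s j k (v (x + y)) - dvf s j k (v x)) * H i k (x + y) +
      if j = i then f (x + y) - f x else 0) ^ 2 ≤ D * Z := by
    intro j
    refine (error_pointwise (b := fun k => dvf s j k (v x)) (b' := fun k => dvf s j k (v (x + y)))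
      (F := F) (ε := ε) (c := c) (N := N) ht (fun k => ?_) hNε hc0 hN0 ?_).trans ?_
    · refine sq_sub_le_of_segment (Φ := dvf s j k) (M := M')
        (fun τ hτ => (contDiffAt_dvf s j k (hne τ hτ)).differentiableAt (by simp)) fun τ hτ m => ?_
      refine (abs_pd_dvf_le s j k m (hne τ hτ)).trans ?_
      rw [hM']
      gcongr
      exact (rpow_between _ hr (hseg τ hτ).1 (hseg τ hτ).2).2
    · split_ifs
      · exact h2 y (hy.trans hδ'.2.1) x hx
      · simpa using mul_nonneg hF (sq_nonneg t)
    · have q1 : ε * (t ^ 2)⁻¹ + t ^ 2 * ∑ j, (H i j (x + y) ^ 2) ^ 2 ≤ Z := by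
        rw [hZ, add_assoc]
        exact le_add_of_nonneg_left (sq_nonneg t)
      have q2 : t ^ 2 ≤ Z := by
        rw [hZ]
        have : 0 ≤ ε * (t ^ 2)⁻¹ := by positivity
        have : 0 ≤ t ^ 2 * ∑ j, (H i j (x + y) ^ 2) ^ 2 := by positivity
        linarith
      have q3 : 0 ≤ 2 * (n * (n * c)) := by positivity
      rw [hD]
      have q4 := mul_le_mul_of_nonneg_left q1 q3
      have q5 := mul_le_mul_of_nonneg_left q2 hF
      rw [add_mul]
      linarith
  have hfl := flux_pointwise (n := n) (a := fun j k => dvf s j k (v x)) (M := M) (z := D * Z)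
    (W := fun k => H i k (x + y) - H i k x)
    (G := fun j => (AH p v H i j (x + y) + if j = i then f (x + y) else 0) -
      (AH p v H i j x + if j = i then f x else 0)) hl
    ?_ (fun j k => ?_) (fun j => ?_) hE
  · have hDZ : 0 ≤ D * Z := by positivity
    have hnl : 0 ≤ n / (2 * lam) * D * Z := by positivity
    have eA : A * Z = Z + n / (2 * lam) * D * Z + 2 * (D * Z) := by rw [hA]; ring
    have k1 : n * (D * Z / (2 * lam)) ≤ A * Z := by
      have : n * (D * Z / (2 * lam)) = n / (2 * lam) * D * Z := by ring
      linarith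
    have k2 : 2 * (D * Z) ≤ A * Z := by linarith
    have k3 : Z ≤ A * Z := by linarith
    refine ⟨by linarith [hfl.1], fun j => by linarith [hfl.2 j], ?_, ?_⟩
    · have w1 : (v (x + y) i - v x i) ^ 2 ≤ N := by
        have := abs_apply_le (v (x + y) - v x) i
        exact sq_le_of_abs_le' this
      have w2 : N ≤ t ^ 2 + ε * (t ^ 2)⁻¹ := by
        have e : t ^ 2 + N ^ 2 * (t ^ 2)⁻¹ - 2 * N = (t ^ 2 - N) ^ 2 * (t ^ 2)⁻¹ := by
          field_simp; ring
        have : 0 ≤ (t ^ 2 - N) ^ 2 * (t ^ 2)⁻¹ := by positivity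
        have : N ^ 2 * (t ^ 2)⁻¹ ≤ ε * (t ^ 2)⁻¹ := by gcongr
        linarith
      have w3 : 0 ≤ t ^ 2 * ∑ j, (H i j (x + y) ^ 2) ^ 2 := by positivity
      have : N ≤ Z := by rw [hZ]; linarith
      linarith
    · simp only [sub_self, ne_eq, OfNat.ofNat_ne_zero, not_false_eq_true, zero_pow]
      positivity
  · refine le_trans ?_ (dvf_elliptic' hvx _)
    have hp : 0 ≤ ∑ k, (H i k (x + y) - H i k x) ^ 2 := Finset.sum_nonneg fun _ _ => sq_nonneg _
    rw [hlam]
    gcongr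
    · exact (le_min zero_le_one (by linarith))
    · exact (rpow_between s hr hx0.1 hx0.2).1
  · refine (abs_dvf_le s j k hvx).trans ?_
    rw [hM]
    gcongr
    exact (rpow_between s hr hx0.1 hx0.2).2
  · simp only [AH, ← hs]
    have : ∑ k, dvf s j k (v x) * (H i k (x + y) - H i k x) +
        ∑ k, (dvf s j k (v (x + y)) - dvf s j k (v x)) * H i k (x + y) =
        ∑ k, dvf s j k (v (x + y)) * H i k (x + y) - ∑ k, dvf s j k (v x) * H i k x := by
      rw [← Finset.sum_add_distrib, ← Finset.sum_sub_distrib]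
      exact Finset.sum_congr rfl fun k _ => by ring
    rw [← add_assoc, this]
    split_ifs <;> ring

end

section

open Filter

variable {p : ℝ} {Ω : Set (Euc n)} {u f : Euc n → ℝ} {v : Euc n → Euc n}
  {H : Fin n → Fin n → Euc n → ℝ} {T : Fin n → Fin n → Fin n → Euc n → ℝ}

/-- Third derivatives of `u` on the regular set. -/
structure Third (Ω : Set (Euc n)) (v : Euc n → Euc n) (H : Fin n → Fin n → Euc n → ℝ)
    (T : Fin n → Fin n → Fin n → Euc n → ℝ) : Prop where
  sq : ∀ i j, L2loc (Reg Ω v) (fun x => H i j x ^ 2)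
  l2 : ∀ i j l, L2loc (Reg Ω v) (T i j l)
  wpd : ∀ i j l, WPD (Reg Ω v) (H i j) (T i j l) l
  symm : ∀ i j l, ∀ᵐ x, x ∈ Reg Ω v → T i j l x = T i l j x
  zero : ∀ i j l x, x ∉ Reg Ω v → T i j l x = 0

lemma PSol.exists_third (S : PSol p Ω u f v) (hH : Hess Ω v H)
    (hH4 : ∀ i j, L2loc (Reg Ω v) (fun x => H i j x ^ 2)) : ∃ T, Third Ω v H T := by
  have h1 : ∀ i j l, ∃ d, L2loc (Reg Ω v) d ∧ WPD (Reg Ω v) (H i j) d l ∧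
      ∀ x, x ∉ Reg Ω v → d x = 0 := by
    intro i j l
    obtain ⟨d, hd, hw⟩ := exists_wpd_of_dq S.isOpen_reg (hH.l2 i j) l fun K hK hKU => by
      obtain ⟨C, δ, hC, hδ, h⟩ := S.dq_hess hH hH4 i hK hKU
      exact ⟨C, δ, hC, hδ, fun y hy => h y hy j⟩
    exact exists_zero_off hd hw
  choose T hT hw hz using h1
  exact ⟨T, hH4, hT, hw, fun i j l => wpd_symm S.isOpen_reg (hH.wpd i j) (hH.wpd i l) (hw i j l)
    (hw i l j) (hT i j l) (hT i l j), hz⟩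

lemma L2loc.mul_of_sq {U : Set (Euc n)} {g h : Euc n → ℝ} (hg : L2loc U g) (hh : L2loc U h)
    (hg2 : L2loc U (fun x => g x ^ 2)) (hh2 : L2loc U (fun x => h x ^ 2)) :
    L2loc U (fun x => g x * h x) := fun K hK hKU => by
  refine ((hg2 K hK hKU).iadd (hh2 K hK hKU)).mono
    ((hg K hK hKU).1.mul (hh K hK hKU).1) (ae_of_all _ fun x => ?_)
  rw [Real.norm_eq_abs, Real.norm_eq_abs, abs_mul, ← sq_abs (g x), ← sq_abs (h x)]
  refine le_trans ?_ (le_abs_self _)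
  nlinarith [sq_nonneg (|g x| - |h x|), sq_nonneg (|g x|), sq_nonneg (|h x|)]

lemma Third.mul (hT : Third Ω v H T) (hH : Hess Ω v H) (i j k l : Fin n) :
    L2loc (Reg Ω v) (fun x => H i j x * H k l x) :=
  (hH.l2 i j).mul_of_sq (hH.l2 k l) (hT.sq i j) (hT.sq k l)

lemma contDiffAt_pd_dvf (s : ℝ) (j k m : Fin n) {ξ : Euc n} (hξ : ξ ≠ 0) :
    ContinuousAt (pd (dvf s j k) m) ξ := by
  have h : ContDiffAt ℝ 1 (dvf s j k) ξ := (contDiffAt_dvf s j k hξ).of_le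
    (by exact_mod_cast le_top)
  have h2 : ContDiffAt ℝ 0 (fderiv ℝ (dvf s j k)) ξ := h.fderiv_right (by norm_num)
  exact (h2.continuousAt.clm_apply continuousAt_const)

/-- Derivative of `dvf s j k (v) * H i k` in direction `l`, summed over `k`. -/
def dflux (s : ℝ) (v : Euc n → Euc n) (H : Fin n → Fin n → Euc n → ℝ)
    (T : Fin n → Fin n → Fin n → Euc n → ℝ) (i l j : Fin n) (x : Euc n) : ℝ :=
  ∑ k, (dvf s j k (v x) * T i k l x + ∑ m, pd (dvf s j k) m (v x) * (H m l x * H i k x))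

lemma PSol.l2_dflux (S : PSol p Ω u f v) (hH : Hess Ω v H) (hT : Third Ω v H T) (s : ℝ)
    (i l j : Fin n) : L2loc (Reg Ω v) (dflux s v H T i l j) := by
  refine L2loc.sum _ fun k _ => ((hT.l2 i k l).mul_cont
    (S.cont_comp fun _ hξ => contDiffAt_dvf s j k hξ)).add (L2loc.sum _ fun m _ =>
      (hT.mul hH m l i k).mul_cont fun x hx => ?_)
  exact (contDiffAt_pd_dvf s j k m hx.2).comp_continuousWithinAt (S.cont_reg x hx)

lemma PSol.wpd_dflux (S : PSol p Ω u f v) (hH : Hess Ω v H) (hT : Third Ω v H T) (s : ℝ)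
    (i l j : Fin n) : WPD (Reg Ω v) (fun x => ∑ k, dvf s j k (v x) * H i k x)
      (dflux s v H T i l j) l := by
  have hc := fun k m => fun x (hx : x ∈ Reg Ω v) =>
    (contDiffAt_pd_dvf s j k m hx.2).comp_continuousWithinAt (S.cont_reg x hx)
  have hd : ∀ k, L2loc (Reg Ω v) (fun x => dvf s j k (v x)) := fun k =>
    .of_continuousOn (S.cont_comp fun _ hξ => contDiffAt_dvf s j k hξ)
  have h1 : ∀ k, WPD (Reg Ω v) (fun x => dvf s j k (v x) * H i k x)
      (fun x => (∑ m, pd (dvf s j k) m (v x) * H m l x) * H i k x + dvf s j k (v x) * T i k l x)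
      l := fun k =>
    WPD.mul (WPD.chain S.isOpen_reg isOpen_ne_zero (fun ξ hξ => ((contDiffAt_dvf s j k hξ).of_le
      (by exact_mod_cast le_top)).contDiffWithinAt) S.cont_reg (fun x hx => hx.2)
      (fun m => hH.l2 m l) fun m => hH.wpd m l) (hT.wpd i k l) S.isOpen_reg (hd k)
      (L2loc.sum _ fun m _ => (hH.l2 m l).mul_cont (hc k m)) (hH.l2 i k) (hT.l2 i k l)
  have h2 : ∀ k, L2loc (Reg Ω v) (fun x => (∑ m, pd (dvf s j k) m (v x) * H m l x) * H i k x +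
      dvf s j k (v x) * T i k l x) := fun k => by
    refine L2loc.add ?_ ((hT.l2 i k l).mul_cont
      (S.cont_comp fun _ hξ => contDiffAt_dvf s j k hξ))
    refine (L2loc.sum Finset.univ fun m _ => (hT.mul hH m l i k).mul_cont (hc k m)).congr
      (.of_forall fun x _ => ?_)
    rw [Finset.sum_mul]
    exact Finset.sum_congr rfl fun m _ => by simp only [Function.comp]; ring
  refine (WPD.sum Finset.univ (fun k _ => h1 k) ?_ ?_).congr (.of_forall fun _ _ => rfl)
    (.of_forall fun x _ => ?_)
  · exact fun k _ => (hH.l2 i k).mul_cont (S.cont_comp fun _ hξ => contDiffAt_dvf s j k hξ)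
  · exact fun k _ => h2 k
  · refine Finset.sum_congr rfl fun k _ => ?_
    rw [Finset.sum_mul, add_comm]
    congr 1
    exact Finset.sum_congr rfl fun m _ => by ring

lemma PSol.lin_third (S : PSol p Ω u f v) (hH : Hess Ω v H) (hT : Third Ω v H T) (i l : Fin n)
    {ψ : Euc n → ℝ} (hψ : IsTestFun (Reg Ω v) ψ) :
    ∑ j, ∫ x, (dflux (p - 2) v H T i l j x + if j = l then pd f i x else 0) * pd ψ j x =
      ∫ x, (0 : ℝ) * ψ x := by
  have h1 := S.lin hH i (hψ.pd l)
  have hfl : L2loc (Reg Ω v) (pd f i) := .of_continuousOn ((S.fcont i).mono reg_subset)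
  have h2 : ∀ j, ∫ x, AH p v H i j x * pd (pd ψ l) j x =
      -∫ x, dflux (p - 2) v H T i l j x * pd ψ j x := fun j => by
    simp_rw [pd_comm hψ.1 l j]
    exact S.wpd_dflux hH hT (p - 2) i l j _ (hψ.pd j)
  have h3 : ∀ j, ∫ x, (dflux (p - 2) v H T i l j x + if j = l then pd f i x else 0) * pd ψ j x =
      (∫ x, dflux (p - 2) v H T i l j x * pd ψ j x) +
        if j = l then ∫ x, pd f i x * pd ψ j x else 0 := by
    intro j
    split_ifs
    · simp_rw [add_mul]
      exact integral_add ((S.l2_dflux hH hT _ i l j).integrable_test (hψ.pd j))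
        (hfl.integrable_test (hψ.pd j))
    · simp
  simp_rw [h2, Finset.sum_neg_distrib] at h1
  simp_rw [h3, Finset.sum_add_distrib, zero_mul, integral_zero]
  simp only [Finset.sum_ite_eq', Finset.mem_univ, if_true]
  linarith

end

section

open Filter

lemma young_three {c N K g y ρ β S : ℝ} (hc : 0 < c) (hN : 1 ≤ N) (hy : y ^ 2 ≤ N * (S * g ^ 2)) :
    c / 2 * (S * g ^ 2) - ((N / c + N) * (ρ ^ 2 * g ^ 2) +
      (N * (N * K) ^ 2 / c + N) * β ^ 2) ≤
      c * (S * g ^ 2) - (ρ * g * y + N * K * (y * β) + N * (ρ * g * β)) := by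
  have hN0 : 0 < N := by linarith
  have e1 : c / (4 * N) * y ^ 2 + N / c * (ρ ^ 2 * g ^ 2) - ρ * g * y =
      (c * y - 2 * N * (ρ * g)) ^ 2 / (4 * N * c) := by field_simp; ring
  have e2 : c / (4 * N) * y ^ 2 + N * (N * K) ^ 2 / c * β ^ 2 - N * K * (y * β) =
      (c * y - 2 * N * (N * K * β)) ^ 2 / (4 * N * c) := by field_simp; ring
  have h1 : 0 ≤ (c * y - 2 * N * (ρ * g)) ^ 2 / (4 * N * c) := by positivity
  have h2 : 0 ≤ (c * y - 2 * N * (N * K * β)) ^ 2 / (4 * N * c) := by positivity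
  have h3 : N * (ρ * g * β) ≤ N * (ρ ^ 2 * g ^ 2 + β ^ 2) := by
    refine mul_le_mul_of_nonneg_left ?_ hN0.le
    nlinarith [sq_nonneg (ρ * g - β), sq_nonneg (ρ * g), sq_nonneg β]
  have h4 : c / (4 * N) * y ^ 2 ≤ c / 4 * (S * g ^ 2) := by
    calc _ ≤ c / (4 * N) * (N * (S * g ^ 2)) := by gcongr
      _ = _ := by field_simp
  linarith

lemma two_mul_add_le {x y k : ℝ} (hx : 0 ≤ x) (hy : 0 ≤ y) (hk : 0 ≤ k) :
    2 * (k * x) + 8 * y ≤ (2 * k + 8) * (x + y) := by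
  linarith [mul_nonneg hk hy]

lemma add_le_of_le_mul {D E a b x y : ℝ} (hx : 0 ≤ x) (hy : 0 ≤ y) (hD : 0 ≤ D) (hE : 0 ≤ E)
    (ha : D * a ≤ D * y) (hb : b ≤ E * x) : D * a + b ≤ (D + E) * (x + y) := by
  linarith [mul_nonneg hD hx, mul_nonneg hE hy]

set_option maxHeartbeats 2000000 in
/-- Pointwise coercivity behind the weighted third-order estimate. -/
lemma third_energy_pointwise (n : ℕ) {s C : ℝ} (hs : -1 < s) (hC : 0 ≤ C) :
    ∃ D : ℝ, 0 ≤ D ∧ ∀ {τ δ φ : ℝ} {ξ : Euc n} (_ : ξ ≠ 0) {a z X φ' : Fin n → ℝ}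
      {w h ρ m : ℝ} (_ : |w| ≤ h) (_ : ∀ j, |z j| ≤ n * ‖ξ‖ * h)
      (_ : ∀ j, |X j - ∑ k, dvf s j k ξ * a k| ≤ ρ) (_ : ∀ j, |φ' j| ≤ m)
      (_ : |cPhi τ δ ξ| ≤ C * (eta δ ξ * ‖ξ‖ ^ (τ - 2))) (_ : 0 ≤ ρ) (_ : 0 ≤ m),
      eta δ ξ ^ 2 * (min 1 (1 + s) / 2 * (‖ξ‖ ^ (τ + s) * ((∑ k, a k ^ 2) * φ ^ 2))) ≤
        ∑ j, X j * (a j * (Phi τ δ ξ * φ ^ 2) + w * (cPhi τ δ ξ * z j * φ ^ 2 +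
          Phi τ δ ξ * (2 * φ * φ' j))) +
        D * (‖ξ‖ ^ (τ + s - 2) * ((h ^ 2) ^ 2 * φ ^ 2) + ‖ξ‖ ^ (τ + s) * (h ^ 2 * m ^ 2) +
          ‖ξ‖ ^ (τ - s) * (ρ ^ 2 * φ ^ 2)) := by
  obtain ⟨c, hc⟩ : ∃ c, c = min 1 (1 + s) := ⟨_, rfl⟩
  have hc0 : 0 < c := by rw [hc]; exact lt_min one_pos (by linarith)
  obtain ⟨N, hN⟩ : ∃ N : ℝ, N = n + 1 := ⟨_, rfl⟩
  have hN1 : 1 ≤ N := by rw [hN]; linarith [(Nat.cast_nonneg n : (0 : ℝ) ≤ n)]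
  have hnN : (n : ℝ) ≤ N := by rw [hN]; linarith
  obtain ⟨K, hK⟩ : ∃ K : ℝ, K = 1 + |s| := ⟨_, rfl⟩
  have hK0 : 0 ≤ K := by rw [hK]; positivity
  obtain ⟨D₁, hD₁⟩ : ∃ D₁ : ℝ, D₁ = N / c + N := ⟨_, rfl⟩
  obtain ⟨D₂, hD₂⟩ : ∃ D₂ : ℝ, D₂ = N * (N * K) ^ 2 / c + N := ⟨_, rfl⟩
  have hN0 : 0 ≤ N := by linarith
  have hD₁0 : 0 ≤ D₁ := by rw [hD₁]; positivity
  have hD₂0 : 0 ≤ D₂ := by rw [hD₂]; positivity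
  refine ⟨D₁ + D₂ * (2 * (C * n) ^ 2 + 8), by positivity, ?_⟩
  intro τ δ φ ξ hξ a z X φ' w h ρ m hw hz hX hφ' hcP hρ hm
  rw [← hc]
  set P := ‖ξ‖ with hP
  have hP0 : 0 < P := norm_pos_iff.2 hξ
  set E := eta δ ξ with hE
  have hE0 : 0 ≤ E := eta_nonneg δ ξ
  have hE1 : E ≤ 1 := eta_le_one δ ξ
  have hE2 : E ^ 2 ≤ E := by nlinarith
  have hh : 0 ≤ h := (abs_nonneg _).trans hw
  set A := ∑ k, |a k| with hA
  have hA0 : 0 ≤ A := Finset.sum_nonneg fun _ _ => abs_nonneg _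
  set S := ∑ k, a k ^ 2 with hS
  have hS0 : 0 ≤ S := Finset.sum_nonneg fun _ _ => sq_nonneg _
  have hAS : A ^ 2 ≤ N * S := by
    have := sq_sum_le_card_mul_sum_sq (s := Finset.univ) (f := fun j => |a j|)
    simp only [sq_abs, Finset.card_univ, Fintype.card_fin] at this
    exact this.trans (by gcongr)
  set g := E * |φ| with hg
  have hg0 : 0 ≤ g := by positivity
  set β := C * n * (h ^ 2 / P) * |φ| + 2 * h * m with hβ
  have hβ0 : 0 ≤ β := by positivity
  have ePhi : Phi τ δ ξ = P ^ τ * E ^ 2 := rfl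
  have ePhi2 : Phi τ δ ξ * φ ^ 2 = P ^ τ * g ^ 2 := by rw [ePhi, hg, mul_pow, sq_abs]; ring
  have eτ : P ^ (τ - 2) * P = P ^ τ * P⁻¹ := by
    rw [← Real.rpow_neg_one, ← Real.rpow_add hP0]
    nth_rw 2 [← Real.rpow_one P]
    rw [← Real.rpow_add hP0]; congr 1; ring
  have hPτ : 0 < P ^ τ := by positivity
  have hPs : 0 < P ^ s := by positivity
  have hb : ∀ j, |w * (cPhi τ δ ξ * z j * φ ^ 2 + Phi τ δ ξ * (2 * φ * φ' j))| ≤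
      P ^ τ * g * β := by
    intro j
    rw [abs_mul]
    calc _ ≤ h * (C * (E * P ^ (τ - 2)) * (n * P * h) * φ ^ 2 + P ^ τ * E ^ 2 * (2 * |φ| * m)) := by
          refine mul_le_mul hw ((abs_add_le _ _).trans (add_le_add ?_ ?_)) (abs_nonneg _) hh
          · rw [abs_mul, abs_mul, abs_of_nonneg (sq_nonneg φ)]
            gcongr
            exact hz j
          · rw [ePhi]
            simp only [abs_mul, abs_two, abs_of_pos hPτ, abs_of_nonneg (sq_nonneg E)]
            gcongr
            exact hφ' j
      _ ≤ h * (C * (E * P ^ (τ - 2)) * (n * P * h) * φ ^ 2 + P ^ τ * E * (2 * |φ| * m)) := by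
          gcongr
      _ = C * n * h ^ 2 * E * φ ^ 2 * (P ^ (τ - 2) * P) + P ^ τ * E * |φ| * (2 * h * m) := by ring
      _ = _ := by rw [eτ, hg, hβ, ← sq_abs φ]; ring
  have hXb : ∀ j, |X j| ≤ K * P ^ s * A + ρ := by
    intro j
    have h1 : |∑ k, dvf s j k ξ * a k| ≤ K * P ^ s * A := by
      rw [hA, Finset.mul_sum]
      refine (Finset.abs_sum_le_sum_abs _ _).trans (Finset.sum_le_sum fun k _ => ?_)
      rw [abs_mul, hK]
      gcongr
      exact abs_dvf_le s j k hξ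
    have h2 := abs_add_le (∑ k, dvf s j k ξ * a k) (X j - ∑ k, dvf s j k ξ * a k)
    rw [add_sub_cancel] at h2
    linarith [hX j]
  have hj : ∀ j, (∑ k, dvf s j k ξ * a k) * a j * (P ^ τ * g ^ 2) - ρ * |a j| * (P ^ τ * g ^ 2) -
      (K * P ^ s * A + ρ) * (P ^ τ * g * β) ≤
      X j * (a j * (Phi τ δ ξ * φ ^ 2) + w * (cPhi τ δ ξ * z j * φ ^ 2 +
          Phi τ δ ξ * (2 * φ * φ' j))) := by
    intro j
    have h1 : -((K * P ^ s * A + ρ) * (P ^ τ * g * β)) ≤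
        X j * (w * (cPhi τ δ ξ * z j * φ ^ 2 + Phi τ δ ξ * (2 * φ * φ' j))) := by
      refine (abs_le.1 ?_).1
      rw [abs_mul]
      exact mul_le_mul (hXb j) (hb j) (abs_nonneg _) (by positivity)
    have h2 : -(ρ * |a j|) ≤ (X j - ∑ k, dvf s j k ξ * a k) * a j := by
      refine (abs_le.1 ?_).1
      rw [abs_mul]
      exact mul_le_mul_of_nonneg_right (hX j) (abs_nonneg _)
    have h3 : 0 ≤ P ^ τ * g ^ 2 := by positivity
    have h4 := mul_le_mul_of_nonneg_right h2 h3
    rw [ePhi2, mul_add]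
    linarith
  have hsum := Finset.sum_le_sum fun j (_ : j ∈ Finset.univ) => hj j
  rw [Finset.sum_sub_distrib, Finset.sum_sub_distrib, ← Finset.sum_mul, ← Finset.sum_mul,
    ← Finset.mul_sum, Finset.sum_const, Finset.card_univ, Fintype.card_fin, nsmul_eq_mul] at hsum
  have hell := dvf_elliptic' (s := s) hξ a
  rw [← hc, ← hP, ← hS] at hell
  have hell2 := mul_le_mul_of_nonneg_right hell (by positivity : 0 ≤ P ^ τ * g ^ 2)
  obtain ⟨r, hr⟩ : ∃ r, r = ρ * (P ^ s)⁻¹ := ⟨_, rfl⟩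
  have hr0 : 0 ≤ r := by rw [hr]; positivity
  have eρ : ρ = r * P ^ s := by rw [hr]; field_simp
  have ets : P ^ (τ + s) = P ^ τ * P ^ s := Real.rpow_add hP0 _ _
  have hy := young_three (c := c) (N := N) (K := K) (g := g) (y := g * A) (ρ := r) (β := β)
    (S := S) hc0 hN1 (by
      rw [mul_pow, mul_comm, ← mul_assoc]
      exact mul_le_mul_of_nonneg_right hAS (sq_nonneg g))
  have hy2 := mul_le_mul_of_nonneg_left hy (by positivity : 0 ≤ P ^ τ * P ^ s)
  rw [← hD₁, ← hD₂] at hy2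
  have hnn : n * ((K * P ^ s * A + ρ) * (P ^ τ * g * β)) ≤
      N * ((K * P ^ s * A + ρ) * (P ^ τ * g * β)) := by gcongr
  have hβ2 : β ^ 2 ≤ (2 * (C * n) ^ 2 + 8) * ((h ^ 2 / P) ^ 2 * φ ^ 2 + h ^ 2 * m ^ 2) := by
    have : β ^ 2 ≤ 2 * (C * n * (h ^ 2 / P) * |φ|) ^ 2 + 2 * (2 * h * m) ^ 2 := by
      rw [hβ, ← mul_add]
      exact add_sq_le
    have e : (C * n * (h ^ 2 / P) * |φ|) ^ 2 = (C * n) ^ 2 * ((h ^ 2 / P) ^ 2 * φ ^ 2) := by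
      rw [mul_pow _ |φ|, sq_abs]; ring
    rw [e, show 2 * (2 * h * m) ^ 2 = 8 * (h ^ 2 * m ^ 2) by ring] at this
    have q1 : 0 ≤ (h ^ 2 / P) ^ 2 * φ ^ 2 := by positivity
    have q2 : 0 ≤ h ^ 2 * m ^ 2 := by positivity
    have q3 : 0 ≤ (C * n) ^ 2 := by positivity
    exact this.trans (two_mul_add_le q1 q2 q3)
  have hg2 : g ^ 2 ≤ φ ^ 2 := by
    rw [hg, mul_pow, sq_abs]
    exact mul_le_of_le_one_left (sq_nonneg φ) (hE2.trans hE1)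
  have e1 : P ^ (τ + s - 2) * ((h ^ 2) ^ 2 * φ ^ 2) =
      P ^ τ * P ^ s * ((h ^ 2 / P) ^ 2 * φ ^ 2) := by
    rw [Real.rpow_sub hP0, ets, Real.rpow_two]; field_simp
  have e2 : P ^ (τ - s) * (ρ ^ 2 * φ ^ 2) = P ^ τ * P ^ s * (r ^ 2 * φ ^ 2) := by
    rw [Real.rpow_sub hP0, eρ]; field_simp
  rw [e1, e2, ets]
  have hfin : D₁ * (r ^ 2 * g ^ 2) + D₂ * β ^ 2 ≤ (D₁ + D₂ * (2 * (C * n) ^ 2 + 8)) *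
      ((h ^ 2 / P) ^ 2 * φ ^ 2 + h ^ 2 * m ^ 2 + r ^ 2 * φ ^ 2) := by
    have f1 : r ^ 2 * g ^ 2 ≤ r ^ 2 * φ ^ 2 := by gcongr
    have f2 : 0 ≤ (h ^ 2 / P) ^ 2 * φ ^ 2 + h ^ 2 * m ^ 2 := by positivity
    have f3 : 0 ≤ r ^ 2 * φ ^ 2 := by positivity
    have f4 : 0 ≤ D₂ * (2 * (C * n) ^ 2 + 8) := by positivity
    have f5 := mul_le_mul_of_nonneg_left f1 hD₁0
    have f6 := mul_le_mul_of_nonneg_left hβ2 hD₂0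
    rw [← mul_assoc] at f6
    exact add_le_of_le_mul f2 f3 hD₁0 f4 f5 f6
  have hfin2 := mul_le_mul_of_nonneg_left hfin (by positivity : 0 ≤ P ^ τ * P ^ s)
  have eL : E ^ 2 * (c / 2 * (P ^ τ * P ^ s * (S * φ ^ 2))) =
      P ^ τ * P ^ s * (c / 2 * (S * g ^ 2)) := by rw [hg, mul_pow, sq_abs]; ring
  rw [eL]
  have eM : c * P ^ s * S * (P ^ τ * g ^ 2) - ρ * A * (P ^ τ * g ^ 2) -
      N * ((K * P ^ s * A + ρ) * (P ^ τ * g * β)) = P ^ τ * P ^ s *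
      (c * (S * g ^ 2) - (r * g * (g * A) + N * K * (g * A * β) + N * (r * g * β))) := by
    rw [eρ]; ring
  linarith

end

section

open Filter

variable {p : ℝ} {Ω : Set (Euc n)} {u f : Euc n → ℝ} {v : Euc n → Euc n}
  {H : Fin n → Fin n → Euc n → ℝ} {T : Fin n → Fin n → Fin n → Euc n → ℝ}

lemma Hess.weight_four_aesm (hH : Hess Ω v H) (S : PSol p Ω u f v) (e : ℝ) {φ : Euc n → ℝ}
    (hφ : Continuous φ) (i k : Fin n) :
    AEStronglyMeasurable (fun x => ‖v x‖ ^ e * ((H i k x ^ 2) ^ 2 * φ x ^ 2)) := by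
  refine aesm_mul_cont S.isOpen_reg (S.cont_comp fun _ hξ => contDiffAt_rpow_norm e hξ)
    ((((hH.aesm S i k).pow 2).pow 2).mul (hφ.pow 2).aestronglyMeasurable) fun x hx => ?_
  simp [hH.zero i k x hx]

lemma PSol.weighted_four_of_nonneg (S : PSol p Ω u f v) {e : ℝ} (he : 0 ≤ e)
    (hL : ∀ i j, L2loc Ω (fun x => H i j x ^ 2)) {φ : Euc n → ℝ} (hφ : IsTestFun Ω φ)
    (i k : Fin n) : Integrable (fun x => ‖v x‖ ^ e * ((H i k x ^ 2) ^ 2 * φ x ^ 2)) := by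
  refine (((hL i k).mul_cont (continuousOn_norm_rpow S.cont he)).integrable_mul (hL i k)
    hφ.sq).congr (.of_forall fun x => ?_)
  simp only
  ring

lemma integrable_mul_test {g φ : Euc n → ℝ} (hφ : IsTestFun Ω φ)
    (hg : IntegrableOn g (tsupport φ)) : Integrable (fun x => g x * φ x) := by
  have h1 : IntegrableOn (fun x => g x * φ x) (tsupport φ) :=
    hg.mul_continuousOn hφ.continuous.continuousOn hφ.isCompact
  rwa [integrableOn_iff_integrable_of_support_subset] at h1
  exact fun x hx => by
    by_contra h
    exact hx (by simp [hφ.eq_zero h])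

lemma PSol.weighted_four_of_interp (S : PSol p Ω u f v) (hH : Hess Ω v H) {b θ q : ℝ}
    (hb : p - 3 < b) (hθ0 : 0 < θ) (hθ1 : θ < 1) (hθq : 2 * θ + q * (1 - θ) = 4)
    (hLq : ∀ i k, ∀ K, IsCompact K → K ⊆ Ω → IntegrableOn (fun x => |H i k x| ^ q) K)
    {φ : Euc n → ℝ} (hφ : IsTestFun Ω φ) (i k : Fin n) :
    Integrable (fun x => ‖v x‖ ^ (b * θ) * ((H i k x ^ 2) ^ 2 * φ x ^ 2)) := by
  have h1 := S.sq_integrable hH hb hφ i k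
  have h2 : Integrable (fun x => |H i k x| ^ q * φ x ^ 2) :=
    integrable_mul_test hφ.sq (hLq i k _ hφ.sq.isCompact hφ.sq.2.2)
  refine (h1.iadd h2).mono (hH.weight_four_aesm S _ hφ.continuous i k) (.of_forall fun x => ?_)
  have e1 : |‖v x‖ ^ (b * θ) * ((H i k x ^ 2) ^ 2 * φ x ^ 2)| =
      ‖v x‖ ^ (b * θ) * ((H i k x ^ 2) ^ 2 * φ x ^ 2) := abs_of_nonneg (by positivity)
  rw [Real.norm_eq_abs, Real.norm_eq_abs, e1]
  refine le_trans ?_ (le_abs_self _)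
  set a := |H i k x| with ha
  have ha2 : H i k x ^ 2 = a ^ 2 := (sq_abs _).symm
  have ha0 : 0 ≤ a := abs_nonneg _
  rw [ha2]
  have hN : 0 ≤ ‖v x‖ := norm_nonneg _
  have key : ‖v x‖ ^ (b * θ) * (a ^ 2) ^ 2 ≤ ‖v x‖ ^ b * a ^ 2 + a ^ q := by
    rcases ha0.eq_or_lt with h0 | h0
    · rw [← h0]
      have : 0 ≤ (0 : ℝ) ^ q := by positivity
      simpa using this
    have hy := Real.geom_mean_le_arith_mean2_weighted hθ0.le (by linarith : 0 ≤ 1 - θ)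
      (by positivity : 0 ≤ ‖v x‖ ^ b * a ^ 2) (by positivity : 0 ≤ a ^ q) (by ring)
    have e2 : (‖v x‖ ^ b * a ^ 2) ^ θ * (a ^ q) ^ (1 - θ) = ‖v x‖ ^ (b * θ) * (a ^ 2) ^ 2 := by
      rw [Real.mul_rpow (by positivity) (by positivity), ← Real.rpow_mul hN, mul_assoc]
      congr 1
      have e4 : (a ^ 2) ^ 2 = a ^ (4 : ℝ) := by rw [← pow_mul, ← Real.rpow_natCast]; norm_num
      have e5 : (a ^ 2) ^ θ = a ^ (2 * θ) := by
        rw [← Real.rpow_natCast a 2, ← Real.rpow_mul ha0]; norm_num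
      rw [e4, e5, ← Real.rpow_mul ha0, ← Real.rpow_add h0, hθq]
    rw [e2] at hy
    have : 0 ≤ ‖v x‖ ^ b * a ^ 2 := by positivity
    have : 0 ≤ a ^ q := by positivity
    nlinarith
  calc _ = ‖v x‖ ^ (b * θ) * (a ^ 2) ^ 2 * φ x ^ 2 := by ring
    _ ≤ (‖v x‖ ^ b * a ^ 2 + a ^ q) * φ x ^ 2 := by gcongr
    _ = _ := by ring

lemma sqn_sq_le (H : Fin n → Fin n → Euc n → ℝ) (x : Euc n) :
    sqn H x ^ 2 ≤ n ^ 2 * ∑ i, ∑ k, (H i k x ^ 2) ^ 2 := by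
  unfold sqn
  have h1 : ∀ g : Fin n → ℝ, (∑ k, g k) ^ 2 ≤ n * ∑ k, g k ^ 2 := fun g => by
    simpa using sq_sum_le_card_mul_sum_sq (s := Finset.univ) (f := g)
  refine (h1 fun i => ∑ k, H i k x ^ 2).trans ?_
  have h2 : (n : ℝ) * ∑ i, (∑ k, H i k x ^ 2) ^ 2 ≤ n * ∑ i, n * ∑ k, (H i k x ^ 2) ^ 2 :=
    mul_le_mul_of_nonneg_left (Finset.sum_le_sum fun i _ => h1 fun k => H i k x ^ 2)
      (Nat.cast_nonneg n)
  rwa [← Finset.mul_sum, ← mul_assoc, ← pow_two] at h2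

lemma PSol.weighted_sqn_sq (S : PSol p Ω u f v) (hH : Hess Ω v H) {e : ℝ} {φ : Euc n → ℝ}
    (hφ : IsTestFun Ω φ)
    (h : ∀ i k, Integrable (fun x => ‖v x‖ ^ e * ((H i k x ^ 2) ^ 2 * φ x ^ 2))) :
    Integrable (fun x => ‖v x‖ ^ e * (sqn H x ^ 2 * φ x ^ 2)) := by
  have h1 : Integrable (fun x => n ^ 2 * ∑ i, ∑ k, ‖v x‖ ^ e * ((H i k x ^ 2) ^ 2 * φ x ^ 2)) :=
    (integrable_finsetSum _ fun i _ => integrable_finsetSum _ fun k _ => h i k).const_mul _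
  refine h1.mono (aesm_mul_cont S.isOpen_reg
    (S.cont_comp fun _ hξ => contDiffAt_rpow_norm e hξ)
    (((sqn_aesm (hH.aesm S)).pow 2).mul (hφ.continuous.pow 2).aestronglyMeasurable)
    fun x hx => by simp [hH.sqn_zero hx]) (.of_forall fun x => ?_)
  rw [Real.norm_eq_abs, Real.norm_eq_abs, abs_of_nonneg (by positivity)]
  refine le_trans ?_ (le_abs_self _)
  simp_rw [← Finset.mul_sum, ← Finset.sum_mul]
  calc _ ≤ ‖v x‖ ^ e * ((n ^ 2 * ∑ i, ∑ k, (H i k x ^ 2) ^ 2) * φ x ^ 2) := by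
        gcongr
        exact sqn_sq_le H x
    _ = _ := by ring

lemma sum_mul_pd_le {s P h : ℝ} {ξ : Euc n} (hξ : ξ ≠ 0) (hP : P = ‖ξ‖) (hh : 0 ≤ h)
    {A B : Fin n → ℝ} (hA : ∀ m, |A m| ≤ h) (hB : ∀ k, |B k| ≤ h) (j : Fin n) :
    |∑ k, ∑ m, pd (dvf s j k) m ξ * (A m * B k)| ≤
      n ^ 2 * (3 * |s| + |s| * |s - 2|) * (P ^ (s - 1) * h ^ 2) := by
  calc _ ≤ ∑ k : Fin n, ∑ m : Fin n, (3 * |s| + |s| * |s - 2|) * P ^ (s - 1) * (h * h) := by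
        refine (Finset.abs_sum_le_sum_abs _ _).trans (Finset.sum_le_sum fun k _ => ?_)
        refine (Finset.abs_sum_le_sum_abs _ _).trans (Finset.sum_le_sum fun m _ => ?_)
        rw [abs_mul, abs_mul, hP]
        exact mul_le_mul (abs_pd_dvf_le s j k m hξ)
          (mul_le_mul (hA m) (hB k) (abs_nonneg _) hh) (by positivity) (by positivity)
    _ = _ := by simp; ring

set_option maxHeartbeats 2000000 in
/-- Weighted estimate for third derivatives. -/
theorem PSol.weighted_third (S : PSol p Ω u f v) (hH : Hess Ω v H) (hT : Third Ω v H T) {τ : ℝ}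
    (hτ1 : p - 3 < τ + (p - 2)) (hτ2 : 0 ≤ τ - (p - 2)) {φ : Euc n → ℝ} (hφ : IsTestFun Ω φ)
    (h4 : Integrable (fun x => ‖v x‖ ^ (τ + (p - 2) - 2) * (sqn H x ^ 2 * φ x ^ 2)))
    (i l : Fin n) :
    Integrable (fun x => ‖v x‖ ^ (τ + (p - 2)) * ((∑ k, T i l k x ^ 2) * φ x ^ 2)) := by
  obtain ⟨s, hs⟩ : ∃ s, s = p - 2 := ⟨_, rfl⟩
  have hs1 : -1 < s := by linarith [S.one_lt]
  obtain ⟨C₀, hC₀, hcP⟩ := abs_cPhi_le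
  obtain ⟨D, hD, hpt⟩ := third_energy_pointwise n hs1 (by positivity : 0 ≤ |τ| + C₀)
  obtain ⟨M, hM⟩ : ∃ M : ℝ, M = n ^ 2 * (3 * |s| + |s| * |s - 2|) := ⟨_, rfl⟩
  have hM0 : 0 ≤ M := by rw [hM]; positivity
  rw [← hs] at hτ1 hτ2 h4 ⊢
  have hfl : L2loc (Reg Ω v) (pd f i) := .of_continuousOn ((S.fcont i).mono reg_subset)
  have key := fun (δ : ℝ) (hδ : 0 < δ) =>
    S.test_reg hH (X := fun j x => dflux s v H T i l j x + if j = l then pd f i x else 0)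
      (fun j => (S.l2_dflux hH hT s i l j).add (by
        split_ifs
        · exact hfl
        · exact .of_continuousOn continuousOn_const)) (g := fun _ => 0)
      (.of_continuousOn continuousOn_const)
      (fun ψ hψ => by rw [hs]; exact S.lin_third hH hT i l hψ) (w := H i l) (W := T i l)
      (hH.l2 i l) (hT.l2 i l) (hT.wpd i l) (fun k j => hT.mul hH i l k j) hφ.sq τ hδ
  simp only [zero_mul, sub_zero] at key
  set I : ℝ → Euc n → ℝ := fun δ x => ∑ j, (dflux s v H T i l j x + if j = l then pd f i x else 0) *
    (T i l j x * (Phi τ δ (v x) * φ x ^ 2) + H i l x * (cPhi τ δ (v x) *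
      (∑ k, v x k * H k j x) * φ x ^ 2 + Phi τ δ (v x) * pd (fun x => φ x ^ 2) j x)) with hI
  set B : Euc n → ℝ := fun x => D * ((1 + 2 * M ^ 2) *
      (‖v x‖ ^ (τ + s - 2) * (sqn H x ^ 2 * φ x ^ 2)) +
    (∑ j, ‖v x‖ ^ (τ + s) * (sqn H x * pd φ j x ^ 2)) +
    2 * (‖v x‖ ^ (τ - s) * (pd f i x ^ 2 * φ x ^ 2))) with hB
  have hB0 : ∀ x, 0 ≤ B x := fun x => by
    have h0 := sqn_nonneg H x
    have : 0 ≤ ∑ j, ‖v x‖ ^ (τ + s) * (sqn H x * pd φ j x ^ 2) :=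
      Finset.sum_nonneg fun _ _ => by positivity
    simp only [hB]; positivity
  have hφ0 : ∀ x, x ∉ tsupport φ → φ x = 0 ∧ ∀ j, pd φ j x = 0 := fun x hx =>
    ⟨hφ.eq_zero hx, fun j => pd_eq_zero_of_notMem hx⟩
  have hBint : Integrable B := by
    have i1 : Integrable (fun x => ∑ j, ‖v x‖ ^ (τ + s) * (sqn H x * pd φ j x ^ 2)) :=
      integrable_finsetSum _ fun j _ => S.weighted_hess hH hτ1 (hφ.pd j)
    have i2 : Integrable (fun x => ‖v x‖ ^ (τ - s) * (pd f i x ^ 2 * φ x ^ 2)) :=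
      integrable_of_continuousOn hφ.isCompact hφ.2.2 ((continuousOn_norm_rpow S.cont hτ2).mul
        (((S.fcont i).pow 2).mul (hφ.continuous.pow 2).continuousOn))
        fun x hx => by simp [hφ0 x hx]
    exact (((h4.const_mul _).iadd i1).iadd (i2.const_mul _)).const_mul _
  have hmin : 0 < min 1 (1 + s) := lt_min one_pos (by linarith)
  have haT : ∀ k, AEStronglyMeasurable (T i l k) := fun k =>
    (hT.l2 i l k).aestronglyMeasurable S.isOpen_reg (hT.zero i l k)
  have hsym : ∀ᵐ x, ∀ k, x ∈ Reg Ω v → T i l k x = T i k l x := by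
    rw [ae_all_iff]; exact fun k => hT.symm i l k
  have h0 : Integrable (fun x => min 1 (1 + s) / 2 *
      (‖v x‖ ^ (τ + s) * ((∑ k, T i l k x ^ 2) * φ x ^ 2))) := by
    refine S.integrable_of_cutoff_bound (AEStronglyMeasurable.const_mul ?_ _) (fun x => ?_)
      (fun x hx => ?_) hBint I (fun δ hδ => (key δ hδ).1) (fun δ hδ => (key δ hδ).2) fun δ hδ => ?_
    · refine aesm_mul_cont S.isOpen_reg (S.cont_comp fun _ hξ => contDiffAt_rpow_norm _ hξ)
        ((Finset.aestronglyMeasurable_fun_sum _ fun k _ => (haT k).pow 2).mul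
          (hφ.continuous.pow 2).aestronglyMeasurable) fun x hx => ?_
      simp [hT.zero i l _ x hx]
    · have : 0 ≤ ∑ k, T i l k x ^ 2 := Finset.sum_nonneg fun _ _ => sq_nonneg _
      positivity
    · simp [hT.zero i l _ x hx]
    · filter_upwards [hsym] with x hxs
      by_cases hx : x ∈ Reg Ω v
      · have hsq0 := sqn_nonneg H x
        have hh2 : √(sqn H x) ^ 2 = sqn H x := Real.sq_sqrt hsq0
        have hHle : ∀ a b, |H a b x| ≤ √(sqn H x) := fun a b =>
          Real.abs_le_sqrt (sq_le_sqn H x a b)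
        have hm0 : 0 ≤ ∑ j, pd φ j x ^ 2 := Finset.sum_nonneg fun _ _ => sq_nonneg _
        have h1 := hpt (τ := τ) (δ := δ) (φ := φ x) hx.2 (a := fun k => T i l k x)
          (z := fun j => ∑ k, v x k * H k j x)
          (X := fun j => dflux s v H T i l j x + if j = l then pd f i x else 0)
          (φ' := fun j => pd φ j x) (w := H i l x) (h := √(sqn H x))
          (ρ := M * (‖v x‖ ^ (s - 1) * √(sqn H x) ^ 2) + |pd f i x|)
          (m := √(∑ j, pd φ j x ^ 2)) (hHle i l) (fun j => ?_) (fun j => ?_)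
          (fun j => Real.abs_le_sqrt (Finset.single_le_sum (f := fun j => pd φ j x ^ 2)
            (fun _ _ => sq_nonneg _) (Finset.mem_univ j))) (hcP τ δ (v x) hδ hx.2)
          (by positivity) (by positivity)
        · simp only [hI, hB, pd_sq hφ.1]
          refine h1.trans (add_le_add le_rfl (mul_le_mul_of_nonneg_left ?_ hD))
          rw [hh2, Real.sq_sqrt hm0]
          have hP0 : 0 < ‖v x‖ := norm_pos_iff.2 hx.2
          have e1 : ‖v x‖ ^ (τ - s) * (‖v x‖ ^ (s - 1)) ^ 2 = ‖v x‖ ^ (τ + s - 2) := by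
            rw [← Real.rpow_natCast, ← Real.rpow_mul hP0.le, ← Real.rpow_add hP0]
            congr 1; push_cast; ring
          have e2 : (M * (‖v x‖ ^ (s - 1) * sqn H x) + |pd f i x|) ^ 2 ≤
              2 * M ^ 2 * ((‖v x‖ ^ (s - 1)) ^ 2 * sqn H x ^ 2) + 2 * pd f i x ^ 2 := by
            rw [← sq_abs (pd f i x)]
            nlinarith [sq_nonneg (M * (‖v x‖ ^ (s - 1) * sqn H x) - |pd f i x|)]
          have e3 : 0 ≤ ‖v x‖ ^ (τ - s) * φ x ^ 2 := by positivity
          have e4 := mul_le_mul_of_nonneg_left e2 e3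
          rw [← Finset.mul_sum, ← Finset.mul_sum, ← e1]
          linarith
        · calc _ ≤ ∑ k : Fin n, ‖v x‖ * √(sqn H x) := by
                refine (Finset.abs_sum_le_sum_abs _ _).trans (Finset.sum_le_sum fun k _ => ?_)
                rw [abs_mul]
                exact mul_le_mul (abs_apply_le _ _) (hHle k j) (abs_nonneg _) (norm_nonneg _)
            _ = _ := by simp; ring
        · have e : dflux s v H T i l j x + (if j = l then pd f i x else 0) -
              ∑ k, dvf s j k (v x) * T i l k x =
              ∑ k, ∑ m, pd (dvf s j k) m (v x) * (H m l x * H i k x) +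
                if j = l then pd f i x else 0 := by
            have e1 : ∑ k, dvf s j k (v x) * T i l k x = ∑ k, dvf s j k (v x) * T i k l x :=
              Finset.sum_congr rfl fun k _ => by rw [hxs k hx]
            simp only [dflux, Finset.sum_add_distrib]
            rw [e1]; ring
          rw [e]
          refine (abs_add_le _ _).trans (add_le_add ?_ ?_)
          · rw [hM]
            exact sum_mul_pd_le hx.2 rfl (Real.sqrt_nonneg _) (fun m => hHle m l)
              (fun k => hHle i k) j
          · split_ifs
            · exact le_rfl
            · simp
      · have e1 : I δ x = 0 := by
          by_cases hxΩ : x ∈ Ω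
          · have hv0 : v x = 0 := by
              by_contra h; exact hx ⟨hxΩ, h⟩
            simp [hI, hv0, Phi_eq_zero hδ (show ‖(0 : Euc n)‖ ^ 2 < δ by simpa using hδ)]
          · have := hφ0 x (fun h => hxΩ (hφ.2.2 h))
            simp [hI, pd_sq hφ.1, this]
        rw [e1]
        simpa [hT.zero i l _ x hx] using hB0 x
  have := h0.const_mul (2 / min 1 (1 + s))
  refine this.congr (.of_forall fun x => ?_)
  simp only
  field_simp

end

section

open Filter

variable {p : ℝ} {Ω : Set (Euc n)} {u f : Euc n → ℝ} {v : Euc n → Euc n}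
  {H : Fin n → Fin n → Euc n → ℝ} {T : Fin n → Fin n → Fin n → Euc n → ℝ}

lemma L2loc.mono_bound {U : Set (Euc n)} {g h : Euc n → ℝ} (hg : L2loc U g)
    (hh : AEStronglyMeasurable h) (hb : ∀ x, |h x| ≤ g x) : L2loc U h := fun K hK hKU =>
  (hg K hK hKU).mono hh.restrict (ae_of_all _ fun x => by
    rw [Real.norm_eq_abs, Real.norm_eq_abs]
    exact (hb x).trans (le_abs_self _))

lemma L2loc.abs {U : Set (Euc n)} {g : Euc n → ℝ} (hg : L2loc U g) :
    L2loc U (fun x => |g x|) := fun K hK hKU => (hg K hK hKU).norm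

/-- Lowering the weight exponent `2 * b` to `e` in a weighted `L²` bound, `v` being bounded. -/
lemma PSol.l2loc_of_weight (S : PSol p Ω u f v) {F : Euc n → ℝ} (hF : AEStronglyMeasurable F)
    (hF0 : ∀ x, x ∉ Reg Ω v → F x = 0) {e b : ℝ} (he : e ≤ 2 * b)
    (h : ∀ φ, IsTestFun Ω φ → Integrable (fun x => ‖v x‖ ^ e * (F x ^ 2 * φ x ^ 2))) :
    L2loc Ω (fun x => ‖v x‖ ^ b * F x) := by
  have hm : AEStronglyMeasurable (fun x => ‖v x‖ ^ b * F x) := aesm_mul_cont S.isOpen_reg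
    (S.cont_comp fun _ hξ => contDiffAt_rpow_norm b hξ) hF hF0
  refine l2loc_of_test S.isOpen hm fun φ hφ => ?_
  obtain ⟨C, hC⟩ := hφ.isCompact.exists_bound_of_continuousOn
    ((continuousOn_norm_rpow S.cont (by linarith : 0 ≤ 2 * b - e)).mono hφ.2.2)
  refine ((h φ hφ).const_mul C).mono
    ((hm.pow 2).mul (hφ.continuous.pow 2).aestronglyMeasurable) (.of_forall fun x => ?_)
  by_cases hx : x ∈ Reg Ω v ∧ x ∈ tsupport φ
  · have h0 : 0 < ‖v x‖ := norm_pos_iff.2 hx.1.2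
    have e1 : (‖v x‖ ^ b * F x) ^ 2 * φ x ^ 2 =
        ‖v x‖ ^ (2 * b - e) * (‖v x‖ ^ e * (F x ^ 2 * φ x ^ 2)) := by
      rw [← mul_assoc, ← Real.rpow_add h0, mul_pow, ← Real.rpow_natCast (‖v x‖ ^ b),
        ← Real.rpow_mul h0.le, mul_assoc]
      congr 2
      push_cast
      ring
    have h1 := hC x hx.2
    rw [e1, norm_mul, norm_mul C]
    exact mul_le_mul_of_nonneg_right (h1.trans (Real.le_norm_self C)) (norm_nonneg _)
  · have : F x = 0 ∨ φ x = 0 := by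
      by_cases hr : x ∈ Reg Ω v
      · exact Or.inr (hφ.eq_zero fun ht => hx ⟨hr, ht⟩)
      · exact Or.inl (hF0 x hr)
    rcases this with h | h <;> simp [h]

lemma abs_le_sqrt_sqn (H : Fin n → Fin n → Euc n → ℝ) (x : Euc n) (i k : Fin n) :
    |H i k x| ≤ √(sqn H x) := Real.abs_le_sqrt (sq_le_sqn H x i k)

lemma sum_dvf_zero (hH : Hess Ω v H) (s : ℝ) (i j : Fin n) {x : Euc n} (hx : x ∉ Reg Ω v) :
    ∑ k, dvf s j k (v x) * H i k x = 0 :=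
  Finset.sum_eq_zero fun k _ => by rw [hH.zero i k x hx, mul_zero]

lemma dflux_zero (hH : Hess Ω v H) (hT : Third Ω v H T) (s : ℝ) (i l j : Fin n) {x : Euc n}
    (hx : x ∉ Reg Ω v) : dflux s v H T i l j x = 0 :=
  Finset.sum_eq_zero fun k _ => by
    rw [hT.zero i k l x hx, mul_zero, zero_add]
    exact Finset.sum_eq_zero fun m _ => by rw [hH.zero i k x hx, mul_zero, mul_zero]

lemma PSol.l2_sum_dvf (S : PSol p Ω u f v) (hH : Hess Ω v H) {s : ℝ} (hs : p - 3 < 2 * s)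
    (i j : Fin n) : L2loc Ω (fun x => ∑ k, dvf s j k (v x) * H i k x) := by
  have h1 : L2loc (Reg Ω v) (fun x => ∑ k, dvf s j k (v x) * H i k x) :=
    .sum _ fun k _ => (hH.l2 i k).mul_cont (S.cont_comp fun _ hξ => contDiffAt_dvf s j k hξ)
  refine ((L2loc.sum Finset.univ fun k _ => (S.l2_weight_hess hH hs i k).abs).const_mul
    (1 + |s|)).mono_bound (h1.aestronglyMeasurable S.isOpen_reg fun x hx =>
      sum_dvf_zero hH s i j hx) fun x => ?_
  by_cases hx : x ∈ Reg Ω v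
  · rw [Finset.mul_sum]
    refine (Finset.abs_sum_le_sum_abs _ _).trans (Finset.sum_le_sum fun k _ => ?_)
    rw [abs_mul, abs_mul, abs_of_nonneg (by positivity : 0 ≤ ‖v x‖ ^ s), ← mul_assoc]
    exact mul_le_mul_of_nonneg_right (abs_dvf_le s j k hx.2) (abs_nonneg _)
  · rw [sum_dvf_zero hH s i j hx, abs_zero]
    positivity

lemma PSol.wpd_vf_ext (S : PSol p Ω u f v) (hH : Hess Ω v H) {s : ℝ} (hs : 0 < s)
    (i j : Fin n) :
    WPD Ω (fun x => vf s j (v x)) (fun x => ∑ k, dvf s j k (v x) * H i k x) i := by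
  have hv : ContinuousOn (fun x => vf s j (v x)) Ω :=
    (continuousOn_norm_rpow S.cont hs.le).mul (continuousOn_coord S.cont j)
  have hs2 : p - 3 < 2 * s := by linarith [S.lt_three]
  have hl2 := S.l2_sum_dvf hH hs2 i j
  have e : ∀ x ∈ Ω, (Reg Ω v).indicator (fun x => vf s j (v x)) x = vf s j (v x) := fun x hx => by
    by_cases h0 : v x = 0
    · have : x ∉ Reg Ω v := fun h => h.2 h0
      simp [this, h0, vf]
    · have : x ∈ Reg Ω v := ⟨hx, h0⟩
      simp [this]
  have hg : L2loc Ω ((Reg Ω v).indicator (fun x => vf s j (v x))) :=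
    (L2loc.of_continuousOn hv).congr (.of_forall fun x hx => (e x hx).symm)
  refine (S.wpd_extend hH (G := (Reg Ω v).indicator (fun x => vf s j (v x))) (j := i)
    (hg.mono reg_subset) (hl2.mono reg_subset) (fun x hx => by simp [hx])
    (fun x hx => sum_dvf_zero hH s i j hx)
    ((S.wpd_vf hH s i j).congr (.of_forall fun x hx => by simp [hx])
      (.of_forall fun x _ => by simp only [hH.symm _ i])) (fun φ hφ => hg.integrable_test hφ)
    (fun φ hφ => hl2.integrable_test hφ) fun k φ hφ => ?_).congr (.of_forall e)
      (.of_forall fun _ _ => rfl)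
  have hm : AEStronglyMeasurable (fun x => (‖v x‖ ^ (-1 : ℝ)) * (H k i x)) :=
    aesm_mul_cont S.isOpen_reg (S.cont_comp fun _ hξ => contDiffAt_rpow_norm _ hξ)
      (hH.aesm S k i) (hH.zero k i)
  refine ((S.l2_weight_hess hH hs2 k i).integrable_test hφ).mono
    (((hg.mono reg_subset).aestronglyMeasurable S.isOpen_reg (fun x hx => by simp [hx])).mul
      hm |>.mul hφ.continuous.aestronglyMeasurable) (.of_forall fun x => ?_)
  by_cases hx : x ∈ Reg Ω v
  · have h0 : 0 < ‖v x‖ := norm_pos_iff.2 hx.2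
    rw [indicator_of_mem hx, norm_mul, norm_mul (_ * _)]
    refine mul_le_mul_of_nonneg_right ?_ (norm_nonneg _)
    rw [norm_mul, norm_mul, norm_mul, ← mul_assoc]
    refine mul_le_mul_of_nonneg_right ?_ (norm_nonneg _)
    rw [Real.norm_of_nonneg (by positivity : 0 ≤ ‖v x‖ ^ (-1 : ℝ)),
      Real.norm_of_nonneg (by positivity : 0 ≤ ‖v x‖ ^ s), Real.norm_eq_abs]
    calc _ ≤ ‖v x‖ ^ (s + 1) * ‖v x‖ ^ (-1 : ℝ) :=
          mul_le_mul_of_nonneg_right (abs_vf_le s j hx.2) (by positivity)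
      _ = ‖v x‖ ^ s := by rw [← Real.rpow_add h0]; congr 1; ring
  · simp only [hx, not_false_eq_true, indicator_of_notMem, zero_mul, norm_zero]
    positivity

lemma PSol.l2_dflux_ext (S : PSol p Ω u f v) (hH : Hess Ω v H) (hT : Third Ω v H T) {s : ℝ}
    (h3 : ∀ i k l, L2loc Ω (fun x => ‖v x‖ ^ s * T i k l x))
    (h4 : L2loc Ω (fun x => ‖v x‖ ^ (s - 1) * sqn H x)) (i l j : Fin n) :
    L2loc Ω (dflux s v H T i l j) := by
  refine (((L2loc.sum Finset.univ fun k _ => (h3 i k l).abs).const_mul (1 + |s|)).add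
    (h4.const_mul (n ^ 2 * (3 * |s| + |s| * |s - 2|)))).mono_bound
    ((S.l2_dflux hH hT s i l j).aestronglyMeasurable S.isOpen_reg fun x hx =>
      dflux_zero hH hT s i l j hx) fun x => ?_
  by_cases hx : x ∈ Reg Ω v
  · rw [dflux, Finset.sum_add_distrib]
    refine (abs_add_le _ _).trans (add_le_add ?_ ?_)
    · rw [Finset.mul_sum]
      refine (Finset.abs_sum_le_sum_abs _ _).trans (Finset.sum_le_sum fun k _ => ?_)
      rw [abs_mul, abs_mul, abs_of_nonneg (by positivity : 0 ≤ ‖v x‖ ^ s), ← mul_assoc]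
      exact mul_le_mul_of_nonneg_right (abs_dvf_le s j k hx.2) (abs_nonneg _)
    · have := sum_mul_pd_le (s := s) (A := fun m => H m l x) (B := fun k => H i k x) hx.2 rfl
        (Real.sqrt_nonneg (sqn H x)) (fun m => abs_le_sqrt_sqn H x m l)
        (fun k => abs_le_sqrt_sqn H x i k) j
      rwa [Real.sq_sqrt (sqn_nonneg H x)] at this
  · rw [dflux_zero hH hT s i l j hx, abs_zero]
    have := sqn_nonneg H x
    positivity

lemma PSol.wpd_dflux_ext (S : PSol p Ω u f v) (hH : Hess Ω v H) (hT : Third Ω v H T) {s : ℝ}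
    (hs : 0 < s) (h3 : ∀ i k l, L2loc Ω (fun x => ‖v x‖ ^ s * T i k l x))
    (h4 : L2loc Ω (fun x => ‖v x‖ ^ (s - 1) * sqn H x)) (i l j : Fin n) :
    WPD Ω (fun x => ∑ k, dvf s j k (v x) * H i k x) (dflux s v H T i l j) l := by
  have hs2 : p - 3 < 2 * s := by linarith [S.lt_three]
  have hl2 := S.l2_sum_dvf hH hs2 i j
  have hd := S.l2_dflux_ext hH hT h3 h4 i l j
  refine S.wpd_extend hH (hl2.mono reg_subset) (hd.mono reg_subset)
    (fun x hx => sum_dvf_zero hH s i j hx) (fun x hx => dflux_zero hH hT s i l j hx)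
    (S.wpd_dflux hH hT s i l j) (fun φ hφ => hl2.integrable_test hφ)
    (fun φ hφ => hd.integrable_test hφ) fun k φ hφ => ?_
  have hm : AEStronglyMeasurable (fun x => (‖v x‖ ^ (-1 : ℝ)) * (H k l x)) :=
    aesm_mul_cont S.isOpen_reg (S.cont_comp fun _ hξ => contDiffAt_rpow_norm _ hξ)
      (hH.aesm S k l) (hH.zero k l)
  refine ((h4.integrable_test hφ).const_mul (n * (1 + |s|))).mono
    (((hl2.mono reg_subset).aestronglyMeasurable S.isOpen_reg
      (fun x hx => sum_dvf_zero hH s i j hx)).mul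
      hm |>.mul hφ.continuous.aestronglyMeasurable) (.of_forall fun x => ?_)
  have hq := sqn_nonneg H x
  by_cases hx : x ∈ Reg Ω v
  · have h0 : 0 < ‖v x‖ := norm_pos_iff.2 hx.2
    rw [norm_mul, ← mul_assoc (n * (1 + |s|)), norm_mul _ (φ x)]
    refine mul_le_mul_of_nonneg_right ?_ (norm_nonneg _)
    rw [Real.norm_of_nonneg (by positivity : 0 ≤ n * (1 + |s|) * (‖v x‖ ^ (s - 1) * sqn H x)),
      norm_mul, norm_mul, Real.norm_of_nonneg (by positivity : 0 ≤ ‖v x‖ ^ (-1 : ℝ)),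
      Real.norm_eq_abs, Real.norm_eq_abs]
    have h1 : |∑ k, dvf s j k (v x) * H i k x| ≤
        n * ((1 + |s|) * ‖v x‖ ^ s * √(sqn H x)) := by
      refine (Finset.abs_sum_le_sum_abs _ _).trans ((Finset.sum_le_card_nsmul _ _
        ((1 + |s|) * ‖v x‖ ^ s * √(sqn H x)) fun k _ => ?_).trans (by simp))
      rw [abs_mul]
      exact mul_le_mul (abs_dvf_le s j k hx.2) (abs_le_sqrt_sqn H x i k) (abs_nonneg _)
        (by positivity)
    calc _ ≤ n * ((1 + |s|) * ‖v x‖ ^ s * √(sqn H x)) * (‖v x‖ ^ (-1 : ℝ) * √(sqn H x)) :=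
          mul_le_mul h1 (mul_le_mul_of_nonneg_left (abs_le_sqrt_sqn H x k l) (by positivity))
            (by positivity) (by positivity)
      _ = n * (1 + |s|) * (‖v x‖ ^ s * ‖v x‖ ^ (-1 : ℝ)) * √(sqn H x) ^ 2 := by ring
      _ = _ := by
        rw [Real.sq_sqrt hq, ← Real.rpow_add h0, ← sub_eq_add_neg]
        ring
  · rw [sum_dvf_zero hH s i j hx]
    simp only [zero_mul, norm_zero]
    positivity

lemma integrableOn_abs_rpow_one {g : Euc n → ℝ} {K : Set (Euc n)} (hg : L2loc Ω g)
    (hK : IsCompact K) (hKΩ : K ⊆ Ω) : IntegrableOn (fun x => |g x| ^ (1 : ℝ)) K := by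
  have := isFiniteMeasure_restrict.2 (hK.measure_lt_top (μ := (volume : Measure (Euc n)))).ne
  simp only [Real.rpow_one]
  exact ((hg K hK hKΩ).integrable one_le_two).abs

/-- Weighted bounds on second and third derivatives give `‖v‖ ^ s • v ∈ W^{2,1}_loc`. -/
theorem PSol.memW2Loc_vf (S : PSol p Ω u f v) (hH : Hess Ω v H) (hT : Third Ω v H T) {s : ℝ}
    (hs : 0 < s) (h3 : ∀ i k l, L2loc Ω (fun x => ‖v x‖ ^ s * T i k l x))
    (h4 : L2loc Ω (fun x => ‖v x‖ ^ (s - 1) * sqn H x)) (j : Fin n) :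
    MemW2Loc Ω 1 (fun x => vf s j (v x)) := by
  have hv : ContinuousOn (fun x => vf s j (v x)) Ω :=
    (continuousOn_norm_rpow S.cont hs.le).mul (continuousOn_coord S.cont j)
  have hs2 : p - 3 < 2 * s := by linarith [S.lt_three]
  exact ⟨fun i x => ∑ k, dvf s j k (v x) * H i k x, fun i l => dflux s v H T i l j,
    fun i => hasWeakPD_of_wpd (S.wpd_vf_ext hH hs i j),
    fun i l => hasWeakPD_of_wpd (S.wpd_dflux_ext hH hT hs h3 h4 i l j),
    fun K hKΩ hK => ⟨integrableOn_abs_rpow_one (.of_continuousOn hv) hK hKΩ,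
      fun i => integrableOn_abs_rpow_one (S.l2_sum_dvf hH hs2 i j) hK hKΩ,
      fun i l => integrableOn_abs_rpow_one (S.l2_dflux_ext hH hT h3 h4 i l j) hK hKΩ⟩⟩

end

section

open Filter

variable {p q α k : ℝ} {Ω : Set (Euc n)} {u f : Euc n → ℝ} {v : Euc n → Euc n}
  {H : Fin n → Fin n → Euc n → ℝ} {T : Fin n → Fin n → Fin n → Euc n → ℝ}

lemma qseq_four (N : ℕ) : qseq 4 N = 2 * 2 ^ N + 2 := by
  induction N with
  | zero => norm_num [qseq]
  | succ N ih => rw [qseq, ih]; ring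

lemma L2loc.of_vf (hv : ContinuousOn v Ω) {s : ℝ} (hs : -1 < s) (j : Fin n) :
    L2loc Ω (fun x => vf s j (v x)) := fun K hK hKΩ => by
  have hm : Measurable (fun ξ : Euc n => vf s j ξ) := by
    unfold vf
    exact (measurable_norm.pow_const s).mul (contDiff_coord j).continuous.measurable
  refine (memLp_of_continuousOn hK
    (continuousOn_norm_rpow (hv.mono hKΩ) (by linarith : 0 ≤ s + 1))).mono
    (hm.comp_aemeasurable ((hv.mono hKΩ).aemeasurable hK.measurableSet)).aestronglyMeasurable
    (ae_of_all _ fun x => ?_)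
  by_cases hx : v x = 0
  · simp [hx, vf]
  · rw [Real.norm_eq_abs, Real.norm_of_nonneg (by positivity)]
    exact abs_vf_le s j hx

lemma continuousOn_gradient {β : ℝ≥0} (hβ : 0 < β) (hΩ : IsOpen Ω) (hu : C1Loc Ω β u) :
    ContinuousOn (gradient u) Ω := fun x hx => by
  obtain ⟨K, hK, hxK, hKΩ⟩ := exists_compact_subset hΩ hx
  obtain ⟨C, hC⟩ := hu.2 K hKΩ hK
  exact ((hC.continuousOn hβ).continuousAt (mem_interior_iff_mem_nhds.1 hxK)).continuousWithinAt

lemma psol_of_weakSol {β β' : ℝ≥0} (hβ : 0 < β) (hβ' : 0 < β') (hΩ : IsOpen Ω)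
    (hu : C1Loc Ω β u) (hf : C1Loc Ω β' f) (hsol : IsPWeakSol p Ω u f) (hp1 : 1 < p)
    (hp3 : p < 3) : PSol p Ω u f (gradient u) where
  isOpen := hΩ
  one_lt := hp1
  lt_three := hp3
  cont := continuousOn_gradient hβ hΩ hu
  diff := hu.1
  pd_eq x _ j := (gradient_apply u x j).symm
  fdiff := hf.1
  fcont j := (continuousOn_coord (continuousOn_gradient hβ' hΩ hf) j).congr
    fun x _ => (gradient_apply f x j).symm
  weak ψ hψ := by
    have h1 := hsol ψ hψ
    have h2 : ∀ x, x ∉ Ω → gradient ψ x = 0 := fun x hx => by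
      ext j
      rw [gradient_apply, (hψ.pd j).eq_zero' hx]
      rfl
    rw [setIntegral_eq_of_zero fun x hx => by rw [h2 x hx, inner_zero_right, mul_zero],
      setIntegral_eq_of_zero fun x hx => by simp [hψ.eq_zero' hx]] at h1
    rw [← h1, ← integral_finsetSum _ fun j _ => (L2loc.of_vf (continuousOn_gradient hβ hΩ hu)
      (by linarith : -1 < p - 2) j).integrable_test (hψ.pd j)]
    refine integral_congr_ae (.of_forall fun x => ?_)
    simp only [inner_eq_sum, Finset.mul_sum, vf]
    exact Finset.sum_congr rfl fun j _ => by rw [gradient_apply ψ x j, mul_assoc]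

lemma integrableOn_abs_rpow {g : Euc n → ℝ} {K : Set (Euc n)} {r : ℝ} (hr : 0 < r)
    (h : MemLp g (ENNReal.ofReal r) (volume.restrict K)) :
    IntegrableOn (fun x => |g x| ^ r) K := by
  have := h.integrable_norm_rpow (by simpa using hr) ENNReal.ofReal_ne_top
  simp only [ENNReal.toReal_ofReal hr.le, Real.norm_eq_abs] at this
  exact this

lemma memLp_sq_of_four {g : Euc n → ℝ} {K : Set (Euc n)}
    (h : MemLp g (ENNReal.ofReal 4) (volume.restrict K)) :
    MemLp (fun x => g x ^ 2) 2 (volume.restrict K) := by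
  refine (memLp_two_iff_integrable_sq (h.1.pow 2)).2
    ((integrableOn_abs_rpow (by norm_num) h).congr (.of_forall fun x => ?_))
  have : (4 : ℝ) = (4 : ℕ) := by norm_num
  simp only [this, Real.rpow_natCast, Pi.pow_apply]
  rw [← pow_mul, (by decide : Even 4).pow_abs (g x)]

/-- The weighted fourth power estimate for the Hessian, by interpolation between the weighted
`L²` and the `L^q` estimate. -/
lemma PSol.weighted_four (S : PSol p Ω u f v) (hH : Hess Ω v H) {N : ℕ} (hN : 2 * 2 ^ N + 2 ≤ q)
    (hq4 : 4 ≤ q)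
    (hLq : ∀ r, r ≤ q → ∀ K, IsCompact K → K ⊆ Ω → ∀ i j,
      MemLp (H i j) (ENNReal.ofReal r) (volume.restrict K))
    (hα0 : N = 0 → 4 - p ≤ α) (hα1 : N ≠ 0 → (3 - p) / 2 ^ N + 1 < α)
    {φ : Euc n → ℝ} (hφ : IsTestFun Ω φ) :
    Integrable (fun x => ‖v x‖ ^ (α + (p - 2) - 2) * (sqn H x ^ 2 * φ x ^ 2)) := by
  refine S.weighted_sqn_sq hH hφ fun i k => ?_
  rcases eq_or_ne N 0 with h0 | h0
  · exact S.weighted_four_of_nonneg (by linarith [hα0 h0])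
      (fun i j K hK hKΩ => memLp_sq_of_four (hLq 4 hq4 K hK hKΩ i j)) hφ i k
  · have hM : (2 : ℝ) ≤ 2 ^ N := by
      calc (2 : ℝ) = 2 ^ 1 := by norm_num
        _ ≤ 2 ^ N := pow_le_pow_right₀ one_le_two (Nat.one_le_iff_ne_zero.2 h0)
    have hα := hα1 h0
    obtain ⟨M, hMe⟩ : ∃ M : ℝ, M = 2 ^ N := ⟨_, rfl⟩
    rw [← hMe] at hM hα hN
    have hM0 : 0 < M := by linarith
    have hi : 1 / M ≤ 1 / 2 := one_div_le_one_div_of_le (by norm_num) hM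
    have hi0 : 0 < 1 / M := by positivity
    have hθ0 : 0 < 1 - 1 / M := by linarith
    have hb : p - 3 < (α + (p - 2) - 2) / (1 - 1 / M) := by
      rw [lt_div_iff₀ hθ0]
      have : (3 - p) / M = (3 - p) * (1 / M) := by ring
      rw [this] at hα
      linarith
    have := S.weighted_four_of_interp hH (q := 2 * M + 2) hb hθ0 (by linarith)
      (by field_simp; ring)
      (fun i j K hK hKΩ => integrableOn_abs_rpow (by linarith) (hLq _ hN K hK hKΩ i j)) hφ i k
    rwa [div_mul_cancel₀ _ hθ0.ne'] at this

theorem PSol.memW2Loc_of_lq (S : PSol p Ω u f v) (hH : Hess Ω v H) {N : ℕ}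
    (hN : 2 * 2 ^ N + 2 ≤ q) (hq4 : 4 ≤ q)
    (hLq : ∀ r, r ≤ q → ∀ K, IsCompact K → K ⊆ Ω → ∀ i j,
      MemLp (H i j) (ENNReal.ofReal r) (volume.restrict K))
    (hα0 : N = 0 → 4 - p ≤ α) (hα1 : N ≠ 0 → (3 - p) / 2 ^ N + 1 < α)
    (hk : (p + α) / 2 ≤ k) (i : Fin n) :
    MemW2Loc Ω 1 (fun x => vf (k - 1) i (v x)) := by
  obtain ⟨T, hT⟩ := S.exists_third hH fun i j K hK hKU =>
    memLp_sq_of_four (hLq 4 hq4 K hK (hKU.trans reg_subset) i j)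
  have hp1 := S.one_lt
  have hp3 := S.lt_three
  have hα : 1 < α := by
    rcases eq_or_ne N 0 with h0 | h0
    · linarith [hα0 h0]
    · have : 0 < (3 - p) / 2 ^ N := div_pos (by linarith) (by positivity)
      linarith [hα1 h0]
  have h4 := fun φ (hφ : IsTestFun Ω φ) => S.weighted_four hH hN hq4 hLq hα0 hα1 hφ
  refine S.memW2Loc_vf hH hT (by linarith) (fun i k l => ?_) ?_ i
  · have hm := (hT.l2 i k l).aestronglyMeasurable S.isOpen_reg (hT.zero i k l)
    refine S.l2loc_of_weight (e := α + (p - 2)) hm (hT.zero i k l) (by linarith) fun φ hφ => ?_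
    refine (S.weighted_third hH hT (by linarith) (by linarith) hφ (h4 φ hφ) i k).mono
      (aesm_mul_cont S.isOpen_reg (S.cont_comp fun _ hξ => contDiffAt_rpow_norm _ hξ)
        ((hm.pow 2).mul (hφ.continuous.pow 2).aestronglyMeasurable)
        fun x hx => by simp [hT.zero i k l x hx]) (.of_forall fun x => ?_)
    rw [Real.norm_of_nonneg (by positivity), Real.norm_of_nonneg (by positivity)]
    gcongr
    exact Finset.single_le_sum (f := fun l => T i k l x ^ 2) (fun _ _ => sq_nonneg _)
      (Finset.mem_univ l)
  · exact S.l2loc_of_weight (e := α + (p - 2) - 2) (sqn_aesm (hH.aesm S))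
      (fun x hx => hH.sqn_zero hx) (by linarith) h4

lemma exponent_bounds (hn : 0 < n) (hq : 4 ≤ q) (hp1 : 2 - 1 / CZ n q < p)
    (hp2 : p < min (2 + 1 / (q - 1)) (2 + 1 / CZ n q)) :
    CZ n q ≠ 0 ∧ 1 < p ∧ p < 3 ∧ (p - 2) * q < p - 1 ∧ |p - 2| ≤ |p - 2| * CZ n q ∧
      |p - 2| * CZ n q < 1 := by
  obtain ⟨h2, h3⟩ := lt_min_iff.1 hp2
  have h0 : CZ n q ≠ 0 := fun h => by
    rw [h, div_zero] at hp1 h3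
    linarith
  have h1 := one_le_CZ hn h0 (by linarith)
  have hC : 0 < CZ n q := by linarith
  have hi : 1 / CZ n q ≤ 1 := by rw [div_le_one hC]; exact h1
  have hq1 : 0 < q - 1 := by linarith
  have h5 : (p - 2) * (q - 1) < 1 := by
    rw [← lt_div_iff₀ hq1]
    linarith
  refine ⟨h0, by linarith, ?_, by linarith, le_mul_of_one_le_right (abs_nonneg _) h1, ?_⟩
  · have : 1 / (q - 1) ≤ 1 := by rw [div_le_one hq1]; linarith
    linarith
  · rw [← lt_div_iff₀ hC, abs_lt]
    constructor <;> linarith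

end

end StressField

/-- Theorem `chestress`, unsigned case: improved regularity of powers of the
stress field when `f` has no sign. -/
theorem stress_field_second_order_unsigned
    {n : ℕ} (hn : 2 ≤ n) (Ω : Set (Euc n)) (hΩo : IsOpen Ω) (hΩc : IsConnected Ω)
    (p q : ℝ) (β β' : ℝ≥0) (hβ : 0 < β) (hβ1 : β < 1) (hβ' : 0 < β') (hβ'1 : β' < 1)
    (u f : Euc n → ℝ) (hu : C1Loc Ω β u) (hsol : IsPWeakSol p Ω u f)
    (N : ℕ) (hq0 : qseq 4 0 ≤ q) (hqN : qseq 4 N ≤ q) (hqN1 : q < qseq 4 (N + 1))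
    (hp1 : 2 - 1 / CZ n q < p)
    (hp2 : p < min (2 + 1 / (q - 1)) (2 + 1 / CZ n q))
    (hf1 : MemW2Loc Ω (q / (q - 1)) f) (hf2 : C1Loc Ω β' f)
    (α k : ℝ)
    (hα0 : N = 0 → 4 - p ≤ α)
    (hα1 : N ≠ 0 → (3 - p) / 2 ^ N + 1 < α)
    (hk : k ≥ (p + α) / 2) :
    ∀ i : Fin n, MemW2Loc Ω 1 (fun x => ‖gradient u x‖ ^ (k - 1) * gradient u x i) := by
  have hn0 : 0 < n := by omega
  have hq4 : 4 ≤ q := hq0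
  obtain ⟨h0, h1, h3, h4, h5, h6⟩ := StressField.exponent_bounds hn0 hq4 hp1 hp2
  have S := StressField.psol_of_weakSol hβ hβ' hΩo hu hf2 hsol h1 h3
  obtain ⟨H, hl2, hw, hs, hz⟩ := S.exists_hess
  have hH : StressField.Hess Ω (gradient u) H := ⟨hl2, hw, hs, hz⟩
  exact fun i => S.memW2Loc_of_lq hH (by rwa [StressField.qseq_four] at hqN) hq4
    (fun r hr K hK hKΩ => S.hess_lq hn0 hH (by linarith) h4 h0 h5 le_rfl h6 hr hK hKΩ)
    hα0 hα1 hk i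

end
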